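/- Let d ≥ 2 and p > p_c(d). There exists a deterministic function μ_p : ℤ^d → [0, ∞) such that for every p₀ ∈ (p_c(d), p] and every x ∈ ℤ^d, under the standard coupling, D^{𝒞_p}(0̃^{𝒞_{p₀}}, ñx^{𝒞_{p₀}})/n converges to μ_p(x) as n → ∞, almost surely and in L¹. -/

import Mathlib

open MeasureTheory Filter Topology
open scoped ENNReal

namespace Perco

/-- Vertices of the hypercubic lattice `ℤ^d`. -/
abbrev V (d : ℕ) := Fin d → ℤ

/-- The `ℓ¹` distance on `ℤ^d`. -/
def dist1 {d : ℕ} (x y : V d) : ℕ := ∑ i, (x i - y i).natAbs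

/-- The `ℓ¹` norm, as a real number. -/
def norm1 {d : ℕ} (x : V d) : ℝ := (dist1 x 0 : ℝ)

/-- The `ℓ¹` distance, descended to unordered pairs. -/
def sym2dist1 {d : ℕ} : Sym2 (V d) → ℕ :=
  Sym2.lift ⟨fun x y => dist1 x y, fun x y => by
    unfold dist1
    exact Finset.sum_congr rfl fun i _ => by rw [← Int.natAbs_neg, neg_sub]⟩

/-- Edges of the lattice `(ℤ^d, 𝔼^d)`: unordered pairs of nearest neighbours. -/
def Edge (d : ℕ) : Type := {e : Sym2 (V d) // sym2dist1 e = 1}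

/-- A bond percolation configuration: every edge is open (`true`) or closed (`false`). -/
abbrev Config (d : ℕ) := Edge d → Bool

/-- The unordered pair `e` is an open edge of the configuration `ω`. -/
def openE {d : ℕ} (ω : Config d) (e : Sym2 (V d)) : Prop :=
  ∃ h : sym2dist1 e = 1, ω ⟨e, h⟩ = true

/-- `⟨x, y⟩` is an open edge of the configuration `ω`. -/
def edgeOpen {d : ℕ} (ω : Config d) (x y : V d) : Prop := openE ω s(x, y)

/-- `f 0, f 1, …, f n` is an `ω`-open path (with `n` edges). -/
def IsOpenPath {d : ℕ} (ω : Config d) (n : ℕ) (f : ℕ → V d) : Prop :=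
  ∀ i < n, edgeOpen ω (f i) (f (i + 1))

/-- `f 0, …, f n` is a (not necessarily open) lattice path of `ℤ^d`. -/
def IsLatticePath {d : ℕ} (n : ℕ) (f : ℕ → V d) : Prop :=
  ∀ i < n, dist1 (f i) (f (i + 1)) = 1

/-- The chemical distance between `x` and `y` in the configuration `ω`:
the minimal number of edges of an `ω`-open path from `x` to `y` (`⊤` if there is none). -/
noncomputable def chemDist {d : ℕ} (ω : Config d) (x y : V d) : ℝ≥0∞ :=
  sInf {r : ℝ≥0∞ | ∃ (n : ℕ) (f : ℕ → V d),
    IsOpenPath ω n f ∧ f 0 = x ∧ f n = y ∧ r = (n : ℝ≥0∞)}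

/-- `x` and `y` are connected by an `ω`-open path. -/
def Connected {d : ℕ} (ω : Config d) (x y : V d) : Prop := chemDist ω x y ≠ ⊤

/-- The open cluster of the vertex `x`. -/
def cluster {d : ℕ} (ω : Config d) (x : V d) : Set (V d) := {y | Connected ω x y}

/-- `x` lies in an infinite open cluster. -/
def InInfiniteCluster {d : ℕ} (ω : Config d) (x : V d) : Prop := (cluster ω x).Infinite

open Classical in
/-- The regularized point `x̃`: a point of the infinite cluster minimizing the `ℓ¹`
distance to `x` (with a deterministic rule to break ties); `x` itself if there is none. -/
noncomputable def regPoint {d : ℕ} (ω : Config d) (x : V d) : V d :=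
  if h : ∃ y : V d, InInfiniteCluster ω y ∧
      ∀ z : V d, InInfiniteCluster ω z → dist1 x y ≤ dist1 x z
  then h.choose else x

/-- Real-valued chemical distance (in the configuration `ωdist`) between the
regularizations (w.r.t. the configuration `ωreg`) of `x` and `y`. -/
noncomputable def DReg {d : ℕ} (ωdist ωreg : Config d) (x y : V d) : ℝ :=
  (chemDist ωdist (regPoint ωreg x) (regPoint ωreg y)).toReal

open Classical in
/-- The number of elements of a set, as an element of `ℝ≥0∞` (`⊤` for infinite sets). -/
noncomputable def eSize {α : Type*} (A : Set α) : ℝ≥0∞ :=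
  if h : A.Finite then (h.toFinset.card : ℝ≥0∞) else ⊤

/-!  ### Boxes and renormalization  -/

/-- The box of "radius" `R` centered at `c`: `∏ₖ [c k - R, c k + R)`. -/
def boxC {d : ℕ} (c : V d) (R : ℕ) : Set (V d) :=
  {x | ∀ k, c k - (R : ℤ) ≤ x k ∧ x k < c k + (R : ℤ)}

/-- The center `i(2N+1)` of the `N`-box of macroscopic index `i`. -/
def center {d : ℕ} (N : ℕ) (i : V d) : V d := fun k => i k * (2 * (N : ℤ) + 1)

/-- The `N`-box `B_N(i) = i(2N+1) + [-N, N)^d`. -/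
def macroBox {d : ℕ} (N : ℕ) (i : V d) : Set (V d) := boxC (center N i) N

/-- The enlarged box `B'_N(i) = i(2N+1) + [-3N, 3N)^d`. -/
def macroBox' {d : ℕ} (N : ℕ) (i : V d) : Set (V d) := boxC (center N i) (3 * N)

/-- An open path all of whose vertices stay in the set `S`. -/
def IsOpenPathIn {d : ℕ} (ω : Config d) (S : Set (V d)) (n : ℕ) (f : ℕ → V d) : Prop :=
  IsOpenPath ω n f ∧ ∀ i ≤ n, f i ∈ S

/-- `x` and `y` are connected by an open path inside `S`. -/
def ConnectedIn {d : ℕ} (ω : Config d) (S : Set (V d)) (x y : V d) : Prop :=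
  ∃ (n : ℕ) (f : ℕ → V d), IsOpenPathIn ω S n f ∧ f 0 = x ∧ f n = y

/-- The open cluster of `x` inside the set `S`. -/
def clusterIn {d : ℕ} (ω : Config d) (S : Set (V d)) (x : V d) : Set (V d) :=
  {y | ConnectedIn ω S x y}

/-- `C` is an open cluster of the region `S`. -/
def IsClusterIn {d : ℕ} (ω : Config d) (S : Set (V d)) (C : Set (V d)) : Prop :=
  ∃ x ∈ S, C = clusterIn ω S x

/-- The cluster `C` has diameter at least `m`. -/
def diamGE {d : ℕ} (C : Set (V d)) (m : ℕ) : Prop :=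
  ∃ x ∈ C, ∃ y ∈ C, ∃ k, (m : ℤ) ≤ |x k - y k|

/-- The cluster `C` is crossing for the box `boxC c R`: for each of the `d` directions,
`C ∩ boxC c R` contains an open path connecting the two opposite faces of the box. -/
def CrossingFor {d : ℕ} (ω : Config d) (C : Set (V d)) (c : V d) (R : ℕ) : Prop :=
  ∀ k : Fin d, ∃ (n : ℕ) (f : ℕ → V d), IsOpenPath ω n f ∧
    (∀ m ≤ n, f m ∈ C ∩ boxC c R) ∧ f 0 k = c k - (R : ℤ) ∧ f n k = c k + (R : ℤ) - 1

/-- The `N`-box `B_N(i)` is good (for the configuration `ω`, with parameter `β`):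
(i) there is a unique open cluster `C` of `B'_N(i)` of diameter at least `N`;
(ii) `C` is crossing for each of the `3^d` `N`-boxes included in `B'_N(i)`;
(iii) any two points of `C ∩ B'_N(i)` are at chemical distance at most `12βN`. -/
def IsGoodBox {d : ℕ} (ω : Config d) (N : ℕ) (β : ℝ) (i : V d) : Prop :=
  ∃ C : Set (V d),
    IsClusterIn ω (macroBox' N i) C ∧ diamGE C N ∧
    (∀ C', IsClusterIn ω (macroBox' N i) C' → diamGE C' N → C' = C) ∧
    (∀ j : V d, (∀ k, |j k - i k| ≤ 1) → CrossingFor ω C (center N j) N) ∧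
    (∀ x ∈ macroBox' N i, ∀ y ∈ macroBox' N i, x ∈ C → y ∈ C →
      chemDist ω x y ≤ ENNReal.ofReal (12 * β * N))

/-- `x` belongs to the crossing cluster of the good box `B_N(j)`, i.e. to a cluster of
`B'_N(j)` of diameter at least `N`. -/
def InCrossingCluster {d : ℕ} (ω : Config d) (N : ℕ) (j : V d) (x : V d) : Prop :=
  ∃ C : Set (V d), IsClusterIn ω (macroBox' N j) C ∧ diamGE C N ∧ x ∈ C

/-!  ### Macroscopic site percolation -/

/-- A nearest-neighbour path of macroscopic sites staying in `S`. -/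
def IsSitePathIn {d : ℕ} (S : Set (V d)) (n : ℕ) (f : ℕ → V d) : Prop :=
  (∀ m ≤ n, f m ∈ S) ∧ ∀ m < n, dist1 (f m) (f (m + 1)) = 1

/-- The sites `i` and `j` are connected by a nearest-neighbour path inside `S`. -/
def SiteConnectedIn {d : ℕ} (S : Set (V d)) (i j : V d) : Prop :=
  ∃ (n : ℕ) (f : ℕ → V d), IsSitePathIn S n f ∧ f 0 = i ∧ f n = j

/-- A `*`-path of macroscopic sites staying in `S` (consecutive sites are `*`-neighbours:
their `ℓ^∞` distance is `1`). -/
def IsStarPathIn {d : ℕ} (S : Set (V d)) (n : ℕ) (f : ℕ → V d) : Prop :=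
  (∀ m ≤ n, f m ∈ S) ∧ ∀ m < n, f m ≠ f (m + 1) ∧ ∀ k, |f (m + 1) k - f m k| ≤ 1

/-- The set of good macroscopic sites. -/
def goodSites {d : ℕ} (ω : Config d) (N : ℕ) (β : ℝ) : Set (V d) :=
  {i | IsGoodBox ω N β i}

/-- The macroscopic site `i` belongs to an infinite cluster of good boxes. -/
def InInfiniteGoodCluster {d : ℕ} (ω : Config d) (N : ℕ) (β : ℝ) (i : V d) : Prop :=
  IsGoodBox ω N β i ∧ {j | SiteConnectedIn (goodSites ω N β) i j}.Infinite

/-- The union of the bad connected components (of the macroscopic site percolation)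
meeting the set `Γ`; its size is `Σ_{C ∈ Bad, C ∩ Γ ≠ ∅} |C|`. -/
def badTouching {d : ℕ} (ω : Config d) (N : ℕ) (β : ℝ) (Γ : Set (V d)) : Set (V d) :=
  {j | ∃ i ∈ Γ, i ∉ goodSites ω N β ∧ SiteConnectedIn {k | k ∉ goodSites ω N β} i j}

/-!  ### Edges and sites of a path -/

/-- The set of edges of the path `f 0, …, f n`. -/
def pathEdges {d : ℕ} (n : ℕ) (f : ℕ → V d) : Set (Sym2 (V d)) :=
  {e | ∃ i < n, e = s(f i, f (i + 1))}

/-- The set of vertices of the path `f 0, …, f n`. -/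
def pathVerts {d : ℕ} (n : ℕ) (f : ℕ → V d) : Set (V d) :=
  {v | ∃ i ≤ n, f i = v}

/-- The set of `ω`-closed edges of the path `f 0, …, f n`. -/
def closedEdges {d : ℕ} (ω : Config d) (n : ℕ) (f : ℕ → V d) : Set (Sym2 (V d)) :=
  {e | e ∈ pathEdges n f ∧ ¬ openE ω e}

/-- The set `Γ` of macroscopic sites whose `N`-box is visited by the path `f 0, …, f n`. -/
def visitedSites {d : ℕ} (N : ℕ) (n : ℕ) (f : ℕ → V d) : Set (V d) :=
  {i | ∃ m ≤ n, f m ∈ macroBox N i}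

/-!  ### Probability: i.i.d. Bernoulli bond percolation -/

/-- A family of i.i.d. Bernoulli bond percolation measures on the configurations:
`P p` is a probability measure under which the states of the edges are independent
Bernoulli variables of parameter `p`. -/
structure BernoulliFamily (d : ℕ) where
  P : ℝ → Measure (Config d)
  prob : ∀ p, IsProbabilityMeasure (P p)
  iid : ∀ p, 0 ≤ p → p ≤ 1 → ∀ (s : Finset (Edge d)) (f : Edge d → Bool),
    P p {ω : Config d | ∀ e ∈ s, ω e = f e}
      = ∏ e ∈ s, ENNReal.ofReal (if f e then p else 1 - p)

/-- The critical parameter `p_c(d)` of the family. -/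
noncomputable def pc {d : ℕ} (F : BernoulliFamily d) : ℝ :=
  sInf {p : ℝ | 0 ≤ p ∧ p ≤ 1 ∧ 0 < F.P p {ω : Config d | InInfiniteCluster ω 0}}

/-- `t` is the time constant of the percolation measure `P`: for every `x ∈ ℤ^d`,
`D^{𝒞}(0̃, ñx)/n → t x` almost surely. -/
def ASTimeConstant {d : ℕ} (P : Measure (Config d)) (t : V d → ℝ) : Prop :=
  ∀ x : V d, ∀ᵐ ω ∂P, Tendsto (fun n : ℕ => DReg ω ω 0 (n • x) / n) atTop (𝓝 (t x))

/-!  ### Couplings -/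

/-- Two-stage coupling configurations: each edge carries a pair `(V, Z)` of Booleans. -/
abbrev CConfig (d : ℕ) := Edge d → Bool × Bool

/-- The `q`-configuration of a coupled configuration: `e` is `q`-open iff `V e = 1`. -/
def cfgQ {d : ℕ} (u : CConfig d) : Config d := fun e => (u e).1

/-- The `p`-configuration of a coupled configuration: `e` is `p`-open iff `V e Z e = 1`. -/
def cfgP {d : ℕ} (u : CConfig d) : Config d := fun e => (u e).1 && (u e).2

/-- Two-stage coupling of the `p`- and `q`-percolations: on each edge, independently,
`V` is Bernoulli of parameter `q` and `Z` is an independent Bernoulli of parameter `p/q`. -/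
structure CouplingMeasure (d : ℕ) (p q : ℝ) where
  Q : Measure (CConfig d)
  prob : IsProbabilityMeasure Q
  iid : ∀ (s : Finset (Edge d)) (f : Edge d → Bool × Bool),
    Q {u : CConfig d | ∀ e ∈ s, u e = f e}
      = ∏ e ∈ s,
          (ENNReal.ofReal (if (f e).1 then q else 1 - q) *
            ENNReal.ofReal (if (f e).2 then p / q else 1 - p / q))

/-- Standard coupling: i.i.d. uniform variables on `[0,1]`, one for each edge. -/
structure UniformCoupling (d : ℕ) where
  Q : Measure (Edge d → ℝ)
  prob : IsProbabilityMeasure Q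
  iid : ∀ (s : Finset (Edge d)) (a : Edge d → ℝ), (∀ e ∈ s, 0 ≤ a e ∧ a e ≤ 1) →
    Q {u | ∀ e ∈ s, u e ≤ a e} = ∏ e ∈ s, ENNReal.ofReal (a e)

open Classical in
/-- The `p`-configuration of the standard coupling: `e` is `p`-open iff `U e ≤ p`. -/
noncomputable def cfgAt {d : ℕ} (u : Edge d → ℝ) (p : ℝ) : Config d :=
  fun e => if u e ≤ p then true else false

/-- The critical parameter `p_c(d)` read on the standard coupling. -/
noncomputable def pcU {d : ℕ} (U : UniformCoupling d) : ℝ :=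
  sInf {p : ℝ | 0 ≤ p ∧ p ≤ 1 ∧ 0 < U.Q {u | InInfiniteCluster (cfgAt u p) 0}}

open Classical in
/-- A deterministically chosen geodesic (open path of minimal length) from `x` to `y`
in the configuration `ω` (a trivial constant path if there is none). -/
noncomputable def geod {d : ℕ} (ω : Config d) (x y : V d) : ℕ × (ℕ → V d) :=
  if h : ∃ nf : ℕ × (ℕ → V d), IsOpenPath ω nf.1 nf.2 ∧ nf.2 0 = x ∧ nf.2 nf.1 = y ∧
      (nf.1 : ℝ≥0∞) = chemDist ω x y
  then h.choose else (0, fun _ => x)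

/-!  ### Norms on `ℝ^d` -/

/-- `f` is a norm on the Euclidean space `ℝ^d`. -/
def IsNorm {d : ℕ} (f : EuclideanSpace ℝ (Fin d) → ℝ) : Prop :=
  (∀ x, 0 ≤ f x) ∧ (∀ x, f x = 0 ↔ x = 0) ∧
  (∀ (c : ℝ) (x), f (c • x) = |c| * f x) ∧ ∀ x y, f (x + y) ≤ f x + f y

/-- The canonical embedding of `ℤ^d` into the Euclidean space `ℝ^d`. -/
noncomputable def toEuc {d : ℕ} (x : V d) : EuclideanSpace ℝ (Fin d) :=
  (WithLp.equiv 2 (Fin d → ℝ)).symm fun i => (x i : ℝ)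

/-- Property (1) of the path-modification lemma: the edges of `γ' \ γ` decompose as a
disjoint union of self-avoiding `p`-open paths intersecting `γ' ∩ γ` at their endpoints. -/
def DisjointPathDecomposition {d : ℕ} (ωp : Config d) (n : ℕ) (f : ℕ → V d)
    (n' : ℕ) (g : ℕ → V d) : Prop :=
  ∃ (K : ℕ) (m : ℕ → ℕ) (h : ℕ → ℕ → V d),
    (⋃ j ∈ Finset.range K, pathEdges (m j) (h j)) = pathEdges n' g \ pathEdges n f ∧
    (∀ j < K, IsOpenPath ωp (m j) (h j)) ∧
    (∀ j < K, ∀ a ≤ m j, ∀ b ≤ m j, h j a = h j b → a = b) ∧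
    (∀ j < K, ∀ l < K, j ≠ l → Disjoint (pathEdges (m j) (h j)) (pathEdges (m l) (h l))) ∧
    (∀ j < K, h j 0 ∈ pathVerts n f ∧ h j (m j) ∈ pathVerts n f) ∧
    (∀ j < K, ∀ a, 0 < a → a < m j → h j a ∉ pathVerts n f)

/-- The conclusion of the path-modification lemma, for the constant `ρ`:
any `q`-open path between well-connected points of `𝒞_p` can be turned into a `p`-open
path, the total length of the bypasses being controlled by the bad clusters met and the
number of `p`-closed edges. -/
def BypassProperty (d : ℕ) (ρ : ℕ) : Prop :=
  ∀ (N : ℕ), 1 ≤ N → ∀ (β : ℝ), 1 ≤ β → ∀ (ωp ωq : Config d),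
    (∀ e, ωp e = true → ωq e = true) →
    ∀ y z : V d, InInfiniteCluster ωp y → InInfiniteCluster ωp z →
    (∃ i, y ∈ macroBox N i ∧ InInfiniteGoodCluster ωp N β i) →
    (∃ i, z ∈ macroBox N i ∧ InInfiniteGoodCluster ωp N β i) →
    ∀ (n : ℕ) (f : ℕ → V d), IsOpenPath ωq n f → f 0 = y → f n = z →
    ∃ (n' : ℕ) (g : ℕ → V d), IsOpenPath ωp n' g ∧ g 0 = y ∧ g n' = z ∧
      DisjointPathDecomposition ωp n f n' g ∧
      eSize (pathEdges n' g \ pathEdges n f) ≤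
        ((ρ * N : ℕ) : ℝ≥0∞) *
          (eSize (badTouching ωp N β (visitedSites N n f)) + eSize (closedEdges ωp n f))


set_option linter.deprecated false
set_option linter.unusedVariables false
set_option linter.unusedSimpArgs false
set_option linter.unusedSectionVars false

section Mod1
section Gen
variable {Ω α β ι : Type*}

theorem real_le_of_fibers [MeasurableSpace Ω] {P : Measure Ω} [IsProbabilityMeasure P] [Countable β]
    {g : Ω → β} (hg : ∀ b, MeasurableSet (g ⁻¹' {b})) {X Y : Set Ω} {c : ℝ} (hc : 0 ≤ c)
    (h : ∀ b, P.real (X ∩ g ⁻¹' {b}) ≤ c * P.real (Y ∩ g ⁻¹' {b})) :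
    P.real X ≤ c * P.real Y := by
  have hX : P X ≤ ∑' b, P (X ∩ g ⁻¹' {b}) := by
    calc P X ≤ P (⋃ b, X ∩ g ⁻¹' {b}) := measure_mono (fun ω hω => by simp [hω])
      _ ≤ _ := measure_iUnion_le _
  have hY : ∑' b, P (Y ∩ g ⁻¹' {b}) = P Y := by
    have : ∀ b, P (Y ∩ g ⁻¹' {b}) = (P.restrict Y) (g ⁻¹' {b}) := fun b => by
      rw [Measure.restrict_apply (hg b), Set.inter_comm]
    simp_rw [this]
    rw [← measure_iUnion _ hg]
    · have : (⋃ b, g ⁻¹' {b}) = Set.univ := by ext; simp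
      rw [this]; simp
    · intro a b hab
      rw [Function.onFun, Set.disjoint_left]
      rintro x rfl hx
      exact hab hx
  have key : P X ≤ ENNReal.ofReal c * P Y := by
    rw [← hY, ← ENNReal.tsum_mul_left]
    refine hX.trans (ENNReal.tsum_le_tsum fun b => ?_)
    have := h b
    rw [← ENNReal.ofReal_toReal (measure_ne_top P (X ∩ g ⁻¹' {b})),
      ← ENNReal.ofReal_toReal (measure_ne_top P (Y ∩ g ⁻¹' {b})), ← ENNReal.ofReal_mul hc]
    exact ENNReal.ofReal_le_ofReal this
  have := ENNReal.toReal_mono (ENNReal.mul_ne_top ENNReal.ofReal_ne_top (measure_ne_top P Y)) key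
  rwa [ENNReal.toReal_mul, ENNReal.toReal_ofReal hc] at this

theorem real_le_sum_of_subset [MeasurableSpace Ω] {P : Measure Ω} [IsProbabilityMeasure P]
    {X : Set Ω} (s : Finset α) (Y : α → Set Ω) (h : X ⊆ ⋃ a ∈ s, Y a) :
    P.real X ≤ ∑ a ∈ s, P.real (Y a) :=
  (measureReal_mono h (measure_ne_top _ _)).trans (measureReal_biUnion_finset_le s Y)

theorem real_union_le [MeasurableSpace Ω] {P : Measure Ω} [IsProbabilityMeasure P]
    {X Y Z : Set Ω} (h : X ⊆ Y ∪ Z) : P.real X ≤ P.real Y + P.real Z :=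
  (measureReal_mono h).trans (measureReal_union_le Y Z)

theorem meas_rtg [MeasurableSpace Ω] [Countable α] {r : Ω → α → α → Prop}
    (h : ∀ a b, MeasurableSet {ω | r ω a b}) (a b : α) :
    MeasurableSet {ω | Relation.ReflTransGen (r ω) a b} := by
  let N : ℕ → α → Set Ω := fun n => Nat.rec (fun c => {_ω | a = c})
    (fun _ S c => ⋃ x, S x ∩ {ω | r ω x c}) n
  have hN : ∀ n c, MeasurableSet (N n c) := by
    intro n
    induction n with
    | zero => intro c; exact MeasurableSet.const _
    | succ n ih => intro c; exact MeasurableSet.iUnion fun x => (ih x).inter (h x c)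
  have : {ω | Relation.ReflTransGen (r ω) a b} = ⋃ n, N n b := by
    ext ω
    simp only [Set.mem_setOf_eq, Set.mem_iUnion]
    constructor
    · intro hr
      induction hr with
      | refl => exact ⟨0, rfl⟩
      | tail _ hbc ih =>
        obtain ⟨n, hn⟩ := ih
        exact ⟨n + 1, Set.mem_iUnion.2 ⟨_, hn, hbc⟩⟩
    · rintro ⟨n, hn⟩
      induction n generalizing b with
      | zero => obtain rfl : a = b := hn; exact .refl
      | succ n ih =>
        obtain ⟨x, hx, hxb⟩ := Set.mem_iUnion.1 hn
        exact (ih x hx).tail hxb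
  rw [this]
  exact MeasurableSet.iUnion fun n => hN n b

theorem meas_all [MeasurableSpace Ω] [Countable α] {p : α → Ω → Prop}
    (h : ∀ a, MeasurableSet {ω | p a ω}) : MeasurableSet {ω | ∀ a, p a ω} := by
  simpa [Set.setOf_forall] using MeasurableSet.iInter h
theorem meas_ex [MeasurableSpace Ω] [Countable α] {p : α → Ω → Prop}
    (h : ∀ a, MeasurableSet {ω | p a ω}) : MeasurableSet {ω | ∃ a, p a ω} := by
  simpa [Set.setOf_exists] using MeasurableSet.iUnion h
theorem meas_and [MeasurableSpace Ω] {p q : Ω → Prop}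
    (h : MeasurableSet {ω | p ω}) (h' : MeasurableSet {ω | q ω}) :
    MeasurableSet {ω | p ω ∧ q ω} := h.inter h'
theorem meas_or [MeasurableSpace Ω] {p q : Ω → Prop}
    (h : MeasurableSet {ω | p ω}) (h' : MeasurableSet {ω | q ω}) :
    MeasurableSet {ω | p ω ∨ q ω} := h.union h'
theorem meas_not [MeasurableSpace Ω] {p : Ω → Prop}
    (h : MeasurableSet {ω | p ω}) : MeasurableSet {ω | ¬ p ω} := h.compl
theorem meas_imp [MeasurableSpace Ω] {p q : Ω → Prop}
    (h : MeasurableSet {ω | p ω}) (h' : MeasurableSet {ω | q ω}) :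
    MeasurableSet {ω | p ω → q ω} := by
  simpa only [imp_iff_not_or] using meas_or (meas_not h) h'
theorem meas_iff [MeasurableSpace Ω] {p q : Ω → Prop}
    (h : MeasurableSet {ω | p ω}) (h' : MeasurableSet {ω | q ω}) :
    MeasurableSet {ω | p ω ↔ q ω} := by
  simpa only [iff_iff_implies_and_implies] using meas_and (meas_imp h h') (meas_imp h' h)
theorem meas_const [MeasurableSpace Ω] (p : Prop) : MeasurableSet {_ω : Ω | p} :=
  MeasurableSet.const p

/-- Finset-valued maps with measurable membership have measurable fibres. -/
theorem meas_finset_eq [MeasurableSpace Ω] [Countable α] {N : Ω → Finset α}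
    (h : ∀ a, MeasurableSet {ω | a ∈ N ω}) (b : Finset α) : MeasurableSet (N ⁻¹' {b}) := by
  have : N ⁻¹' {b} = {ω | ∀ a, (a ∈ N ω ↔ a ∈ b)} := by
    ext ω; simp [Finset.ext_iff]
  rw [this]
  exact meas_all fun a => meas_iff (h a) (meas_const _)

/-- `A` is determined by the coordinates in `I`. -/
def DetBy (I : Set ι) (A : Set (ι → Bool)) : Prop :=
  ∀ ω ω' : ι → Bool, (∀ i ∈ I, ω i = ω' i) → ω ∈ A → ω' ∈ A

theorem DetBy.iff {I : Set ι} {A : Set (ι → Bool)} (h : DetBy I A) {ω ω' : ι → Bool}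
    (hh : ∀ i ∈ I, ω i = ω' i) : ω ∈ A ↔ ω' ∈ A :=
  ⟨h _ _ hh, h _ _ fun i hi => (hh i hi).symm⟩
theorem DetBy.mono {I J : Set ι} {A : Set (ι → Bool)} (h : DetBy I A) (hIJ : I ⊆ J) : DetBy J A :=
  fun ω ω' hh => h ω ω' fun i hi => hh i (hIJ hi)
theorem DetBy.compl {I : Set ι} {A : Set (ι → Bool)} (h : DetBy I A) : DetBy I Aᶜ :=
  fun _ _ hh hA hA' => hA ((h.iff hh).2 hA')
theorem DetBy.inter {I : Set ι} {A B : Set (ι → Bool)} (h : DetBy I A) (h' : DetBy I B) :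
    DetBy I (A ∩ B) := fun _ _ hh hA => ⟨h _ _ hh hA.1, h' _ _ hh hA.2⟩
theorem DetBy.union {I : Set ι} {A B : Set (ι → Bool)} (h : DetBy I A) (h' : DetBy I B) :
    DetBy I (A ∪ B) := fun _ _ hh hA => hA.imp (h _ _ hh) (h' _ _ hh)
theorem DetBy.biInter {I : Set ι} {s : Finset α} {A : α → Set (ι → Bool)}
    (h : ∀ a ∈ s, DetBy I (A a)) : DetBy I (⋂ a ∈ s, A a) := by
  intro ω ω' hh hA
  simp only [Set.mem_iInter] at *
  exact fun a ha => h a ha _ _ hh (hA a ha)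

/-- The Bernoulli measure on `Bool`. -/
noncomputable def bern (p : unitInterval) : Measure Bool :=
  ENNReal.ofReal p • Measure.dirac true + ENNReal.ofReal (1 - p) • Measure.dirac false

instance (p : unitInterval) : IsProbabilityMeasure (bern p) := ⟨by
  simp only [bern, Measure.coe_add, Measure.coe_smul, Pi.add_apply, Pi.smul_apply, measure_univ,
    smul_eq_mul, mul_one]
  rw [← ENNReal.ofReal_add p.2.1 (by linarith [p.2.2])]; simp⟩

theorem bern_true (p : unitInterval) : (bern p) {true} = ENNReal.ofReal p := by
  simp [bern]
theorem bern_false (p : unitInterval) : (bern p) {false} = ENNReal.ofReal (1 - p) := by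
  simp [bern]

/-- Product of Bernoulli measures. -/
noncomputable def PB (q : ι → unitInterval) : Measure (ι → Bool) :=
  Measure.infinitePi fun i => bern (q i)

instance (q : ι → unitInterval) : IsProbabilityMeasure (PB q) := by
  unfold PB; infer_instance

theorem DetBy.meas_comap {I : Set ι} {A : Set (ι → Bool)} (h : DetBy I A) (hA : MeasurableSet A) :
    MeasurableSet[⨆ i ∈ I, MeasurableSpace.comap (fun ω : ι → Bool => ω i) inferInstance] A := by
  classical
  let g : (ι → Bool) → (ι → Bool) := fun ω i => if i ∈ I then ω i else false
  have hg : Measurable[⨆ i ∈ I, MeasurableSpace.comap (fun ω : ι → Bool => ω i) inferInstance] g := by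
    refine @measurable_pi_lambda _ _ _ (_) _ g fun i => ?_
    by_cases hi : i ∈ I
    · simp only [g, hi, if_true]
      have h1 : MeasurableSpace.comap (fun ω : ι → Bool => ω i) inferInstance ≤
        ⨆ i ∈ I, MeasurableSpace.comap (fun ω : ι → Bool => ω i) inferInstance :=
        le_iSup₂ (f := fun i (_ : i ∈ I) =>
          MeasurableSpace.comap (fun ω : ι → Bool => ω i) inferInstance) i hi
      exact (comap_measurable (fun ω : ι → Bool => ω i)).mono h1 le_rfl
    · simp only [g, hi, if_false]; exact measurable_const
  have : A = g ⁻¹' A := by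
    ext ω
    exact h.iff fun i hi => by simp [g, hi]
  rw [this]
  exact hg hA

theorem indep_detBy (q : ι → unitInterval) {I J : Set ι} {A B : Set (ι → Bool)}
    (hA : MeasurableSet A) (hB : MeasurableSet B) (dA : DetBy I A) (dB : DetBy J B)
    (hIJ : Disjoint I J) : (PB q).real (A ∩ B) = (PB q).real A * (PB q).real B := by
  have h1 : ProbabilityTheory.iIndepFun (fun i (ω : ι → Bool) => ω i) (PB q) :=
    ProbabilityTheory.iIndepFun_infinitePi (X := fun i ω => ω) (fun i => measurable_id)
  have h2 := ProbabilityTheory.indep_iSup_of_disjoint (fun i => (measurable_pi_apply i).comap_le)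
    h1 hIJ
  have h3 := (ProbabilityTheory.Indep_iff _ _ _).1 h2 A B (dA.meas_comap hA) (dB.meas_comap hB)
  simp [Measure.real, h3, ENNReal.toReal_mul]

theorem detBy_coord (i : ι) (b : Bool) : DetBy {i} {ω : ι → Bool | ω i = b} :=
  fun _ _ hh h => by rw [Set.mem_setOf_eq, ← hh i rfl]; exact h

theorem meas_coord (i : ι) (b : Bool) : MeasurableSet {ω : ι → Bool | ω i = b} :=
  (measurable_pi_apply (X := fun _ : ι => Bool) i) (measurableSet_singleton b)

theorem PB_map_eval (q : ι → unitInterval) (i : ι) (b : Bool) :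
    (PB q) {ω | ω i = b} = bern (q i) {b} := by
  have := Measure.infinitePi_map_eval (fun i => bern (q i)) i
  rw [← this, Measure.map_apply (measurable_pi_apply i) (measurableSet_singleton b)]
  rfl

theorem PB_true (q : ι → unitInterval) (i : ι) : (PB q).real {ω | ω i = true} = q i := by
  rw [Measure.real, PB_map_eval, bern_true, ENNReal.toReal_ofReal (q i).2.1]
theorem PB_false (q : ι → unitInterval) (i : ι) : (PB q).real {ω | ω i = false} = 1 - q i := by
  rw [Measure.real, PB_map_eval, bern_false, ENNReal.toReal_ofReal (by linarith [(q i).2.2])]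

/-- independence of one event and a family of block events -/
theorem indep_blocks (q : ι → unitInterval) {I : Set ι} {A : Set (ι → Bool)}
    (hA : MeasurableSet A) (dA : DetBy I A) (B : α → Set (ι → Bool)) (J : α → Set ι)
    (N : Finset α) (hB : ∀ a ∈ N, MeasurableSet (B a)) (dB : ∀ a ∈ N, DetBy (J a) (B a))
    (hJ : ∀ a ∈ N, ∀ b ∈ N, a ≠ b → Disjoint (J a) (J b)) (hI : ∀ a ∈ N, Disjoint I (J a)) :
    (PB q).real (A ∩ ⋂ a ∈ N, B a) = (PB q).real A * ∏ a ∈ N, (PB q).real (B a) := by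
  classical
  induction N using Finset.induction_on with
  | empty => simp
  | insert a N ha ih =>
    rw [Finset.prod_insert ha, Finset.set_biInter_insert, Set.inter_left_comm, mul_left_comm,
      ← ih (fun b hb => hB b (by simp [hb])) (fun b hb => dB b (by simp [hb]))
        (fun b hb c hc => hJ b (by simp [hb]) c (by simp [hc])) (fun b hb => hI b (by simp [hb]))]
    have m2 : MeasurableSet (⋂ b ∈ N, B b) :=
      Finset.measurableSet_biInter N fun b hb => hB b (by simp [hb])
    have d2 : DetBy (I ∪ ⋃ b ∈ N, J b) (A ∩ ⋂ b ∈ N, B b) := by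
      refine (dA.mono Set.subset_union_left).inter (DetBy.biInter fun b hb => ?_)
      refine (dB b (by simp [hb])).mono (subset_trans ?_ Set.subset_union_right)
      exact Set.subset_biUnion_of_mem (u := fun b => J b) hb
    refine indep_detBy q (hB a (by simp)) (hA.inter m2) (dB a (by simp)) d2 ?_
    rw [Set.disjoint_union_right]
    refine ⟨(hI a (by simp)).symm, ?_⟩
    simp only [Set.disjoint_iUnion_right]
    intro b hb
    exact hJ a (by simp) b (by simp [hb]) (by rintro rfl; exact ha hb)

theorem indep_blocks' (q : ι → unitInterval) (B : α → Set (ι → Bool)) (J : α → Set ι)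
    (N : Finset α) (hB : ∀ a ∈ N, MeasurableSet (B a)) (dB : ∀ a ∈ N, DetBy (J a) (B a))
    (hJ : ∀ a ∈ N, ∀ b ∈ N, a ≠ b → Disjoint (J a) (J b)) :
    (PB q).real (⋂ a ∈ N, B a) = ∏ a ∈ N, (PB q).real (B a) := by
  have := indep_blocks q (A := Set.univ) (I := ∅) MeasurableSet.univ (fun _ _ _ _ => trivial)
    B J N hB dB hJ (by simp)
  simpa using this

/-- Closing lemma, upper bound. -/
theorem closing_le [Countable α] (q : ι → unitInterval) {A : Set (ι → Bool)}
    (hA : MeasurableSet A) (B : α → Set (ι → Bool)) (J : α → Set ι)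
    (N : (ι → Bool) → Finset α) (hN : ∀ a, MeasurableSet {ω | a ∈ N ω})
    (I : Finset α → Set ι) (dA : ∀ s, DetBy (I s) (A ∩ N ⁻¹' {s}))
    (hB : ∀ a, MeasurableSet (B a)) (dB : ∀ a, DetBy (J a) (B a))
    (hJ : ∀ s, (A ∩ N ⁻¹' {s}).Nonempty → ∀ a ∈ s, ∀ b ∈ s, a ≠ b → Disjoint (J a) (J b))
    (hI : ∀ s, (A ∩ N ⁻¹' {s}).Nonempty → ∀ a ∈ s, Disjoint (I s) (J a)) {β : ℝ}
    (hβ0 : 0 ≤ β) (h1 : β ≤ 1) (hβ : ∀ a, (PB q).real (B a) ≤ β) (t : ℕ) :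
    (PB q).real (A ∩ {ω | t ≤ (N ω).card ∧ ∀ a ∈ N ω, ω ∈ B a}) ≤ β ^ t * (PB q).real A := by
  refine real_le_of_fibers (meas_finset_eq hN) (by positivity) fun s => ?_
  by_cases hne : (A ∩ N ⁻¹' {s}).Nonempty
  swap
  · rw [Set.not_nonempty_iff_eq_empty] at hne
    have : A ∩ {ω | t ≤ (N ω).card ∧ ∀ a ∈ N ω, ω ∈ B a} ∩ N ⁻¹' {s} ⊆ ∅ := by
      rw [← hne]; exact fun ω h => ⟨h.1.1, h.2⟩
    rw [Set.subset_empty_iff.1 this, hne]; simp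
  by_cases hs : t ≤ s.card
  · have : A ∩ {ω | t ≤ (N ω).card ∧ ∀ a ∈ N ω, ω ∈ B a} ∩ N ⁻¹' {s} ⊆
        (A ∩ N ⁻¹' {s}) ∩ ⋂ a ∈ s, B a := by
      rintro ω ⟨⟨h1, h2, h3⟩, h4⟩
      obtain rfl : N ω = s := h4
      exact ⟨⟨h1, rfl⟩, by simpa using h3⟩
    refine (measureReal_mono this).trans ?_
    rw [indep_blocks q (hA.inter (meas_finset_eq hN s)) (dA s) B J s (fun a _ => hB a)
      (fun a _ => dB a) (hJ s hne) (hI s hne), mul_comm]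
    gcongr
    calc ∏ a ∈ s, (PB q).real (B a) ≤ ∏ a ∈ s, β :=
          Finset.prod_le_prod (fun _ _ => measureReal_nonneg) fun a _ => hβ a
      _ = β ^ s.card := by simp
      _ ≤ β ^ t := pow_le_pow_of_le_one hβ0 h1 hs
  · have : A ∩ {ω | t ≤ (N ω).card ∧ ∀ a ∈ N ω, ω ∈ B a} ∩ N ⁻¹' {s} = ∅ := by
      ext ω
      simp only [Set.mem_inter_iff, Set.mem_setOf_eq, Set.mem_preimage, Set.mem_singleton_iff,
        Set.mem_empty_iff_false, iff_false]
      rintro ⟨⟨_, h2, _⟩, rfl⟩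
      exact hs h2
    rw [this]; simp; positivity

/-- Closing lemma, lower bound. -/
theorem closing_ge [Countable α] (q : ι → unitInterval) {A : Set (ι → Bool)}
    (hA : MeasurableSet A) (B : α → Set (ι → Bool)) (J : α → Set ι)
    (N : (ι → Bool) → Finset α) (hN : ∀ a, MeasurableSet {ω | a ∈ N ω})
    (I : Finset α → Set ι) (dA : ∀ s, DetBy (I s) (A ∩ N ⁻¹' {s}))
    (hB : ∀ a, MeasurableSet (B a)) (dB : ∀ a, DetBy (J a) (B a))
    (hJ : ∀ s, (A ∩ N ⁻¹' {s}).Nonempty → ∀ a ∈ s, ∀ b ∈ s, a ≠ b → Disjoint (J a) (J b))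
    (hI : ∀ s, (A ∩ N ⁻¹' {s}).Nonempty → ∀ a ∈ s, Disjoint (I s) (J a)) {β : ℝ}
    (h0 : 0 < β) (h1 : β ≤ 1) (hβ : ∀ a, β ≤ (PB q).real (B a)) (t : ℕ) :
    (PB q).real (A ∩ {ω | (N ω).card ≤ t}) * β ^ t ≤
      (PB q).real (A ∩ {ω | (N ω).card ≤ t ∧ ∀ a ∈ N ω, ω ∈ B a}) := by
  suffices h : (PB q).real (A ∩ {ω | (N ω).card ≤ t}) ≤ (β ^ t)⁻¹ *
      (PB q).real (A ∩ {ω | (N ω).card ≤ t ∧ ∀ a ∈ N ω, ω ∈ B a}) by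
    rwa [← div_eq_inv_mul, le_div_iff₀ (by positivity)] at h
  refine real_le_of_fibers (meas_finset_eq hN) (by positivity) fun s => ?_
  by_cases hne : (A ∩ N ⁻¹' {s}).Nonempty
  swap
  · rw [Set.not_nonempty_iff_eq_empty] at hne
    have : A ∩ {ω | (N ω).card ≤ t} ∩ N ⁻¹' {s} ⊆ ∅ := by
      rw [← hne]; exact fun ω h => ⟨h.1.1, h.2⟩
    rw [Set.subset_empty_iff.1 this]; simp; positivity
  by_cases hs : s.card ≤ t
  · have e1 : A ∩ {ω | (N ω).card ≤ t} ∩ N ⁻¹' {s} = A ∩ N ⁻¹' {s} := by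
      ext ω; constructor
      · exact fun h => ⟨h.1.1, h.2⟩
      · rintro ⟨h, h'⟩; exact ⟨⟨h, by rw [Set.mem_setOf_eq, show N ω = s from h']; exact hs⟩, h'⟩
    have e2 : A ∩ {ω | (N ω).card ≤ t ∧ ∀ a ∈ N ω, ω ∈ B a} ∩ N ⁻¹' {s} =
        (A ∩ N ⁻¹' {s}) ∩ ⋂ a ∈ s, B a := by
      ext ω; constructor
      · rintro ⟨⟨h1, h2, h3⟩, h4⟩
        obtain rfl : N ω = s := h4
        exact ⟨⟨h1, rfl⟩, by simpa using h3⟩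
      · rintro ⟨⟨h1, h2⟩, h3⟩
        obtain rfl : N ω = s := h2
        exact ⟨⟨h1, hs, by simpa using h3⟩, rfl⟩
    rw [e1, e2, indep_blocks q (hA.inter (meas_finset_eq hN s)) (dA s) B J s (fun a _ => hB a)
      (fun a _ => dB a) (hJ s hne) (hI s hne), ← div_eq_inv_mul, le_div_iff₀ (by positivity)]
    gcongr
    calc β ^ t ≤ β ^ s.card := pow_le_pow_of_le_one h0.le h1 hs
      _ = ∏ a ∈ s, β := by simp
      _ ≤ ∏ a ∈ s, (PB q).real (B a) := Finset.prod_le_prod (fun _ _ => h0.le) fun a _ => hβ a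
  · have : A ∩ {ω | (N ω).card ≤ t} ∩ N ⁻¹' {s} = ∅ := by
      ext ω
      simp only [Set.mem_inter_iff, Set.mem_setOf_eq, Set.mem_preimage, Set.mem_singleton_iff,
        Set.mem_empty_iff_false, iff_false]
      rintro ⟨⟨_, h2⟩, rfl⟩
      exact hs h2
    rw [this]; simp; positivity

end Gen
end Mod1

section Mod2
section Graph
variable {d : ℕ}

instance : Countable (Edge d) := by unfold Edge; infer_instance
noncomputable instance : DecidableEq (Edge d) := Classical.decEq _

theorem dist1_comm (x y : V d) : dist1 x y = dist1 y x := by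
  unfold dist1
  exact Finset.sum_congr rfl fun i _ => by rw [← Int.natAbs_neg, neg_sub]

theorem dist1_self (x : V d) : dist1 x x = 0 := by simp [dist1]

theorem dist1_eq_zero {x y : V d} : dist1 x y = 0 ↔ x = y := by
  unfold dist1
  rw [Finset.sum_eq_zero_iff]
  constructor
  · intro h; funext i; have := h i (Finset.mem_univ i); omega
  · rintro rfl i _; simp

theorem dist1_triangle (x y z : V d) : dist1 x z ≤ dist1 x y + dist1 y z := by
  unfold dist1
  rw [← Finset.sum_add_distrib]
  exact Finset.sum_le_sum fun i _ => by omega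

theorem coord_le_dist1 (x y : V d) (i : Fin d) : (x i - y i).natAbs ≤ dist1 x y :=
  Finset.single_le_sum (f := fun i => (x i - y i).natAbs) (fun _ _ => Nat.zero_le _)
    (Finset.mem_univ i)

/-- the edge between two neighbours -/
def mkE (x y : V d) (h : dist1 x y = 1) : Edge d := ⟨s(x, y), h⟩

theorem edgeOpen_iff {ω : Config d} {x y : V d} :
    edgeOpen ω x y ↔ ∃ h : dist1 x y = 1, ω (mkE x y h) = true := Iff.rfl

theorem edgeOpen.adj {ω : Config d} {x y : V d} (h : edgeOpen ω x y) : dist1 x y = 1 := h.1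

theorem edgeOpen.symm {ω : Config d} {x y : V d} (h : edgeOpen ω x y) : edgeOpen ω y x := by
  unfold edgeOpen at *; rwa [Sym2.eq_swap]

theorem edgeOpen_comm {ω : Config d} {x y : V d} : edgeOpen ω x y ↔ edgeOpen ω y x :=
  ⟨edgeOpen.symm, edgeOpen.symm⟩

/-- edges with both endpoints in `S` -/
def Inside (S : Set (V d)) : Set (Edge d) := {e | ∀ v ∈ e.1, v ∈ S}
/-- edges with at least one endpoint in `S` -/
def Touch (S : Set (V d)) : Set (Edge d) := {e | ∃ v ∈ e.1, v ∈ S}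

theorem mkE_inside {S : Set (V d)} {x y : V d} {h : dist1 x y = 1} :
    mkE x y h ∈ Inside S ↔ x ∈ S ∧ y ∈ S := by
  show (∀ v ∈ s(x, y), v ∈ S) ↔ _
  simp
theorem mkE_touch {S : Set (V d)} {x y : V d} {h : dist1 x y = 1} :
    mkE x y h ∈ Touch S ↔ x ∈ S ∨ y ∈ S := by
  show (∃ v ∈ s(x, y), v ∈ S) ↔ _
  simp
theorem Inside_mono {S T : Set (V d)} (h : S ⊆ T) : Inside S ⊆ Inside T :=
  fun _ he v hv => h (he v hv)
theorem Touch_mono {S T : Set (V d)} (h : S ⊆ T) : Touch S ⊆ Touch T :=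
  fun _ ⟨v, hv, hS⟩ => ⟨v, hv, h hS⟩

theorem Edge.exists_mk (e : Edge d) : ∃ x y h, e = mkE x y h := by
  obtain ⟨e, he⟩ := e
  induction e using Sym2.ind with
  | _ x y => exact ⟨x, y, he, rfl⟩

/-- connection inside a set -/
def Conn (ω : Config d) (S : Set (V d)) (x y : V d) : Prop :=
  Relation.ReflTransGen (fun a b => edgeOpen ω a b ∧ a ∈ S ∧ b ∈ S) x y

theorem Conn.refl (ω : Config d) (S : Set (V d)) (x : V d) : Conn ω S x x := Relation.ReflTransGen.refl
theorem Conn.trans {ω : Config d} {S : Set (V d)} {x y z : V d} (h : Conn ω S x y)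
    (h' : Conn ω S y z) : Conn ω S x z := Relation.ReflTransGen.trans h h'
theorem Conn.symm {ω : Config d} {S : Set (V d)} {x y : V d} (h : Conn ω S x y) :
    Conn ω S y x := by
  induction h with
  | refl => exact Conn.refl _ _ _
  | tail _ h ih => exact Relation.ReflTransGen.head ⟨h.1.symm, h.2.2, h.2.1⟩ ih
theorem Conn.single {ω : Config d} {S : Set (V d)} {x y : V d} (h : edgeOpen ω x y)
    (hx : x ∈ S) (hy : y ∈ S) : Conn ω S x y :=
  Relation.ReflTransGen.single ⟨h, hx, hy⟩
theorem Conn.mono {ω ω' : Config d} {S S' : Set (V d)} {x y : V d} (h : Conn ω S x y)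
    (hω : ∀ e ∈ Inside S, ω e = true → ω' e = true) (hS : S ⊆ S') : Conn ω' S' x y := by
  induction h with
  | refl => exact Conn.refl _ _ _
  | tail _ h ih =>
    obtain ⟨⟨h1, h2⟩, ha, hb⟩ := h
    exact Relation.ReflTransGen.tail ih ⟨⟨h1, hω _ ((mkE_inside (h := h1)).2 ⟨ha, hb⟩) h2⟩, hS ha, hS hb⟩
theorem Conn.monoS {ω : Config d} {S S' : Set (V d)} {x y : V d} (h : Conn ω S x y)
    (hS : S ⊆ S') : Conn ω S' x y := h.mono (fun _ _ h => h) hS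
theorem Conn.congr {ω ω' : Config d} {S : Set (V d)} (hω : ∀ e ∈ Inside S, ω e = ω' e)
    {x y : V d} : Conn ω S x y ↔ Conn ω' S x y :=
  ⟨fun h => h.mono (fun e he h => by rw [← hω e he]; exact h) subset_rfl,
   fun h => h.mono (fun e he h => by rw [hω e he]; exact h) subset_rfl⟩
theorem Conn.mem {ω : Config d} {S : Set (V d)} {x y : V d} (h : Conn ω S x y)
    (hx : x ∈ S) : y ∈ S := by
  induction h with
  | refl => exact hx
  | tail _ h _ => exact h.2.2
theorem Conn.mem_iff {ω : Config d} {S : Set (V d)} {x y : V d} (h : Conn ω S x y) :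
    x ∈ S ↔ y ∈ S := ⟨fun hx => h.mem hx, fun hy => h.symm.mem hy⟩

/-- `n`-step connections -/
def Steps (ω : Config d) : ℕ → V d → V d → Prop
  | 0, x, y => x = y
  | n + 1, x, y => ∃ z, Steps ω n x z ∧ edgeOpen ω z y

theorem steps_iff {ω : Config d} {n : ℕ} {x y : V d} :
    Steps ω n x y ↔ ∃ f : ℕ → V d, IsOpenPath ω n f ∧ f 0 = x ∧ f n = y := by
  induction n generalizing y with
  | zero =>
    constructor
    · rintro rfl; exact ⟨fun _ => x, fun i hi => absurd hi (by omega), rfl, rfl⟩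
    · rintro ⟨f, _, rfl, rfl⟩; rfl
  | succ n ih =>
    constructor
    · rintro ⟨z, hz, hzy⟩
      obtain ⟨f, hf, h0, hn⟩ := ih.1 hz
      refine ⟨fun i => if i ≤ n then f i else y, fun i hi => ?_, by simp [h0], by simp⟩
      rcases Nat.lt_or_ge i n with h | h
      · simp [h.le, Nat.succ_le_of_lt h]; exact hf i h
      · obtain rfl : i = n := by omega
        simp [hn, hzy]
    · rintro ⟨f, hf, h0, hn⟩
      exact ⟨f n, ih.2 ⟨f, fun i hi => hf i (by omega), h0, rfl⟩, hn ▸ hf n (by omega)⟩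

theorem Steps.add {ω : Config d} {m n : ℕ} {x y z : V d} (h : Steps ω m x y)
    (h' : Steps ω n y z) : Steps ω (m + n) x z := by
  induction n generalizing z with
  | zero => obtain rfl : y = z := h'; exact h
  | succ n ih => obtain ⟨w, h1, h2⟩ := h'; exact ⟨w, ih h1, h2⟩

theorem Steps.symm {ω : Config d} {n : ℕ} {x y : V d} (h : Steps ω n x y) : Steps ω n y x := by
  induction n generalizing y with
  | zero => exact Eq.symm h
  | succ n ih =>
    obtain ⟨w, h1, h2⟩ := h
    have := Steps.add (m := 1) (n := n) ⟨y, rfl, h2.symm⟩ (ih h1)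
    rwa [Nat.add_comm] at this

theorem chemDist_eq (ω : Config d) (x y : V d) :
    chemDist ω x y = ⨅ n : ℕ, ⨅ (_ : Steps ω n x y), (n : ℝ≥0∞) := by
  unfold chemDist
  apply le_antisymm
  · refine le_iInf₂ fun n h => sInf_le ?_
    obtain ⟨f, h1, h2, h3⟩ := steps_iff.1 h
    exact ⟨n, f, h1, h2, h3, rfl⟩
  · refine le_sInf ?_
    rintro r ⟨n, f, h1, h2, h3, rfl⟩
    exact iInf₂_le n (steps_iff.2 ⟨f, h1, h2, h3⟩)

theorem chemDist_le_of_steps {ω : Config d} {n : ℕ} {x y : V d} (h : Steps ω n x y) :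
    chemDist ω x y ≤ n := by
  rw [chemDist_eq]; exact iInf₂_le n h

theorem connected_iff_steps {ω : Config d} {x y : V d} :
    Connected ω x y ↔ ∃ n, Steps ω n x y := by
  unfold Connected
  constructor
  · intro h
    by_contra hn
    push Not at hn
    exact h (by rw [chemDist_eq]; simp [hn])
  · rintro ⟨n, h⟩
    exact ne_top_of_le_ne_top (ENNReal.natCast_ne_top n) (chemDist_le_of_steps h)

theorem exists_steps_chemDist {ω : Config d} {x y : V d} (h : Connected ω x y) :
    ∃ n : ℕ, Steps ω n x y ∧ chemDist ω x y = n := by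
  classical
  have h' := connected_iff_steps.1 h
  refine ⟨Nat.find h', Nat.find_spec h', le_antisymm (chemDist_le_of_steps (Nat.find_spec h')) ?_⟩
  rw [chemDist_eq]
  exact le_iInf₂ fun n hn => by exact_mod_cast Nat.find_min' h' hn

theorem chemDist_comm (ω : Config d) (x y : V d) : chemDist ω x y = chemDist ω y x := by
  rw [chemDist_eq, chemDist_eq]
  exact iInf_congr fun n => iInf_congr_Prop ⟨Steps.symm, Steps.symm⟩ fun _ => rfl

theorem chemDist_self (ω : Config d) (x : V d) : chemDist ω x x = 0 :=
  le_antisymm (by simpa using chemDist_le_of_steps (n := 0) (ω := ω) (x := x) (y := x) rfl) bot_le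

theorem chemDist_triangle (ω : Config d) (x y z : V d) :
    chemDist ω x z ≤ chemDist ω x y + chemDist ω y z := by
  by_cases h1 : Connected ω x y
  swap
  · have : chemDist ω x y = ⊤ := by simpa [Connected] using h1
    simp [this]
  by_cases h2 : Connected ω y z
  swap
  · have : chemDist ω y z = ⊤ := by simpa [Connected] using h2
    simp [this]
  obtain ⟨m, hm, e1⟩ := exists_steps_chemDist h1
  obtain ⟨n, hn, e2⟩ := exists_steps_chemDist h2
  rw [e1, e2]
  exact_mod_cast chemDist_le_of_steps (hm.add hn)

theorem connected_iff_conn {ω : Config d} {x y : V d} :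
    Connected ω x y ↔ Conn ω Set.univ x y := by
  rw [connected_iff_steps]
  constructor
  · rintro ⟨n, h⟩
    induction n generalizing y with
    | zero => obtain rfl : x = y := h; exact Conn.refl _ _ _
    | succ n ih =>
      obtain ⟨w, h1, h2⟩ := h
      exact (ih h1).trans (Conn.single h2 trivial trivial)
  · intro h
    induction h with
    | refl => exact ⟨0, rfl⟩
    | tail _ h ih => obtain ⟨n, hn⟩ := ih; exact ⟨n + 1, _, hn, h.1⟩

theorem Connected.symm {ω : Config d} {x y : V d} (h : Connected ω x y) : Connected ω y x := by
  rw [connected_iff_conn] at *; exact h.symm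
theorem Connected.trans {ω : Config d} {x y z : V d} (h : Connected ω x y)
    (h' : Connected ω y z) : Connected ω x z := by
  rw [connected_iff_conn] at *; exact Conn.trans h h'

theorem Conn.connected {ω : Config d} {S : Set (V d)} {x y : V d} (h : Conn ω S x y) :
    Connected ω x y := connected_iff_conn.2 (h.monoS (Set.subset_univ S))

/-- restricted open graph -/
def gr (ω : Config d) (S : Set (V d)) : SimpleGraph (V d) where
  Adj a b := edgeOpen ω a b ∧ a ∈ S ∧ b ∈ S
  symm := ⟨fun a b ⟨h, ha, hb⟩ => ⟨h.symm, hb, ha⟩⟩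
  loopless := ⟨fun a h => by have := h.1.adj; rw [dist1_self] at this; omega⟩

theorem walk_conn {ω : Config d} {S : Set (V d)} {x y : V d} (w : (gr ω S).Walk x y) :
    Conn ω S x y := by
  induction w with
  | nil => exact Conn.refl _ _ _
  | cons h _ ih => exact (Conn.single h.1 h.2.1 h.2.2).trans ih

theorem Conn.chemDist_le {ω : Config d} {S : Finset (V d)} {x y : V d} (h : Conn ω S x y)
    (hx : x ∈ S) : chemDist ω x y ≤ S.card := by
  classical
  have hr : (gr ω S).Reachable x y := by
    induction h with
    | refl => exact .refl _
    | tail _ h ih => exact ih.trans (SimpleGraph.Adj.reachable h)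
  obtain ⟨p, hp⟩ := hr.exists_isPath
  have hsub : p.support.toFinset ⊆ S := by
    intro v hv
    rw [List.mem_toFinset] at hv
    have hv' : Conn ω S x v := walk_conn (p.takeUntil v hv)
    exact hv'.mem hx
  have hlen : p.length ≤ S.card := by
    have h1 := Finset.card_le_card hsub
    rw [List.toFinset_card_of_nodup hp.support_nodup, SimpleGraph.Walk.length_support] at h1
    omega
  refine le_trans (chemDist_le_of_steps (n := p.length) (steps_iff.2 ⟨p.getVert, ?_, by simp, by simp⟩)) (by exact_mod_cast hlen)
  intro i hi
  exact (p.adj_getVert_succ hi).1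

end Graph
end Mod2

section Mod3
section Erg
variable {ι X : Type*} [MeasurableSpace X]

theorem ergodic_shift [Countable ι] (ν : Measure X) [IsProbabilityMeasure ν] (e : ι ≃ ι)
    (he : ∀ s : Finset ι, ∃ n : ℕ, ∀ i ∈ s, ∀ j ∈ s, (e^[n]) i ≠ j) :
    Ergodic (fun (u : ι → X) i => u (e i)) (Measure.infinitePi fun _ : ι => ν) := by
  classical
  set Q := Measure.infinitePi fun _ : ι => ν with hQ
  set τ := fun (u : ι → X) i => u (e i) with hτ
  have mτ : Measurable τ := by fun_prop
  have mp : MeasurePreserving τ Q Q :=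
    ⟨mτ, Measure.map_infinitePi_infinitePi_of_inj (P := fun _ : ι => ν) e.injective⟩
  refine ⟨mp, ⟨fun A hA hinv => ?_⟩⟩
  have iter : ∀ n u i, (τ^[n]) u i = u ((e^[n]) i) := by
    intro n
    induction n with
    | zero => intro u i; rfl
    | succ n ih =>
      intro u i
      rw [Function.iterate_succ_apply, ih, Function.iterate_succ_apply' e]
  have hinvn : ∀ n, (τ^[n]) ⁻¹' A = A := fun n => by
    induction n with
    | zero => rfl
    | succ n ih => rw [Function.iterate_succ, Set.preimage_comp, ih, hinv]
  have key : ∀ ε : ℝ, 0 < ε → |Q.real A - Q.real A ^ 2| ≤ 4 * ε := by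
    intro ε hε
    obtain ⟨t, ht, hlt⟩ := exists_measure_symmDiff_lt_of_generateFrom_isSetRing (μ := Q)
      (isSetRing_measurableCylinders (α := fun _ : ι => X))
      ⟨{Set.univ}, Set.countable_singleton _, by simpa using univ_mem_measurableCylinders (fun _ : ι => X), by simp⟩
      generateFrom_measurableCylinders.symm hA (ε := ENNReal.ofReal ε) (by simpa using hε)
    have hlt' : Q.real (symmDiff t A) ≤ ε := by
      rw [Measure.real]; exact ENNReal.toReal_le_of_le_ofReal hε.le hlt.le
    rw [mem_measurableCylinders] at ht
    obtain ⟨s, S, mS, rfl⟩ := ht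
    obtain ⟨n, hn⟩ := he s
    set t := cylinder (α := fun _ : ι => X) s S with htdef
    have mt : MeasurableSet t := MeasurableSet.cylinder s mS
    set t' := (τ^[n]) ⁻¹' t with ht'
    have mpn := mp.iterate n
    have mt' : MeasurableSet t' := mpn.measurable mt
    have q1 : Q.real t' = Q.real t := by
      rw [Measure.real, Measure.real, mpn.measure_preimage mt.nullMeasurableSet]
    have q2 : Q.real (t ∩ t') = Q.real t * Q.real t' := by
      have h1 : ProbabilityTheory.iIndepFun (fun i (u : ι → X) => u i) Q :=
        ProbabilityTheory.iIndepFun_infinitePi (X := fun i u => u) (fun i => measurable_id)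
      let T : Finset ι := s.image (e^[n])
      have hd : Disjoint s T := by
        rw [Finset.disjoint_left]
        intro i hi hi'
        obtain ⟨j, hj, rfl⟩ := Finset.mem_image.1 hi'
        exact hn j hj _ hi rfl
      have h2 := h1.indepFun_finset s T hd (fun i => measurable_pi_apply i)
      let S' : Set (T → X) := (fun (v : T → X) (i : s) =>
        v ⟨(e^[n]) i, Finset.mem_image_of_mem _ i.2⟩) ⁻¹' S
      have mS' : MeasurableSet S' := by
        refine measurableSet_preimage ?_ mS
        exact measurable_pi_lambda _ fun i => measurable_pi_apply _
      have h3 := h2.measure_inter_preimage_eq_mul S S' mS mS'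
      have e1 : (fun (a : ι → X) (i : s) => a i) ⁻¹' S = t := rfl
      have e2 : (fun (a : ι → X) (i : T) => a i) ⁻¹' S' = t' := by
        ext u
        simp only [S', t', t, cylinder, Set.mem_preimage]
        refine iff_of_eq (congrArg (· ∈ S) ?_)
        funext i
        exact (iter n u i).symm
      rw [e1, e2] at h3
      simp [Measure.real, h3]
    have sub1 : |Q.real t - Q.real A| ≤ ε := by
      refine le_trans ?_ hlt'
      exact abs_measureReal_sub_le_measureReal_symmDiff mt.nullMeasurableSet hA.nullMeasurableSet
    have sub2 : |Q.real (t ∩ t') - Q.real A| ≤ 2 * ε := by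
      have h1 : Q.real (symmDiff t' A) ≤ ε := by
        have : symmDiff t' A = (τ^[n]) ⁻¹' (symmDiff t A) := by
          conv_lhs => rw [← hinvn n]
          rfl
        rw [this, Measure.real, mpn.measure_preimage (mt.symmDiff hA).nullMeasurableSet]
        exact hlt'
      refine (abs_measureReal_sub_le_measureReal_symmDiff (mt.inter mt').nullMeasurableSet
        hA.nullMeasurableSet).trans ?_
      have : symmDiff (t ∩ t') A ⊆ symmDiff t A ∪ symmDiff t' A := by
        intro u; simp only [Set.mem_symmDiff, Set.mem_union, Set.mem_inter_iff]; tauto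
      have := real_union_le (P := Q) this
      linarith
    have b1 : Q.real t ≤ 1 := measureReal_le_one
    have b2 : Q.real A ≤ 1 := measureReal_le_one
    have b3 : 0 ≤ Q.real t := measureReal_nonneg
    have b4 : 0 ≤ Q.real A := measureReal_nonneg
    rw [q2, q1] at sub2
    rw [abs_le] at *
    constructor <;> nlinarith
  have h0 : Q.real A - Q.real A ^ 2 = 0 := by
    by_contra hne
    have hpos : 0 < |Q.real A - Q.real A ^ 2| := abs_pos.2 hne
    have := key (|Q.real A - Q.real A ^ 2| / 8) (by positivity)
    linarith
  have h1 : Q.real A = 0 ∨ Q.real A = 1 := by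
    have : Q.real A * (1 - Q.real A) = 0 := by linarith
    rcases mul_eq_zero.1 this with h | h
    · exact Or.inl h
    · right; linarith
  rw [Filter.eventuallyConst_set']
  rcases h1 with h | h
  · left
    rw [measureReal_eq_zero_iff] at h
    exact ae_eq_empty.2 h
  · right
    rw [ae_eq_univ, prob_compl_eq_zero_iff hA]
    rw [Measure.real] at h
    rw [← ENNReal.ofReal_toReal (measure_ne_top Q A), h]; simp

end Erg

section Unif
variable {d : ℕ}

theorem UQ_iic (U : UniformCoupling d) (e : Edge d) (a : ℝ) :
    U.Q {u | u e ≤ a} = ENNReal.ofReal (min a 1) := by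
  have := U.prob
  have h01 : ∀ b : ℝ, 0 ≤ b → b ≤ 1 → U.Q {u | u e ≤ b} = ENNReal.ofReal b := by
    intro b h0 h1
    have := U.iid {e} (fun _ => b) (by simp [h0, h1])
    simpa using this
  rcases lt_or_ge a 0 with h | h
  · rw [ENNReal.ofReal_of_nonpos (by simp [h.le])]
    refine measure_mono_null ?_ ((h01 0 le_rfl zero_le_one).trans (by simp))
    exact fun u hu => le_trans hu h.le
  rcases le_or_gt a 1 with h' | h'
  · rw [min_eq_left h']; exact h01 a h h'
  · rw [min_eq_right h'.le]
    refine le_antisymm (by simpa using prob_le_one) ?_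
    rw [← h01 1 zero_le_one le_rfl]
    exact measure_mono fun u hu => le_trans hu h'.le

/-- the uniform law -/
noncomputable def unif : Measure ℝ := volume.restrict (Set.Icc 0 1)
instance : IsProbabilityMeasure unif := ⟨by simp [unif]⟩

theorem UQ_map_eval (U : UniformCoupling d) (e : Edge d) : U.Q.map (fun u => u e) = unif := by
  have := U.prob
  have : IsProbabilityMeasure (U.Q.map fun u => u e) :=
    Measure.isProbabilityMeasure_map (measurable_pi_apply e).aemeasurable
  refine Measure.ext_of_Iic _ _ fun a => ?_
  rw [Measure.map_apply (measurable_pi_apply e) measurableSet_Iic, unif,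
    Measure.restrict_apply measurableSet_Iic]
  have h1 : Set.Iic a ∩ Set.Icc 0 1 = Set.Icc 0 (min a 1) := by
    ext x; simp only [Set.mem_inter_iff, Set.mem_Iic, Set.mem_Icc, le_min_iff]; tauto
  rw [h1, Real.volume_Icc, sub_zero, ← UQ_iic U e a]
  rfl

theorem UQ_eq (U : UniformCoupling d) : U.Q = Measure.infinitePi fun _ : Edge d => unif := by
  have := U.prob
  have hind : ProbabilityTheory.iIndepFun (fun e (u : Edge d → ℝ) => u e) U.Q := by
    refine ProbabilityTheory.iIndepSets.iIndep
      (fun e => (measurable_pi_apply e).comap_le)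
      (fun e => {t | ∃ s ∈ Set.range (Set.Iic : ℝ → Set ℝ), (fun u : Edge d → ℝ => u e) ⁻¹' s = t})
      (fun e => isPiSystem_Iic.comap _) (fun e => ?_) ?_
    · show MeasurableSpace.comap (fun u : Edge d → ℝ => u e) Real.measurableSpace = _
      rw [show Real.measurableSpace = MeasurableSpace.generateFrom (Set.range Set.Iic)
        from (BorelSpace.measurable_eq (α := ℝ)).trans (borel_eq_generateFrom_Iic ℝ),
        MeasurableSpace.comap_generateFrom]
      rfl
    · rw [ProbabilityTheory.iIndepSets_iff]
      intro s f hf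
      have : ∀ e, ∃ a : ℝ, e ∈ s → f e = {u | u e ≤ a} := by
        intro e
        by_cases he : e ∈ s
        · obtain ⟨_, ⟨a, rfl⟩, h⟩ := hf e he
          exact ⟨a, fun _ => h.symm⟩
        · exact ⟨0, fun h => absurd h he⟩
      choose a ha using this
      have e1 : ∏ e ∈ s, U.Q (f e) = ∏ e ∈ s, ENNReal.ofReal (min (a e) 1) :=
        Finset.prod_congr rfl fun e he => by rw [ha e he, UQ_iic]
      rw [e1]
      by_cases hneg : ∃ e ∈ s, a e < 0
      · obtain ⟨e, he, hlt⟩ := hneg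
        rw [Finset.prod_eq_zero he (ENNReal.ofReal_of_nonpos (by simp [hlt.le]))]
        refine measure_mono_null (Set.biInter_subset_of_mem he) ?_
        rw [ha e he, UQ_iic, ENNReal.ofReal_of_nonpos (by simp [hlt.le])]
      · push Not at hneg
        have h := U.iid s (fun e => min (a e) 1) (fun e he => ⟨le_min (hneg e he) zero_le_one, min_le_right _ _⟩)
        rw [← h]
        have hle : ∀ᵐ u ∂U.Q, ∀ e, u e ≤ 1 := by
          rw [ae_all_iff]
          intro e
          have : U.Q {u | u e ≤ 1} = 1 := by rw [UQ_iic]; simp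
          rw [ae_iff]
          exact (prob_compl_eq_zero_iff (measurableSet_le (measurable_pi_apply e) measurable_const)).2 this
        apply measure_congr
        filter_upwards [hle] with u hu
        apply propext
        show u ∈ (⋂ i ∈ s, f i) ↔ ∀ e ∈ s, u e ≤ min (a e) 1
        simp only [Set.mem_iInter]
        refine forall₂_congr fun e he => ?_
        rw [ha e he]
        simp [hu e]
  have := (ProbabilityTheory.iIndepFun_iff_map_fun_eq_infinitePi_map
    (X := fun e (u : Edge d → ℝ) => u e) (P := U.Q) (fun e => measurable_pi_apply e)).1 hind
  simp only [UQ_map_eval] at this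
  rw [← this]
  exact (Measure.map_id (μ := U.Q)).symm

/-- Bernoulli bond percolation -/
noncomputable def Pc (d : ℕ) (q : unitInterval) : Measure (Config d) := PB fun _ : Edge d => q
instance (q : unitInterval) : IsProbabilityMeasure (Pc d q) := by unfold Pc; infer_instance

theorem meas_cfgAt (q : ℝ) : Measurable (fun u : Edge d → ℝ => cfgAt u q) := by
  refine measurable_pi_lambda _ fun e => ?_
  unfold cfgAt
  exact Measurable.ite (measurableSet_le (measurable_pi_apply e) measurable_const)
    measurable_const measurable_const

theorem UQ_map_cfgAt (U : UniformCoupling d) (q : unitInterval) :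
    U.Q.map (fun u => cfgAt u q) = Pc d q := by
  classical
  have mf : Measurable (fun a : ℝ => if a ≤ (q : ℝ) then true else false) :=
    Measurable.ite measurableSet_Iic measurable_const measurable_const
  have h := Measure.infinitePi_map_pi (ι := Edge d) (μ := fun _ => unif)
    (f := fun _ a => if a ≤ (q : ℝ) then true else false) (fun _ => mf)
  rw [UQ_eq, Pc, PB]
  have hb : unif.map (fun a : ℝ => if a ≤ (q : ℝ) then true else false) = bern q := by
    have : IsProbabilityMeasure (unif.map fun a : ℝ => if a ≤ (q : ℝ) then true else false) :=
      Measure.isProbabilityMeasure_map mf.aemeasurable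
    have ht : unif.map (fun a : ℝ => if a ≤ (q : ℝ) then true else false) {true} = bern q {true} := by
      rw [Measure.map_apply mf (measurableSet_singleton _), bern_true, unif,
        Measure.restrict_apply (mf (measurableSet_singleton _))]
      have : (fun a : ℝ => if a ≤ (q : ℝ) then true else false) ⁻¹' {true} ∩ Set.Icc 0 1
          = Set.Icc 0 (q : ℝ) := by
        ext x
        have := q.2.2
        simp only [Set.mem_inter_iff, Set.mem_preimage, Set.mem_singleton_iff, Set.mem_Icc,
          ite_eq_left_iff, Bool.false_eq_true, imp_false, not_not]
        constructor
        · tauto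
        · rintro ⟨h1, h2⟩; exact ⟨h2, h1, h2.trans this⟩
      rw [this]; simp
    have hf : unif.map (fun a : ℝ => if a ≤ (q : ℝ) then true else false) {false} = bern q {false} := by
      have e : ({false} : Set Bool) = {true}ᶜ := by ext b; cases b <;> simp
      rw [e, prob_compl_eq_one_sub (measurableSet_singleton _),
        prob_compl_eq_one_sub (measurableSet_singleton _), ht]
    refine Measure.ext_of_singleton fun b => ?_
    cases b
    · exact hf
    · exact ht
  simp only [hb] at h
  rw [← h]
  congr 1

theorem UQ_real_cfgAt (U : UniformCoupling d) (q : unitInterval) {A : Set (Config d)}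
    (hA : MeasurableSet A) : U.Q.real {u | cfgAt u q ∈ A} = (Pc d q).real A := by
  rw [← UQ_map_cfgAt U q, Measure.real, Measure.real, Measure.map_apply (meas_cfgAt _) hA]
  rfl

theorem cfgAt_mono {u : Edge d → ℝ} {p q : ℝ} (h : p ≤ q) {e : Edge d}
    (he : cfgAt u p e = true) : cfgAt u q e = true := by
  simp only [cfgAt] at *
  by_cases h1 : u e ≤ p
  · simp [h1.trans h]
  · simp [h1] at he

end Unif
end Mod3

section Mod4
section FKG
variable {ι : Type*}

theorem PB_cyl (q : ι → unitInterval) (I : Finset ι) (f : ι → Bool) :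
    (PB q).real {ω | ∀ i ∈ I, ω i = f i} = ∏ i ∈ I, (PB q).real {ω | ω i = f i} := by
  rw [← indep_blocks' q (fun i => {ω | ω i = f i}) (fun i => {i}) I (fun i _ => meas_coord i _)
    (fun i _ => detBy_coord i _) (fun a _ b _ h => by simpa using h)]
  congr 1; ext ω
  simp

theorem fkg_inc [Countable ι] (q : ι → unitInterval) (I : Finset ι) {A B : Set (ι → Bool)}
    (hA : MeasurableSet A) (hB : MeasurableSet B)
    (dA : DetBy (I : Set ι) A) (dB : DetBy (I : Set ι) B)
    (iA : ∀ ω ω' : ι → Bool, ω ≤ ω' → ω ∈ A → ω' ∈ A)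
    (iB : ∀ ω ω' : ι → Bool, ω ≤ ω' → ω ∈ B → ω' ∈ B) :
    (PB q).real A * (PB q).real B ≤ (PB q).real (A ∩ B) := by
  classical
  let ex : (I → Bool) → (ι → Bool) := fun f i => if h : i ∈ I then f ⟨i, h⟩ else false
  have exmono : Monotone ex := by
    intro f g h i
    by_cases hi : i ∈ I
    · simp only [ex, hi, dif_pos]; exact h _
    · simp [ex, hi]
  let w : (I → Bool) → ℝ := fun f => ∏ i : I, (PB q).real {ω | ω i = f i}
  have w0 : 0 ≤ w := fun f => Finset.prod_nonneg fun _ _ => measureReal_nonneg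
  have rep : ∀ C : Set (ι → Bool), MeasurableSet C → DetBy (I : Set ι) C →
      (PB q).real C = ∑ f, w f * (if ex f ∈ C then 1 else 0) := by
    intro C hC dC
    let g : (ι → Bool) → (I → Bool) := fun ω i => ω i
    have hg : ∀ f, MeasurableSet (g ⁻¹' {f}) := by
      intro f
      have : g ⁻¹' {f} = {ω | ∀ i : I, ω i = f i} := by
        ext ω; simp [g, funext_iff]
      rw [this]
      exact meas_all fun i => meas_coord _ _
    have h1 : C = ⋃ f ∈ (Finset.univ : Finset (I → Bool)), C ∩ g ⁻¹' {f} := by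
      ext ω; simp
    have h2 : (PB q).real C = ∑ f, (PB q).real (C ∩ g ⁻¹' {f}) := by
      conv_lhs => rw [h1]
      refine measureReal_biUnion_finset ?_ fun f _ => hC.inter (hg f)
      intro f _ f' _ hne
      refine Set.disjoint_left.2 fun ω h h' => hne ?_
      rw [← show g ω = f from h.2, ← show g ω = f' from h'.2]
    rw [h2]
    refine Finset.sum_congr rfl fun f _ => ?_
    have hagree : ∀ ω ∈ g ⁻¹' {f}, ∀ i ∈ (I : Set ι), ω i = ex f i := by
      intro ω hω i hi
      have hi' : i ∈ I := hi
      simp only [ex, hi', dif_pos]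
      exact congrFun (show g ω = f from hω) ⟨i, hi'⟩
    by_cases hf : ex f ∈ C
    · have : C ∩ g ⁻¹' {f} = {ω | ∀ i ∈ I, ω i = ex f i} := by
        ext ω; constructor
        · intro h i hi; exact hagree ω h.2 i hi
        · intro h
          refine ⟨(dC.iff (fun i hi => h i hi)).2 hf, ?_⟩
          show g ω = f
          funext i
          have := h i i.2
          simpa [ex, g] using this
      rw [this, PB_cyl, if_pos hf, mul_one, ← Finset.prod_coe_sort]
      refine Finset.prod_congr rfl fun i _ => ?_
      simp [ex]
    · have : C ∩ g ⁻¹' {f} = ∅ := by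
        refine Set.eq_empty_of_forall_notMem fun ω h => hf ((dC.iff (hagree ω h.2)).1 h.1)
      rw [this, if_neg hf]; simp
  rw [rep A hA dA, rep B hB dB, rep (A ∩ B) (hA.inter hB) (dA.inter dB)]
  have hone : ∑ f, w f = 1 := by
    have := rep Set.univ MeasurableSet.univ (fun _ _ _ _ => trivial)
    simpa using this.symm
  have := fkg (α := I → Bool) (μ := w) (f := fun f => if ex f ∈ A then (1:ℝ) else 0)
    (g := fun f => if ex f ∈ B then (1:ℝ) else 0) w0 (fun f => by positivity) (fun f => by positivity)
    (by
      intro f g h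
      by_cases h1 : ex f ∈ A
      · simp [h1, iA _ _ (exmono h) h1]
      · simp only [h1, if_false]; positivity)
    (by
      intro f g h
      by_cases h1 : ex f ∈ B
      · simp [h1, iB _ _ (exmono h) h1]
      · simp only [h1, if_false]; positivity)
    (by
      intro a b
      simp only [w]
      rw [← Finset.prod_mul_distrib, ← Finset.prod_mul_distrib]
      refine le_of_eq (Finset.prod_congr rfl fun i _ => ?_)
      rw [Pi.inf_apply, Pi.sup_apply]
      cases a i <;> cases b i <;> simp [mul_comm])
  rw [hone, one_mul] at this
  refine this.trans (le_of_eq (Finset.sum_congr rfl fun f _ => ?_))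
  by_cases h1 : ex f ∈ A <;> by_cases h2 : ex f ∈ B <;> simp [h1, h2]

theorem fkg_dec [Countable ι] (q : ι → unitInterval) (I : Finset ι) {A B : Set (ι → Bool)}
    (hA : MeasurableSet A) (hB : MeasurableSet B)
    (dA : DetBy (I : Set ι) A) (dB : DetBy (I : Set ι) B)
    (iA : ∀ ω ω' : ι → Bool, ω ≤ ω' → ω' ∈ A → ω ∈ A)
    (iB : ∀ ω ω' : ι → Bool, ω ≤ ω' → ω' ∈ B → ω ∈ B) :
    (PB q).real A * (PB q).real B ≤ (PB q).real (A ∩ B) := by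
  have := fkg_inc q I hA.compl hB.compl dA.compl dB.compl
    (fun ω ω' h h' h'' => h' (iA _ _ h h'')) (fun ω ω' h h' h'' => h' (iB _ _ h h''))
  have e1 : (PB q).real (Aᶜ ∩ Bᶜ) = 1 - (PB q).real (A ∪ B) := by
    rw [← Set.compl_union, probReal_compl_eq_one_sub (hA.union hB)]
  rw [probReal_compl_eq_one_sub hA, probReal_compl_eq_one_sub hB, e1] at this
  have e2 := measureReal_union_add_inter (μ := PB q) (s := A) hB
  nlinarith

theorem fkg_dec_prod [Countable ι] {α : Type*} (q : ι → unitInterval) (I : Finset ι)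
    (s : Finset α) (A : α → Set (ι → Bool))
    (hA : ∀ a, MeasurableSet (A a)) (dA : ∀ a, DetBy (I : Set ι) (A a))
    (iA : ∀ a, ∀ ω ω' : ι → Bool, ω ≤ ω' → ω' ∈ A a → ω ∈ A a) :
    ∏ a ∈ s, (PB q).real (A a) ≤ (PB q).real (⋂ a ∈ s, A a) := by
  classical
  induction s using Finset.induction_on with
  | empty => simp
  | insert a s ha ih =>
    rw [Finset.prod_insert ha, Finset.set_biInter_insert]
    refine le_trans (mul_le_mul_of_nonneg_left ih measureReal_nonneg) ?_
    refine fkg_dec q I (hA a) (s.measurableSet_biInter fun b _ => hA b) (dA a)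
      (DetBy.biInter fun b _ => dA b) (iA a) ?_
    intro ω ω' h h'
    simp only [Set.mem_iInter] at *
    exact fun b hb => iA b _ _ h (h' b hb)

end FKG
end Mod4

section Mod5
section Geo
variable {d : ℕ}

/-- sup-norm ball -/
noncomputable def box (n : ℕ) (x : V d) : Finset (V d) := Finset.Icc (fun i => x i - n) (fun i => x i + n)

theorem mem_box {n : ℕ} {x y : V d} : y ∈ box n x ↔ ∀ i, |y i - x i| ≤ n := by
  simp only [box, Finset.mem_Icc, Pi.le_def, abs_le]
  constructor
  · rintro ⟨h1, h2⟩ i; have := h1 i; have := h2 i; constructor <;> linarith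
  · intro h; exact ⟨fun i => by linarith [(h i).1], fun i => by linarith [(h i).2]⟩

theorem card_box (n : ℕ) (x : V d) : (box n x).card = (2 * n + 1) ^ d := by
  rw [box, Pi.card_Icc]
  simp only [Int.card_Icc]
  have : ∀ i : Fin d, (x i + n + 1 - (x i - n)).toNat = 2 * n + 1 := by intro i; omega
  simp [this]

theorem self_mem_box (n : ℕ) (x : V d) : x ∈ box n x := by simp [mem_box]

theorem box_mono {m n : ℕ} (h : m ≤ n) (x : V d) : box m x ⊆ box n x := by
  intro y; simp only [mem_box]
  intro hy i; exact (hy i).trans (by exact_mod_cast h)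

theorem box_sub {m n k : ℕ} {x y : V d} (hy : y ∈ box n x) (h : n + m ≤ k) : box m y ⊆ box k x := by
  intro z hz
  rw [mem_box] at *
  intro i
  have h1 := hy i; have h2 := hz i
  have h3 : ((n + m : ℕ) : ℤ) ≤ k := by exact_mod_cast h
  push_cast at h3
  rw [abs_le] at *
  constructor <;> linarith [h1.1, h1.2, h2.1, h2.2]

theorem mem_box_comm {n : ℕ} {x y : V d} : y ∈ box n x ↔ x ∈ box n y := by
  simp only [mem_box]
  refine forall_congr' fun i => ?_
  rw [abs_sub_comm]

theorem adj_mem_box {x y : V d} (h : dist1 x y = 1) : y ∈ box 1 x := by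
  rw [mem_box]; intro i
  have := coord_le_dist1 x y i
  rw [h] at this
  rw [abs_le]; constructor <;> omega

theorem mem_box_dist1 (x y : V d) : y ∈ box (dist1 x y) x := by
  rw [mem_box]; intro i
  have := coord_le_dist1 x y i
  rw [abs_le]; constructor <;> omega

theorem dist1_le_of_box {n : ℕ} {x y : V d} (h : y ∈ box n x) : dist1 x y ≤ d * n := by
  rw [mem_box] at h
  unfold dist1
  calc ∑ i, (x i - y i).natAbs ≤ ∑ _i : Fin d, n := Finset.sum_le_sum fun i _ => by
        have := h i; rw [abs_le] at this; omega
    _ = d * n := by simp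

theorem exists_box_of_finite {S : Set (V d)} (h : S.Finite) (x : V d) : ∃ n : ℕ, S ⊆ box n x := by
  obtain ⟨n, hn⟩ := (h.image (dist1 x)).bddAbove
  exact ⟨n, fun y hy => box_mono (hn (Set.mem_image_of_mem _ hy)) x (mem_box_dist1 x y)⟩

/-- first exit -/
theorem Conn.exit {ω : Config d} {S T : Set (V d)} {x y : V d} (h : Conn ω S x y)
    (hx : x ∈ T) (hy : y ∉ T) : ∃ a b, a ∈ T ∧ b ∉ T ∧ edgeOpen ω a b ∧ a ∈ S ∧ b ∈ S ∧
      Conn ω (S ∩ T) x a ∧ Conn ω S b y := by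
  induction h using Relation.ReflTransGen.head_induction_on with
  | refl => exact absurd hx hy
  | @head u v h1 h2 ih =>
    by_cases hv : v ∈ T
    · obtain ⟨a, b, ha, hb, hab, haS, hbS, hc, hc'⟩ := ih hv
      exact ⟨a, b, ha, hb, hab, haS, hbS, (Conn.single (S := S ∩ T) h1.1 ⟨h1.2.1, hx⟩ ⟨h1.2.2, hv⟩).trans hc, hc'⟩
    · exact ⟨u, v, hx, hv, h1.1, h1.2.1, h1.2.2, Conn.refl _ _ _, h2⟩

/-- last exit -/
theorem Conn.last_exit {ω : Config d} {S T : Set (V d)} {x y : V d} (h : Conn ω S x y)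
    (hx : x ∈ T) (hy : y ∉ T) : ∃ a b, a ∈ T ∧ b ∉ T ∧ edgeOpen ω a b ∧ a ∈ S ∧ b ∈ S ∧
      Conn ω (S \ T) b y ∧ Conn ω S x a := by
  obtain ⟨b, a, hb, ha, hba, hbS, haS, hc, hc'⟩ := h.symm.exit (T := Tᶜ) hy (fun h => h hx)
  exact ⟨a, b, not_not.1 ha, hb, hba.symm, haS, hbS, hc.symm, hc'.symm⟩

theorem meas_edgeOpen (x y : V d) : MeasurableSet {ω : Config d | edgeOpen ω x y} := by
  by_cases h : dist1 x y = 1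
  · have : {ω : Config d | edgeOpen ω x y} = {ω | ω (mkE x y h) = true} := by
      ext ω; exact ⟨fun h => h.2, fun h' => ⟨h, h'⟩⟩
    rw [this]; exact meas_coord _ _
  · have : {ω : Config d | edgeOpen ω x y} = ∅ := by
      ext ω; exact ⟨fun h' => h h'.1, fun h => h.elim⟩
    rw [this]; exact MeasurableSet.empty

theorem meas_conn (S : Set (V d)) (x y : V d) : MeasurableSet {ω : Config d | Conn ω S x y} :=
  meas_rtg (r := fun ω a b => edgeOpen ω a b ∧ a ∈ S ∧ b ∈ S)
    (fun a b => meas_and (meas_edgeOpen a b) (meas_const _)) x y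

theorem detBy_conn (S : Set (V d)) (x y : V d) : DetBy (Inside S) {ω : Config d | Conn ω S x y} :=
  fun _ _ h h' => (Conn.congr h).1 h'

theorem conn_mono_cfg {ω ω' : Config d} (h : ω ≤ ω') {S : Set (V d)} {x y : V d}
    (hc : Conn ω S x y) : Conn ω' S x y :=
  hc.mono (fun e _ he => by have := h e; rw [he] at this; exact this rfl) subset_rfl

theorem connected_iff_conn_univ {ω : Config d} {x y : V d} :
    Connected ω x y ↔ Conn ω Set.univ x y := connected_iff_conn

theorem inf_iff {ω : Config d} {x : V d} :
    InInfiniteCluster ω x ↔ ∀ n : ℕ, ∃ y, y ∉ box n 0 ∧ Conn ω Set.univ x y := by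
  constructor
  · intro h n
    by_contra hc
    push Not at hc
    refine h ((box n (0 : V d)).finite_toSet.subset fun y hy => ?_)
    by_contra hy'
    exact hc y hy' (connected_iff_conn_univ.1 hy)
  · intro h hf
    obtain ⟨n, hn⟩ := exists_box_of_finite hf 0
    obtain ⟨y, hy, hc⟩ := h n
    exact hy (hn (connected_iff_conn_univ.2 hc))

theorem meas_inf (x : V d) : MeasurableSet {ω : Config d | InInfiniteCluster ω x} := by
  simp only [inf_iff]
  exact meas_all fun n => meas_ex fun y => meas_and (meas_const _) (meas_conn _ _ _)

theorem inf_of_conn {ω : Config d} {x y : V d} (h : InInfiniteCluster ω x)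
    (hc : Conn ω Set.univ x y) : InInfiniteCluster ω y := by
  rw [inf_iff] at *
  intro n
  obtain ⟨z, hz, hz'⟩ := h n
  exact ⟨z, hz, hc.symm.trans hz'⟩

theorem inf_mono_cfg {ω ω' : Config d} (h : ω ≤ ω') {x : V d}
    (hx : InInfiniteCluster ω x) : InInfiniteCluster ω' x := by
  rw [inf_iff] at *
  intro n
  obtain ⟨z, hz, hz'⟩ := hx n
  exact ⟨z, hz, conn_mono_cfg h hz'⟩

/-- lattice isometries -/
structure Iso (d : ℕ) where
  φ : V d ≃ V d
  iso : ∀ x y, dist1 (φ x) (φ y) = dist1 x y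

theorem sym2dist1_map (g : Iso d) (e : Sym2 (V d)) : sym2dist1 (e.map g.φ) = sym2dist1 e := by
  induction e using Sym2.ind with
  | _ x y => exact g.iso x y

/-- inverse isometry -/
def Iso.inv (g : Iso d) : Iso d := ⟨g.φ.symm, fun x y => by
  rw [← g.iso]; simp⟩

/-- action on edges -/
def Iso.e (g : Iso d) : Edge d ≃ Edge d where
  toFun e := ⟨e.1.map g.φ, by rw [sym2dist1_map]; exact e.2⟩
  invFun e := ⟨e.1.map g.inv.φ, by rw [sym2dist1_map]; exact e.2⟩
  left_inv e := by
    apply Subtype.ext; simp [Sym2.map_map, Iso.inv]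
  right_inv e := by
    apply Subtype.ext; simp [Sym2.map_map, Iso.inv]

/-- translation -/
def Iso.tr (v : V d) : Iso d := ⟨Equiv.addRight v, fun x y => by simp [dist1]⟩
@[simp] theorem Iso.tr_apply (v x : V d) : (Iso.tr v).φ x = x + v := rfl

theorem edgeOpen_iso (g : Iso d) (ω : Config d) (x y : V d) :
    edgeOpen (fun e => ω (g.e e)) x y ↔ edgeOpen ω (g.φ x) (g.φ y) := by
  constructor
  · rintro ⟨h, h'⟩; exact ⟨(g.iso x y).trans h, h'⟩
  · rintro ⟨h, h'⟩; exact ⟨(g.iso x y).symm.trans h, h'⟩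

theorem conn_iso (g : Iso d) (ω : Config d) (S : Set (V d)) (x y : V d) :
    Conn (fun e => ω (g.e e)) S x y ↔ Conn ω (g.φ '' S) (g.φ x) (g.φ y) := by
  constructor
  · intro h
    induction h with
    | refl => exact Conn.refl _ _ _
    | tail _ h ih =>
      exact Relation.ReflTransGen.tail ih ⟨(edgeOpen_iso g ω _ _).1 h.1,
        Set.mem_image_of_mem _ h.2.1, Set.mem_image_of_mem _ h.2.2⟩
  · intro h
    obtain ⟨a, ha⟩ : ∃ a, a = g.φ x := ⟨_, rfl⟩
    obtain ⟨b, hb⟩ : ∃ b, b = g.φ y := ⟨_, rfl⟩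
    rw [← ha, ← hb] at h
    have : x = g.φ.symm a := by simp [ha]
    rw [this]
    have : y = g.φ.symm b := by simp [hb]
    rw [this]
    clear * - h
    induction h with
    | refl => exact Conn.refl _ _ _
    | tail _ h ih =>
      obtain ⟨h1, ⟨u, hu, rfl⟩, ⟨v, hv, rfl⟩⟩ := h
      refine Relation.ReflTransGen.tail ih ⟨(edgeOpen_iso g ω _ _).2 (by simpa using h1), ?_, ?_⟩
      · simpa using hu
      · simpa using hv

theorem conn_iso_univ (g : Iso d) (ω : Config d) (x y : V d) :
    Conn (fun e => ω (g.e e)) Set.univ x y ↔ Conn ω Set.univ (g.φ x) (g.φ y) := by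
  rw [conn_iso]; simp

theorem Pc_iso (g : Iso d) (q : unitInterval) {A : Set (Config d)} (hA : MeasurableSet A) :
    (Pc d q).real {ω | (fun e => ω (g.e e)) ∈ A} = (Pc d q).real A := by
  have h : (Pc d q).map (fun ω e => ω (g.e e)) = Pc d q :=
    Measure.map_infinitePi_infinitePi_of_inj (P := fun _ : Edge d => bern q) g.e.injective
  conv_rhs => rw [← h]
  rw [Measure.real, Measure.real, Measure.map_apply (by fun_prop) hA]
  rfl

theorem box_iso_tr (n : ℕ) (x v : V d) : (Iso.tr v).φ '' (box n x : Set (V d)) = box n (x + v) := by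
  ext y
  simp only [Set.mem_image, Finset.mem_coe, mem_box, Iso.tr_apply]
  constructor
  · rintro ⟨z, hz, rfl⟩ i; simpa using hz i
  · intro h; exact ⟨y - v, fun i => by have := h i; simp only [Pi.add_apply] at this; rw [Pi.sub_apply, sub_sub, add_comm (v i)]; exact this, by simp⟩

theorem chemDist_iso (g : Iso d) (ω : Config d) (x y : V d) :
    chemDist (fun e => ω (g.e e)) x y = chemDist ω (g.φ x) (g.φ y) := by
  have : ∀ n x y, Steps (fun e => ω (g.e e)) n x y ↔ Steps ω n (g.φ x) (g.φ y) := by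
    intro n
    induction n with
    | zero => intro x y; simp [Steps]
    | succ n ih =>
      intro x y
      simp only [Steps]
      constructor
      · rintro ⟨z, h⟩; refine ⟨g.φ z, ?_⟩; simpa [ih, edgeOpen_iso] using h
      · rintro ⟨z, h⟩; refine ⟨g.φ.symm z, ?_⟩; simpa [ih, edgeOpen_iso] using h
  simp only [chemDist_eq, this]

theorem inf_iso (g : Iso d) (ω : Config d) (x : V d) :
    InInfiniteCluster (fun e => ω (g.e e)) x ↔ InInfiniteCluster ω (g.φ x) := by
  have : cluster ω (g.φ x) = g.φ '' cluster (fun e => ω (g.e e)) x := by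
    ext y
    simp only [cluster, Connected, chemDist_iso, Set.mem_image]
    constructor
    · intro h; exact ⟨g.φ.symm y, by simpa using h, by simp⟩
    · rintro ⟨z, hz, rfl⟩; exact hz
  rw [InInfiniteCluster, InInfiniteCluster, this, Set.infinite_image_iff g.φ.injective.injOn]

end Geo
end Mod5

section Mod6
section P1
variable {d : ℕ}

/-- sum of the `k`-th coordinates of the endpoints -/
def eSum (k : Fin d) (e : Edge d) : ℤ :=
  Sym2.lift ⟨fun x y : V d => x k + y k, fun x y => add_comm _ _⟩ e.1

theorem eSum_tr (k : Fin d) (v : V d) (e : Edge d) : eSum k ((Iso.tr v).e e) = eSum k e + 2 * v k := by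
  obtain ⟨x, y, h, rfl⟩ := e.exists_mk
  show (x + v) k + (y + v) k = x k + y k + 2 * v k
  simp only [Pi.add_apply]; ring

theorem eSum_iter (k : Fin d) (v : V d) (n : ℕ) (e : Edge d) :
    eSum k (((Iso.tr v).e)^[n] e) = eSum k e + 2 * n * v k := by
  induction n with
  | zero => simp
  | succ n ih => rw [Function.iterate_succ_apply', eSum_tr, ih]; push_cast; ring

theorem ergodic_tr (U : UniformCoupling d) {v : V d} (hv : v ≠ 0) :
    Ergodic (fun (u : Edge d → ℝ) e => u ((Iso.tr v).e e)) U.Q := by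
  rw [UQ_eq]
  apply ergodic_shift
  intro s
  obtain ⟨k, hk⟩ : ∃ k, v k ≠ 0 := by
    by_contra h; push Not at h; exact hv (funext h)
  obtain ⟨M, hM⟩ := ((s ×ˢ s).finite_toSet.image fun p => (eSum k p.2 - eSum k p.1).natAbs).bddAbove
  refine ⟨M + 1, fun i hi j hj h => ?_⟩
  have h1 := congrArg (eSum k) h
  rw [eSum_iter] at h1
  have h2 : (eSum k j - eSum k i).natAbs ≤ M :=
    hM ⟨(i, j), by simp [hi, hj], rfl⟩
  have h3 : eSum k j - eSum k i = 2 * (M + 1 : ℕ) * v k := by linarith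
  rw [h3, Int.natAbs_mul, Int.natAbs_mul] at h2
  have h4 : 1 ≤ (v k).natAbs := by omega
  have h5 : (Int.natAbs 2) * ((M + 1 : ℕ) : ℤ).natAbs = 2 * (M + 1) := by rw [Int.natAbs_natCast]; rfl
  rw [h5] at h2
  nlinarith

theorem all_open_conn (ω : Config d) (h : ∀ e, ω e = true) (k : Fin d) (n : ℕ) :
    Conn ω Set.univ 0 (Pi.single k (n : ℤ)) := by
  induction n with
  | zero => simp only [Nat.cast_zero, Pi.single_zero]; exact Conn.refl _ _ _
  | succ n ih =>
    refine ih.trans (Conn.single ⟨?_, h _⟩ trivial trivial)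
    show dist1 _ _ = 1
    unfold dist1
    rw [Finset.sum_eq_single k]
    · simp
    · intro b _ hb; simp [Pi.single_eq_of_ne hb]
    · simp

theorem exists_theta_pos (hd : 2 ≤ d) (U : UniformCoupling d) {q : ℝ} (h : pcU U < q) :
    0 < U.Q {u | InInfiniteCluster (cfgAt u q) 0} := by
  have := U.prob
  have hne : (1 : ℝ) ∈ {p : ℝ | 0 ≤ p ∧ p ≤ 1 ∧ 0 < U.Q {u | InInfiniteCluster (cfgAt u p) 0}} := by
    refine ⟨zero_le_one, le_rfl, ?_⟩
    have hle : ∀ᵐ u ∂U.Q, ∀ e, u e ≤ 1 := by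
      rw [ae_all_iff]
      intro e
      have : U.Q {u | u e ≤ 1} = 1 := by rw [UQ_iic]; simp
      rw [ae_iff]
      exact (prob_compl_eq_zero_iff (measurableSet_le (measurable_pi_apply e) measurable_const)).2 this
    have h1 : ∀ᵐ u ∂U.Q, u ∈ {u | InInfiniteCluster (cfgAt u 1) 0} := by
      filter_upwards [hle] with u hu
      show InInfiniteCluster (cfgAt u 1) 0
      rw [inf_iff]
      intro n
      let k : Fin d := ⟨0, by omega⟩
      refine ⟨Pi.single k ((n + 1 : ℕ) : ℤ), ?_, all_open_conn _ (fun e => by simp [cfgAt, hu e]) k (n + 1)⟩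
      rw [mem_box]
      intro h
      have := h k
      simp only [Pi.single_eq_same, Pi.zero_apply, sub_zero] at this
      rw [abs_le] at this
      push_cast at this; linarith [this.2]
    refine pos_iff_ne_zero.2 fun h0 => ?_
    have h2 := measure_eq_zero_iff_ae_notMem.1 h0
    obtain ⟨u, hu1, hu2⟩ := (h1.and h2).exists
    exact hu2 hu1
  obtain ⟨r, ⟨_, _, hr⟩, hlt⟩ := exists_lt_of_csInf_lt ⟨1, hne⟩ h
  refine hr.trans_le (measure_mono fun u hu => ?_)
  exact inf_mono_cfg (fun e => by
    intro he; exact cfgAt_mono hlt.le he) hu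

theorem exists_inf_ae (hd : 2 ≤ d) (U : UniformCoupling d) {q : unitInterval} (h : pcU U < q) :
    (Pc d q).real {ω | ∃ x, InInfiniteCluster ω x} = 1 := by
  have := U.prob
  have mE : MeasurableSet {ω : Config d | ∃ x, InInfiniteCluster ω x} := meas_ex meas_inf
  rw [← UQ_real_cfgAt U q mE]
  let k : Fin d := ⟨0, by omega⟩
  have hv : (Pi.single k 1 : V d) ≠ 0 := by
    intro h; have := congrFun h k; simp at this
  have erg := ergodic_tr U hv
  have mE' : MeasurableSet {u : Edge d → ℝ | ∃ x, InInfiniteCluster (cfgAt u q) x} :=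
    meas_cfgAt q mE
  have h01 := erg.toPreErgodic.prob_eq_zero_or_one mE' (by
    ext u
    show (∃ x, InInfiniteCluster (fun e => cfgAt u q ((Iso.tr _).e e)) x) ↔
      (∃ x, InInfiniteCluster (cfgAt u q) x)
    simp only [inf_iso]
    constructor
    · rintro ⟨x, hx⟩; exact ⟨_, hx⟩
    · rintro ⟨x, hx⟩; exact ⟨(Iso.tr (Pi.single k 1)).φ.symm x, by rw [Equiv.apply_symm_apply]; exact hx⟩)
  rcases h01 with h0 | h1
  · exfalso
    have := exists_theta_pos hd U h
    refine absurd (measure_mono_null (fun u hu => ?_) h0) this.ne'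
    exact ⟨0, hu⟩
  · show (U.Q {u : Edge d → ℝ | ∃ x, InInfiniteCluster (cfgAt u q) x}).toReal = 1
    rw [h1]; rfl

theorem exists_box_inf (hd : 2 ≤ d) (U : UniformCoupling d) {q : unitInterval} (h : pcU U < q)
    {ε : ℝ} (hε : 0 < ε) : ∃ m : ℕ, 1 ≤ m ∧
      1 - ε ≤ (Pc d q).real {ω | ∃ x ∈ box m (0 : V d), InInfiniteCluster ω x} := by
  have h1 : Tendsto (fun m : ℕ => (Pc d q).real {ω | ∃ x ∈ box m (0 : V d), InInfiniteCluster ω x}) atTop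
      (𝓝 ((Pc d q).real (⋃ m : ℕ, {ω | ∃ x ∈ box m (0 : V d), InInfiniteCluster ω x}))) := by
    refine (ENNReal.tendsto_toReal (measure_ne_top _ _)).comp (tendsto_measure_iUnion_atTop ?_)
    intro m n hmn ω
    rintro ⟨x, hx, h⟩; exact ⟨x, box_mono hmn 0 hx, h⟩
  have h2 : (⋃ m : ℕ, {ω : Config d | ∃ x ∈ box m (0 : V d), InInfiniteCluster ω x}) =
      {ω | ∃ x, InInfiniteCluster ω x} := by
    ext ω
    simp only [Set.mem_iUnion]
    constructor
    · rintro ⟨m, x, _, h⟩; exact ⟨x, h⟩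
    · rintro ⟨x, h⟩; exact ⟨dist1 0 x, x, mem_box_dist1 0 x, h⟩
  rw [h2, exists_inf_ae hd U h] at h1
  obtain ⟨m, hm1, hm2⟩ := ((h1.eventually (lt_mem_nhds (show 1 - ε < 1 by linarith))).and
    (eventually_ge_atTop 1)).exists
  exact ⟨m, hm2, hm1.le⟩

end P1
end Mod6

section Mod7
section D1
variable {d : ℕ}

open Classical in
/-- edges incident to a vertex -/
noncomputable def star (y : V d) : Finset (Edge d) :=
  (box 1 y).biUnion fun z => if h : dist1 y z = 1 then {mkE y z h} else ∅

theorem mkE_mem_star {y z : V d} (h : dist1 y z = 1) : mkE y z h ∈ star y := by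
  simp only [star, Finset.mem_biUnion]
  exact ⟨z, adj_mem_box h, by simp [h]⟩
theorem mkE_comm {y z : V d} (h : dist1 y z = 1) :
    mkE y z h = mkE z y (by rw [dist1_comm]; exact h) := Subtype.ext Sym2.eq_swap
theorem mem_star {y : V d} {e : Edge d} : e ∈ star y ↔ y ∈ e.1 := by
  constructor
  · simp only [star, Finset.mem_biUnion]
    rintro ⟨z, _, hz⟩
    by_cases h : dist1 y z = 1
    · simp only [h, dif_pos, Finset.mem_singleton] at hz
      subst hz; exact Sym2.mem_mk_left _ _
    · simp [h] at hz
  · intro h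
    obtain ⟨a, b, hab, rfl⟩ := e.exists_mk
    rcases Sym2.mem_iff.1 h with rfl | rfl
    · exact mkE_mem_star hab
    · rw [mkE_comm]; exact mkE_mem_star _
theorem card_star (y : V d) : (star y).card ≤ 3 ^ d := by
  refine (Finset.card_biUnion_le_card_mul _ _ 1 ?_).trans ?_
  · intro z _
    split_ifs <;> simp
  · rw [card_box]; simp

open Classical in
/-- finset of edges inside a finite set of vertices -/
noncomputable def eIn (S : Finset (V d)) : Finset (Edge d) :=
  (S.biUnion star).filter fun e => e ∈ Inside (S : Set (V d))

theorem mem_eIn {S : Finset (V d)} {e : Edge d} : e ∈ eIn S ↔ e ∈ Inside (S : Set (V d)) := by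
  simp only [eIn, Finset.mem_filter, and_iff_right_iff_imp, Finset.mem_biUnion]
  intro h
  obtain ⟨a, b, hab, rfl⟩ := e.exists_mk
  exact ⟨a, (mkE_inside.1 h).1, mkE_mem_star hab⟩
theorem coe_eIn (S : Finset (V d)) : (eIn S : Set (Edge d)) = Inside (S : Set (V d)) := by
  ext e; exact mem_eIn
theorem card_eIn (S : Finset (V d)) : (eIn S).card ≤ S.card * 3 ^ d :=
  by classical exact (Finset.card_filter_le _ _).trans (Finset.card_biUnion_le_card_mul _ _ _ fun y _ => card_star y)

theorem PB_allfalse {ι : Type*} (q : ι → unitInterval) (J : Finset ι) :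
    (PB q).real {ω | ∀ e ∈ J, ω e = false} = ∏ e ∈ J, (1 - (q e : ℝ)) := by
  rw [PB_cyl q J (fun _ => false)]
  exact Finset.prod_congr rfl fun i _ => PB_false q i
theorem PB_alltrue {ι : Type*} (q : ι → unitInterval) (J : Finset ι) :
    (PB q).real {ω | ∀ e ∈ J, ω e = true} = ∏ e ∈ J, (q e : ℝ) := by
  rw [PB_cyl q J (fun _ => true)]
  exact Finset.prod_congr rfl fun i _ => PB_true q i
theorem meas_allb {ι : Type*} (J : Finset ι) (b : Bool) :
    MeasurableSet {ω : ι → Bool | ∀ e ∈ J, ω e = b} := by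
  have : {ω : ι → Bool | ∀ e ∈ J, ω e = b} = ⋂ e ∈ J, {ω | ω e = b} := by ext; simp
  rw [this]; exact J.measurableSet_biInter fun e _ => meas_coord e b
theorem detBy_allb {ι : Type*} (J : Finset ι) (b : Bool) :
    DetBy (J : Set ι) {ω : ι → Bool | ∀ e ∈ J, ω e = b} :=
  fun ω ω' h h' e he => by rw [← h e he]; exact h' e he

open Classical in
/-- boundary points reached from the small box -/
noncomputable def Y (m n : ℕ) (ω : Config d) : Finset (V d) :=
  (box n 0).filter fun y => (∃ i, |y i| = n) ∧ ∃ x ∈ box m 0, Conn ω (box n (0 : V d)) x y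

theorem mem_Y {m n : ℕ} {ω : Config d} {y : V d} :
    y ∈ Y m n ω ↔ y ∈ box n 0 ∧ (∃ i, |y i| = n) ∧ ∃ x ∈ box m 0, Conn ω (box n (0 : V d)) x y := by
  simp [Y]

theorem bd_of_exit {n : ℕ} {a b : V d} (ha : a ∈ box n 0) (hb : b ∉ box n 0) (h : dist1 a b = 1) :
    ∃ i, |a i| = n := by
  rw [mem_box] at hb ha
  push Not at hb
  obtain ⟨i, hi⟩ := hb
  refine ⟨i, ?_⟩
  have h1 := mem_box.1 (adj_mem_box h) i
  have h2 := ha i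
  simp only [Pi.zero_apply, sub_zero] at *
  rw [abs_le] at h1 h2
  rw [lt_abs] at hi
  push_cast at h1
  rcases hi with hi | hi
  · rw [abs_of_nonneg (by omega)]; omega
  · rw [abs_of_nonpos (by omega)]; omega

theorem exit_Y {m n : ℕ} (hmn : m ≤ n) {ω : Config d} {x y : V d} {S : Set (V d)} (hx : x ∈ box m 0)
    (hy : y ∉ box n 0) (h : Conn ω S x y) : ∃ a ∈ Y m n ω, ∃ b ∉ box n (0 : V d), edgeOpen ω a b := by
  obtain ⟨a, b, ha, hb, hab, -, -, hc, -⟩ := h.exit (T := (box n 0 : Finset (V d)))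
    (box_mono hmn 0 hx) hy
  exact ⟨a, mem_Y.2 ⟨ha, bd_of_exit ha hb hab.adj, x, hx, hc.monoS Set.inter_subset_right⟩, b, hb, hab⟩

theorem meas_mem_Y (m n : ℕ) (y : V d) : MeasurableSet {ω : Config d | y ∈ Y m n ω} := by
  simp only [mem_Y]
  exact meas_and (meas_const _) (meas_and (meas_const _) (meas_ex fun x =>
    meas_and (meas_const _) (meas_conn _ _ _)))

theorem Y_congr {m n : ℕ} {ω ω' : Config d}
    (h : ∀ e ∈ Inside (box n (0 : V d) : Set (V d)), ω e = ω' e) : Y m n ω = Y m n ω' := by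
  ext y; simp only [mem_Y, Conn.congr h]

theorem bd_not_mem_smaller {n : ℕ} {y : V d} (h : ∃ i, |y i| = ((n + 1 : ℕ) : ℤ)) : y ∉ box n 0 := by
  rw [mem_box]
  obtain ⟨i, hi⟩ := h
  intro h
  have := h i
  simp only [Pi.zero_apply, sub_zero] at this
  push_cast at *; omega

theorem Y_small (q : unitInterval) (hq : (q : ℝ) < 1) {m : ℕ} {ε : ℝ} (hε : 0 < ε)
    (hm : 1 - ε ≤ (Pc d q).real {ω | ∃ x ∈ box m (0 : V d), InInfiniteCluster ω x}) (t : ℕ) :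
    ∃ n0, ∀ n ≥ n0, m ≤ n ∧ (Pc d q).real {ω | (Y m n ω).card ≤ t} ≤ 2 * ε := by
  set P := Pc d q with hP
  let a : ℕ → ℝ := fun n => P.real {ω | (Y m n ω).Nonempty}
  have mY : ∀ n, MeasurableSet {ω : Config d | (Y m n ω).Nonempty} := fun n =>
    meas_ex fun y => meas_mem_Y m n y
  have hstep : ∀ n, m ≤ n → ∀ ω : Config d, (Y m (n+1) ω).Nonempty → (Y m n ω).Nonempty := by
    rintro n hn ω ⟨y, hy⟩
    obtain ⟨hy1, hy2, x, hx, hc⟩ := mem_Y.1 hy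
    obtain ⟨a, ha, _⟩ := exit_Y hn hx (bd_not_mem_smaller hy2) hc
    exact ⟨a, ha⟩
  have anti : ∀ n, m ≤ n → a (n+1) ≤ a n := fun n hn => measureReal_mono (hstep n hn)
  have age : ∀ n, m ≤ n → 1 - ε ≤ a n := by
    intro n hn
    refine hm.trans (measureReal_mono ?_)
    rintro ω ⟨x, hx, hinf⟩
    obtain ⟨y, hy, hc⟩ := inf_iff.1 hinf n
    obtain ⟨a, ha, _⟩ := exit_Y hn hx hy hc
    exact ⟨a, ha⟩
  have hdiff : Tendsto (fun n => a (n + m) - a (n + m + 1)) atTop (𝓝 0) := by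
    have hanti : Antitone fun n => a (n + m) := antitone_nat_of_succ_le fun n => by
      have := anti (n + m) (by omega)
      rwa [show n + 1 + m = n + m + 1 by ring]
    have hl := tendsto_atTop_ciInf hanti ⟨0, by rintro _ ⟨n, rfl⟩; exact measureReal_nonneg⟩
    have hl' := hl.comp (tendsto_add_atTop_nat 1)
    have := hl.sub hl'
    rw [sub_self] at this
    refine this.congr fun n => ?_
    simp only [Function.comp]
    rw [show n + 1 + m = n + m + 1 by ring]
  set K := 3 ^ d
  set β : ℝ := (1 - q) ^ K
  have hβ : 0 < β := pow_pos (by linarith) _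
  have q0 : (0:ℝ) ≤ q := q.2.1
  have key : ∀ n, m ≤ n → P.real ({ω | (Y m n ω).Nonempty} ∩ {ω | (Y m n ω).card ≤ t}) * β ^ t
      ≤ a n - a (n + 1) := by
    intro n hn
    classical
    let J : V d → Finset (Edge d) := fun y => (star y).filter fun e => e ∉ Inside (box n (0 : V d) : Set (V d))
    have := closing_ge (fun _ : Edge d => q) (A := {ω | (Y m n ω).Nonempty}) (mY n)
      (fun y => {ω | ∀ e ∈ J y, ω e = false}) (fun y => (J y : Set (Edge d))) (Y m n) (meas_mem_Y m n)
      (fun _ => Inside (box n (0 : V d) : Set (V d)))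
      (by
        intro s ω ω' h h'
        have e := Y_congr (m := m) h
        refine ⟨?_, ?_⟩
        · show (Y m n ω').Nonempty
          rw [← e]; exact h'.1
        · show Y m n ω' = s
          rw [← e]; exact h'.2)
      (fun y => meas_allb _ _) (fun y => detBy_allb _ _)
      (by
        rintro s ⟨ω, -, hs⟩ y hy z hz hyz
        obtain rfl : Y m n ω = s := hs
        rw [Finset.disjoint_coe, Finset.disjoint_left]
        intro e he he'
        simp only [J, Finset.mem_filter, mem_star] at he he'
        obtain ⟨a, b, hab, rfl⟩ := e.exists_mk
        have hyB := (mem_Y.1 hy).1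
        have hzB := (mem_Y.1 hz).1
        apply he.2
        rw [mkE_inside]
        rcases Sym2.mem_iff.1 he.1 with rfl | rfl <;> rcases Sym2.mem_iff.1 he'.1 with rfl | rfl
        · exact absurd rfl hyz
        · exact ⟨hyB, hzB⟩
        · exact ⟨hzB, hyB⟩
        · exact absurd rfl hyz)
      (by
        intro s _ y _
        rw [Set.disjoint_left]
        intro e he he'
        exact (Finset.mem_filter.1 he').2 he)
      hβ (pow_le_one₀ (by linarith) (by linarith))
      (by
        intro y
        show β ≤ (PB fun _ => q).real _
        rw [PB_allfalse, Finset.prod_const]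
        refine pow_le_pow_of_le_one (by linarith) (by linarith) ?_
        exact (Finset.card_filter_le _ _).trans (card_star y)) t
    refine this.trans ?_
    rw [show a n - a (n+1) = P.real ({ω | (Y m n ω).Nonempty} \ {ω | (Y m (n+1) ω).Nonempty}) from
      (measureReal_diff (hstep n hn) (mY (n+1))).symm]
    refine measureReal_mono ?_
    rintro ω ⟨h1, -, h2⟩
    refine ⟨h1, ?_⟩
    rintro ⟨y, hy⟩
    obtain ⟨hy1, hy2, x, hx, hc⟩ := mem_Y.1 hy
    obtain ⟨a, ha, b, hb, hab⟩ := exit_Y hn hx (bd_not_mem_smaller hy2) hc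
    have := h2 a ha (mkE a b hab.adj) (by
      simp only [J, Finset.mem_filter]
      exact ⟨mkE_mem_star _, fun h => hb (mkE_inside.1 h).2⟩)
    exact Bool.noConfusion (hab.2.symm.trans this)
  have hev := hdiff.eventually (gt_mem_nhds (show 0 < ε * β ^ t by positivity))
  obtain ⟨n0, hn0⟩ := eventually_atTop.1 hev
  refine ⟨n0 + m, fun n hn => ⟨by omega, ?_⟩⟩
  have h1 := hn0 (n - m) (by omega)
  rw [show n - m + m = n by omega] at h1
  have h2 := key n (by omega)
  have h3 : P.real ({ω | (Y m n ω).Nonempty} ∩ {ω | (Y m n ω).card ≤ t}) ≤ ε := by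
    by_contra hc
    push Not at hc
    have : ε * β ^ t < P.real ({ω | (Y m n ω).Nonempty} ∩ {ω | (Y m n ω).card ≤ t}) * β ^ t :=
      mul_lt_mul_of_pos_right hc (by positivity)
    linarith
  have h4 : P.real {ω | (Y m n ω).Nonempty}ᶜ ≤ ε := by
    rw [probReal_compl_eq_one_sub (mY n)]; linarith [age n (by omega)]
  have h5 := real_union_le (P := P) (X := {ω | (Y m n ω).card ≤ t})
    (Y := {ω | (Y m n ω).Nonempty} ∩ {ω | (Y m n ω).card ≤ t}) (Z := {ω | (Y m n ω).Nonempty}ᶜ)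
    (fun ω h => by
      by_cases h' : (Y m n ω).Nonempty
      · exact Or.inl ⟨h', h⟩
      · exact Or.inr h')
  linarith

end D1
end Mod7

section Mod8
section D2
variable {d : ℕ}

open Classical in
/-- quarter face -/
noncomputable def Face (n : ℕ) (x : V d) (i : Fin d) (s : Fin d → ℤˣ) : Finset (V d) :=
  (box n x).filter fun y => (s i : ℤ) * (y i - x i) = n ∧ ∀ j, 0 ≤ (s j : ℤ) * (y j - x j)

theorem mem_Face {n : ℕ} {x y : V d} {i : Fin d} {s : Fin d → ℤˣ} :
    y ∈ Face n x i s ↔ y ∈ box n x ∧ (s i : ℤ) * (y i - x i) = n ∧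
      ∀ j, 0 ≤ (s j : ℤ) * (y j - x j) := by simp [Face]

theorem abs_unit_mul (u : ℤˣ) (a : ℤ) : |(u : ℤ) * a| = |a| := by
  rcases Int.units_eq_one_or u with rfl | rfl <;> simp

/-- reflection -/
def Iso.refl' (s : Fin d → ℤˣ) : Iso d where
  φ := { toFun := fun x j => s j * x j
         invFun := fun x j => s j * x j
         left_inv := fun x => by
            funext j
            rcases Int.units_eq_one_or (s j) with h | h <;> simp [h]
         right_inv := fun x => by
            funext j
            rcases Int.units_eq_one_or (s j) with h | h <;> simp [h] }
  iso x y := by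
    unfold dist1
    refine Finset.sum_congr rfl fun j _ => ?_
    show ((s j : ℤ) * x j - s j * y j).natAbs = _
    rw [← mul_sub, Int.natAbs_mul]; simp

/-- permutation -/
def Iso.perm (σ : Equiv.Perm (Fin d)) : Iso d where
  φ := Equiv.arrowCongr σ (Equiv.refl ℤ)
  iso x y := by
    unfold dist1
    exact Equiv.sum_comp σ.symm (fun i => (x i - y i).natAbs)

/-- composition -/
def Iso.comp (g h : Iso d) : Iso d := ⟨h.φ.trans g.φ, fun x y => by
  simp [g.iso, h.iso]⟩

theorem Y_iso (g : Iso d) (hg : ∀ n : ℕ, ∀ y, g.φ y ∈ box n (0 : V d) ↔ y ∈ box n 0)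
    (hb : ∀ n : ℕ, ∀ y : V d, (∃ i, |g.φ y i| = (n : ℤ)) ↔ ∃ i, |y i| = (n : ℤ))
    (m n : ℕ) (ω : Config d) (y : V d) :
    y ∈ Y m n (fun e => ω (g.e e)) ↔ g.φ y ∈ Y m n ω := by
  have him : g.φ '' (box n (0 : V d) : Set (V d)) = (box n (0 : V d) : Set (V d)) := by
    ext z
    constructor
    · rintro ⟨w, hw, rfl⟩; exact (hg n w).2 hw
    · intro hz; exact ⟨g.φ.symm z, by
        have := (hg n (g.φ.symm z)).1 (by simpa using hz)
        exact this, by simp⟩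
  simp only [mem_Y, conn_iso, him, hg, hb]
  refine and_congr_right fun _ => and_congr_right fun _ => ?_
  constructor
  · rintro ⟨x, hx, h⟩; exact ⟨g.φ x, (hg m x).2 hx, h⟩
  · rintro ⟨x, hx, h⟩
    exact ⟨g.φ.symm x, (hg m _).1 (by simpa using hx), by simpa using h⟩

theorem face_exists_iso (n : ℕ) (i i' : Fin d) (s s' : Fin d → ℤˣ) : ∃ g : Iso d,
    (∀ n : ℕ, ∀ y, g.φ y ∈ box n (0 : V d) ↔ y ∈ box n 0) ∧
    (∀ n : ℕ, ∀ y : V d, (∃ i, |g.φ y i| = (n : ℤ)) ↔ ∃ i, |y i| = (n : ℤ)) ∧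
    ∀ y, g.φ y ∈ Face n 0 i' s' ↔ y ∈ Face n 0 i s := by
  set σ := Equiv.swap i i' with hσ
  set r : Fin d → ℤˣ := fun j => s' j * s (σ j)
  have hap : ∀ y j, ((Iso.refl' r).comp (Iso.perm σ)).φ y j = r j * y (σ j) := by
    intro y j; rfl
  have hbox : ∀ n : ℕ, ∀ y, ((Iso.refl' r).comp (Iso.perm σ)).φ y ∈ box n (0 : V d) ↔ y ∈ box n 0 := by
    intro n y
    simp only [mem_box, hap, Pi.zero_apply, sub_zero, abs_unit_mul]
    constructor
    · intro h j; have := h (σ j); simpa [hσ] using this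
    · intro h j; exact h _
  refine ⟨(Iso.refl' r).comp (Iso.perm σ), hbox, ?_, ?_⟩
  · intro n y
    simp only [hap, abs_unit_mul]
    constructor
    · rintro ⟨j, hj⟩; exact ⟨_, hj⟩
    · rintro ⟨j, hj⟩; exact ⟨σ j, by simpa [hσ] using hj⟩
  · intro y
    simp only [mem_Face, hbox, hap, Pi.zero_apply, sub_zero]
    have e : ∀ j, (s' j : ℤ) * (r j * y (σ j)) = s (σ j) * y (σ j) := by
      intro j
      simp only [r, Units.val_mul]
      rw [← mul_assoc, ← mul_assoc]
      rcases Int.units_eq_one_or (s' j) with h | h <;> simp [h]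
    simp only [e]
    refine and_congr_right fun _ => and_congr ?_ ?_
    · simp [hσ]
    · constructor
      · intro h j; have := h (σ j); simpa [hσ] using this
      · intro h j; exact h _

theorem meas_cardYF (m n : ℕ) (F : Finset (V d)) (t : ℕ) :
    MeasurableSet {ω : Config d | (Y m n ω ∩ F).card < t} := by
  classical
  have : {ω : Config d | (Y m n ω ∩ F).card < t} =
      ⋃ s ∈ {s : Finset (V d) | (s ∩ F).card < t}, Y m n ⁻¹' {s} := by
    ext ω; simp
  rw [this]
  exact MeasurableSet.biUnion (Set.to_countable _) fun s _ => meas_finset_eq (meas_mem_Y m n) s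

theorem Y_mono {m n : ℕ} {ω ω' : Config d} (h : ω ≤ ω') : Y m n ω ⊆ Y m n ω' := by
  intro y
  simp only [mem_Y]
  rintro ⟨h1, h2, x, hx, hc⟩
  exact ⟨h1, h2, x, hx, conn_mono_cfg h hc⟩

theorem Y_face (hd : 2 ≤ d) (U : UniformCoupling d) {q : unitInterval} (h : pcU U < q)
    (hq : (q : ℝ) < 1) {η : ℝ} (hη : 0 < η) : ∃ m : ℕ, 1 ≤ m ∧ ∀ t : ℕ, ∃ n0, ∀ n ≥ n0, m ≤ n ∧
      ∀ i s, (Pc d q).real {ω | (Y m n ω ∩ Face n 0 i s).card < t} ≤ η := by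
  classical
  set N := (Finset.univ : Finset (Fin d × (Fin d → ℤˣ))).card with hN
  obtain ⟨m, hm1, hm⟩ := exists_box_inf hd U h (ε := η ^ N / 2) (by positivity)
  refine ⟨m, hm1, fun t => ?_⟩
  obtain ⟨n0, hn0⟩ := Y_small q hq (by positivity) hm (N * t)
  refine ⟨n0, fun n hn => ⟨(hn0 n hn).1, fun i s => ?_⟩⟩
  have h2 := (hn0 n hn).2
  rw [mul_div_cancel₀ _ (two_ne_zero)] at h2
  let A : Fin d × (Fin d → ℤˣ) → Set (Config d) := fun a => {ω | (Y m n ω ∩ Face n 0 a.1 a.2).card < t}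
  have hA : ∀ a, MeasurableSet (A a) := fun a => meas_cardYF _ _ _ _
  have hsame : ∀ a, (Pc d q).real (A a) = (Pc d q).real (A (i, s)) := by
    intro a
    obtain ⟨g, h1, h2, h3⟩ := face_exists_iso n i a.1 s a.2
    rw [← Pc_iso g q (hA (i, s))]
    congr 1
    ext ω
    show (Y m n ω ∩ Face n 0 a.1 a.2).card < t ↔
      (Y m n (fun e => ω (g.e e)) ∩ Face n 0 i s).card < t
    have : Y m n ω ∩ Face n 0 a.1 a.2 =
      (Y m n (fun e => ω (g.e e)) ∩ Face n 0 i s).map g.φ.toEmbedding := by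
      ext z
      simp only [Finset.mem_inter, Finset.mem_map_equiv, Y_iso g h1 h2, ← h3, Equiv.apply_symm_apply]
    rw [this, Finset.card_map]
  have hprod := fkg_dec_prod (fun _ : Edge d => q) (eIn (box n 0)) Finset.univ A hA
    (by
      intro a ω ω' hh h'
      rw [coe_eIn] at hh
      show (Y m n ω' ∩ Face n 0 a.1 a.2).card < t
      rw [← Y_congr hh]; exact h')
    (by
      intro a ω ω' hh h'
      refine lt_of_le_of_lt (Finset.card_le_card ?_) h'
      exact Finset.inter_subset_inter_right (Y_mono hh))
  have e1 : ∏ a, (PB fun _ : Edge d => q).real (A a) = (Pc d q).real (A (i, s)) ^ N := by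
    show ∏ a, (Pc d q).real (A a) = _
    rw [Finset.prod_congr rfl fun a _ => hsame a, Finset.prod_const]
  rw [e1] at hprod
  have h3 : (Pc d q).real (A (i, s)) ^ N ≤ η ^ N := by
    refine hprod.trans (le_trans (measureReal_mono ?_) h2)
    intro ω hω
    simp only [Set.mem_iInter] at hω
    show (Y m n ω).card ≤ N * t
    have hsub : Y m n ω ⊆ Finset.univ.biUnion fun a : Fin d × (Fin d → ℤˣ) => Y m n ω ∩ Face n 0 a.1 a.2 := by
      intro y hy
      obtain ⟨hb, ⟨j, hj⟩, -⟩ := mem_Y.1 hy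
      let s : Fin d → ℤˣ := fun k => if 0 ≤ y k then 1 else -1
      have hs : ∀ k, (s k : ℤ) * y k = |y k| := by
        intro k
        by_cases hk : 0 ≤ y k
        · simp [s, hk, abs_of_nonneg hk]
        · simp [s, hk, abs_of_neg (not_le.1 hk)]
      rw [Finset.mem_biUnion]
      refine ⟨(j, s), Finset.mem_univ _, Finset.mem_inter.2 ⟨hy, mem_Face.2 ⟨hb, ?_, ?_⟩⟩⟩
      · simp only [Pi.zero_apply, sub_zero, hs]; exact hj
      · intro k; simp only [Pi.zero_apply, sub_zero, hs]; positivity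
    refine (Finset.card_le_card hsub).trans ((Finset.card_biUnion_le_card_mul _ _ t ?_))
    intro a ha
    exact (hω a ha).le
  have hN0 : N ≠ 0 := by
    rw [hN]; exact Finset.card_ne_zero_of_mem (Finset.mem_univ (i, s))
  exact le_of_pow_le_pow_left₀ hN0 hη.le h3

end D2
end Mod8

section Mod9
section D3
variable {d : ℕ}

/-- labels of the layers -/
abbrev Lab (d : ℕ) := Fin 4 ⊕ (V d × Bool)
/-- indices of the layered space -/
abbrev LI (d : ℕ) := Edge d × Lab d
/-- the base layer -/
abbrev Lab.base {d : ℕ} : Lab d := Sum.inl 0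
/-- the filling layer -/
abbrev Lab.fill {d : ℕ} : Lab d := Sum.inl 1
/-- the starting layer -/
abbrev Lab.start {d : ℕ} : Lab d := Sum.inl 2
/-- the extra layer -/
abbrev Lab.extra {d : ℕ} : Lab d := Sum.inl 3
/-- layered configurations -/
abbrev LC (d : ℕ) := LI d → Bool

/-- layer of a layered configuration -/
def layer (l : Lab d) (ω : LC d) : Config d := fun e => ω (e, l)

/-- layered measure -/
noncomputable def PL (qq : Lab d → unitInterval) : Measure (LC d) := PB fun i : LI d => qq i.2
instance (qq : Lab d → unitInterval) : IsProbabilityMeasure (PL qq) := by unfold PL; infer_instance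

theorem meas_layer (l : Lab d) : Measurable (layer l : LC d → Config d) := by
  unfold layer; fun_prop

theorem PL_layer (qq : Lab d → unitInterval) (l : Lab d) {A : Set (Config d)} (hA : MeasurableSet A) :
    (PL qq).real {ω | layer l ω ∈ A} = (Pc d (qq l)).real A := by
  have h : (PL qq).map (layer l) = Pc d (qq l) :=
    Measure.map_infinitePi_infinitePi_of_inj (P := fun i : LI d => bern (qq i.2))
      (f := fun e : Edge d => (e, l)) (fun e e' h => (Prod.mk.inj h).1)
  rw [← h, Measure.real, Measure.real, Measure.map_apply (meas_layer l) hA]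
  rfl

open Classical in
/-- points of `F` connected to the small box -/
noncomputable def YF (m n : ℕ) (x : V d) (F : Finset (V d)) (ω : Config d) : Finset (V d) :=
  F.filter fun y => ∃ a ∈ box m x, Conn ω (box n x) a y

theorem mem_YF {m n : ℕ} {x y : V d} {F : Finset (V d)} {ω : Config d} :
    y ∈ YF m n x F ω ↔ y ∈ F ∧ ∃ a ∈ box m x, Conn ω (box n x) a y := by simp [YF]

theorem meas_mem_YF (m n : ℕ) (x : V d) (F : Finset (V d)) (y : V d) :
    MeasurableSet {ω | y ∈ YF m n x F ω} := by
  simp only [mem_YF]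
  exact meas_and (meas_const _) (meas_ex fun x => meas_and (meas_const _) (meas_conn _ _ _))

theorem meas_finset_pred {Ω α : Type*} [MeasurableSpace Ω] [Countable α] {N : Ω → Finset α}
    (h : ∀ a, MeasurableSet {ω | a ∈ N ω}) (p : Finset α → Prop) : MeasurableSet {ω | p (N ω)} := by
  have : {ω | p (N ω)} = ⋃ s ∈ {s : Finset α | p s}, N ⁻¹' {s} := by
    ext ω; simp
  rw [this]
  exact MeasurableSet.biUnion (Set.to_countable _) fun s _ => meas_finset_eq h s

theorem YF_face (hd : 2 ≤ d) (U : UniformCoupling d) {q : unitInterval} (h : pcU U < q)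
    (hq : (q : ℝ) < 1) {η : ℝ} (hη : 0 < η) : ∃ m : ℕ, 1 ≤ m ∧ ∀ t : ℕ, ∃ n0, ∀ n ≥ n0, m ≤ n ∧
      ∀ x i s, (Pc d q).real {ω | (YF m n x (Face n x i s) ω).card < t} ≤ η := by
  classical
  obtain ⟨m, hm, H⟩ := Y_face hd U h hq hη
  refine ⟨m, hm, fun t => ?_⟩
  obtain ⟨n0, hn0⟩ := H t
  refine ⟨n0, fun n hn => ⟨(hn0 n hn).1, fun x i s => ?_⟩⟩
  refine le_trans (le_of_eq ?_) ((hn0 n hn).2 i s)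
  rw [← Pc_iso (Iso.tr x) q (meas_cardYF m n (Face n 0 i s) t)]
  congr 1; ext ω
  show (YF m n x (Face n x i s) ω).card < t ↔
    (Y m n (fun e => ω ((Iso.tr x).e e)) ∩ Face n 0 i s).card < t
  have : YF m n x (Face n x i s) ω =
      (Y m n (fun e => ω ((Iso.tr x).e e)) ∩ Face n 0 i s).map (Iso.tr x).φ.toEmbedding := by
    ext z
    obtain ⟨w, rfl⟩ := (Iso.tr x).φ.surjective z
    rw [Finset.mem_map_equiv, Equiv.symm_apply_apply, Finset.mem_inter, mem_YF, mem_Y]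
    have hF : (Iso.tr x).φ w ∈ Face n x i s ↔ w ∈ Face n 0 i s := by
      simp [mem_Face, mem_box]
    have hc : ∀ a : V d, Conn (fun e => ω ((Iso.tr x).e e)) (box n (0 : V d)) a w ↔
        Conn ω (box n x) ((Iso.tr x).φ a) ((Iso.tr x).φ w) := by
      intro a
      rw [conn_iso, box_iso_tr, zero_add]
    rw [hF]
    constructor
    · rintro ⟨h1, a, ha, hc'⟩
      refine ⟨⟨(mem_Face.1 h1).1, ⟨i, ?_⟩, (Iso.tr x).φ.symm a, ?_, ?_⟩, h1⟩
      · have := (mem_Face.1 h1).2.1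
        simp only [Pi.zero_apply, sub_zero] at this
        rw [← abs_unit_mul (s i), this]; simp
      · rw [mem_box] at *
        intro j; have := ha j
        simpa [Iso.tr, sub_eq_add_neg] using this
      · rw [hc]; simpa using hc'
    · rintro ⟨⟨_, _, a, ha, hc'⟩, h1⟩
      refine ⟨h1, (Iso.tr x).φ a, ?_, (hc a).1 hc'⟩
      rw [mem_box] at *; intro j; have := ha j; simpa using this
  rw [this, Finset.card_map]

/-- `y` is the centre of a seed -/
def Seed (m : ℕ) (y : V d) (ω : Config d) : Prop := ∀ e ∈ eIn (box m y), ω e = true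

theorem meas_seed (m : ℕ) (y : V d) : MeasurableSet {ω | Seed m y ω} := meas_allb _ _

/-- lower bound on the probability of a seed -/
def sExp (d m : ℕ) : ℕ := (2 * m + 1) ^ d * 3 ^ d

theorem seed_prob (qq : Lab d → unitInterval) (l : Lab d) (m : ℕ) (y : V d) :
    (qq l : ℝ) ^ sExp d m ≤ (PL qq).real {ω | Seed m y (layer l ω)} := by
  rw [show {ω : LC d | Seed m y (layer l ω)} = {ω | layer l ω ∈ {ω | Seed m y ω}} from rfl,
    PL_layer qq l (meas_seed m y)]
  show _ ≤ (PB fun _ : Edge d => qq l).real {ω : Config d | ∀ e ∈ eIn (box m y), ω e = true}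
  rw [PB_alltrue, Finset.prod_const]
  refine pow_le_pow_of_le_one (qq l).2.1 (qq l).2.2 ?_
  have := card_eIn (box m y)
  rwa [card_box] at this

/-- residue classes -/
def res (m : ℕ) (y : V d) : Fin d → ZMod m := fun i => (y i : ZMod m)

theorem box_disj_of_res {m : ℕ} {y z : V d} (h : res (2 * m + 1) y = res (2 * m + 1) z) (hne : y ≠ z) :
    Disjoint (box m y) (box m z) := by
  rw [Finset.disjoint_left]
  intro w hw hw'
  apply hne
  funext i
  have h1 := mem_box.1 hw i
  have h2 := mem_box.1 hw' i
  have h3 : ((2 * m + 1 : ℕ) : ℤ) ∣ z i - y i := (ZMod.intCast_eq_intCast_iff_dvd_sub _ _ _).1 (congrFun h i)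
  rw [abs_le] at h1 h2
  have h4 : z i - y i = 0 := by
    apply Int.eq_zero_of_abs_lt_dvd h3
    rw [abs_lt]; push_cast; constructor <;> linarith [h1.1, h1.2, h2.1, h2.2]
  linarith

theorem exists_class (m t : ℕ) (s : Finset (V d)) (hs : t * (2 * m + 1) ^ d ≤ s.card) :
    ∃ r ⊆ s, t ≤ r.card ∧ ∀ y ∈ r, ∀ z ∈ r, res (2 * m + 1) y = res (2 * m + 1) z := by
  classical
  obtain ⟨c, -, hc⟩ := Finset.exists_le_card_fiber_of_mul_le_card_of_maps_to
    (s := s) (t := (Finset.univ : Finset (Fin d → ZMod (2 * m + 1)))) (f := res (2 * m + 1)) (n := t)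
    (fun _ _ => Finset.mem_univ _) Finset.univ_nonempty (by
      rw [Finset.card_univ, Fintype.card_fun, ZMod.card, Fintype.card_fin, mul_comm]; exact hs)
  refine ⟨_, Finset.filter_subset _ _, hc, fun y hy z hz => ?_⟩
  rw [(Finset.mem_filter.1 hy).2, (Finset.mem_filter.1 hz).2]

/-- edges determining a seed, in a layer -/
def seedJ (m : ℕ) (l : Lab d) (y : V d) : Set (LI d) := {i | i.1 ∈ eIn (box m y) ∧ i.2 = l}

theorem detBy_seed (m : ℕ) (l : Lab d) (y : V d) : DetBy (seedJ m l y) {ω | Seed m y (layer l ω)} :=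
  fun ω ω' h h' e he => by
    have := h (e, l) ⟨he, rfl⟩
    show ω' (e, l) = true
    rw [← this]; exact h' e he

theorem seedJ_disj {m : ℕ} {y z : V d} (h : Disjoint (box m y) (box m z)) (l l' : Lab d) :
    Disjoint (seedJ m l y) (seedJ m l' z) := by
  rw [Set.disjoint_left]
  rintro ⟨e, l⟩ ⟨he, -⟩ ⟨he', -⟩
  obtain ⟨a, b, hab, rfl⟩ := e.exists_mk
  exact Finset.disjoint_left.1 h (mkE_inside.1 (mem_eIn.1 he)).1 (mkE_inside.1 (mem_eIn.1 he')).1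

/-- connection to a seed on the face -/
def Good3 (m n : ℕ) (x : V d) (F : Finset (V d)) (l : Lab d) (ω : LC d) : Prop :=
  ∃ a ∈ box m x, ∃ y ∈ F, Conn (layer Lab.base ω) (box n x) a y ∧ Seed m y (layer l ω)

theorem good3_fail (qq : Lab d → unitInterval) (l : Lab d) (hl : l ≠ Lab.base) (m n : ℕ) (x : V d)
    (F : Finset (V d)) (t : ℕ) :
    (PL qq).real {ω | ¬ Good3 m n x F l ω} ≤
      (Pc d (qq Lab.base)).real {ω | (YF m n x F ω).card < t * (2 * m + 1) ^ d} +
        (1 - (qq l : ℝ) ^ sExp d m) ^ t := by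
  classical
  set T := t * (2 * m + 1) ^ d
  have hex : ∀ s : Finset (V d), ∃ r ⊆ s, (T ≤ s.card → t ≤ r.card) ∧
      ∀ y ∈ r, ∀ z ∈ r, res (2 * m + 1) y = res (2 * m + 1) z := by
    intro s
    by_cases hs : T ≤ s.card
    · obtain ⟨r, h1, h2, h3⟩ := exists_class m t s hs
      exact ⟨r, h1, fun _ => h2, h3⟩
    · exact ⟨∅, by simp, fun h => absurd h hs, by simp⟩
  choose g g1 g2 g3 using hex
  have mYF : ∀ y, MeasurableSet {ω : LC d | y ∈ YF m n x F (layer Lab.base ω)} := fun y =>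
    meas_layer _ (meas_mem_YF m n x F y)
  have mcard : MeasurableSet {ω : Config d | (YF m n x F ω).card < T} :=
    meas_finset_pred (meas_mem_YF m n x F) fun s => s.card < T
  rw [← PL_layer qq Lab.base mcard]
  set κ := (qq l : ℝ) ^ sExp d m
  have κ0 : 0 ≤ κ := pow_nonneg (qq l).2.1 _
  have κ1 : κ ≤ 1 := pow_le_one₀ (qq l).2.1 (qq l).2.2
  have := closing_le (fun i : LI d => qq i.2) (A := Set.univ) MeasurableSet.univ
    (fun y => {ω | Seed m y (layer l ω)}ᶜ) (seedJ m l) (fun ω => g (YF m n x F (layer Lab.base ω)))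
    (fun a => meas_finset_pred mYF fun s => a ∈ g s) (fun _ => {i | i.2 = Lab.base})
    (by
      intro s ω ω' h h'
      refine ⟨trivial, ?_⟩
      have : layer Lab.base ω = layer Lab.base ω' := funext fun e => h (e, Lab.base) rfl
      show g (YF m n x F (layer Lab.base ω')) = s
      rw [← this]; exact h'.2)
    (fun y => (meas_layer l (meas_seed m y)).compl) (fun y => (detBy_seed m l y).compl)
    (by
      rintro s ⟨ω, -, hs⟩ y hy z hz hyz
      obtain rfl : g (YF m n x F (layer Lab.base ω)) = s := hs
      exact seedJ_disj (box_disj_of_res (g3 _ y hy z hz) hyz) l l)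
    (by
      intro s _ y _
      rw [Set.disjoint_left]
      rintro ⟨e, l'⟩ h1 ⟨-, h2⟩
      exact hl (h2.symm.trans h1))
    (β := 1 - κ) (by linarith) (by linarith)
    (by
      intro y
      have e := probReal_compl_eq_one_sub (μ := PL qq) (s := {ω : LC d | Seed m y (layer l ω)})
        (meas_layer l (meas_seed m y))
      have := seed_prob qq l m y
      show (PL qq).real {ω : LC d | Seed m y (layer l ω)}ᶜ ≤ 1 - κ
      rw [e]; linarith) t
  rw [show (PB fun i : LI d => qq i.2) = PL qq from rfl, probReal_univ, mul_one] at this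
  refine (real_union_le (P := PL qq) ?_).trans (add_le_add le_rfl this)
  intro ω hω
  by_cases hc : (YF m n x F (layer Lab.base ω)).card < T
  · exact Or.inl hc
  · right
    refine ⟨trivial, g2 _ (not_lt.1 hc), fun y hy hs => hω ?_⟩
    obtain ⟨hyF, a, ha, hca⟩ := mem_YF.1 (g1 _ hy)
    exact ⟨a, ha, y, hyF, hca, hs⟩

end D3
end Mod9

section Mod10
section D4
variable {d : ℕ}

theorem meas_exP {Ω : Type*} [MeasurableSpace Ω] {P : Prop} {f : P → Ω → Prop}
    (h : ∀ a, MeasurableSet {ω | f a ω}) : MeasurableSet {ω | ∃ a, f a ω} := by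
  by_cases hP : P
  · have : {ω | ∃ a, f a ω} = {ω | f hP ω} := by
      ext ω; exact ⟨fun ⟨_, h⟩ => h, fun h => ⟨hP, h⟩⟩
    rw [this]; exact h hP
  · have : {ω | ∃ a, f a ω} = ∅ := by
      ext ω; exact ⟨fun ⟨h, _⟩ => hP h, fun h => h.elim⟩
    rw [this]; exact MeasurableSet.empty

open Classical in
/-- new sites found in one step -/
noncomputable def newS (n : ℕ) (x : V d) (R : Finset (V d)) (l1 : Lab d) (ω : LC d) : Finset (V d) :=
  (box n x \ R).filter fun b => ∃ a ∈ R, ∃ b0 ∈ box n x \ R, a ∈ box n x ∧ edgeOpen (layer l1 ω) a b0 ∧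
    Conn (layer Lab.base ω) (↑(box n x) \ ↑R) b0 b

theorem mem_newS {n : ℕ} {x : V d} {R : Finset (V d)} {l1 : Lab d} {ω : LC d} {b : V d} :
    b ∈ newS n x R l1 ω ↔ b ∈ box n x \ R ∧ ∃ a ∈ R, ∃ b0 ∈ box n x \ R, a ∈ box n x ∧
      edgeOpen (layer l1 ω) a b0 ∧ Conn (layer Lab.base ω) (↑(box n x) \ ↑R) b0 b := by simp [newS]

/-- success of a step -/
def StepOK (m n : ℕ) (x : V d) (F R : Finset (V d)) (l1 l2 : Lab d) (y : V d) (ω : LC d) : Prop :=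
  y ∈ F ∧ (y ∈ R ∨ y ∈ newS n x R l1 ω) ∧ Seed m y (layer l2 ω)

theorem meas_newS (n : ℕ) (x : V d) (R : Finset (V d)) (l1 : Lab d) (b : V d) :
    MeasurableSet {ω | b ∈ newS n x R l1 ω} := by
  simp only [mem_newS]
  exact meas_and (meas_const _) (meas_ex fun a => meas_and (meas_const _) (meas_ex fun b0 =>
    meas_and (meas_const _) (meas_and (meas_const _) (meas_and (meas_layer l1 (meas_edgeOpen a b0))
      (meas_layer _ (meas_conn _ b0 b))))))

theorem meas_stepOK (m n : ℕ) (x : V d) (F R : Finset (V d)) (l1 l2 : Lab d) (y : V d) :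
    MeasurableSet {ω | StepOK m n x F R l1 l2 y ω} :=
  meas_and (meas_const _) (meas_and (meas_or (meas_const _) (meas_newS n x R l1 y))
    (meas_layer l2 (meas_seed m y)))

/-- coordinates used by a step -/
def stepI (R : Finset (V d)) (l1 l2 : Lab d) : Set (LI d) :=
  {i | (i.2 = Lab.base ∧ i.1 ∉ Touch (R : Set (V d))) ∨ i.2 = l1 ∨ i.2 = l2}

theorem inside_diff_not_touch {S R : Set (V d)} {e : Edge d} (h : e ∈ Inside (S \ R)) : e ∉ Touch R := by
  rintro ⟨v, hv, hvR⟩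
  exact (h v hv).2 hvR

theorem newS_congr {n : ℕ} {x : V d} {R : Finset (V d)} {l1 : Lab d} {ω ω' : LC d}
    (h1 : ∀ e ∈ Inside (↑(box n x) \ (R : Set (V d))), ω (e, Lab.base) = ω' (e, Lab.base))
    (h2 : ∀ e, ω (e, l1) = ω' (e, l1)) : newS n x R l1 ω = newS n x R l1 ω' := by
  have e1 : layer l1 ω = layer l1 ω' := funext h2
  ext b
  rw [mem_newS, mem_newS, e1]
  have : ∀ b0, Conn (layer Lab.base ω) (↑(box n x) \ (R : Set (V d))) b0 b ↔
      Conn (layer Lab.base ω') (↑(box n x) \ (R : Set (V d))) b0 b := fun b0 =>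
    (detBy_conn _ b0 b).iff h1
  simp only [this]

theorem stepOK_congr {m n : ℕ} {x : V d} {F R : Finset (V d)} {l1 l2 : Lab d} {y : V d} {ω ω' : LC d}
    (h : ∀ i ∈ stepI R l1 l2, ω i = ω' i) :
    StepOK m n x F R l1 l2 y ω ↔ StepOK m n x F R l1 l2 y ω' := by
  unfold StepOK
  rw [newS_congr (ω' := ω') (fun e he => h _ (Or.inl ⟨rfl, inside_diff_not_touch he⟩))
    (fun e => h _ (Or.inr (Or.inl rfl)))]
  have : layer l2 ω = layer l2 ω' := funext fun e => h _ (Or.inr (Or.inr rfl))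
  rw [this]

open Classical in
/-- pivotal edges -/
noncomputable def NN (m n : ℕ) (x : V d) (F R : Finset (V d)) (l2 : Lab d) (ω : LC d) : Finset (Edge d) :=
  (eIn (box n x)).filter fun e => ∃ a b, ∃ h : dist1 a b = 1, e = mkE a b h ∧ a ∈ R ∧
    b ∈ box n x \ R ∧ ∃ y ∈ F, Seed m y (layer l2 ω) ∧ Conn (layer Lab.base ω) (↑(box n x) \ ↑R) b y

theorem mem_NN {m n : ℕ} {x : V d} {F R : Finset (V d)} {l2 : Lab d} {ω : LC d} {e : Edge d} :
    e ∈ NN m n x F R l2 ω ↔ e ∈ eIn (box n x) ∧ ∃ a b, ∃ h : dist1 a b = 1, e = mkE a b h ∧ a ∈ R ∧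
    b ∈ box n x \ R ∧ ∃ y ∈ F, Seed m y (layer l2 ω) ∧
      Conn (layer Lab.base ω) (↑(box n x) \ ↑R) b y := by simp [NN]

theorem step_fail (qq : Lab d → unitInterval) {l1 l2 : Lab d} (h1 : l1 ≠ Lab.base)
    (h2 : l2 ≠ Lab.base) (h12 : l1 ≠ l2) (hb : (qq Lab.base : ℝ) < 1) (m n : ℕ) (x : V d)
    (F R : Finset (V d)) (hR : box m x ⊆ R) (t : ℕ) :
    (PL qq).real {ω | ¬ ∃ y, StepOK m n x F R l1 l2 y ω} ≤
      (PL qq).real {ω | ¬ Good3 m n x F l2 ω} / (1 - qq Lab.base) ^ t + (1 - qq l1) ^ t := by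
  classical
  set Z : Set (LC d) := {ω | ∀ y ∈ F, y ∈ R → ¬ Seed m y (layer l2 ω)} with hZ
  have mZ : MeasurableSet Z := meas_all fun y => meas_imp (meas_const _) (meas_imp (meas_const _)
    (meas_not (meas_layer l2 (meas_seed m y))))
  set I : Set (LI d) := {i | (i.2 = Lab.base ∧ i.1 ∈ Inside (↑(box n x) \ (R : Set (V d)))) ∨ i.2 = l2} with hI
  have mN : ∀ e, MeasurableSet {ω | e ∈ NN m n x F R l2 ω} := by
    intro e
    simp only [mem_NN]
    exact meas_and (meas_const _) (meas_ex fun a => meas_ex fun b => meas_exP fun h =>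
      meas_and (meas_const _) (meas_and (meas_const _) (meas_and (meas_const _) (meas_ex fun y =>
        meas_and (meas_const _) (meas_and (meas_layer l2 (meas_seed m y))
          (meas_layer _ (meas_conn _ b y)))))))
  have dZ : ∀ s, DetBy I (Z ∩ NN m n x F R l2 ⁻¹' {s}) := by
    rintro s ω ω' h ⟨hz, hs⟩
    have e2 : layer l2 ω = layer l2 ω' := funext fun e => h _ (Or.inr rfl)
    refine ⟨fun y hy hyR => e2 ▸ hz y hy hyR, ?_⟩
    obtain rfl : NN m n x F R l2 ω = s := hs
    show NN m n x F R l2 ω' = NN m n x F R l2 ω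
    ext e
    rw [mem_NN, mem_NN, e2]
    have : ∀ b y, Conn (layer Lab.base ω) (↑(box n x) \ (R : Set (V d))) b y ↔
      Conn (layer Lab.base ω') (↑(box n x) \ (R : Set (V d))) b y := fun b0 y =>
      (detBy_conn _ b0 y).iff fun e he => h _ (Or.inl ⟨rfl, he⟩)
    simp only [this]
  have hin : ∀ s, (Z ∩ NN m n x F R l2 ⁻¹' {s}).Nonempty → ∀ e ∈ s,
      e ∉ Inside (↑(box n x) \ (R : Set (V d))) := by
    rintro s ⟨ω, -, hs⟩ e he
    obtain rfl : NN m n x F R l2 ω = s := hs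
    obtain ⟨-, a, b, h, rfl, ha, -⟩ := mem_NN.1 he
    intro hi
    exact (mkE_inside.1 hi).1.2 ha
  have hβ0 : 0 < 1 - (qq Lab.base : ℝ) := by linarith
  have c1 := closing_ge (fun i : LI d => qq i.2) mZ (fun e => {ω | ω (e, Lab.base) = false})
    (fun e => {(e, Lab.base)}) (NN m n x F R l2) mN (fun _ => I) dZ
    (fun e => meas_coord _ _) (fun e => detBy_coord _ _)
    (by
      intro s _ a _ b _ hab
      simpa using hab)
    (by
      intro s hs e he
      rw [Set.disjoint_singleton_right]
      rintro (⟨-, h⟩ | h)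
      · exact hin s hs e he h
      · exact h2 h.symm)
    hβ0 (by linarith [(qq Lab.base).2.1]) (fun e => (PB_false (fun i : LI d => qq i.2) (e, Lab.base)).ge) t
  have c2 := closing_le (fun i : LI d => qq i.2) mZ (fun e => {ω | ω (e, l1) = false})
    (fun e => {(e, l1)}) (NN m n x F R l2) mN (fun _ => I) dZ
    (fun e => meas_coord _ _) (fun e => detBy_coord _ _)
    (by
      intro s _ a _ b _ hab
      simpa using hab)
    (by
      intro s hs e he
      rw [Set.disjoint_singleton_right]
      rintro (⟨h, -⟩ | h)
      · exact h1 h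
      · exact h12 h)
    (β := 1 - (qq l1 : ℝ)) (by linarith [(qq l1).2.2]) (by linarith [(qq l1).2.1]) (fun e => (PB_false (fun i : LI d => qq i.2) (e, l1)).le) t
  have hsub : {ω : LC d | ¬ ∃ y, StepOK m n x F R l1 l2 y ω} ⊆
      (Z ∩ {ω | (NN m n x F R l2 ω).card ≤ t}) ∪
      (Z ∩ {ω | t ≤ (NN m n x F R l2 ω).card ∧ ∀ a ∈ NN m n x F R l2 ω, ω ∈ {ω : LC d | ω (a, l1) = false}}) := by
    intro ω hω
    have hz : ω ∈ Z := fun y hy hyR hs => hω ⟨y, hy, Or.inl hyR, hs⟩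
    rcases le_total (NN m n x F R l2 ω).card t with h | h
    · exact Or.inl ⟨hz, h⟩
    · refine Or.inr ⟨hz, h, fun e he => ?_⟩
      obtain ⟨hbx, a, b, hab, rfl, ha, hb', y, hy, hs, hc⟩ := mem_NN.1 he
      show ω (_, l1) = false
      by_contra hne
      rw [Bool.not_eq_false] at hne
      have hyb := hc.mem (by simpa using hb')
      refine hω ⟨y, hy, Or.inr (mem_newS.2 ⟨by simpa using hyb, a, ha, b, hb', ?_, ⟨hab, hne⟩, hc⟩), hs⟩
      exact (mkE_inside.1 (mem_eIn.1 hbx)).1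
  have hsub2 : (Z ∩ {ω | (NN m n x F R l2 ω).card ≤ t ∧ ∀ a ∈ NN m n x F R l2 ω, ω ∈ {ω : LC d | ω (a, Lab.base) = false}})
      ⊆ {ω | ¬ Good3 m n x F l2 ω} := by
    rintro ω ⟨hz, -, hcl⟩ ⟨a0, ha0, y, hy, hc, hs⟩
    have hyR : y ∉ R := fun h => hz y hy h hs
    obtain ⟨a, b, ha, hb', hab, ha', hb'', hc', -⟩ := hc.last_exit (T := (R : Set (V d))) (hR ha0) hyR
    have hcc := hcl (mkE a b hab.1) (mem_NN.2 ⟨mem_eIn.2 (mkE_inside.2 ⟨ha', hb''⟩), a, b, hab.1, rfl, ha,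
      by rw [Finset.mem_sdiff]; exact ⟨hb'', hb'⟩, y, hy, hs, hc'⟩)
    exact Bool.noConfusion (hab.2.symm.trans hcc)
  refine (real_union_le (P := PL qq) hsub).trans (add_le_add ?_ (c2.trans ?_))
  · rw [le_div_iff₀ (by positivity)]
    exact c1.trans (measureReal_mono hsub2)
  · exact mul_le_of_le_one_right (pow_nonneg (by linarith [(qq l1).2.2]) _) measureReal_le_one

/-- the step lemma -/
theorem step_lemma (hd : 2 ≤ d) (U : UniformCoupling d) {p' : unitInterval} (h : pcU U < p')
    (hq : (p' : ℝ) < 1) {δ : ℝ} (hδ : 0 < δ) (hδ1 : δ ≤ 1) {η : ℝ} (hη : 0 < η) :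
    ∃ m n : ℕ, 1 ≤ m ∧ m ≤ n ∧ ∀ (qq : Lab d → unitInterval), qq Lab.base = p' →
      ∀ {l1 l2 : Lab d}, l1 ≠ Lab.base → l2 ≠ Lab.base → l1 ≠ l2 → δ ≤ qq l1 → δ ≤ qq l2 →
      ∀ x i s R, box m x ⊆ R →
      (PL qq).real {ω | ¬ ∃ y, StepOK m n x (Face n x i s) R l1 l2 y ω} ≤ η := by
  have hη3 : 0 < η / 2 := by linarith
  have pw : ∀ {c : ℝ}, 0 < c → c ≤ 1 → ∀ {ε : ℝ}, 0 < ε → ∃ t : ℕ, (1 - c) ^ t ≤ ε := by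
    intro c hc hc1 ε hε
    obtain ⟨t, ht⟩ := exists_pow_lt_of_lt_one hε (show 1 - c < 1 by linarith)
    exact ⟨t, ht.le⟩
  obtain ⟨t, ht⟩ := pw hδ hδ1 hη3
  have hb : 0 < 1 - (p' : ℝ) := by linarith
  set η1 := η / 2 * (1 - (p' : ℝ)) ^ t / 2 with hη1
  have hη1p : 0 < η1 := by positivity
  obtain ⟨m, hm, H⟩ := YF_face hd U h hq hη1p
  obtain ⟨t2, ht2⟩ := pw (c := δ ^ sExp d m) (by positivity) (pow_le_one₀ hδ.le hδ1) hη1p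
  obtain ⟨n, hn⟩ := H (t2 * (2 * m + 1) ^ d)
  obtain ⟨hmn, hn⟩ := hn n le_rfl
  refine ⟨m, n, hm, hmn, fun qq hqq l1 l2 hl1 hl2 hl12 hd1 hd2 x i s R hR => ?_⟩
  refine (step_fail qq hl1 hl2 hl12 (by rw [hqq]; exact hq) m n x _ R hR t).trans ?_
  have g := good3_fail qq l2 hl2 m n x (Face n x i s) t2
  rw [hqq] at g ⊢
  have e1 : (1 - (qq l2 : ℝ) ^ sExp d m) ^ t2 ≤ (1 - δ ^ sExp d m) ^ t2 := by
    have a1 : (qq l2 : ℝ) ^ sExp d m ≤ 1 := pow_le_one₀ (qq l2).2.1 (qq l2).2.2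
    have a2 : δ ^ sExp d m ≤ (qq l2 : ℝ) ^ sExp d m := pow_le_pow_left₀ hδ.le hd2 _
    exact pow_le_pow_left₀ (by linarith) (by linarith) _
  have e2 : (1 - (qq l1 : ℝ)) ^ t ≤ (1 - δ) ^ t :=
    pow_le_pow_left₀ (by linarith [(qq l1).2.2]) (by linarith) _
  have e3 : (PL qq).real {ω | ¬ Good3 m n x (Face n x i s) l2 ω} / (1 - (p' : ℝ)) ^ t ≤ η / 2 := by
    rw [div_le_iff₀ (by positivity)]
    have := hn x i s
    linarith
  linarith

end D4
end Mod10

section Mod11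
section E1
variable {d : ℕ}

theorem newS_det {n : ℕ} {x : V d} {R : Finset (V d)} {l1 : Lab d} {ω ω' : LC d}
    (h1 : ∀ e ∈ Touch (newS n x R l1 ω : Set (V d)), ω (e, Lab.base) = ω' (e, Lab.base))
    (h2 : ∀ e, ω (e, l1) = ω' (e, l1)) : newS n x R l1 ω' = newS n x R l1 ω := by
  have e1 : layer l1 ω = layer l1 ω' := funext h2
  have hopen : ∀ a b, (a ∈ newS n x R l1 ω ∨ b ∈ newS n x R l1 ω) →
      (edgeOpen (layer Lab.base ω) a b ↔ edgeOpen (layer Lab.base ω') a b) := by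
    intro a b hab
    rw [edgeOpen_iff, edgeOpen_iff]
    refine exists_congr fun h => ?_
    show ω (mkE a b h, Lab.base) = true ↔ ω' (mkE a b h, Lab.base) = true
    rw [h1 _ (mkE_touch.2 hab)]
  ext b
  constructor
  · intro hb
    obtain ⟨hbb, a, ha, b0, hb0, hab, ho, hc⟩ := mem_newS.1 hb
    have hb0N : b0 ∈ newS n x R l1 ω := mem_newS.2 ⟨hb0, a, ha, b0, hb0, hab, e1 ▸ ho, Conn.refl _ _ _⟩
    by_contra hbN
    obtain ⟨u, v, hu, hv, huv, huS, hvS, -, -⟩ := hc.exit (T := (newS n x R l1 ω : Set (V d))) hb0N hbN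
    obtain ⟨-, a', ha', b1, hb1, hab1, ho1, hc1⟩ := mem_newS.1 hu
    exact hv (mem_newS.2 ⟨by simpa using hvS, a', ha', b1, hb1, hab1, ho1,
      hc1.trans (Conn.single ((hopen u v (Or.inl hu)).2 huv) huS hvS)⟩)
  · intro hb
    obtain ⟨hbb, a, ha, b0, hb0, hab, ho, hc⟩ := mem_newS.1 hb
    refine mem_newS.2 ⟨hbb, a, ha, b0, hb0, hab, e1 ▸ ho, ?_⟩
    clear hbb hb
    induction hc with
    | refl => exact Conn.refl _ _ _
    | @tail u v huv hl ih =>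
      refine ih.trans (Conn.single ((hopen u v (Or.inl ?_)).1 hl.1) hl.2.1 hl.2.2)
      exact mem_newS.2 ⟨by simpa using hl.2.1, a, ha, b0, hb0, hab, ho, huv⟩

/-- exploration states: explored vertices, occupied sites with centres, failed sites -/
abbrev St (d : ℕ) := Finset (V d) × Finset (V d × V d) × Finset (V d)

open Classical in
/-- occupied sites -/
noncomputable def dom (s : St d) : Finset (V d) := s.2.1.image Prod.fst

theorem mem_dom {s : St d} {z : V d} : z ∈ dom s ↔ ∃ x, (z, x) ∈ s.2.1 := by
  simp [dom]

/-- frontier attempts -/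
def Fr (W : Set (V d)) (s : St d) (w : V d × V d × V d) : Prop :=
  w.1 ∈ W ∧ w.1 ∉ dom s ∧ w.1 ∉ s.2.2 ∧ (w.2.1, w.2.2) ∈ s.2.1 ∧ dist1 w.2.1 w.1 = 1

/-- labels of an attempt -/
abbrev lab1 (z : V d) : Lab d := Sum.inr (z, true)
/-- labels of an attempt -/
abbrev lab2 (z : V d) : Lab d := Sum.inr (z, false)

open Classical in
/-- target face -/
noncomputable def tgt (n : ℕ) (z z' x : V d) : Finset (V d) :=
  if h : ∃ i, z i ≠ z' i then Face n x h.choose fun j =>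
    if (if j = h.choose then z j < z' j else x j ≤ n * z j) then 1 else -1 else ∅

/-- success in an attempt -/
def AOK (m n : ℕ) (s : St d) (w : V d × V d × V d) (y : V d) (ω : LC d) : Prop :=
  StepOK m n w.2.2 (tgt n w.2.1 w.1 w.2.2) s.1 (lab1 w.1) (lab2 w.1) y ω

open Classical in
/-- one attempt -/
noncomputable def att (m n : ℕ) (s : St d) (w : V d × V d × V d) (ω : LC d) : St d :=
  if h : ((tgt n w.2.1 w.1 w.2.2).filter fun y => AOK m n s w y ω).Nonempty then
    (s.1 ∪ newS n w.2.2 s.1 (lab1 w.1) ω ∪ box m h.choose, insert (w.1, h.choose) s.2.1, s.2.2)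
  else (s.1 ∪ newS n w.2.2 s.1 (lab1 w.1) ω, s.2.1, insert w.1 s.2.2)

theorem att_cases (m n : ℕ) (s : St d) (w : V d × V d × V d) (ω : LC d) :
    (∃ y, AOK m n s w y ω ∧ (att m n s w ω).1 = s.1 ∪ newS n w.2.2 s.1 (lab1 w.1) ω ∪ box m y ∧
      (att m n s w ω).2.1 = insert (w.1, y) s.2.1 ∧ (att m n s w ω).2.2 = s.2.2) ∨
    ((¬ ∃ y, AOK m n s w y ω) ∧ (att m n s w ω).1 = s.1 ∪ newS n w.2.2 s.1 (lab1 w.1) ω ∧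
      (att m n s w ω).2.1 = s.2.1 ∧ (att m n s w ω).2.2 = insert w.1 s.2.2) := by
  classical
  by_cases h : ((tgt n w.2.1 w.1 w.2.2).filter fun y => AOK m n s w y ω).Nonempty
  · left
    refine ⟨h.choose, (Finset.mem_filter.1 h.choose_spec).2, ?_⟩
    have e : att m n s w ω = (s.1 ∪ newS n w.2.2 s.1 (lab1 w.1) ω ∪ box m h.choose,
      insert (w.1, h.choose) s.2.1, s.2.2) := by
      unfold att; rw [dif_pos h]
    rw [e]; refine ⟨?_, ?_, rfl⟩ <;> ext <;> simp
  · right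
    refine ⟨fun ⟨y, hy⟩ => h ⟨y, Finset.mem_filter.2 ⟨hy.1, hy⟩⟩, ?_⟩
    have e : att m n s w ω = (s.1 ∪ newS n w.2.2 s.1 (lab1 w.1) ω, s.2.1, insert w.1 s.2.2) := by
      unfold att; rw [dif_neg h]
    rw [e]; refine ⟨?_, rfl, ?_⟩ <;> ext <;> simp

theorem att_eq_of {m n : ℕ} {s : St d} {w : V d × V d × V d} {ω ω' : LC d}
    (h1 : newS n w.2.2 s.1 (lab1 w.1) ω = newS n w.2.2 s.1 (lab1 w.1) ω')
    (h2 : ∀ y, AOK m n s w y ω ↔ AOK m n s w y ω') : att m n s w ω = att m n s w ω' := by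
  classical
  have e : (fun y => AOK m n s w y ω) = fun y => AOK m n s w y ω' := funext fun y => propext (h2 y)
  unfold att
  simp only [h1, h2]

theorem meas_aok (m n : ℕ) (s : St d) (w : V d × V d × V d) (y : V d) :
    MeasurableSet {ω | AOK m n s w y ω} := meas_stepOK _ _ _ _ _ _ _ _

theorem meas_att (m n : ℕ) (s : St d) (w : V d × V d × V d) (s' : St d) :
    MeasurableSet (att m n s w ⁻¹' {s'}) := by
  classical
  let Ys : LC d → Finset (V d) := fun ω => (tgt n w.2.1 w.1 w.2.2).filter fun y => AOK m n s w y ω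
  have mY : ∀ a, MeasurableSet {ω | a ∈ Ys ω} := by
    intro a
    simp only [Ys, Finset.mem_filter]
    exact meas_and (meas_const _) (meas_aok m n s w a)
  have mN : ∀ a, MeasurableSet {ω | a ∈ newS n w.2.2 s.1 (lab1 w.1) ω} := meas_newS _ _ _ _
  have : att m n s w ⁻¹' {s'} = ⋃ N : Finset (V d), ⋃ Y : Finset (V d),
      ((newS n w.2.2 s.1 (lab1 w.1)) ⁻¹' {N} ∩ Ys ⁻¹' {Y}) ∩
        {ω | ∃ ω', newS n w.2.2 s.1 (lab1 w.1) ω' = N ∧ Ys ω' = Y ∧ att m n s w ω' = s'} := by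
    ext ω
    simp only [Set.mem_iUnion]
    constructor
    · intro h
      exact ⟨_, _, ⟨rfl, rfl⟩, ω, rfl, rfl, h⟩
    · rintro ⟨N, Y, ⟨hN, hY⟩, ω', h1, h2, h3⟩
      show att m n s w ω = s'
      rw [← h3]
      refine att_eq_of (hN.trans h1.symm) fun y => ?_
      have hyy : y ∈ Ys ω ↔ y ∈ Ys ω' := by rw [h2, hY]
      simp only [Ys, Finset.mem_filter] at hyy
      exact ⟨fun h => (hyy.1 ⟨h.1, h⟩).2, fun h => (hyy.2 ⟨h.1, h⟩).2⟩
  rw [this]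
  exact MeasurableSet.iUnion fun N => MeasurableSet.iUnion fun Y =>
    ((meas_finset_eq mN N).inter (meas_finset_eq mY Y)).inter (meas_const _)

/-- revealed coordinates -/
def stI (s : St d) : Set (LI d) := {i | (i.2 = Lab.base ∧ i.1 ∈ Touch (s.1 : Set (V d))) ∨
  (∃ z b, i.2 = Sum.inr (z, b) ∧ (z ∈ dom s ∨ z ∈ s.2.2)) ∨ ∃ k : Fin 4, k ≠ 0 ∧ i.2 = Sum.inl k}

theorem att_mono (m n : ℕ) (s : St d) (w : V d × V d × V d) (ω : LC d) :
    s.1 ⊆ (att m n s w ω).1 ∧ newS n w.2.2 s.1 (lab1 w.1) ω ⊆ (att m n s w ω).1 ∧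
    s.2.1 ⊆ (att m n s w ω).2.1 ∧ s.2.2 ⊆ (att m n s w ω).2.2 ∧
    (w.1 ∈ dom (att m n s w ω) ∨ w.1 ∈ (att m n s w ω).2.2) := by
  classical
  rcases att_cases m n s w ω with ⟨y, -, h1, h2, h3⟩ | ⟨-, h1, h2, h3⟩
  · rw [mem_dom, h1, h2, h3]
    refine ⟨fun v hv => by simp [hv], fun v hv => by simp [hv], Finset.subset_insert _ _, subset_rfl,
      Or.inl ⟨y, Finset.mem_insert_self _ _⟩⟩
  · rw [h1, h2, h3]
    exact ⟨Finset.subset_union_left, Finset.subset_union_right, subset_rfl, Finset.subset_insert _ _,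
      Or.inr (Finset.mem_insert_self _ _)⟩

theorem stI_mono {s s' : St d} (h1 : s.1 ⊆ s'.1) (h2 : s.2.1 ⊆ s'.2.1) (h3 : s.2.2 ⊆ s'.2.2) :
    stI s ⊆ stI s' := by
  rintro i (⟨h, h'⟩ | ⟨z, b, h, h'⟩ | h)
  · exact Or.inl ⟨h, Touch_mono (by exact_mod_cast h1) h'⟩
  · refine Or.inr (Or.inl ⟨z, b, h, h'.imp (fun h => ?_) fun h => h3 h⟩)
    rw [mem_dom] at *
    exact h.imp fun x hx => h2 hx
  · exact Or.inr (Or.inr h)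

theorem detBy_att (m n : ℕ) (s : St d) (w : V d × V d × V d) (s' : St d) :
    DetBy (stI s') (att m n s w ⁻¹' {s'}) := by
  intro ω ω' h hs
  obtain rfl : att m n s w ω = s' := hs
  obtain ⟨-, m2, -, -, m5⟩ := att_mono m n s w ω
  have hl : ∀ (b : Bool) e, ω (e, Sum.inr (w.1, b)) = ω' (e, Sum.inr (w.1, b)) := fun b e =>
    h _ (Or.inr (Or.inl ⟨w.1, b, rfl, m5⟩))
  have hN : newS n w.2.2 s.1 (lab1 w.1) ω' = newS n w.2.2 s.1 (lab1 w.1) ω :=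
    newS_det (fun e he => h _ (Or.inl ⟨rfl, Touch_mono (by exact_mod_cast m2) he⟩)) (hl true)
  refine att_eq_of hN fun y => ?_
  unfold AOK StepOK
  rw [hN, show layer (lab2 w.1) ω = layer (lab2 w.1) ω' from funext (hl false)]

open Classical in
/-- one step of exploration -/
noncomputable def stp (m n : ℕ) (W : Set (V d)) (s : St d) (ω : LC d) : St d :=
  if h : ∃ w, Fr W s w then att m n s h.choose ω else s

/-- exploration -/
noncomputable def run (m n : ℕ) (W : Set (V d)) : ℕ → St d → LC d → St d
  | 0, s, _ => s
  | T + 1, s, ω => run m n W T (stp m n W s ω) ω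

theorem stp_cases (m n : ℕ) (W : Set (V d)) (s : St d) :
    (∃ w, Fr W s w ∧ ∀ ω, stp m n W s ω = att m n s w ω) ∨
    ((¬ ∃ w, Fr W s w) ∧ ∀ ω, stp m n W s ω = s) := by
  by_cases h : ∃ w, Fr W s w
  · exact Or.inl ⟨h.choose, h.choose_spec, fun ω => dif_pos h⟩
  · exact Or.inr ⟨h, fun ω => dif_neg h⟩

theorem meas_stp (m n : ℕ) (W : Set (V d)) (s s' : St d) : MeasurableSet (stp m n W s ⁻¹' {s'}) := by
  rcases stp_cases m n W s with ⟨w, -, h⟩ | ⟨-, h⟩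
  · rw [show stp m n W s = att m n s w from funext h]; exact meas_att m n s w s'
  · rw [show stp m n W s = fun _ => s from funext h]; exact meas_const _

theorem meas_run (m n : ℕ) (W : Set (V d)) (T : ℕ) (s s' : St d) :
    MeasurableSet (run m n W T s ⁻¹' {s'}) := by
  induction T generalizing s with
  | zero => exact meas_const (Ω := LC d) (s = s')
  | succ T ih =>
    have : run m n W (T + 1) s ⁻¹' {s'} = ⋃ s1, stp m n W s ⁻¹' {s1} ∩ run m n W T s1 ⁻¹' {s'} := by
      ext ω; simp [run]
    rw [this]
    exact MeasurableSet.iUnion fun s1 => (meas_stp m n W s s1).inter (ih s1)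

theorem meas_run_pred (m n : ℕ) (W : Set (V d)) (T : ℕ) (s : St d) (p : St d → Prop) :
    MeasurableSet {ω | p (run m n W T s ω)} := by
  have : {ω | p (run m n W T s ω)} = ⋃ s' ∈ {s' | p s'}, run m n W T s ⁻¹' {s'} := by
    ext ω; simp
  rw [this]
  exact MeasurableSet.biUnion (Set.to_countable _) fun s' _ => meas_run m n W T s s'

/-- centres are explored -/
def Inv (m : ℕ) (s : St d) : Prop := ∀ w ∈ s.2.1, box m w.2 ⊆ s.1

theorem inv_att {m n : ℕ} {s : St d} (h : Inv m s) (w : V d × V d × V d) (ω : LC d) :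
    Inv m (att m n s w ω) := by
  classical
  intro u hu
  have hm := (att_mono m n s w ω).1
  rcases att_cases m n s w ω with ⟨y, -, h1, h2, h3⟩ | ⟨-, h1, h2, h3⟩
  · rw [h2] at hu
    rcases Finset.mem_insert.1 hu with rfl | hu
    · rw [h1]; exact Finset.subset_union_right
    · exact (h u hu).trans hm
  · rw [h2] at hu
    exact (h u hu).trans hm

open Classical in
/-- bound on failure sets -/
noncomputable def phi (η : ℝ) (S : Finset (V d)) (s : St d) : ℝ :=
  if Disjoint S (dom s) then η ^ (S \ s.2.2).card else 0

theorem phi_nonneg {η : ℝ} (h : 0 ≤ η) (S : Finset (V d)) (s : St d) : 0 ≤ phi η S s := by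
  unfold phi; split_ifs <;> positivity

/-- all the steps are likely to succeed -/
def StepProb (qq : Lab d → unitInterval) (m n : ℕ) (η : ℝ) : Prop :=
  ∀ z' x i s R, box m x ⊆ R →
    (PL qq).real {ω | ¬ ∃ y, StepOK m n x (Face n x i s) R (lab1 z') (lab2 z') y ω} ≤ η

theorem fail_bound {qq : Lab d → unitInterval} {m n : ℕ} {η : ℝ} (hs : StepProb qq m n η)
    {W : Set (V d)} {s : St d} (hI : Inv m s) {w : V d × V d × V d} (hw : Fr W s w)
    {H : Set (LC d)} (mH : MeasurableSet H) (dH : DetBy (stI s) H) :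
    (PL qq).real (H ∩ {ω | ¬ ∃ y, AOK m n s w y ω}) ≤ (PL qq).real H * η := by
  classical
  have hne : ∃ i, w.2.1 i ≠ w.1 i := by
    by_contra h
    push Not at h
    have h2 := hw.2.2.2.2
    rw [funext h, dist1_self] at h2
    omega
  have hAe : ∀ ω, (¬ ∃ y, AOK m n s w y ω) ↔ ¬ ∃ y, StepOK m n w.2.2 (Face n w.2.2 hne.choose _) s.1
      (lab1 w.1) (lab2 w.1) y ω := fun ω => by
    unfold AOK tgt; rw [dif_pos hne]
  have mA : MeasurableSet {ω | ¬ ∃ y, AOK m n s w y ω} := meas_not (meas_ex fun y => meas_aok m n s w y)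
  have dA : DetBy (stepI s.1 (lab1 w.1) (lab2 w.1)) {ω | ¬ ∃ y, AOK m n s w y ω} := by
    intro ω ω' h h'
    rintro ⟨y, hy⟩
    exact h' ⟨y, (stepOK_congr h).2 hy⟩
  have hd : Disjoint (stI s) (stepI s.1 (lab1 w.1) (lab2 w.1)) := by
    rw [Set.disjoint_left]
    rintro ⟨e, l⟩ h1 h2
    simp only [stI, stepI, Set.mem_setOf_eq] at h1 h2
    rcases h2 with ⟨h2, h3⟩ | h2
    · subst h2
      rcases h1 with h1 | ⟨z, b, h1, -⟩ | ⟨k, hk, h1⟩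
      · exact h3 h1.2
      · cases h1
      · cases h1; exact hk rfl
    · have : ∃ b, l = Sum.inr (w.1, b) := h2.elim (fun h => ⟨_, h⟩) fun h => ⟨_, h⟩
      obtain ⟨b, rfl⟩ := this
      rcases h1 with h1 | ⟨z, b', h1, h4⟩ | ⟨k, hk, h1⟩
      · cases h1.1
      · cases h1
        exact h4.elim hw.2.1 hw.2.2.1
      · cases h1
  have := indep_detBy (fun i : LI d => qq i.2) mH mA dH dA hd
  show (PL qq).real _ ≤ _
  rw [show (PB fun i : LI d => qq i.2) = PL qq from rfl] at this
  rw [this]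
  refine mul_le_mul_of_nonneg_left ?_ measureReal_nonneg
  rw [show {ω : LC d | ¬ ∃ y, AOK m n s w y ω} = _ from Set.ext hAe]
  exact hs w.1 w.2.2 _ _ s.1 (hI _ hw.2.2.2.1)

theorem run_bound {qq : Lab d → unitInterval} {m n : ℕ} {η : ℝ} (hη : 0 < η) (hη1 : η ≤ 1)
    (hs : StepProb qq m n η) (W : Set (V d)) (S : Finset (V d)) (T : ℕ) (s : St d) (hI : Inv m s)
    {H : Set (LC d)} (mH : MeasurableSet H) (dH : DetBy (stI s) H) :
    (PL qq).real (H ∩ {ω | S ⊆ (run m n W T s ω).2.2 ∧ Disjoint S (dom (run m n W T s ω))}) ≤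
      phi η S s * (PL qq).real H := by
  classical
  induction T generalizing s H with
  | zero =>
    by_cases h : S ⊆ s.2.2 ∧ Disjoint S (dom s)
    · have : phi η S s = 1 := by
        unfold phi; rw [if_pos h.2, Finset.sdiff_eq_empty_iff_subset.2 h.1]; simp
      rw [this, one_mul]
      exact measureReal_mono Set.inter_subset_left
    · have : H ∩ {ω | S ⊆ (run m n W 0 s ω).2.2 ∧ Disjoint S (dom (run m n W 0 s ω))} = ∅ := by
        ext ω; exact ⟨fun h' => h h'.2, fun h => h.elim⟩
      rw [this, measureReal_empty]
      exact mul_nonneg (phi_nonneg hη.le _ _) measureReal_nonneg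
  | succ T ih =>
    rcases stp_cases m n W s with ⟨w, hw, hstp⟩ | ⟨-, hstp⟩
    swap
    · have := ih s hI mH dH
      refine le_trans (le_of_eq ?_) this
      congr 1; ext ω
      show _ ∧ (_ ⊆ (run m n W T (stp m n W s ω) ω).2.2 ∧ Disjoint S (dom (run m n W T (stp m n W s ω) ω))) ↔ _
      rw [hstp]; rfl
    have key : ∀ s', (att m n s w ⁻¹' {s'}).Nonempty →
        (PL qq).real (H ∩ {ω | S ⊆ (run m n W (T + 1) s ω).2.2 ∧ Disjoint S (dom (run m n W (T + 1) s ω))} ∩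
          att m n s w ⁻¹' {s'}) ≤ phi η S s' * (PL qq).real (H ∩ att m n s w ⁻¹' {s'}) := by
      rintro s' ⟨ω, hω⟩
      obtain rfl : att m n s w ω = s' := hω
      obtain ⟨a1, -, a3, a4, -⟩ := att_mono m n s w ω
      refine le_trans (measureReal_mono ?_) (ih (att m n s w ω) (inv_att hI w ω)
        (H := H ∩ att m n s w ⁻¹' {att m n s w ω}) (mH.inter (meas_att _ _ _ _ _))
        ((dH.mono (stI_mono a1 a3 a4)).inter (detBy_att _ _ _ _ _)))
      rintro ω' ⟨⟨h1, h2⟩, h3⟩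
      refine ⟨⟨h1, h3⟩, ?_⟩
      have h3' : att m n s w ω' = att m n s w ω := h3
      change S ⊆ (run m n W T (stp m n W s ω') ω').2.2 ∧ Disjoint S (dom (run m n W T (stp m n W s ω') ω')) at h2
      rw [hstp, h3'] at h2
      exact h2
    have hne0 : ∀ s', ¬ (att m n s w ⁻¹' {s'}).Nonempty → ∀ X : Set (LC d),
        (PL qq).real (X ∩ att m n s w ⁻¹' {s'}) = 0 := by
      intro s' h X
      rw [Set.not_nonempty_iff_eq_empty.1 h, Set.inter_empty, measureReal_empty]
    have hdom : ∀ ω, dom s ⊆ dom (att m n s w ω) := fun ω z hz => by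
      rw [mem_dom] at *
      exact hz.imp fun x hx => (att_mono m n s w ω).2.2.1 hx
    by_cases hzS : w.1 ∈ S
    · -- bound through failure
      have h1 : (PL qq).real (H ∩ {ω | S ⊆ (run m n W (T + 1) s ω).2.2 ∧
          Disjoint S (dom (run m n W (T + 1) s ω))}) ≤
          (phi η S s / η) * (PL qq).real (H ∩ {ω | ¬ ∃ y, AOK m n s w y ω}) := by
        refine real_le_of_fibers (g := att m n s w) (meas_att m n s w)
          (div_nonneg (phi_nonneg hη.le _ _) hη.le) fun s' => ?_
        by_cases hne : (att m n s w ⁻¹' {s'}).Nonempty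
        swap
        · rw [hne0 s' hne, hne0 s' hne, mul_zero]
        refine (key s' hne).trans ?_
        obtain ⟨ω, hω⟩ := hne
        obtain rfl : att m n s w ω = s' := hω
        rcases att_cases m n s w ω with ⟨y, -, c1, c2, c3⟩ | ⟨-, c1, c2, c3⟩
        · have hin : w.1 ∈ dom (att m n s w ω) := by
            rw [mem_dom, c2]; exact ⟨y, Finset.mem_insert_self _ _⟩
          have : phi η S (att m n s w ω) = 0 := by
            unfold phi
            rw [if_neg fun h => Finset.disjoint_left.1 h hzS hin]
          rw [this, zero_mul]
          exact mul_nonneg (div_nonneg (phi_nonneg hη.le _ _) hη.le) measureReal_nonneg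
        · have hsub : H ∩ att m n s w ⁻¹' {att m n s w ω} ⊆
              (H ∩ {ω | ¬ ∃ y, AOK m n s w y ω}) ∩ att m n s w ⁻¹' {att m n s w ω} := by
            rintro ω' ⟨hH, he⟩
            have he' : att m n s w ω' = att m n s w ω := he
            refine ⟨⟨hH, ?_⟩, he⟩
            rcases att_cases m n s w ω' with ⟨y, -, -, -, c3'⟩ | ⟨hf, -⟩
            · exfalso
              rw [he', c3] at c3'
              exact hw.2.2.1 (c3' ▸ Finset.mem_insert_self _ _)
            · exact hf
          refine mul_le_mul ?_ (measureReal_mono hsub) measureReal_nonneg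
            (div_nonneg (phi_nonneg hη.le _ _) hη.le)
          have hde : dom (att m n s w ω) = dom s := by unfold dom; rw [c2]
          unfold phi
          rw [hde, c3]
          split_ifs
          · have hc : (S \ s.2.2).card = (S \ insert w.1 s.2.2).card + 1 := by
              have h3 : S \ s.2.2 = insert w.1 (S \ insert w.1 s.2.2) := by
                ext v
                simp only [Finset.mem_sdiff, Finset.mem_insert]
                constructor
                · rintro ⟨a, b⟩
                  by_cases hv : v = w.1
                  · exact Or.inl hv
                  · exact Or.inr ⟨a, fun h => h.elim hv b⟩
                · rintro (rfl | ⟨a, b⟩)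
                  · exact ⟨hzS, hw.2.2.1⟩
                  · exact ⟨a, fun h => b (Or.inr h)⟩
              rw [h3, Finset.card_insert_of_notMem (by simp)]
            rw [hc, pow_succ, mul_div_assoc, div_self hη.ne', mul_one]
          · simp
      refine h1.trans ?_
      have h2 := fail_bound hs hI hw mH dH
      calc (phi η S s / η) * (PL qq).real (H ∩ {ω | ¬ ∃ y, AOK m n s w y ω})
          ≤ (phi η S s / η) * ((PL qq).real H * η) :=
            mul_le_mul_of_nonneg_left h2 (div_nonneg (phi_nonneg hη.le _ _) hη.le)
        _ = _ := by field_simp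
    · refine real_le_of_fibers (g := att m n s w) (meas_att m n s w) (phi_nonneg hη.le _ _) fun s' => ?_
      by_cases hne : (att m n s w ⁻¹' {s'}).Nonempty
      swap
      · rw [hne0 s' hne, hne0 s' hne, mul_zero]
      refine (key s' hne).trans (mul_le_mul_of_nonneg_right ?_ measureReal_nonneg)
      obtain ⟨ω, hω⟩ := hne
      obtain rfl : att m n s w ω = s' := hω
      unfold phi
      by_cases h1 : Disjoint S (dom (att m n s w ω))
      · rw [if_pos h1, if_pos (h1.mono_right (hdom ω))]
        refine pow_le_pow_of_le_one hη.le hη1 (Finset.card_le_card ?_)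
        intro v hv
        rw [Finset.mem_sdiff] at *
        refine ⟨hv.1, fun h => hv.2 ?_⟩
        rcases att_cases m n s w ω with ⟨y, -, -, -, c3⟩ | ⟨-, -, -, c3⟩
        · rwa [c3] at h
        · rw [c3] at h
          exact (Finset.mem_insert.1 h).resolve_left fun h' => hzS (h' ▸ hv.1)
      · rw [if_neg h1]
        split_ifs <;> positivity

end E1
end Mod11

section Mod12
section E2
variable {d : ℕ}

theorem dist1_update (y : V d) (i : Fin d) (c : ℤ) (hc : (y i - c).natAbs = 1) :
    dist1 y (Function.update y i c) = 1 := by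
  unfold dist1
  rw [Finset.sum_eq_single i]
  · simpa using hc
  · intro j _ hj; simp [Function.update_of_ne hj]
  · simp

theorem exists_closer {x y : V d} (h : x ≠ y) : ∃ y', dist1 y y' = 1 ∧ dist1 x y' < dist1 x y ∧
    ∀ i, (x i ≤ y' i ∧ y' i ≤ y i) ∨ (y i ≤ y' i ∧ y' i ≤ x i) := by
  obtain ⟨i, hi⟩ := Function.ne_iff.1 h
  set c : ℤ := if x i < y i then y i - 1 else y i + 1 with hc
  refine ⟨Function.update y i c, dist1_update y i c ?_, ?_, fun j => ?_⟩
  · rw [hc]; split_ifs <;> simp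
  · unfold dist1
    refine Finset.sum_lt_sum (fun j _ => ?_) ⟨i, Finset.mem_univ _, ?_⟩
    · by_cases hj : j = i
      · subst hj; rw [Function.update_self, hc]; split_ifs <;> omega
      · rw [Function.update_of_ne hj]
    · rw [Function.update_self, hc]; split_ifs <;> omega
  · by_cases hj : j = i
    · subst hj; rw [Function.update_self, hc]; split_ifs <;> omega
    · rw [Function.update_of_ne hj]; omega

theorem box_conn {m : ℕ} {y : V d} {ω : Config d} (h : ∀ e ∈ eIn (box m y), ω e = true) (a : V d)
    (ha : a ∈ box m y) : Conn ω (box m y) y a := by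
  induction hk : dist1 y a using Nat.strong_induction_on generalizing a with
  | _ k ih =>
    by_cases hya : y = a
    · subst hya; exact Conn.refl _ _ _
    · obtain ⟨a', h1, h2, h3⟩ := exists_closer hya
      have ha' : a' ∈ box m y := by
        rw [mem_box] at *
        intro i
        have := ha i
        rw [abs_le] at *
        rcases h3 i with h | h <;> constructor <;> linarith [this.1, this.2, h.1, h.2]
      refine (ih _ (hk ▸ h2) a' ha' rfl).trans (Conn.symm (Conn.single ⟨h1, ?_⟩ ha ha'))
      exact h (mkE a a' h1) (mem_eIn.2 (mkE_inside.2 ⟨ha, ha'⟩))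

theorem seed_conn {m : ℕ} {y : V d} {ω : Config d} (h : Seed m y ω) {a b : V d}
    (ha : a ∈ box m y) (hb : b ∈ box m y) : Conn ω (box m y) a b :=
  (box_conn h a ha).symm.trans (box_conn h b hb)

/-- scaled site -/
def sc (n : ℕ) (z : V d) : V d := fun i => n * z i

/-- macroscopic cell of an edge -/
noncomputable def cell (n : ℕ) (e : Edge d) : V d := fun i => (Quot.out e.1).1 i / n

/-- neighbouring cells -/
noncomputable def Nbr (n : ℕ) (e : Edge d) : Finset (V d) :=
  Finset.Icc (fun i => cell n e i - 5) (fun i => cell n e i + 5)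

/-- labels attached to an edge -/
noncomputable def Ls (n : ℕ) (e : Edge d) : Finset (Lab d) :=
  (Finset.univ : Finset (Fin 4)).disjSum (Nbr n e ×ˢ (Finset.univ : Finset Bool))

open Classical in
/-- final configuration -/
noncomputable def Fin' (n : ℕ) (ω : LC d) : Config d := fun e => decide (∃ l ∈ Ls n e, ω (e, l) = true)

theorem final_open {n : ℕ} {ω : LC d} {e : Edge d} : Fin' n ω e = true ↔ ∃ l ∈ Ls n e, ω (e, l) = true := by
  simp [Fin']

theorem out_mem (a b : V d) (h : dist1 a b = 1) :
    (Quot.out (mkE a b h).1).1 = a ∨ (Quot.out (mkE a b h).1).1 = b := by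
  have : (Quot.out (mkE a b h).1).1 ∈ s(a, b) := Sym2.out_fst_mem (s(a, b))
  simpa using this

theorem mem_Nbr {n : ℕ} (hn : 1 ≤ n) {a b : V d} (h : dist1 a b = 1) {z : V d}
    (ha : a ∈ box (3 * n) (sc n z)) (hb : b ∈ box (3 * n) (sc n z)) : z ∈ Nbr n (mkE a b h) := by
  have key : ∀ c : V d, c ∈ box (3 * n) (sc n z) → ∀ i, z i - 3 ≤ c i / n ∧ c i / n ≤ z i + 3 := by
    intro c hc i
    have h1 := mem_box.1 hc i
    rw [abs_le] at h1
    unfold sc at h1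
    push_cast at h1
    have hn' : (0 : ℤ) < n := by exact_mod_cast hn
    constructor
    · rw [Int.le_ediv_iff_mul_le hn']; nlinarith [h1.1, h1.2]
    · apply Int.le_of_lt_add_one
      rw [Int.ediv_lt_iff_lt_mul hn']; nlinarith [h1.1, h1.2]
  have hk : ∀ i, z i - 3 ≤ cell n (mkE a b h) i ∧ cell n (mkE a b h) i ≤ z i + 3 := by
    intro i
    unfold cell
    rcases out_mem a b h with e | e
    · rw [e]; exact key a ha i
    · rw [e]; exact key b hb i
  unfold Nbr
  rw [Finset.mem_Icc]
  exact ⟨fun i => by have := hk i; show _ ≤ _; linarith [this.1, this.2],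
    fun i => by have := hk i; show _ ≤ _; linarith [this.1, this.2]⟩

theorem final_inl {n : ℕ} {ω : LC d} {a b : V d} (k : Fin 4) (h : edgeOpen (layer (Sum.inl k) ω) a b) :
    edgeOpen (Fin' n ω) a b :=
  ⟨h.1, final_open.2 ⟨Sum.inl k, by simp [Ls], h.2⟩⟩

theorem final_inr {n : ℕ} (hn : 1 ≤ n) {ω : LC d} {a b z : V d} (c : Bool)
    (h : edgeOpen (layer (Sum.inr (z, c)) ω) a b)
    (ha : a ∈ box (3 * n) (sc n z)) (hb : b ∈ box (3 * n) (sc n z)) : edgeOpen (Fin' n ω) a b :=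
  ⟨h.1, final_open.2 ⟨Sum.inr (z, c), by
    have := mem_Nbr hn h.1 ha hb
    unfold Ls
    rw [Finset.inr_mem_disjSum, Finset.mem_product]
    exact ⟨this, Finset.mem_univ _⟩, h.2⟩⟩

/-- region of the exploration -/
def Reg (n : ℕ) (R0 W : Set (V d)) : Set (V d) := R0 ∪ {v | ∃ z ∈ W, v ∈ box (3 * n) (sc n z)}

theorem sc_adj {n : ℕ} {z z' : V d} (h : dist1 z z' = 1) : sc n z ∈ box n (sc n z') := by
  rw [mem_box]; intro i
  have h1 := mem_box.1 (adj_mem_box h) i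
  unfold sc
  rw [show (n : ℤ) * z i - n * z' i = - (n * (z' i - z i)) by ring, abs_neg, abs_mul, Nat.abs_cast]
  have : (0 : ℤ) ≤ n := by positivity
  push_cast at h1
  nlinarith

theorem tgt_mem {n : ℕ} {z z' x y : V d} (h : dist1 z z' = 1) (hx : x ∈ box n (sc n z))
    (hy : y ∈ tgt n z z' x) : y ∈ box n (sc n z') := by
  classical
  unfold tgt at hy
  split_ifs at hy with hne
  swap
  · simp at hy
  set i := hne.choose with hi
  have hi' : z i ≠ z' i := hne.choose_spec
  obtain ⟨hyb, hyi, hyj⟩ := mem_Face.1 hy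
  have hsum : (z i - z' i).natAbs + ∑ j ∈ Finset.univ.erase i, (z j - z' j).natAbs = 1 := by
    rw [Finset.add_sum_erase _ (fun j => (z j - z' j).natAbs) (Finset.mem_univ i)]; exact h
  have hi1 : (z i - z' i).natAbs = 1 := by
    have : (z i - z' i).natAbs ≠ 0 := by rw [Int.natAbs_ne_zero]; omega
    omega
  have hj0 : ∀ j, j ≠ i → z j = z' j := by
    intro j hj
    have : ∑ j ∈ Finset.univ.erase i, (z j - z' j).natAbs = 0 := by omega
    have := Finset.sum_eq_zero_iff.1 this j (Finset.mem_erase.2 ⟨hj, Finset.mem_univ _⟩)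
    omega
  have hn0 : (0 : ℤ) ≤ n := by positivity
  rw [mem_box] at *
  intro j
  have hxj := hx j
  have hyb' := hyb j
  have hyj' := hyj j
  unfold sc at *
  rw [abs_le] at *
  by_cases hj : j = i
  · subst hj
    simp only [if_true] at hyi
    by_cases hlt : z i < z' i
    · simp only [hlt, if_true] at hyi
      have : z' i = z i + 1 := by omega
      rw [this]
      push_cast at hyi
      constructor <;> nlinarith [hxj.1, hxj.2]
    · simp only [hlt, if_false] at hyi
      have : z' i = z i - 1 := by omega
      rw [this]
      push_cast at hyi
      constructor <;> nlinarith [hxj.1, hxj.2]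
  · simp only [hj, if_false] at hyj'
    rw [← hj0 j hj]
    by_cases hle : x j ≤ n * z j
    · simp only [hle, if_true] at hyj'
      push_cast at hyj'
      constructor <;> linarith [hxj.1, hxj.2, hyb'.1, hyb'.2]
    · simp only [hle, if_false] at hyj'
      push_cast at hyj'
      constructor <;> linarith [hxj.1, hxj.2, hyb'.1, hyb'.2]

/-- invariants of the exploration -/
structure GI (m n : ℕ) (W R0 : Set (V d)) (ω : LC d) (s : St d) : Prop where
  inv : Inv m s
  disj : Disjoint (dom s) s.2.2
  ctr : ∀ w ∈ s.2.1, w.2 ∈ box n (sc n w.1)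
  fW : ∀ z ∈ s.2.2, z ∈ W
  conn : ∀ v ∈ s.1, ∃ a ∈ R0, Conn (Fin' n ω) (Reg n R0 W) a v

theorem GI.att {m n : ℕ} (hn : 1 ≤ n) (hmn : m ≤ n) {W R0 : Set (V d)} {ω : LC d} {s : St d}
    (h : GI m n W R0 ω s) {w : V d × V d × V d} (hw : Fr W s w) :
    GI m n W R0 ω (att m n s w ω) := by
  classical
  obtain ⟨hwW, hwd, hwF, hwQ, hwa⟩ := hw
  have hx := h.ctr _ hwQ
  have hbx : box n w.2.2 ⊆ box (3 * n) (sc n w.1) := by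
    refine box_sub (n := 2 * n) ?_ (by omega)
    exact box_sub (sc_adj hwa) (by omega) hx
  have hreg : ∀ v ∈ box (3 * n) (sc n w.1), v ∈ Reg n R0 W := fun v hv => Or.inr ⟨w.1, hwW, hv⟩
  have hnew : ∀ v ∈ newS n w.2.2 s.1 (lab1 w.1) ω, ∃ a ∈ R0, Conn (Fin' n ω) (Reg n R0 W) a v := by
    intro v hv
    obtain ⟨-, a, ha, b0, hb0, hax, ho, hc⟩ := mem_newS.1 hv
    obtain ⟨a0, ha0, hc0⟩ := h.conn a ha
    have hb0' := (Finset.mem_sdiff.1 hb0).1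
    refine ⟨a0, ha0, hc0.trans ((Conn.single (final_inr hn true ho (hbx hax) (hbx hb0'))
      (hreg _ (hbx hax)) (hreg _ (hbx hb0'))).trans ?_)⟩
    refine Conn.mono hc (fun e he ho => ?_) (fun u hu => hreg u (hbx (Finset.mem_coe.1 hu.1)))
    obtain ⟨a, b, hab, rfl⟩ := e.exists_mk
    exact (final_inl 0 ⟨hab, ho⟩).2
  have hold : ∀ v ∈ s.1 ∪ newS n w.2.2 s.1 (lab1 w.1) ω, ∃ a ∈ R0, Conn (Fin' n ω) (Reg n R0 W) a v := by
    intro v hv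
    rcases Finset.mem_union.1 hv with hv | hv
    · exact h.conn v hv
    · exact hnew v hv
  rcases att_cases m n s w ω with ⟨y, hy, h1, h2, h3⟩ | ⟨-, h1, h2, h3⟩
  · have hyb : y ∈ box n (sc n w.1) := tgt_mem hwa hx hy.1
    have hyb3 : box m y ⊆ box (3 * n) (sc n w.1) := box_sub hyb (by omega)
    refine ⟨inv_att h.inv w ω, ?_, ?_, ?_, ?_⟩
    · rw [h3, Finset.disjoint_left]
      intro z hz hzF
      obtain ⟨x', hx'⟩ := mem_dom.1 hz
      rw [h2] at hx'
      rcases Finset.mem_insert.1 hx' with he | hx'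
      · rw [(Prod.mk.inj he).1] at hzF; exact hwF hzF
      · exact Finset.disjoint_left.1 h.disj (mem_dom.2 ⟨x', hx'⟩) hzF
    · intro u hu
      rw [h2] at hu
      rcases Finset.mem_insert.1 hu with rfl | hu
      · exact hyb
      · exact h.ctr u hu
    · rw [h3]; exact h.fW
    · intro v hv
      rw [h1] at hv
      rcases Finset.mem_union.1 hv with hv | hv
      · exact hold v hv
      · obtain ⟨a, ha, hc⟩ := hold y (by
          rcases hy.2.1 with hy | hy
          · exact Finset.mem_union_left _ hy
          · exact Finset.mem_union_right _ hy)
        refine ⟨a, ha, hc.trans ?_⟩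
        refine Conn.mono (seed_conn hy.2.2 (self_mem_box m y) hv) (fun e he ho => ?_) (fun u hu => hreg u (hyb3 hu))
        obtain ⟨a, b, hab, rfl⟩ := e.exists_mk
        have hab2 := mkE_inside.1 he
        exact (final_inr hn false ⟨hab, ho⟩ (hyb3 hab2.1) (hyb3 hab2.2)).2
  · refine ⟨inv_att h.inv w ω, ?_, ?_, ?_, ?_⟩
    · have hde : dom (Perco.att m n s w ω) = dom s := by unfold dom; rw [h2]
      rw [h3, hde, Finset.disjoint_insert_right]
      exact ⟨hwd, h.disj⟩
    · rw [h2]; exact h.ctr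
    · rw [h3]; intro z hz
      rcases Finset.mem_insert.1 hz with rfl | hz
      · exact hwW
      · exact h.fW z hz
    · rw [h1]; exact hold

theorem GI.run {m n : ℕ} (hn : 1 ≤ n) (hmn : m ≤ n) {W R0 : Set (V d)} {ω : LC d} {s : St d}
    (h : GI m n W R0 ω s) (T : ℕ) : GI m n W R0 ω (run m n W T s ω) := by
  induction T generalizing s with
  | zero => exact h
  | succ T ih =>
    show GI m n W R0 ω (Perco.run m n W T (stp m n W s ω) ω)
    rcases stp_cases m n W s with ⟨w, hw, hs⟩ | ⟨-, hs⟩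
    · rw [hs]; exact ih (h.att hn hmn hw)
    · rw [hs]; exact ih h

theorem run_mono (m n : ℕ) (W : Set (V d)) (T : ℕ) (s : St d) (ω : LC d) :
    s.2.1 ⊆ (run m n W T s ω).2.1 := by
  induction T generalizing s with
  | zero => exact subset_rfl
  | succ T ih =>
    refine subset_trans ?_ (ih (stp m n W s ω))
    rcases stp_cases m n W s with ⟨w, hw, hs⟩ | ⟨-, hs⟩
    · rw [hs]; exact (att_mono m n s w ω).2.2.1
    · rw [hs]

theorem run_complete (m n : ℕ) (W : Finset (V d)) (T : ℕ) (s : St d) (ω : LC d) (hT : W.card ≤ T) :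
    ¬ ∃ w, Fr (W : Set (V d)) (run m n W T s ω) w := by
  classical
  suffices h : ∀ T s, (W.filter fun z => z ∉ dom s ∧ z ∉ s.2.2).card ≤ T →
      ¬ ∃ w, Fr (W : Set (V d)) (run m n W T s ω) w from
    h T s ((Finset.card_filter_le _ _).trans hT)
  clear hT T s
  intro T
  induction T with
  | zero =>
    rintro s hs ⟨w, hw⟩
    have := Finset.card_eq_zero.1 (Nat.le_zero.1 hs)
    exact Finset.notMem_empty w.1 (this ▸ Finset.mem_filter.2 ⟨hw.1, hw.2.1, hw.2.2.1⟩)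
  | succ T ih =>
    intro s hs
    show ¬ ∃ w, Fr (W : Set (V d)) (run m n W T (stp m n W s ω) ω) w
    rcases stp_cases m n (W : Set (V d)) s with ⟨w, hw, hstp⟩ | ⟨hno, hstp⟩
    · apply ih
      rw [hstp]
      have hlt : (W.filter fun z => z ∉ dom (att m n s w ω) ∧ z ∉ (att m n s w ω).2.2).card <
          (W.filter fun z => z ∉ dom s ∧ z ∉ s.2.2).card := by
        obtain ⟨-, -, a3, a4, a5⟩ := att_mono m n s w ω
        apply Finset.card_lt_card
        rw [Finset.ssubset_iff_of_subset]
        · refine ⟨w.1, Finset.mem_filter.2 ⟨hw.1, hw.2.1, hw.2.2.1⟩, fun h => ?_⟩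
          have := (Finset.mem_filter.1 h).2
          exact a5.elim this.1 this.2
        · intro z hz
          rw [Finset.mem_filter] at *
          refine ⟨hz.1, fun h => hz.2.1 ?_, fun h => hz.2.2 (a4 h)⟩
          rw [mem_dom] at *
          exact h.imp fun x hx => a3 hx
      omega
    · rw [hstp]
      have : ∀ T, run m n (W : Set (V d)) T s ω = s := by
        intro T
        induction T with
        | zero => rfl
        | succ T ih => show run m n (W : Set (V d)) T (stp m n W s ω) ω = s; rw [hstp]; exact ih
      rw [this]; exact hno

end E2
end Mod12

section Mod13
section Law
variable {d : ℕ}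

theorem card_Ls (n : ℕ) (e : Edge d) (g : Lab d → ℝ) (g0 : ℝ) (hg : ∀ z b, g (Sum.inr (z, b)) = g0) :
    ∏ l ∈ Ls n e, g l = (∏ k : Fin 4, g (Sum.inl k)) * g0 ^ (11 ^ d * 2) := by
  unfold Ls
  rw [Finset.prod_disjSum]
  congr 1
  rw [Finset.prod_congr rfl (fun x _ => hg x.1 x.2), Finset.prod_const, Finset.card_product]
  congr 1
  unfold Nbr
  rw [Pi.card_Icc]
  simp only [Int.card_Icc]
  have : ∀ i : Fin d, (cell n e i + 5 + 1 - (cell n e i - 5)).toNat = 11 := fun i => by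
    rw [show cell n e i + 5 + 1 - (cell n e i - 5) = 11 by ring]; rfl
  simp [this]

theorem meas_Fin' (n : ℕ) : Measurable (Fin' n : LC d → Config d) := by
  classical
  refine measurable_pi_lambda _ fun e => ?_
  have hm : MeasurableSet {ω : LC d | ∃ l, l ∈ Ls n e ∧ ω (e, l) = true} :=
    meas_ex fun l => meas_and (meas_const _) (meas_coord _ _)
  refine measurable_to_bool ?_
  convert hm using 1
  ext ω
  exact final_open

theorem bern_ext (q : unitInterval) (ν : Measure Bool) [IsProbabilityMeasure ν]
    (h : ν.real {false} = 1 - q) : ν = bern q := by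
  have hf : ν {false} = bern q {false} := by
    rw [bern_false, ← h, Measure.real, ENNReal.ofReal_toReal (measure_ne_top _ _)]
  have ht : ν {true} = bern q {true} := by
    have e : ({true} : Set Bool) = {false}ᶜ := by ext b; cases b <;> simp
    rw [e, prob_compl_eq_one_sub (measurableSet_singleton _), hf,
      prob_compl_eq_one_sub (measurableSet_singleton _)]
  refine Measure.ext_of_singleton fun b => ?_
  cases b
  · exact hf
  · exact ht

theorem law_final (n : ℕ) (qq : Lab d → unitInterval) (p : unitInterval) (δ : ℝ)
    (hδ : ∀ z b, (qq (Sum.inr (z, b)) : ℝ) = δ)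
    (h : (∏ k : Fin 4, (1 - (qq (Sum.inl k) : ℝ))) * (1 - δ) ^ (11 ^ d * 2) = 1 - p) :
    (PL qq).map (Fin' n) = Pc d p := by
  classical
  unfold Pc PB
  refine Measure.eq_infinitePi _ fun s t ht => ?_
  rw [Measure.map_apply (meas_Fin' n) (MeasurableSet.pi s.countable_toSet fun i _ => ht i)]
  have hB : ∀ e, MeasurableSet {ω : LC d | Fin' n ω e ∈ t e} := fun e =>
    ((measurable_pi_apply e).comp (meas_Fin' n)) (ht e)
  have h1 := indep_blocks' (fun i : LI d => qq i.2) (fun e => {ω : LC d | Fin' n ω e ∈ t e})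
    (fun e => {i : LI d | i.1 = e}) s (fun e _ => hB e) (fun e _ ω ω' hh hA => by
      have : Fin' n ω e = Fin' n ω' e := by
        have : ∀ l, ω (e, l) = ω' (e, l) := fun l => hh (e, l) rfl
        unfold Fin'; simp only [this]
      show Fin' n ω' e ∈ t e
      rw [← this]; exact hA)
    (fun a _ b _ hab => by
      rw [Set.disjoint_left]; intro i hi hj; exact hab (hi.symm.trans hj))
  have h2 : ∀ e, (PL qq).map (fun ω => Fin' n ω e) = bern p := by
    intro e
    have me : Measurable (fun ω : LC d => Fin' n ω e) := (measurable_pi_apply e).comp (meas_Fin' n)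
    have : IsProbabilityMeasure ((PL qq).map (fun ω => Fin' n ω e)) :=
      Measure.isProbabilityMeasure_map me.aemeasurable
    refine bern_ext p _ ?_
    rw [Measure.real, Measure.map_apply me (measurableSet_singleton _)]
    have e1 : (fun ω : LC d => Fin' n ω e) ⁻¹' {false} =
        {ω | ∀ i ∈ (Ls n e).image (fun l => (e, l)), ω i = false} := by
      ext ω
      have := final_open (n := n) (ω := ω) (e := e)
      simp only [Set.mem_preimage, Set.mem_singleton_iff, Finset.mem_image, Set.mem_setOf_eq]
      rw [← Bool.not_eq_true, this]
      constructor
      · rintro h i ⟨l, hl, rfl⟩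
        by_contra hc
        exact h ⟨l, hl, by simpa using hc⟩
      · rintro h ⟨l, hl, h2⟩
        have := h _ ⟨l, hl, rfl⟩
        rw [this] at h2; cases h2
    rw [e1]
    have := PB_allfalse (fun i : LI d => qq i.2) ((Ls n e).image (fun l => (e, l)))
    show (PB fun i : LI d => qq i.2).real _ = _
    rw [this, Finset.prod_image (fun a _ b _ hab => (Prod.mk.inj hab).2)]
    rw [card_Ls n e (fun l => 1 - (qq l : ℝ)) (1 - δ) (fun z b => by rw [hδ])]
    exact h
  have h3 : ∀ e, (PB fun i : LI d => qq i.2).real {ω : LC d | Fin' n ω e ∈ t e} = (bern p).real (t e) := by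
    intro e
    rw [← h2 e, Measure.real, Measure.real, Measure.map_apply _ (ht e)]
    · rfl
    · exact (measurable_pi_apply e).comp (meas_Fin' n)
  have e2 : Fin' n ⁻¹' (Set.pi ↑s t) = ⋂ e ∈ s, {ω : LC d | Fin' n ω e ∈ t e} := by
    ext ω; simp [Set.mem_pi]
  rw [e2, ← ENNReal.toReal_eq_toReal_iff' (measure_ne_top _ _) (ENNReal.prod_ne_top fun _ _ => measure_ne_top _ _),
    ENNReal.toReal_prod]
  exact h1.trans (Finset.prod_congr rfl fun e _ => h3 e)

/-- existence of the layered parameters -/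
theorem exists_params (d : ℕ) (p' p : unitInterval) (h : p' < p) : ∃ δ : ℝ, 0 < δ ∧ δ < 1 ∧
    ∃ qq : Lab d → unitInterval, qq Lab.base = p' ∧ (qq Lab.start : ℝ) = δ ∧ (qq Lab.extra : ℝ) = δ ∧
      (∀ z b, (qq (Sum.inr (z, b)) : ℝ) = δ) ∧ ∀ n, (PL qq).map (Fin' n) = Pc d p := by
  set K : ℕ := 2 + 11 ^ d * 2 with hK
  have h' : (p' : ℝ) < p := h
  have hp0 := p'.2.1
  have hp1 := p.2.2
  have hK1 : (2 : ℝ) ≤ K := by rw [hK]; push_cast; linarith [show (0:ℝ) ≤ 11 ^ d * 2 by positivity]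
  set δ : ℝ := (p - p') / (K + 1) with hδ
  have hδ0 : 0 < δ := by rw [hδ]; apply div_pos <;> linarith
  have hKδ : K * δ + δ = p - p' := by rw [hδ]; field_simp
  have hδ1 : δ < 1 := by nlinarith
  have hpow : 1 - K * δ ≤ (1 - δ) ^ K := by
    have := one_add_mul_le_pow (a := -δ) (by linarith) K
    rw [show (1 : ℝ) + -δ = 1 - δ by ring] at this
    linarith
  set A : ℝ := (1 - p') * (1 - δ) ^ K with hA
  have hA1 : 1 - p ≤ A := by
    have : (1 - (p' : ℝ)) * (1 - K * δ) ≤ A := mul_le_mul_of_nonneg_left hpow (by linarith)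
    nlinarith [mul_nonneg hp0 (mul_nonneg (by linarith : (0:ℝ) ≤ K) hδ0.le)]
  have hA0 : 0 < A := mul_pos (by linarith) (pow_pos (by linarith) _)
  let qf : unitInterval := ⟨1 - (1 - p) / A, by
    rw [Set.mem_Icc]
    have : (1 - (p : ℝ)) / A ≤ 1 := (div_le_one hA0).2 hA1
    have : 0 ≤ (1 - (p : ℝ)) / A := div_nonneg (by linarith) hA0.le
    constructor <;> linarith⟩
  let dl : unitInterval := ⟨δ, hδ0.le, hδ1.le⟩
  refine ⟨δ, hδ0, hδ1, Sum.elim ![p', qf, dl, dl] (fun _ => dl), rfl, rfl, rfl, fun _ _ => rfl, fun n => ?_⟩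
  refine law_final n _ p δ (fun _ _ => rfl) ?_
  rw [Fin.prod_univ_four]
  show (1 - (p' : ℝ)) * (1 - (1 - (1 - p) / A)) * (1 - δ) * (1 - δ) * (1 - δ) ^ (11 ^ d * 2) = 1 - p
  have : (1 - (p' : ℝ)) * (1 - (1 - (1 - p) / A)) * (1 - δ) * (1 - δ) * (1 - δ) ^ (11 ^ d * 2)
     = (1 - p) / A * A := by rw [hA, hK, pow_add]; ring
  rw [this, div_mul_cancel₀ _ hA0.ne']

end Law
end Mod13

section Mod14
section Hier
variable {d : ℕ}

/-- block index at scale `L` -/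
def bx (L : ℕ) (z : V d) : V d := fun i => z i / L

theorem bx_bx (ℓ k : ℕ) (z : V d) : bx ℓ (bx (ℓ ^ k) z) = bx (ℓ ^ (k + 1)) z := by
  funext i
  unfold bx
  rw [Int.ediv_ediv_of_nonneg (by positivity), pow_succ]
  push_cast; rfl

theorem bx_eq_iff {ℓ : ℕ} (hℓ : 1 ≤ ℓ) {z b : V d} :
    bx ℓ z = b ↔ ∀ i, ℓ * b i ≤ z i ∧ z i < ℓ * b i + ℓ := by
  have h0 : (0 : ℤ) < ℓ := by exact_mod_cast hℓ
  constructor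
  · rintro rfl i
    unfold bx
    have h1 := Int.mul_ediv_add_emod (z i) ℓ
    have h2 := Int.emod_nonneg (z i) h0.ne'
    have h3 := Int.emod_lt_of_pos (z i) h0
    constructor <;> linarith
  · intro h
    funext i
    unfold bx
    have := h i
    apply le_antisymm
    · apply Int.le_of_lt_add_one; rw [Int.ediv_lt_iff_lt_mul h0]; linarith [this.2]
    · rw [Int.le_ediv_iff_mul_le h0]; linarith [this.1]

/-- hierarchically bad boxes -/
def Bad (ℓ : ℕ) (F : Set (V d)) : ℕ → V d → Prop
  | 0, z => z ∈ F
  | k + 1, b => ∃ b1 b2, bx ℓ b1 = b ∧ bx ℓ b2 = b ∧ Bad ℓ F k b1 ∧ Bad ℓ F k b2 ∧ ∃ i, 2 ≤ b1 i - b2 i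

/-- one dimensional hull of the bad boxes -/
def Hi (ℓ : ℕ) (F : Set (V d)) (k : ℕ) (b : V d) (i : Fin d) (t : ℤ) : Prop :=
  (∃ b', bx ℓ b' = b ∧ Bad ℓ F k b' ∧ b' i ≤ t) ∧ ∃ b', bx ℓ b' = b ∧ Bad ℓ F k b' ∧ t ≤ b' i

/-- hull of the bad boxes -/
def InH (ℓ : ℕ) (F : Set (V d)) (k : ℕ) (c : V d) : Prop := ∀ i, Hi ℓ F k (bx ℓ c) i (c i)

/-- hierarchically good sites -/
def inG (ℓ : ℕ) (F : Set (V d)) : ℕ → V d → Prop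
  | 0, z => z ∉ F
  | k + 1, z => inG ℓ F k z ∧ ¬ InH ℓ F k (bx (ℓ ^ k) z)

theorem Hi_width {ℓ : ℕ} {F : Set (V d)} {k : ℕ} {b : V d} (h : ¬ Bad ℓ F (k + 1) b) {i : Fin d} {t t' : ℤ}
    (h1 : Hi ℓ F k b i t) (h2 : Hi ℓ F k b i t') : t' - t ≤ 1 := by
  by_contra hc
  obtain ⟨⟨b1, e1, B1, l1⟩, -⟩ := h1
  obtain ⟨-, b2, e2, B2, l2⟩ := h2
  exact h ⟨b2, b1, e2, e1, B2, B1, i, by omega⟩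

theorem Bad.inH {ℓ : ℕ} {F : Set (V d)} {k : ℕ} {c : V d} (h : Bad ℓ F k c) : InH ℓ F k c :=
  fun i => ⟨⟨c, rfl, h, le_rfl⟩, ⟨c, rfl, h, le_rfl⟩⟩

theorem avoid {ℓ : ℕ} {F : Set (V d)} {k : ℕ} {b b' : V d} (h : ¬ Bad ℓ F (k + 1) b)
    (h' : ¬ Bad ℓ F (k + 1) b') (i : Fin d) (c : ℤ) :
    ∃ v, c ≤ v ∧ v ≤ c + 4 ∧ ¬ Hi ℓ F k b i v ∧ ¬ Hi ℓ F k b' i v := by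
  by_contra hc
  push Not at hc
  have key : ∀ v, c ≤ v → v ≤ c + 4 → Hi ℓ F k b i v ∨ Hi ℓ F k b' i v := by
    intro v h1 h2
    by_contra hn
    push Not at hn
    exact hn.2 (hc v h1 h2 hn.1)
  have w1 : ∀ {t t'}, Hi ℓ F k b i t → Hi ℓ F k b i t' → t' - t ≤ 1 := Hi_width h
  have w2 : ∀ {t t'}, Hi ℓ F k b' i t → Hi ℓ F k b' i t' → t' - t ≤ 1 := Hi_width h'
  rcases key c (by omega) (by omega) with a1 | a1 <;> rcases key (c+2) (by omega) (by omega) with a2 | a2 <;>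
    rcases key (c+4) (by omega) (by omega) with a3 | a3
  all_goals first
    | (have := w1 a1 a2; omega) | (have := w1 a1 a3; omega) | (have := w1 a2 a3; omega)
    | (have := w2 a1 a2; omega) | (have := w2 a1 a3; omega) | (have := w2 a2 a3; omega)

theorem good_nonempty (hd : 2 ≤ d) {ℓ : ℕ} (hℓ : 5 ≤ ℓ) {F : Set (V d)} (k : ℕ) (c : V d)
    (h : ¬ Bad ℓ F k c) : ∃ z, inG ℓ F k z ∧ bx (ℓ ^ k) z = c := by
  induction k generalizing c with
  | zero => exact ⟨c, h, by funext i; simp [bx]⟩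
  | succ k ih =>
    let i : Fin d := ⟨0, by omega⟩
    obtain ⟨v, v1, v2, v3, -⟩ := avoid h h i (ℓ * c i)
    let c' : V d := fun j => if j = i then v else ℓ * c j
    have hc' : bx ℓ c' = c := by
      rw [bx_eq_iff (by omega)]
      intro j
      show _ ≤ (if j = i then v else _) ∧ (if j = i then v else _) < _
      split_ifs with hj
      · subst hj; constructor <;> omega
      · constructor <;> omega
    have hH : ¬ InH ℓ F k c' := by
      intro hh
      have := hh i
      rw [hc'] at this
      have e : c' i = v := if_pos rfl
      rw [e] at this; exact v3 this
    obtain ⟨z, hz, hzc⟩ := ih c' (fun hb => hH hb.inH)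
    exact ⟨z, ⟨hz, hzc ▸ hH⟩, by rw [← bx_bx, hzc, hc']⟩

theorem slab_closed {ℓ : ℕ} (hℓ : 5 ≤ ℓ) {F : Set (V d)} {k : ℕ} {b : V d} {P : V d → Prop}
    (hP : ∀ c c', bx ℓ c = b → bx ℓ c' = b → ¬ InH ℓ F k c → ¬ InH ℓ F k c' → dist1 c c' = 1 → P c → P c')
    {i : Fin d} {v : ℤ} (hv : ¬ Hi ℓ F k b i v) {c : V d} (hc : bx ℓ c = b) (hcv : c i = v) (hPc : P c)
    {c' : V d} (hc' : bx ℓ c' = b) (hcv' : c' i = v) : P c' := by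
  have hN : ∀ a : V d, bx ℓ a = b → a i = v → ¬ InH ℓ F k a := by
    intro a ha hav hh
    have := hh i
    rw [ha, hav] at this
    exact hv this
  induction hk : dist1 c c' using Nat.strong_induction_on generalizing c' with
  | _ n ih =>
    by_cases hcc : c = c'
    · exact hcc ▸ hPc
    · obtain ⟨y, h1, h2, h3⟩ := exists_closer hcc
      have hy : bx ℓ y = b := by
        rw [bx_eq_iff (by omega)] at *
        intro j
        have a1 := hc j
        have a2 := hc' j
        rcases h3 j with h | h <;> constructor <;> omega
      have hyv : y i = v := by rcases h3 i with h | h <;> omega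
      exact hP y c' hy hc' (hN y hy hyv) (hN c' hc' hcv') (dist1_comm c' y ▸ h1) (ih _ (hk ▸ h2) hy hyv rfl)

theorem bx_update {ℓ : ℕ} (hℓ : 5 ≤ ℓ) {c b : V d} (hc : bx ℓ c = b) (j : Fin d) {v : ℤ}
    (h1 : ℓ * b j ≤ v) (h2 : v < ℓ * b j + ℓ) : bx ℓ (Function.update c j v) = b := by
  rw [bx_eq_iff (by omega)] at *
  intro t
  by_cases ht : t = j
  · subst ht; rw [Function.update_self]; exact ⟨h1, h2⟩
  · rw [Function.update_of_ne ht]; exact hc t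

theorem exists_ne_fin (hd : 2 ≤ d) (i : Fin d) : ∃ j : Fin d, j ≠ i := by
  by_cases h : i.1 = 0
  · exact ⟨⟨1, by omega⟩, fun e => by rw [← e] at h; simp at h⟩
  · exact ⟨⟨0, by omega⟩, fun e => h (by rw [← e])⟩

theorem grid_closed (hd : 2 ≤ d) {ℓ : ℕ} (hℓ : 5 ≤ ℓ) {F : Set (V d)} {k : ℕ} {b : V d}
    (hb : ¬ Bad ℓ F (k + 1) b) {P : V d → Prop}
    (hP : ∀ c c', bx ℓ c = b → bx ℓ c' = b → ¬ InH ℓ F k c → ¬ InH ℓ F k c' → dist1 c c' = 1 → P c → P c')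
    {c : V d} (hc : bx ℓ c = b) (hcH : ¬ InH ℓ F k c) (hPc : P c)
    {c' : V d} (hc' : bx ℓ c' = b) (hcH' : ¬ InH ℓ F k c') : P c' := by
  unfold InH at hcH hcH'
  push Not at hcH hcH'
  obtain ⟨i, hi⟩ := hcH
  obtain ⟨j, hj⟩ := hcH'
  rw [hc] at hi
  rw [hc'] at hj
  have r := (bx_eq_iff (by omega)).1 hc
  have r' := (bx_eq_iff (by omega)).1 hc'
  by_cases hij : i = j
  · subst hij
    obtain ⟨j, hji⟩ := exists_ne_fin hd i
    obtain ⟨v, v1, v2, v3, -⟩ := avoid hb hb j (ℓ * b j)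
    have u1 := bx_update hℓ hc j v1 (by omega)
    have u2 := bx_update hℓ hc' j v1 (by omega)
    have p1 : P (Function.update c j v) :=
      slab_closed hℓ hP hi hc rfl hPc u1 (Function.update_of_ne hji.symm _ _)
    have p2 : P (Function.update c' j v) :=
      slab_closed hℓ hP v3 u1 (Function.update_self ..) p1 u2 (Function.update_self ..)
    exact slab_closed hℓ hP hj u2 (Function.update_of_ne hji.symm _ _) p2 hc' rfl
  · have u1 := bx_update hℓ hc j (r' j).1 (r' j).2
    have p1 : P (Function.update c j (c' j)) :=
      slab_closed hℓ hP hi hc rfl hPc u1 (Function.update_of_ne hij _ _)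
    exact slab_closed hℓ hP hj u1 (Function.update_self ..) p1 hc' rfl

theorem adj_ex {a b : V d} (h : dist1 a b = 1) :
    ∃ i, (b i = a i + 1 ∨ b i = a i - 1) ∧ ∀ j, j ≠ i → b j = a j := by
  have hne : ∃ i, a i ≠ b i := by
    by_contra hc
    push Not at hc
    have : a = b := funext hc
    rw [this, dist1_self] at h; omega
  obtain ⟨i, hi⟩ := hne
  have hsum : (a i - b i).natAbs + ∑ j ∈ Finset.univ.erase i, (a j - b j).natAbs = 1 := by
    rw [Finset.add_sum_erase _ (fun j => (a j - b j).natAbs) (Finset.mem_univ i)]; exact h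
  refine ⟨i, by omega, fun j hj => ?_⟩
  have : ∑ j ∈ Finset.univ.erase i, (a j - b j).natAbs = 0 := by omega
  have := Finset.sum_eq_zero_iff.1 this j (Finset.mem_erase.2 ⟨hj, Finset.mem_univ _⟩)
  omega

/-- closed sets contain the good sites of adjacent good boxes -/
theorem hier_C (hd : 2 ≤ d) {ℓ : ℕ} (hℓ : 5 ≤ ℓ) {F Q W : Set (V d)}
    (hQ : ∀ z ∈ Q, ∀ z' ∈ W, dist1 z z' = 1 → z' ∉ F → z' ∈ Q) (k : ℕ) (w w' : V d)
    (hww : w = w' ∨ dist1 w w' = 1) (hw : ¬ Bad ℓ F k w) (hw' : ¬ Bad ℓ F k w')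
    (hW : ∀ z, bx (ℓ ^ k) z = w → z ∈ W) (hW' : ∀ z, bx (ℓ ^ k) z = w' → z ∈ W)
    (hz : ∃ z ∈ Q, inG ℓ F k z ∧ bx (ℓ ^ k) z = w) :
    ∀ z, inG ℓ F k z → bx (ℓ ^ k) z = w' → z ∈ Q := by
  induction k generalizing w w' with
  | zero =>
    have e : ∀ z : V d, bx (ℓ ^ 0) z = z := fun z => by funext i; simp [bx]
    intro z hzG hzw
    rw [e] at hzw
    obtain ⟨y, hyQ, hyG, hyw⟩ := hz
    rw [e] at hyw
    subst hzw hyw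
    rcases hww with rfl | h
    · exact hyQ
    · exact hQ y hyQ z (hW' z (e z)) h hzG
  | succ k ih =>
    set P : V d → Prop := fun c => ∀ z, inG ℓ F k z → bx (ℓ ^ k) z = c → z ∈ Q with hPd
    have hstep : ∀ c c', (bx ℓ c = w ∨ bx ℓ c = w') → (bx ℓ c' = w ∨ bx ℓ c' = w') → ¬ InH ℓ F k c →
        ¬ InH ℓ F k c' → dist1 c c' = 1 → P c → P c' := by
      intro c c' h1 h2 h3 h4 h5 h6
      obtain ⟨z, hzG, hzc⟩ := good_nonempty hd hℓ k c (fun hb => h3 hb.inH)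
      refine ih c c' (Or.inr h5) (fun hb => h3 hb.inH) (fun hb => h4 hb.inH) ?_ ?_ ⟨z, h6 z hzG hzc, hzG, hzc⟩
      · intro y hy
        rcases h1 with h | h
        · exact hW y (by rw [← bx_bx, hy, h])
        · exact hW' y (by rw [← bx_bx, hy, h])
      · intro y hy
        rcases h2 with h | h
        · exact hW y (by rw [← bx_bx, hy, h])
        · exact hW' y (by rw [← bx_bx, hy, h])
    obtain ⟨y, hyQ, ⟨hyG, hyH⟩, hyw⟩ := hz
    rw [← bx_bx] at hyw
    have hPy : P (bx (ℓ ^ k) y) := by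
      refine ih _ _ (Or.inl rfl) (fun hb => hyH hb.inH) (fun hb => hyH hb.inH) ?_ ?_ ⟨y, hyQ, hyG, rfl⟩
      · intro x hx; exact hW x (by rw [← bx_bx, hx, hyw])
      · intro x hx; exact hW x (by rw [← bx_bx, hx, hyw])
    have hPw : ∀ c, bx ℓ c = w → ¬ InH ℓ F k c → P c := fun c hc hcH =>
      grid_closed hd hℓ hw (fun a a' ha ha' => hstep a a' (Or.inl ha) (Or.inl ha')) hyw hyH hPy hc hcH
    have hPw' : ∀ c, bx ℓ c = w' → ¬ InH ℓ F k c → P c := by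
      rcases hww with rfl | hadj
      · exact hPw
      · obtain ⟨i, hi, hoth⟩ := adj_ex hadj
        obtain ⟨j, hji⟩ := exists_ne_fin hd i
        obtain ⟨v, v1, v2, v3, v4⟩ := avoid hw hw' j (ℓ * w j)
        have hwj := hoth j hji
        let c : V d := fun t => if t = i then (if w' i = w i + 1 then ℓ * w i + ℓ - 1 else ℓ * w i) else
          if t = j then v else ℓ * w t
        have ci : c i = if w' i = w i + 1 then ℓ * w i + ℓ - 1 else ℓ * w i := if_pos rfl
        have cj : c j = v := by show (if j = i then _ else if j = j then v else _) = v; rw [if_neg hji, if_pos rfl]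
        have ct : ∀ t, t ≠ i → t ≠ j → c t = ℓ * w t := by
          intro t h1 h2
          show (if t = i then _ else if t = j then v else _) = _; rw [if_neg h1, if_neg h2]
        let c' : V d := Function.update c i (if w' i = w i + 1 then c i + 1 else c i - 1)
        have hcb : bx ℓ c = w := by
          rw [bx_eq_iff (by omega)]
          intro t
          by_cases h1 : t = i
          · subst h1; rw [ci]; split_ifs <;> constructor <;> omega
          · by_cases h2 : t = j
            · subst h2; rw [cj]; constructor <;> omega
            · rw [ct t h1 h2]; constructor <;> omega
        have hcb' : bx ℓ c' = w' := by
          rw [bx_eq_iff (by omega)]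
          intro t
          by_cases h1 : t = i
          · subst h1
            show _ ≤ Function.update c t _ t ∧ Function.update c t _ t < _
            rw [Function.update_self, ci]
            split_ifs with h
            · rw [h]; constructor <;> nlinarith
            · have h' : w' t = w t - 1 := by omega
              rw [h']; constructor <;> nlinarith
          · show _ ≤ Function.update c i _ t ∧ Function.update c i _ t < _
            rw [Function.update_of_ne h1, hoth t h1]
            exact (bx_eq_iff (by omega)).1 hcb t
        have hcc : dist1 c c' = 1 := dist1_update c i _ (by split_ifs <;> simp)
        have hcH : ¬ InH ℓ F k c := by
          intro hh; have := hh j; rw [hcb, cj] at this; exact v3 this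
        have hcH' : ¬ InH ℓ F k c' := by
          intro hh; have := hh j
          rw [hcb', show c' j = v from (Function.update_of_ne hji _ _).trans cj] at this; exact v4 this
        have hPc' := hstep c c' (Or.inl hcb) (Or.inr hcb') hcH hcH' hcc (hPw c hcb hcH)
        exact fun a ha haH =>
          grid_closed hd hℓ hw' (fun a a' ha ha' => hstep a a' (Or.inr ha) (Or.inr ha')) hcb' hcH' hPc' ha haH
    rintro z ⟨hzG, hzH⟩ hzw
    exact hPw' (bx (ℓ ^ k) z) (by rw [bx_bx, hzw]) hzH z hzG rfl

end Hier
end Mod14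

section Mod15
section Hier2
variable {d : ℕ}

theorem crossing (g : ℕ → ℤ) (s t : ℕ) (hst : s ≤ t) (hg : ∀ j, s ≤ j → j < t → |g (j + 1) - g j| ≤ 1)
    (lo hi : ℤ) (hl : lo ≤ hi) (h1 : g s ≤ lo) (h2 : hi ≤ g t) :
    ∃ s1 t1, s ≤ s1 ∧ s1 ≤ t1 ∧ t1 ≤ t ∧ g s1 = lo ∧ g t1 = hi ∧ ∀ j, s1 ≤ j → j ≤ t1 → lo ≤ g j ∧ g j ≤ hi := by
  classical
  have hex : ∃ L, ∃ s1, s ≤ s1 ∧ s1 + L ≤ t ∧ g s1 ≤ lo ∧ hi ≤ g (s1 + L) :=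
    ⟨t - s, s, le_rfl, by omega, h1, by rw [show s + (t - s) = t by omega]; exact h2⟩
  obtain ⟨s1, a1, a2, a3, a4⟩ := Nat.find_spec hex
  set L := Nat.find hex with hL
  have hmin : ∀ L' < L, ¬ ∃ s1, s ≤ s1 ∧ s1 + L' ≤ t ∧ g s1 ≤ lo ∧ hi ≤ g (s1 + L') :=
    fun L' h => Nat.find_min hex h
  have b1 : g s1 = lo := by
    by_contra hne
    have hlt : g s1 < lo := lt_of_le_of_ne a3 hne
    have hL0 : L ≠ 0 := by intro h0; rw [h0, Nat.add_zero] at a4; omega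
    have := abs_le.1 (hg s1 a1 (by omega))
    exact hmin (L - 1) (by omega) ⟨s1 + 1, by omega, by omega, by omega,
      by rw [show s1 + 1 + (L - 1) = s1 + L by omega]; exact a4⟩
  have b2 : g (s1 + L) = hi := by
    by_contra hne
    have hlt : hi < g (s1 + L) := lt_of_le_of_ne a4 (Ne.symm hne)
    have hL0 : L ≠ 0 := by intro h0; rw [h0, Nat.add_zero] at hlt; omega
    have := abs_le.1 (hg (s1 + (L - 1)) (by omega) (by omega))
    rw [show s1 + (L - 1) + 1 = s1 + L by omega] at this
    exact hmin (L - 1) (by omega) ⟨s1, by omega, by omega, by omega, by omega⟩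
  refine ⟨s1, s1 + L, a1, by omega, a2, b1, b2, fun j h h' => ?_⟩
  constructor
  · by_contra hc
    have hne : j ≠ s1 := by rintro rfl; omega
    exact hmin (s1 + L - j) (by omega) ⟨j, by omega, by omega, by omega,
      by rw [show j + (s1 + L - j) = s1 + L by omega]; omega⟩
  · by_contra hc
    have hne : j ≠ s1 + L := by rintro rfl; omega
    exact hmin (j - s1) (by omega) ⟨s1, by omega, by omega, by omega,
      by rw [show s1 + (j - s1) = j by omega]; omega⟩

theorem crossing' (g : ℕ → ℤ) (s t : ℕ) (hst : s ≤ t) (hg : ∀ j, s ≤ j → j < t → |g (j + 1) - g j| ≤ 1)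
    (lo hi : ℤ) (hl : lo ≤ hi) (h : (g s ≤ lo ∧ hi ≤ g t) ∨ (g t ≤ lo ∧ hi ≤ g s)) :
    ∃ s1 t1, s ≤ s1 ∧ s1 ≤ t1 ∧ t1 ≤ t ∧ hi - lo ≤ |g t1 - g s1| ∧
      ∀ j, s1 ≤ j → j ≤ t1 → lo ≤ g j ∧ g j ≤ hi := by
  rcases h with ⟨h1, h2⟩ | ⟨h1, h2⟩
  · obtain ⟨s1, t1, a, b, c, e1, e2, h⟩ := crossing g s t hst hg lo hi hl h1 h2
    exact ⟨s1, t1, a, b, c, by rw [e1, e2]; exact le_abs_self _, h⟩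
  · obtain ⟨s1, t1, a, b, c, e1, e2, h⟩ := crossing (fun j => - g j) s t hst
      (fun j x y => by rw [show -g (j+1) - -g j = -(g (j+1) - g j) by ring, abs_neg]; exact hg j x y)
      (-hi) (-lo) (by omega) (by omega) (by omega)
    refine ⟨s1, t1, a, b, c, ?_, fun j x y => by have := h j x y; omega⟩
    have e1' : g s1 = hi := by have : - g s1 = -hi := e1; omega
    have e2' : g t1 = lo := by have : - g t1 = -lo := e2; omega
    rw [e1', e2', abs_sub_comm]; exact le_abs_self _

/-- spread needed at each level -/
def Dk (C ℓ : ℕ) : ℕ → ℕ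
  | 0 => 0
  | k + 1 => C * ℓ ^ k

theorem Dk_le {C ℓ : ℕ} (hℓ : C + 1 ≤ ℓ) (k : ℕ) : (Dk C ℓ k : ℤ) ≤ ((ℓ ^ k : ℕ) : ℤ) - 1 := by
  have : Dk C ℓ k + 1 ≤ ℓ ^ k := by
    rcases k with _ | k
    · simp [Dk]
    · have h1 : 0 < ℓ ^ k := Nat.pow_pos (by omega)
      calc Dk C ℓ (k + 1) + 1 ≤ C * ℓ ^ k + ℓ ^ k := by show C * ℓ ^ k + 1 ≤ _; omega
        _ = (C + 1) * ℓ ^ k := by ring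
        _ ≤ ℓ * ℓ ^ k := Nat.mul_le_mul_right _ hℓ
        _ = ℓ ^ (k + 1) := by ring
  omega

theorem card_le_two {T : Finset ℤ} (h : ∀ a ∈ T, ∀ b ∈ T, b - a ≤ 1) : T.card ≤ 2 := by
  rcases T.eq_empty_or_nonempty with rfl | hne
  · simp
  · have : T ⊆ Finset.Icc (T.min' hne) (T.min' hne + 1) := by
      intro a ha
      rw [Finset.mem_Icc]
      exact ⟨T.min'_le a ha, by have := h _ (T.min'_mem hne) a ha; omega⟩
    refine (Finset.card_le_card this).trans ?_
    rw [Int.card_Icc]; omega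

theorem step_coord {x y : V d} (h : dist1 x y ≤ 1) (i : Fin d) : |y i - x i| ≤ 1 := by
  have := coord_le_dist1 x y i
  rw [abs_le]; omega

set_option maxHeartbeats 1000000 in
theorem hier_P (hd : 1 ≤ d) {C ℓ : ℕ} (hC : C = 2 * 3 ^ d + 4) (hℓ : C + 1 ≤ ℓ) {F : Set (V d)} (k : ℕ)
    (f : ℕ → V d) (s t : ℕ) (hst : s ≤ t) (hf : ∀ j, s ≤ j → j < t → dist1 (f j) (f (j + 1)) ≤ 1)
    (hg : ∀ j, s ≤ j → j ≤ t → ¬ Bad ℓ F k (bx (ℓ ^ k) (f j)))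
    (hD : ∃ i, (Dk C ℓ k : ℤ) ≤ |f t i - f s i|) :
    ∃ Z : Finset (V d), 2 ^ k ≤ Z.card ∧ ∀ z ∈ Z, inG ℓ F k z ∧ ∃ j, s ≤ j ∧ j ≤ t ∧ f j = z := by
  classical
  induction k generalizing s t with
  | zero =>
    refine ⟨{f s}, by simp, fun z hz => ?_⟩
    rw [Finset.mem_singleton] at hz
    subst hz
    have := hg s le_rfl hst
    rw [show bx (ℓ ^ 0) (f s) = f s by funext i; simp [bx]] at this
    exact ⟨this, s, le_rfl, hst, rfl⟩
  | succ k ih =>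
    have hLpos : (0 : ℤ) < ((ℓ ^ k : ℕ) : ℤ) := by have : 0 < ℓ ^ k := Nat.pow_pos (by omega); exact_mod_cast this
    set L : ℤ := ((ℓ ^ k : ℕ) : ℤ) with hL
    have hDk : (Dk C ℓ (k + 1) : ℤ) = C * L := by rw [hL]; simp [Dk]
    rw [hDk] at hD
    have hex : ∃ t', s ≤ t' ∧ t' ≤ t ∧ ∃ i, C * L ≤ |f t' i - f s i| := ⟨t, hst, le_rfl, hD⟩
    obtain ⟨c1, c2, i, hi⟩ := Nat.find_spec hex
    set t' := Nat.find hex with ht'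
    have hmin : ∀ j, s ≤ j → j < t' → ∀ i', |f j i' - f s i'| < C * L := by
      intro j h1 h2 i'
      by_contra hc
      exact Nat.find_min hex h2 ⟨h1, by omega, i', not_lt.1 hc⟩
    have hle : ∀ j, s ≤ j → j ≤ t' → ∀ i', |f j i' - f s i'| ≤ C * L := by
      intro j h1 h2 i'
      rcases Nat.lt_or_ge j t' with h | h
      · exact (hmin j h1 h i').le
      · obtain rfl : j = t' := le_antisymm h2 h
        rcases Nat.eq_or_lt_of_le h1 with h0 | h0
        · rw [← h0]; simp; positivity
        · have a1 := hmin (t' - 1) (by omega) (by omega) i'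
          have a2 := step_coord (hf (t' - 1) (by omega) (by omega)) i'
          rw [show t' - 1 + 1 = t' by omega] at a2
          rw [abs_lt] at a1
          rw [abs_le] at *
          constructor <;> omega
    set B : Finset (V d) := Finset.Icc (fun j => bx (ℓ ^ (k + 1)) (f s) j - 1) (fun j => bx (ℓ ^ (k + 1)) (f s) j + 1)
      with hB
    have hBcard : B.card = 3 ^ d := by
      rw [hB, Pi.card_Icc]
      simp only [Int.card_Icc]
      have : ∀ j : Fin d, (bx (ℓ ^ (k + 1)) (f s) j + 1 + 1 - (bx (ℓ ^ (k + 1)) (f s) j - 1)).toNat = 3 := fun j => by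
        rw [show bx (ℓ ^ (k + 1)) (f s) j + 1 + 1 - (bx (ℓ ^ (k + 1)) (f s) j - 1) = 3 by ring]; rfl
      simp [this]
    have hCL : C * L ≤ ((ℓ ^ (k + 1) : ℕ) : ℤ) := by
      rw [pow_succ]; push_cast; rw [hL]; push_cast
      have : (C : ℤ) ≤ ℓ := by exact_mod_cast (by omega : C ≤ ℓ)
      rw [mul_comm]
      exact mul_le_mul_of_nonneg_left this (by positivity)
    have hbB : ∀ j, s ≤ j → j ≤ t' → bx (ℓ ^ (k + 1)) (f j) ∈ B := by
      intro j h1 h2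
      have hp : (0 : ℤ) < ((ℓ ^ (k + 1) : ℕ) : ℤ) := by
        have : 0 < ℓ ^ (k + 1) := Nat.pow_pos (by omega)
        exact_mod_cast this
      have hq := (bx_eq_iff (ℓ := ℓ ^ (k + 1)) (z := f s) (Nat.pow_pos (by omega))).1 rfl
      have key : ∀ i', bx (ℓ ^ (k + 1)) (f s) i' - 1 ≤ bx (ℓ ^ (k + 1)) (f j) i' ∧
          bx (ℓ ^ (k + 1)) (f j) i' ≤ bx (ℓ ^ (k + 1)) (f s) i' + 1 := by
        intro i'
        have h3 := abs_le.1 (hle j h1 h2 i')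
        have h4 := hq i'
        set q := bx (ℓ ^ (k + 1)) (f s) i' with hqd
        unfold bx
        constructor
        · rw [Int.le_ediv_iff_mul_le hp]; nlinarith
        · apply Int.le_of_lt_add_one; rw [Int.ediv_lt_iff_lt_mul hp]; nlinarith
      rw [hB, Finset.mem_Icc]
      exact ⟨fun i' => (key i').1, fun i' => (key i').2⟩
    set q : ℤ := f s i / L with hq
    have hq1 : L * q ≤ f s i ∧ f s i < L * q + L := by
      have h1 := Int.mul_ediv_add_emod (f s i) L
      have h2 := Int.emod_nonneg (f s i) hLpos.ne'
      have h3 := Int.emod_lt_of_pos (f s i) hLpos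
      constructor <;> linarith
    set TT : V d → Finset ℤ := fun b => (Finset.Icc (q - C) (q + C)).filter fun t => Hi ℓ F k b i t with hTT
    set T : Finset ℤ := (B.filter fun b => ¬ Bad ℓ F (k + 1) b).biUnion TT with hT
    have hTcard : T.card ≤ 3 ^ d * 2 := by
      refine (Finset.card_biUnion_le_card_mul _ _ 2 fun b hb => ?_).trans ?_
      · refine card_le_two fun x hx y hy => ?_
        exact Hi_width (Finset.mem_filter.1 hb).2 (Finset.mem_filter.1 hx).2 (Finset.mem_filter.1 hy).2
      · exact Nat.mul_le_mul_right 2 ((Finset.card_filter_le _ _).trans hBcard.le)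
    -- candidate slabs
    obtain ⟨S, hScard, hSr, hScr⟩ : ∃ S : Finset ℤ, S.card = C - 1 ∧ S ⊆ Finset.Icc (q - C) (q + C) ∧
        ∀ x ∈ S, (f s i ≤ L * x ∧ L * x + L - 1 ≤ f t' i) ∨ (f t' i ≤ L * x ∧ L * x + L - 1 ≤ f s i) := by
      rcases le_abs.1 hi with h | h
      · refine ⟨Finset.Icc (q + 1) (q + C - 1), ?_, ?_, ?_⟩
        · rw [Int.card_Icc]; omega
        · intro x hx; rw [Finset.mem_Icc] at *; omega
        · intro x hx; rw [Finset.mem_Icc] at hx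
          left
          have e1 : L * (q + 1) ≤ L * x := mul_le_mul_of_nonneg_left hx.1 hLpos.le
          have e2 : L * x ≤ L * (q + C - 1) := mul_le_mul_of_nonneg_left hx.2 hLpos.le
          constructor <;> nlinarith
      · refine ⟨Finset.Icc (q + 1 - C) (q - 1), ?_, ?_, ?_⟩
        · rw [Int.card_Icc]; omega
        · intro x hx; rw [Finset.mem_Icc] at *; omega
        · intro x hx; rw [Finset.mem_Icc] at hx
          right
          have e1 : L * (q + 1 - C) ≤ L * x := mul_le_mul_of_nonneg_left hx.1 hLpos.le
          have e2 : L * x ≤ L * (q - 1) := mul_le_mul_of_nonneg_left hx.2 hLpos.le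
          constructor <;> nlinarith
    have hST : 1 < (S \ T).card := by
      have := Finset.le_card_sdiff T S
      omega
    have hmain : ∀ x ∈ S \ T, ∃ Z : Finset (V d), 2 ^ k ≤ Z.card ∧
        ∀ z ∈ Z, inG ℓ F (k + 1) z ∧ z i / L = x ∧ ∃ j, s ≤ j ∧ j ≤ t ∧ f j = z := by
      intro x hx
      obtain ⟨hxS, hxT⟩ := Finset.mem_sdiff.1 hx
      obtain ⟨s1, t1, b1, b2, b3, b4, b5⟩ := crossing' (fun j => f j i) s t' c1
        (fun j h1 h2 => step_coord (hf j h1 (by omega)) i) (L * x) (L * x + L - 1) (by omega) (hScr x hxS)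
      have hslab : ∀ j, s1 ≤ j → j ≤ t1 → f j i / L = x := by
        intro j h1 h2
        have := b5 j h1 h2
        apply le_antisymm
        · apply Int.le_of_lt_add_one; rw [Int.ediv_lt_iff_lt_mul hLpos]; nlinarith [this.2]
        · rw [Int.le_ediv_iff_mul_le hLpos]; linarith [this.1]
      have hnH : ∀ j, s1 ≤ j → j ≤ t1 → ¬ InH ℓ F k (bx (ℓ ^ k) (f j)) := by
        intro j h1 h2 hh
        have h3 := hh i
        rw [bx_bx] at h3
        have e : bx (ℓ ^ k) (f j) i = x := hslab j h1 h2
        rw [e] at h3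
        refine hxT (Finset.mem_biUnion.2 ⟨bx (ℓ ^ (k + 1)) (f j), Finset.mem_filter.2
          ⟨hbB j (by omega) (by omega), hg j (by omega) (by omega)⟩, Finset.mem_filter.2 ⟨hSr hxS, h3⟩⟩)
      obtain ⟨Z, hZ1, hZ2⟩ := ih s1 t1 b2 (fun j h1 h2 => hf j (by omega) (by omega))
        (fun j h1 h2 hb => hnH j h1 h2 hb.inH) ⟨i, by
          exact (Dk_le hℓ k).trans (le_trans (by omega) b4)⟩
      refine ⟨Z, hZ1, fun z hz => ?_⟩
      obtain ⟨h1, j, h2, h3, rfl⟩ := hZ2 z hz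
      exact ⟨⟨h1, hnH j h2 h3⟩, hslab j h2 h3, j, by omega, by omega, rfl⟩
    obtain ⟨x1, hx1, x2, hx2, hne⟩ := Finset.one_lt_card.1 hST
    obtain ⟨Z1, a1, a2⟩ := hmain x1 hx1
    obtain ⟨Z2, a3, a4⟩ := hmain x2 hx2
    refine ⟨Z1 ∪ Z2, ?_, ?_⟩
    · rw [Finset.card_union_of_disjoint, pow_succ]
      · omega
      · rw [Finset.disjoint_left]
        intro z h1 h2
        exact hne ((a2 z h1).2.1.symm.trans (a4 z h2).2.1)
    · intro z hz
      rcases Finset.mem_union.1 hz with hz | hz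
      · exact ⟨(a2 z hz).1, (a2 z hz).2.2⟩
      · exact ⟨(a4 z hz).1, (a4 z hz).2.2⟩

/-- sub-boxes -/
noncomputable def subb (ℓ : ℕ) (b : V d) : Finset (V d) :=
  Finset.Icc (fun i => ℓ * b i) (fun i => ℓ * b i + ℓ - 1)

theorem mem_subb {ℓ : ℕ} (hℓ : 1 ≤ ℓ) {b c : V d} : c ∈ subb ℓ b ↔ bx ℓ c = b := by
  rw [bx_eq_iff hℓ, subb, Finset.mem_Icc]
  constructor
  · intro h i; have h1 := h.1 i; have h2 := h.2 i; simp only at h1 h2; constructor <;> omega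
  · intro h; exact ⟨fun i => (h i).1, fun i => by have := (h i).2; show c i ≤ ℓ * b i + ℓ - 1; omega⟩

theorem card_subb (ℓ : ℕ) (b : V d) : (subb ℓ b).card = ℓ ^ d := by
  rw [subb, Pi.card_Icc]
  simp only [Int.card_Icc]
  have : ∀ j : Fin d, ((ℓ : ℤ) * b j + ℓ - 1 + 1 - ℓ * b j).toNat = ℓ := fun j => by
    rw [show (ℓ : ℤ) * b j + ℓ - 1 + 1 - ℓ * b j = ℓ by ring]; simp
  simp [this]

/-- families of witnesses of badness -/
noncomputable def fam (ℓ : ℕ) : ℕ → V d → Finset (Finset (V d))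
  | 0, b => {{b}}
  | k + 1, b => ((subb ℓ b ×ˢ subb ℓ b).filter fun w => w.1 ≠ w.2).biUnion fun w =>
      (fam ℓ k w.1 ×ˢ fam ℓ k w.2).image fun S => S.1 ∪ S.2

theorem fam_spec {ℓ : ℕ} (hℓ : 1 ≤ ℓ) (k : ℕ) (b : V d) {S : Finset (V d)} (hS : S ∈ fam ℓ k b) :
    S.card = 2 ^ k ∧ ∀ z ∈ S, bx (ℓ ^ k) z = b := by
  classical
  induction k generalizing b S with
  | zero =>
    rw [fam, Finset.mem_singleton] at hS
    subst hS
    refine ⟨by simp, fun z hz => ?_⟩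
    rw [Finset.mem_singleton] at hz
    subst hz; funext i; simp [bx]
  | succ k ih =>
    rw [fam, Finset.mem_biUnion] at hS
    obtain ⟨w, hw, hS⟩ := hS
    obtain ⟨hw1, hw2⟩ := Finset.mem_filter.1 hw
    obtain ⟨hw3, hw4⟩ := Finset.mem_product.1 hw1
    obtain ⟨⟨S1, S2⟩, hSS, rfl⟩ := Finset.mem_image.1 hS
    obtain ⟨h1, h2⟩ := Finset.mem_product.1 hSS
    obtain ⟨i1, i2⟩ := ih _ h1
    obtain ⟨i3, i4⟩ := ih _ h2
    constructor
    · show (S1 ∪ S2).card = _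
      rw [Finset.card_union_of_disjoint, pow_succ]
      · have e1 : S1.card = 2 ^ k := i1
        have e2 : S2.card = 2 ^ k := i3
        omega
      · rw [Finset.disjoint_left]
        intro z hz hz'
        exact hw2 ((i2 z hz).symm.trans (i4 z hz'))
    · intro z hz
      rw [← bx_bx]
      rcases Finset.mem_union.1 hz with hz | hz
      · rw [i2 z hz]; exact (mem_subb hℓ).1 hw3
      · rw [i4 z hz]; exact (mem_subb hℓ).1 hw4

theorem fam_card (ℓ : ℕ) (k : ℕ) (b : V d) :
    (fam ℓ k b).card * ℓ ^ (2 * d) ≤ (ℓ ^ (2 * d)) ^ (2 ^ k) := by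
  classical
  induction k generalizing b with
  | zero => simp [fam]
  | succ k ih =>
    set X := ℓ ^ (2 * d) with hX
    rcases Nat.eq_zero_or_pos X with h0 | hpos
    · rw [h0]; simp
    set M := X ^ (2 ^ k) / X with hM
    have hle : ∀ b : V d, (fam ℓ k b).card ≤ M := fun b => (Nat.le_div_iff_mul_le hpos).2 (ih b)
    have hMX : M * X ≤ X ^ (2 ^ k) := Nat.div_mul_le_self _ _
    have h1 : (fam ℓ (k + 1) b).card ≤ X * (M * M) := by
      rw [fam]
      refine (Finset.card_biUnion_le_card_mul _ _ (M * M) fun w _ => ?_).trans ?_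
      · refine Finset.card_image_le.trans ?_
        rw [Finset.card_product]
        exact Nat.mul_le_mul (hle _) (hle _)
      · refine Nat.mul_le_mul_right _ ((Finset.card_filter_le _ _).trans ?_)
        rw [Finset.card_product, card_subb, hX, two_mul, pow_add]
    calc (fam ℓ (k + 1) b).card * X ≤ X * (M * M) * X := Nat.mul_le_mul_right _ h1
      _ = (M * X) * (M * X) := by ring
      _ ≤ X ^ (2 ^ k) * X ^ (2 ^ k) := Nat.mul_le_mul hMX hMX
      _ = X ^ (2 ^ (k + 1)) := by rw [← pow_add]; congr 1; ring

theorem bad_fam {ℓ : ℕ} (hℓ : 1 ≤ ℓ) {F : Set (V d)} (k : ℕ) (b : V d) (h : Bad ℓ F k b) :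
    ∃ S ∈ fam ℓ k b, (S : Set (V d)) ⊆ F := by
  classical
  induction k generalizing b with
  | zero => exact ⟨{b}, by simp [fam], by rw [Finset.coe_singleton]; exact Set.singleton_subset_iff.2 h⟩
  | succ k ih =>
    obtain ⟨b1, b2, e1, e2, B1, B2, i, hi⟩ := h
    obtain ⟨S1, h1, h1'⟩ := ih b1 B1
    obtain ⟨S2, h2, h2'⟩ := ih b2 B2
    refine ⟨S1 ∪ S2, ?_, by push_cast; exact Set.union_subset h1' h2'⟩
    rw [fam, Finset.mem_biUnion]
    refine ⟨(b1, b2), Finset.mem_filter.2 ⟨Finset.mem_product.2 ⟨(mem_subb hℓ).2 e1, (mem_subb hℓ).2 e2⟩, ?_⟩,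
      Finset.mem_image.2 ⟨(S1, S2), Finset.mem_product.2 ⟨h1, h2⟩, rfl⟩⟩
    intro (he : b1 = b2)
    subst he; omega

end Hier2
end Mod15

section Mod16
variable {d : ℕ}

/-- probability that a box is bad -/
theorem bad_prob {qq : Lab d → unitInterval} {m n : ℕ} {η : ℝ} (hη : 0 < η) (hη1 : η ≤ 1)
    (hs : StepProb qq m n η) {ℓ : ℕ} (hℓ : 1 ≤ ℓ) (W : Set (V d)) (T : ℕ) (s : St d) (hI : Inv m s) (hF : s.2.2 = ∅)
    {H : Set (LC d)} (mH : MeasurableSet H) (dH : DetBy (stI s) H)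
    (hdis : ∀ ω ∈ H, Disjoint (dom (run m n W T s ω)) (run m n W T s ω).2.2) (k : ℕ) (b : V d) :
    (PL qq).real (H ∩ {ω | Bad ℓ ((run m n W T s ω).2.2 : Set (V d)) k b}) ≤
      ((ℓ : ℝ) ^ (2 * d) * η) ^ (2 ^ k) * (PL qq).real H := by
  classical
  refine (real_le_sum_of_subset (fam ℓ k b) (fun S => H ∩ {ω | S ⊆ (run m n W T s ω).2.2 ∧
    Disjoint S (dom (run m n W T s ω))}) ?_).trans ?_
  · rintro ω ⟨hH, hB⟩
    obtain ⟨S, hS, hSF⟩ := bad_fam hℓ k b hB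
    have hSF' : S ⊆ (run m n W T s ω).2.2 := by exact_mod_cast hSF
    exact Set.mem_biUnion hS ⟨hH, hSF', (hdis ω hH).symm.mono_left hSF'⟩
  · have h1 : ∀ S ∈ fam ℓ k b, (PL qq).real (H ∩ {ω | S ⊆ (run m n W T s ω).2.2 ∧
        Disjoint S (dom (run m n W T s ω))}) ≤ η ^ (2 ^ k) * (PL qq).real H := by
      intro S hS
      refine (run_bound hη hη1 hs W S T s hI mH dH).trans (mul_le_mul_of_nonneg_right ?_ measureReal_nonneg)
      unfold phi
      split_ifs
      · rw [hF, Finset.sdiff_empty, (fam_spec hℓ k b hS).1]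
      · positivity
    refine (Finset.sum_le_sum h1).trans ?_
    rw [Finset.sum_const, nsmul_eq_mul, mul_pow, ← mul_assoc]
    gcongr
    have h2 := fam_card ℓ k b
    have h3 : 1 ≤ ℓ ^ (2 * d) := Nat.one_le_pow _ _ hℓ
    have h4 : (fam ℓ k b).card ≤ (ℓ ^ (2 * d)) ^ (2 ^ k) :=
      le_trans (Nat.le_mul_of_pos_right _ h3) h2
    exact_mod_cast h4

theorem bad_prob_all {qq : Lab d → unitInterval} {m n : ℕ} {η : ℝ} (hη : 0 < η) (hη1 : η ≤ 1)
    (hs : StepProb qq m n η) {ℓ : ℕ} (hℓ : 1 ≤ ℓ) (W : Set (V d)) (T : ℕ) (s : St d) (hI : Inv m s) (hF : s.2.2 = ∅)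
    {H : Set (LC d)} (mH : MeasurableSet H) (dH : DetBy (stI s) H)
    (hdis : ∀ ω ∈ H, Disjoint (dom (run m n W T s ω)) (run m n W T s ω).2.2) (k : ℕ) (B : Finset (V d)) :
    (PL qq).real (H ∩ {ω | ∃ b ∈ B, Bad ℓ ((run m n W T s ω).2.2 : Set (V d)) k b}) ≤
      B.card * ((ℓ : ℝ) ^ (2 * d) * η) ^ (2 ^ k) * (PL qq).real H := by
  refine (real_le_sum_of_subset B (fun b => H ∩ {ω | Bad ℓ ((run m n W T s ω).2.2 : Set (V d)) k b}) ?_).trans ?_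
  · rintro ω ⟨hH, b, hb, hB⟩
    exact Set.mem_biUnion hb ⟨hH, hB⟩
  · refine (Finset.sum_le_sum fun b _ => bad_prob hη hη1 hs hℓ W T s hI hF mH dH hdis k b).trans ?_
    rw [Finset.sum_const, nsmul_eq_mul, mul_assoc]

theorem inG_of_nbr (hd : 1 ≤ d) {ℓ : ℕ} {F : Set (V d)} (k : ℕ) (z : V d)
    (h : ∀ j ≤ k, ∀ b ∈ box 1 (bx (ℓ ^ j) z), ¬ Bad ℓ F j b) : inG ℓ F k z := by
  induction k with
  | zero =>
    refine h 0 le_rfl z ?_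
    have : bx (ℓ ^ 0) z = z := by funext i; simp [bx]
    rw [this]; exact self_mem_box _ _
  | succ k ih =>
    refine ⟨ih fun j hj => h j (by omega), fun hH => ?_⟩
    have hg : ¬ Bad ℓ F (k + 1) (bx ℓ (bx (ℓ ^ k) z)) := by
      rw [bx_bx]; exact h (k + 1) le_rfl _ (self_mem_box _ _)
    obtain ⟨⟨b', e, hB, -⟩, -⟩ := hH ⟨0, hd⟩
    refine h k (by omega) b' ?_ hB
    rw [mem_box]
    intro i
    have hbi : Hi ℓ F k (bx ℓ (bx (ℓ ^ k) z)) i (b' i) := ⟨⟨b', e, hB, le_rfl⟩, ⟨b', e, hB, le_rfl⟩⟩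
    have h1 := Hi_width hg hbi (hH i)
    have h2 := Hi_width hg (hH i) hbi
    rw [abs_le]; push_cast; constructor <;> omega

theorem sum_pow_two_le {x : ℝ} (h0 : 0 ≤ x) (h1 : x ≤ 1 / 2) (k : ℕ) :
    ∑ j ∈ Finset.range k, x ^ (2 ^ j) ≤ 2 * x := by
  have : ∀ j, x ^ (2 ^ j) ≤ x * (1 / 2) ^ j := by
    intro j
    calc x ^ (2 ^ j) ≤ x ^ (j + 1) := pow_le_pow_of_le_one h0 (by linarith) (Nat.lt_two_pow_self)
      _ = x * x ^ j := by ring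
      _ ≤ _ := by gcongr
  calc _ ≤ ∑ j ∈ Finset.range k, x * (1 / 2) ^ j := Finset.sum_le_sum fun j _ => this j
    _ = x * ∑ j ∈ Finset.range k, (1 / 2 : ℝ) ^ j := by rw [Finset.mul_sum]
    _ ≤ x * 2 := by
      gcongr
      have := geom_sum_eq (show (1 / 2 : ℝ) ≠ 1 by norm_num) k
      rw [this, show (1 / 2 - 1 : ℝ) = -(1 / 2) by norm_num, div_neg, div_div_eq_mul_div]
      have h : (0 : ℝ) ≤ (1 / 2) ^ k := by positivity
      linarith
    _ = _ := by ring

/-- a given site is hierarchically good -/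
theorem start_prob (hd : 1 ≤ d) {qq : Lab d → unitInterval} {m n : ℕ} {η : ℝ} (hη : 0 < η) (hη1 : η ≤ 1)
    (hs : StepProb qq m n η) {ℓ : ℕ} (hℓ : 1 ≤ ℓ) (W : Set (V d)) (T : ℕ) (s : St d) (hI : Inv m s) (hF : s.2.2 = ∅)
    {H : Set (LC d)} (mH : MeasurableSet H) (dH : DetBy (stI s) H)
    (hdis : ∀ ω ∈ H, Disjoint (dom (run m n W T s ω)) (run m n W T s ω).2.2)
    (hx : (ℓ : ℝ) ^ (2 * d) * η ≤ 1 / 2) (k : ℕ) (z : V d) :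
    (PL qq).real (H ∩ {ω | ¬ inG ℓ ((run m n W T s ω).2.2 : Set (V d)) k z}) ≤
      2 * 3 ^ d * ((ℓ : ℝ) ^ (2 * d) * η) * (PL qq).real H := by
  refine (real_le_sum_of_subset (Finset.range (k + 1)) (fun j => H ∩ {ω | ∃ b ∈ box 1 (bx (ℓ ^ j) z),
    Bad ℓ ((run m n W T s ω).2.2 : Set (V d)) j b}) ?_).trans ?_
  · rintro ω ⟨hH, hG⟩
    by_contra hc
    refine hG (inG_of_nbr hd k z fun j hj b hb hB => hc ?_)
    exact Set.mem_biUnion (x := j) (by simp; omega) ⟨hH, b, hb, hB⟩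
  · refine (Finset.sum_le_sum fun j _ =>
      bad_prob_all hη hη1 hs hℓ W T s hI hF mH dH hdis j (box 1 (bx (ℓ ^ j) z))).trans ?_
    rw [← Finset.sum_mul]
    refine mul_le_mul_of_nonneg_right ?_ measureReal_nonneg
    have hc : ∀ j, ((box 1 (bx (ℓ ^ j) z)).card : ℝ) = 3 ^ d := fun j => by rw [card_box]; norm_num
    simp only [hc]
    rw [← Finset.mul_sum]
    have := sum_pow_two_le (x := (ℓ : ℝ) ^ (2 * d) * η) (by positivity) hx (k + 1)
    have h3 : (0 : ℝ) < 3 ^ d := by positivity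
    nlinarith
end Mod16

section Mod17
variable {d : ℕ}

/-- block lemma -/
theorem block_lemma {ι α : Type*} [Countable α] (q : ι → unitInterval) {H : Set (ι → Bool)} (mH : MeasurableSet H)
    (G : Finset α) (B : α → Set (ι → Bool)) (J : α → Set ι) (mB : ∀ a ∈ G, MeasurableSet (B a))
    (dB : ∀ a ∈ G, DetBy (J a) (B a)) (hJ : ∀ a ∈ G, ∀ b ∈ G, a ≠ b → Disjoint (J a) (J b))
    (dH : DetBy (⋃ a ∈ G, J a)ᶜ H) (N : (ι → Bool) → Finset α) (mN : ∀ v, MeasurableSet (N ⁻¹' {v}))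
    (hN : ∀ ω ∈ H, N ω ⊆ G)
    (dN : ∀ v ⊆ G, DetBy {i | ∀ a ∈ G, a ∉ v → i ∉ J a} (H ∩ N ⁻¹' {v}))
    {β : ℝ} (hβ0 : 0 ≤ β) (hβ1 : β ≤ 1) (hB : ∀ a ∈ G, 0 < (PB q).real (B a) ∧ (PB q).real (B a) ≤ β) (t : ℕ) :
    (PB q).real (H ∩ {ω | t ≤ (N ω).card ∧ ∀ a ∈ N ω, ω ∈ B a}) ≤ β ^ t * (PB q).real H := by
  classical
  set P := PB q
  have hpos : 0 < ∏ a ∈ G, P.real (B a) := Finset.prod_pos fun a ha => (hB a ha).1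
  have hβt : 0 ≤ β ^ t := pow_nonneg hβ0 _
  have e1 : P.real (H ∩ ⋂ a ∈ G, B a) = P.real H * ∏ a ∈ G, P.real (B a) :=
    indep_blocks q mH dH B J G mB dB hJ fun a ha => by
      rw [Set.disjoint_left]; intro i hi hi'
      exact hi (Set.mem_biUnion ha hi')
  have key : P.real (H ∩ {ω | t ≤ (N ω).card ∧ ∀ a ∈ N ω, ω ∈ B a}) * ∏ a ∈ G, P.real (B a) ≤
      β ^ t * P.real (H ∩ ⋂ a ∈ G, B a) := by
    rw [mul_comm]
    have : P.real (H ∩ {ω | t ≤ (N ω).card ∧ ∀ a ∈ N ω, ω ∈ B a}) ≤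
        (β ^ t / ∏ a ∈ G, P.real (B a)) * P.real (H ∩ ⋂ a ∈ G, B a) := by
      refine real_le_of_fibers mN (by positivity) fun v => ?_
      by_cases hv : v ⊆ G ∧ t ≤ v.card
      swap
      · have : H ∩ {ω | t ≤ (N ω).card ∧ ∀ a ∈ N ω, ω ∈ B a} ∩ N ⁻¹' {v} = ∅ := by
          ext ω
          simp only [Set.mem_inter_iff, Set.mem_empty_iff_false, iff_false]
          rintro ⟨⟨h1, h2, -⟩, h3⟩
          obtain rfl : N ω = v := h3
          exact hv ⟨hN ω h1, h2⟩
        rw [this, measureReal_empty]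
        positivity
      obtain ⟨hvG, hvt⟩ := hv
      set A : Set (ι → Bool) := (H ∩ N ⁻¹' {v}) ∩ ⋂ a ∈ v, B a with hA
      have mA : MeasurableSet A := (mH.inter (mN v)).inter (Finset.measurableSet_biInter _ fun a ha => mB a (hvG ha))
      have dA : DetBy {i | ∀ a ∈ G, a ∉ v → i ∉ J a} A := by
        refine (dN v hvG).inter (DetBy.biInter fun a ha => (dB a (hvG ha)).mono ?_)
        intro i hi b hb hbv hib
        exact Set.disjoint_left.1 (hJ a (hvG ha) b hb fun h => hbv (h ▸ ha)) hi hib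
      have e2 := indep_blocks q mA dA B J (G \ v) (fun a ha => mB a (Finset.mem_sdiff.1 ha).1)
        (fun a ha => dB a (Finset.mem_sdiff.1 ha).1)
        (fun a ha b hb => hJ a (Finset.mem_sdiff.1 ha).1 b (Finset.mem_sdiff.1 hb).1)
        (fun a ha => by
          rw [Set.disjoint_left]; intro i hi hi'
          exact hi a (Finset.mem_sdiff.1 ha).1 (Finset.mem_sdiff.1 ha).2 hi')
      have s1 : H ∩ {ω | t ≤ (N ω).card ∧ ∀ a ∈ N ω, ω ∈ B a} ∩ N ⁻¹' {v} = A := by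
        ext ω
        constructor
        · rintro ⟨⟨h1, h2, h3⟩, h4⟩
          have h4' : N ω = v := h4
          exact ⟨⟨h1, h4⟩, Set.mem_iInter₂.2 fun a ha => h3 a (h4' ▸ ha)⟩
        · rintro ⟨⟨h1, h4⟩, h3⟩
          have h4' : N ω = v := h4
          refine ⟨⟨h1, h4' ▸ hvt, fun a ha => Set.mem_iInter₂.1 h3 a (h4' ▸ ha)⟩, h4⟩
      have s2 : (H ∩ ⋂ a ∈ G, B a) ∩ N ⁻¹' {v} = A ∩ ⋂ a ∈ G \ v, B a := by
        ext ω
        simp only [hA, Set.mem_inter_iff, Set.mem_iInter, Finset.mem_sdiff]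
        constructor
        · rintro ⟨⟨h1, h2⟩, h3⟩
          exact ⟨⟨⟨h1, h3⟩, fun a ha => h2 a (hvG ha)⟩, fun a ha => h2 a ha.1⟩
        · rintro ⟨⟨⟨h1, h3⟩, h2⟩, h4⟩
          refine ⟨⟨h1, fun a ha => ?_⟩, h3⟩
          by_cases h : a ∈ v
          · exact h2 a h
          · exact h4 a ⟨ha, h⟩
      rw [s1, s2, e2, ← Finset.prod_sdiff hvG]
      have hp1 : 0 < ∏ a ∈ G \ v, P.real (B a) :=
        Finset.prod_pos fun a ha => (hB a (Finset.mem_sdiff.1 ha).1).1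
      have hp2 : 0 < ∏ a ∈ v, P.real (B a) := Finset.prod_pos fun a ha => (hB a (hvG ha)).1
      have hp3 : ∏ a ∈ v, P.real (B a) ≤ β ^ t := by
        rcases v.eq_empty_or_nonempty with h | ⟨a, ha⟩
        · subst h; simp at hvt; simp [hvt]
        · calc ∏ a ∈ v, P.real (B a) ≤ ∏ a ∈ v, β :=
                Finset.prod_le_prod (fun _ _ => measureReal_nonneg) fun a ha => (hB a (hvG ha)).2
            _ = β ^ v.card := by rw [Finset.prod_const]
            _ ≤ β ^ t := pow_le_pow_of_le_one hβ0 hβ1 hvt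
      rw [div_mul_eq_mul_div, le_div_iff₀ (by positivity)]
      have hAn : 0 ≤ P.real A := measureReal_nonneg
      have := mul_le_mul_of_nonneg_left hp3 (mul_nonneg hAn hp1.le)
      nlinarith
    rw [div_mul_eq_mul_div, le_div_iff₀ hpos] at this
    linarith
  rw [e1] at key
  refine le_of_mul_le_mul_right ?_ hpos
  linarith
end Mod17

section Mod18
variable {d : ℕ}

theorem att_congr {m n : ℕ} {s : St d} {w : V d × V d × V d} {ω ω' : LC d}
    (h : ∀ i : LI d, (i.2 = Lab.base ∨ ∃ w, i.2 = Sum.inr w) → ω i = ω' i) : att m n s w ω = att m n s w ω' :=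
  att_eq_of (newS_congr (fun e _ => h _ (Or.inl rfl)) fun e => h _ (Or.inr ⟨_, rfl⟩)) fun y =>
    stepOK_congr fun i hi => h i (by
      rcases hi with hi | hi | hi
      · exact Or.inl hi.1
      · exact Or.inr ⟨_, hi⟩
      · exact Or.inr ⟨_, hi⟩)

theorem run_congr {m n : ℕ} {W : Set (V d)} (T : ℕ) (s : St d) {ω ω' : LC d}
    (h : ∀ i : LI d, (i.2 = Lab.base ∨ ∃ w, i.2 = Sum.inr w) → ω i = ω' i) :
    run m n W T s ω = run m n W T s ω' := by
  induction T generalizing s with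
  | zero => rfl
  | succ T ih =>
    show run m n W T (stp m n W s ω) ω = run m n W T (stp m n W s ω') ω'
    rw [ih]
    rcases stp_cases m n W s with ⟨w, hw, hs⟩ | ⟨-, hs⟩
    · rw [hs, hs, att_congr h]
    · rw [hs, hs]

theorem sc_disj {n : ℕ} (hn : 1 ≤ n) {u u' : V d} (h : res 3 u = res 3 u') (hne : u ≠ u') :
    Disjoint (box n (sc n u)) (box n (sc n u')) := by
  rw [Finset.disjoint_left]
  intro w hw hw'
  apply hne
  funext i
  have h1 := abs_le.1 (mem_box.1 hw i)
  have h2 := abs_le.1 (mem_box.1 hw' i)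
  have h3 : (u i : ZMod 3) = (u' i : ZMod 3) := congrFun h i
  have h4 := (ZMod.intCast_eq_intCast_iff_dvd_sub (u i) (u' i) 3).1 h3
  unfold sc at h1 h2
  have hn' : (0 : ℤ) < n := by exact_mod_cast hn
  have a1 : u i - u' i ≤ 2 := by nlinarith
  have a2 : u' i - u i ≤ 2 := by nlinarith
  push_cast at h4
  omega

/-- sites in a residue class with property `p`, visited by the cluster of `v` -/
noncomputable def visd (n : ℕ) (Sh : Set (V d)) (v : V d) (G : Finset (V d)) (ω : LC d) : Finset (V d) :=
  by classical exact G.filter fun u => ∃ y ∈ box n (sc n u), Conn (Fin' n ω) Sh v y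

theorem mem_visd {n : ℕ} {Sh : Set (V d)} {v : V d} {G : Finset (V d)} {ω : LC d} {u : V d} :
    u ∈ visd n Sh v G ω ↔ u ∈ G ∧ ∃ y ∈ box n (sc n u), Conn (Fin' n ω) Sh v y := by
  classical
  simp [visd]

theorem meas_visd (n : ℕ) (Sh : Set (V d)) (v : V d) (G w : Finset (V d)) :
    MeasurableSet (visd n Sh v G ⁻¹' {w}) := by
  refine meas_finset_eq (fun u => ?_) w
  simp only [mem_visd]
  exact meas_and (meas_const _) (meas_ex fun y => meas_and (meas_const _) (meas_Fin' n (meas_conn Sh v y)))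

theorem visd_det {n : ℕ} {Sh : Set (V d)} {v : V d} {G : Finset (V d)} {ω ω' : LC d}
    (h : ∀ i : LI d, (∀ u ∈ G, u ∉ visd n Sh v G ω → i ∉ seedJ n Lab.extra (sc n u)) → ω i = ω' i) :
    visd n Sh v G ω' = visd n Sh v G ω := by
  classical
  have key : ∀ a b, Conn (Fin' n ω) Sh v a → (edgeOpen (Fin' n ω) a b ↔ edgeOpen (Fin' n ω') a b) := by
    intro a b ha
    rw [edgeOpen_iff, edgeOpen_iff]
    refine exists_congr fun hab => ?_
    rw [final_open, final_open]
    refine exists_congr fun l => and_congr_right fun _ => ?_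
    rw [h (mkE a b hab, l) fun u hu hn hi => ?_]
    refine hn (mem_visd.2 ⟨hu, a, ?_, ha⟩)
    exact (mkE_inside.1 (mem_eIn.1 hi.1)).1
  have c1 : ∀ a, Conn (Fin' n ω) Sh v a → Conn (Fin' n ω') Sh v a := by
    intro a ha
    induction ha with
    | refl => exact Conn.refl _ _ _
    | tail h1 h2 ih => exact Relation.ReflTransGen.tail ih ⟨(key _ _ h1).1 h2.1, h2.2⟩
  have c2 : ∀ a, Conn (Fin' n ω') Sh v a → Conn (Fin' n ω) Sh v a := by
    intro a ha
    induction ha with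
    | refl => exact Conn.refl _ _ _
    | tail h1 h2 ih => exact Relation.ReflTransGen.tail ih ⟨(key _ _ ih).2 h2.1, h2.2⟩
  ext u
  rw [mem_visd, mem_visd]
  exact and_congr_right fun _ => exists_congr fun y => and_congr_right fun _ => ⟨c2 y, c1 y⟩

theorem extra_prob (hd : 1 ≤ d) (qq : Lab d → unitInterval) (l : Lab d) (h1 : (qq l : ℝ) < 1) {n : ℕ} (hn : 1 ≤ n) (y : V d) :
    0 < (PL qq).real {ω | Seed n y (layer l ω)}ᶜ ∧
    (PL qq).real {ω | Seed n y (layer l ω)}ᶜ ≤ 1 - (qq l : ℝ) ^ sExp d n := by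
  have mS : MeasurableSet {ω : LC d | Seed n y (layer l ω)} := meas_layer l (meas_seed n y)
  rw [probReal_compl_eq_one_sub mS]
  refine ⟨?_, by linarith [seed_prob qq l n y]⟩
  let y' : V d := Function.update y ⟨0, hd⟩ (y ⟨0, hd⟩ + 1)
  have hy : dist1 y y' = 1 := dist1_update _ _ _ (by simp)
  have hsub : {ω : LC d | Seed n y (layer l ω)} ⊆ {ω | ω (mkE y y' hy, l) = true} := by
    intro ω hω
    refine hω (mkE y y' hy) (mem_eIn.2 (mkE_inside.2 ⟨self_mem_box _ _, ?_⟩))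
    exact box_mono hn _ (adj_mem_box hy)
  have : (PL qq).real {ω | Seed n y (layer l ω)} ≤ qq l :=
    (measureReal_mono hsub).trans (PB_true (fun i : LI d => qq i.2) (mkE y y' hy, l)).le
  linarith

theorem contact_prob (hd : 1 ≤ d) {qq : Lab d → unitInterval} (h1 : (qq Lab.extra : ℝ) < 1) {m n : ℕ} (hn : 1 ≤ n)
    (W : Set (V d)) (T : ℕ) (s : St d) {H : Set (LC d)} (mH : MeasurableSet H)
    (dH : DetBy {i | i.2 ≠ Lab.extra} H) (Sh : Set (V d)) (v : V d) (g : St d → Finset (V d))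
    (hg : ∀ s', ∀ u ∈ g s', ∀ u' ∈ g s', res 3 u = res 3 u') (t : ℕ) :
    (PL qq).real (H ∩ {ω | t ≤ (visd n Sh v (g (run m n W T s ω)) ω).card ∧
      ∀ u ∈ visd n Sh v (g (run m n W T s ω)) ω, ¬ Seed n (sc n u) (layer Lab.extra ω)}) ≤
      (1 - (qq Lab.extra : ℝ) ^ sExp d n) ^ t * (PL qq).real H := by
  have hβ0 : 0 ≤ 1 - (qq Lab.extra : ℝ) ^ sExp d n := by
    have := pow_le_one₀ (n := sExp d n) (qq Lab.extra).2.1 (qq Lab.extra).2.2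
    linarith
  have hβ1 : 1 - (qq Lab.extra : ℝ) ^ sExp d n ≤ 1 := by
    have := pow_nonneg (qq Lab.extra).2.1 (sExp d n)
    linarith
  refine real_le_of_fibers (meas_run m n W T s) (pow_nonneg hβ0 _) fun s' => ?_
  have dR : DetBy {i | i.2 ≠ Lab.extra} (run m n W T s ⁻¹' {s'}) := by
    intro ω ω' h hω
    have := run_congr (m := m) (n := n) (W := W) T s (ω := ω) (ω' := ω') fun i hi => h i (by
      show i.2 ≠ _
      rcases hi with hi | ⟨w, hi⟩ <;> rw [hi] <;> simp [Lab.base, Lab.extra])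
    show run m n W T s ω' = s'
    rw [← this]; exact hω
  have sub : ∀ G : Finset (V d), {i : LI d | i.2 ≠ Lab.extra} ⊆ (⋃ a ∈ G, seedJ n Lab.extra (sc n a))ᶜ := by
    intro G i hi hi'
    simp only [Set.mem_iUnion] at hi'
    obtain ⟨a, -, ha⟩ := hi'
    exact hi ha.2
  have := block_lemma (fun i : LI d => qq i.2) (mH.inter (meas_run m n W T s s')) (g s')
    (fun u => {ω | Seed n (sc n u) (layer Lab.extra ω)}ᶜ) (fun u => seedJ n Lab.extra (sc n u))
    (fun u _ => (meas_layer Lab.extra (meas_seed n (sc n u))).compl)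
    (fun u _ => (detBy_seed n Lab.extra (sc n u)).compl)
    (fun u hu u' hu' hne => seedJ_disj (sc_disj hn (hg s' u hu u' hu') hne) _ _)
    ((dH.inter dR).mono (sub _)) (visd n Sh v (g s')) (meas_visd n Sh v (g s'))
    (fun ω _ u hu => (mem_visd.1 hu).1)
    (fun w hw => by
      intro ω ω' h hω
      obtain rfl : visd n Sh v (g s') ω = w := hω.2
      refine ⟨(dH.inter dR) ω ω' (fun i hi => h i fun a ha _ hia => hi hia.2) hω.1, ?_⟩
      exact visd_det fun i hi => h i hi)
    hβ0 hβ1 (fun u _ => extra_prob hd qq Lab.extra h1 hn (sc n u)) t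
  refine le_trans (measureReal_mono ?_) this
  rintro ω ⟨⟨hω, h2, h3⟩, h4⟩
  have h4' : run m n W T s ω = s' := h4
  rw [h4'] at h2 h3
  exact ⟨⟨hω, h4⟩, h2, h3⟩
end Mod18

section Mod19
variable {d : ℕ}

/-! ### M19: geometry of the shell -/

theorem Conn.path {ω : Config d} {S : Set (V d)} {x y : V d} (h : Conn ω S x y) :
    ∃ (N : ℕ) (f : ℕ → V d), f 0 = x ∧ f N = y ∧ (∀ j < N, dist1 (f j) (f (j + 1)) = 1) ∧
      ∀ j ≤ N, Conn ω S x (f j) := by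
  induction h with
  | refl =>
    refine ⟨0, fun _ => x, rfl, rfl, fun j hj => absurd hj (by omega), fun j hj => Conn.refl _ _ _⟩
  | @tail b c hb hbc ih =>
    obtain ⟨N, f, h0, hN, hf, hc⟩ := ih
    refine ⟨N + 1, fun j => if j ≤ N then f j else c, by simp [h0], by simp, ?_, ?_⟩
    · intro j hj
      rcases Nat.lt_or_ge j N with h | h
      · have h1 : j ≤ N := h.le
        have h2 : j + 1 ≤ N := h
        simp only [h1, h2, if_true]
        exact hf j h
      · have h1 : j = N := by omega
        subst h1
        have h2 : ¬ (j + 1 ≤ j) := by omega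
        simp only [h2, le_refl, if_true, if_false, hN]
        exact hbc.1.adj
    · intro j hj
      rcases Nat.lt_or_ge N j with h | h
      · have h2 : ¬ j ≤ N := by omega
        simp only [h2, if_false]
        exact Relation.ReflTransGen.tail hb hbc
      · simp only [h, if_true]
        exact hc j h

/-- the cube `[-N, N)^d`. -/
def inA (N : ℕ) (w : V d) : Prop := ∀ i, -(N : ℤ) ≤ w i ∧ w i < N

theorem inA_bx {L : ℕ} (hL : 1 ≤ L) (N : ℕ) (z : V d) : inA N (bx L z) ↔ inA (N * L) z := by
  have hL' : (0 : ℤ) < L := by exact_mod_cast hL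
  unfold inA bx
  refine forall_congr' fun i => ?_
  rw [Int.le_ediv_iff_mul_le hL', Int.ediv_lt_iff_lt_mul hL']
  push_cast
  rw [neg_mul]

noncomputable def gN (z : V d) : ℕ := Finset.univ.sup (fun i => (max (z i) (-z i - 1)).toNat)

theorem gN_lt {N : ℕ} (hN : 1 ≤ N) (z : V d) : gN z < N ↔ inA N z := by
  unfold gN
  rw [Finset.sup_lt_iff (by exact hN)]
  unfold inA
  constructor
  · intro h i
    have := h i (Finset.mem_univ _)
    constructor <;> omega
  · intro h i _
    have := h i
    omega

theorem coord_of_dist1 {z z' : V d} (h : dist1 z z' ≤ 1) (i : Fin d) : |z i - z' i| ≤ 1 := by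
  have := coord_le_dist1 z z' i
  rw [abs_le]; constructor <;> omega

theorem gN_lip {z z' : V d} (h : dist1 z z' ≤ 1) : gN z' ≤ gN z + 1 := by
  have h1 : inA (gN z + 1) z := (gN_lt (by omega) z).1 (by omega)
  have : inA (gN z + 2) z' := by
    intro i
    have := h1 i
    have h2 := abs_le.1 (coord_of_dist1 h i)
    push_cast at *
    constructor <;> omega
  have := (gN_lt (by omega) z').2 this
  omega

theorem bx_lip {n : ℕ} (hn : 1 ≤ n) {y y' : V d} (h : dist1 y y' = 1) : dist1 (bx n y) (bx n y') ≤ 1 := by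
  have hn' : (0 : ℤ) < n := by exact_mod_cast hn
  obtain ⟨i, hi, hj⟩ := adj_ex h
  have h1 : ∀ j, j ≠ i → bx n y' j = bx n y j := fun j hji => by unfold bx; rw [hj j hji]
  have h2 : (bx n y i - bx n y' i).natAbs ≤ 1 := by
    have a1 := Int.mul_ediv_add_emod (y i) n
    have a2 := Int.mul_ediv_add_emod (y' i) n
    have b1 := Int.emod_nonneg (y i) hn'.ne'
    have b2 := Int.emod_nonneg (y' i) hn'.ne'
    have c1 := Int.emod_lt_of_pos (y i) hn'
    have c2 := Int.emod_lt_of_pos (y' i) hn'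
    show (y i / n - y' i / n).natAbs ≤ 1
    have e1 : y i / n - y' i / n < 2 := by
      by_contra hc
      push Not at hc
      have := mul_le_mul_of_nonneg_left hc hn'.le
      rw [mul_sub] at this
      rcases hi with hi | hi <;> linarith
    have e2 : -2 < y i / n - y' i / n := by
      by_contra hc
      push Not at hc
      have := mul_le_mul_of_nonneg_left hc hn'.le
      rw [mul_sub] at this
      rcases hi with hi | hi <;> linarith
    omega
  unfold dist1
  rw [Finset.sum_eq_single i]
  · exact h2
  · intro j _ hji
    rw [h1 j hji]; simp
  · intro h; exact absurd (Finset.mem_univ _) h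

theorem mem_box_sc_bx {n : ℕ} (hn : 1 ≤ n) (y : V d) : y ∈ box n (sc n (bx n y)) := by
  rw [mem_box]
  intro i
  have := ((bx_eq_iff hn (z := y) (b := bx n y)).1 rfl i)
  unfold sc
  rw [abs_le]; constructor <;> omega

/-- the index shell -/
def Ish (w : V d) : Prop := inA 4 w ∧ ¬ inA 2 w

theorem shell_A {P : V d → Prop} (hP : ∀ w w', Ish w → Ish w' → dist1 w w' = 1 → P w → P w')
    (i : Fin d) : ∀ (N : ℕ) (w w' : V d), dist1 w w' ≤ N → inA 4 w → inA 4 w' → w i = w' i →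
    ¬ (-2 ≤ w i ∧ w i < 2) → P w' → P w := by
  intro N
  induction N with
  | zero =>
    intro w w' h _ _ _ _ hp
    have := dist1_eq_zero.1 (Nat.le_zero.1 h)
    rwa [this]
  | succ N ih =>
    intro w w' h h4 h4' hi hb hp
    by_cases hne : w = w'
    · rwa [hne]
    obtain ⟨c, hc1, hc2, hc3⟩ := exists_closer hne
    have hc4 : inA 4 c := fun j => by
      have := h4 j; have := h4' j; have := hc3 j
      constructor <;> omega
    have hci : c i = w i := by
      have := hc3 i; omega
    have big : ∀ u : V d, inA 4 u → u i = w i → Ish u := fun u hu hui =>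
      ⟨hu, fun h2 => hb (by have := h2 i; rw [hui] at this; exact_mod_cast this)⟩
    exact ih w c (by omega) h4 hc4 hci.symm hb (hP w' c (big _ h4' hi.symm) (big _ hc4 hci) hc1 hp)

theorem shell_closed (hd : 2 ≤ d) {P : V d → Prop}
    (hP : ∀ w w', Ish w → Ish w' → dist1 w w' = 1 → P w → P w')
    {w w' : V d} (hw : Ish w) (hw' : Ish w') (h : P w) : P w' := by
  have key : ∀ (w w' : V d) (i i' : Fin d), i ≠ i' → inA 4 w → inA 4 w' →
      ¬ (-2 ≤ w i ∧ w i < 2) → ¬ (-2 ≤ w' i' ∧ w' i' < 2) → P w → P w' := by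
    intro w w' i i' hii h4 h4' hb hb' h
    let c : V d := Function.update w i' (w' i')
    have hci : c i = w i := Function.update_of_ne hii _ _
    have hci' : c i' = w' i' := Function.update_self _ _ _
    have hc4 : inA 4 c := fun j => by
      by_cases hj : j = i'
      · subst hj; rw [hci']; exact h4' j
      · have : c j = w j := Function.update_of_ne hj _ _
        rw [this]; exact h4 j
    have h1 : P c := shell_A hP i _ c w le_rfl hc4 h4 hci (by rw [hci]; exact hb) h
    exact shell_A hP i' _ w' c le_rfl h4' hc4 hci'.symm hb' h1
  have ex : ∀ u : V d, Ish u → ∃ i, ¬ (-2 ≤ u i ∧ u i < 2) := by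
    intro u hu
    by_contra hc
    push Not at hc
    exact hu.2 fun i => by have := hc i; push_cast; omega
  obtain ⟨i, hi⟩ := ex w hw
  obtain ⟨i', hi'⟩ := ex w' hw'
  by_cases hii : i = i'
  · subst hii
    obtain ⟨j, hj⟩ := exists_ne_fin hd i
    let c : V d := Function.update w j 3
    have hci : c i = w i := Function.update_of_ne hj.symm _ _
    have hcj : c j = 3 := Function.update_self _ _ _
    have hc4 : inA 4 c := fun j' => by
      by_cases hj' : j' = j
      · subst hj'; rw [hcj]; norm_num
      · have : c j' = w j' := Function.update_of_ne hj' _ _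
        rw [this]; exact hw.1 j'
    have h1 : P c := shell_A hP i _ c w le_rfl hc4 hw.1 hci (by rw [hci]; exact hi) h
    exact key c w' j i hj hc4 hw'.1 (by rw [hcj]; norm_num) hi' h1
  · exact key w w' i i' hii hw.1 hw'.1 hi hi' h

/-- coarse sites of the shell -/
def Wsh (L : ℕ) : Set (V d) := {z | Ish (bx L z)}

theorem Wsh_iff {L : ℕ} (hL : 1 ≤ L) (z : V d) : z ∈ (Wsh L : Set (V d)) ↔ inA (4 * L) z ∧ ¬ inA (2 * L) z := by
  show Ish (bx L z) ↔ _
  unfold Ish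
  rw [inA_bx hL, inA_bx hL]

/-- spatial shell -/
def Shl (a : ℕ) : Set (V d) := {y | y ∈ box (5 * a) (0 : V d) ∧ y ∉ box (a - 1) (0 : V d)}

theorem box_sub_Shl {n L : ℕ} (hn : 1 ≤ n) (hL : 3 ≤ L) {z : V d} (hz : z ∈ (Wsh L : Set (V d))) :
    ∀ v ∈ box (3 * n) (sc n z), v ∈ (Shl (n * L) : Set (V d)) := by
  intro v hv
  rw [Wsh_iff (by omega)] at hz
  obtain ⟨h4, h2⟩ := hz
  rw [mem_box] at hv
  have hn' : (1 : ℤ) ≤ n := by exact_mod_cast hn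
  have hL' : (3 : ℤ) ≤ L := by exact_mod_cast hL
  constructor
  · rw [mem_box]
    intro i
    have h1 := abs_le.1 (hv i)
    have h3 := h4 i
    unfold sc at h1
    push_cast at *
    rw [abs_le]
    simp only [Pi.zero_apply, sub_zero]
    constructor <;> nlinarith
  · intro hb
    rw [mem_box] at hb
    apply h2
    intro i
    have h1 := abs_le.1 (hv i)
    have h3 := abs_le.1 (hb i)
    unfold sc at h1
    have h5 : ((n * L - 1 : ℕ) : ℤ) = n * L - 1 := by
      have : 1 ≤ n * L := Nat.mul_pos (by omega) (by omega)
      push_cast [this]; rfl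
    rw [h5] at h3
    push_cast at *
    simp only [Pi.zero_apply, sub_zero] at h3
    constructor
    · by_contra hc
      push Not at hc
      have : z i + 1 ≤ -(2 * L) := by omega
      nlinarith
    · by_contra hc
      push Not at hc
      nlinarith

theorem shell_cross (hd : 1 ≤ d) {C ℓ : ℕ} (hC : C = 2 * 3 ^ d + 4) (hℓ : C + 1 ≤ ℓ) {F : Set (V d)} (k : ℕ)
    {n : ℕ} (hn : 1 ≤ n) {ω : Config d} {S : Set (V d)} {v y y' : V d}
    (hgood : ∀ b : V d, Ish b → ¬ Bad ℓ F k b)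
    (hy : y ∈ box (n * ℓ ^ k) (0 : V d)) (hy' : y' ∉ box (5 * (n * ℓ ^ k) - 1) (0 : V d))
    (h1 : Conn ω S v y) (h2 : Conn ω S v y') :
    ∃ Z : Finset (V d), 2 ^ k ≤ Z.card ∧ ∀ z ∈ Z, inG ℓ F k z ∧ z ∈ (Wsh (ℓ ^ k) : Set (V d)) ∧
      ∃ x ∈ box n (sc n z), Conn ω S v x := by
  set L := ℓ ^ k with hLdef
  have hL : 1 ≤ L := Nat.one_le_pow _ _ (by omega)
  have hL' : (1 : ℤ) ≤ L := by exact_mod_cast hL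
  have hn' : (1 : ℤ) ≤ n := by exact_mod_cast hn
  have hnL : 1 ≤ n * L := Nat.mul_pos hn hL
  obtain ⟨N, f, f0, fN, hf, hc⟩ := (h1.symm.trans h2).path
  have hst : ∀ j, dist1 (f j) (f (j+1)) = 1 → dist1 (bx n (f j)) (bx n (f (j+1))) ≤ 1 :=
    fun j h => bx_lip hn h
  let g : ℕ → ℤ := fun j => gN (bx n (f j))
  have hg0 : g 0 ≤ 2 * L := by
    have : gN (bx n (f 0)) < 2 * L := by
      rw [gN_lt (by omega), f0, inA_bx hn]
      intro i
      have := abs_le.1 ((mem_box.1 hy) i)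
      simp only [Pi.zero_apply, sub_zero] at this
      push_cast at *
      constructor <;> nlinarith
    show ((gN (bx n (f 0)) : ℕ) : ℤ) ≤ _
    exact_mod_cast this.le
  have hgN : (4 * L - 1 : ℤ) ≤ g N := by
    have : ¬ gN (bx n (f N)) < 4 * L := by
      rw [gN_lt (by omega), fN, inA_bx hn]
      intro hA
      apply hy'
      rw [mem_box]
      intro i
      have h3 := hA i
      have h5 : ((5 * (n * L) - 1 : ℕ) : ℤ) = 5 * (n * L) - 1 := by
        have : 1 ≤ 5 * (n * L) := by omega
        push_cast [this]; rfl
      rw [h5]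
      push_cast at *
      simp only [Pi.zero_apply, sub_zero]
      rw [abs_le]
      constructor <;> nlinarith
    show _ ≤ ((gN (bx n (f N)) : ℕ) : ℤ)
    push Not at this
    have h : (4 * L : ℤ) ≤ (gN (bx n (f N)) : ℕ) := by exact_mod_cast this
    omega
  obtain ⟨s1, t1, hs, hstt, ht, e1, e2, hb⟩ := crossing g 0 N (by omega) (by
    intro j _ hj
    have a1 := gN_lip (hst j (hf j hj))
    have a2 := gN_lip (by rw [dist1_comm]; exact hst j (hf j hj))
    show |((gN (bx n (f (j+1))) : ℕ) : ℤ) - (gN (bx n (f j)) : ℕ)| ≤ 1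
    rw [abs_le]; constructor <;> omega) (2 * L) (4 * L - 1) (by omega) hg0 hgN
  have hW : ∀ j, s1 ≤ j → j ≤ t1 → bx n (f j) ∈ (Wsh L : Set (V d)) := by
    intro j hj hj'
    have h3 : (2 * L : ℤ) ≤ (gN (bx n (f j)) : ℕ) ∧ ((gN (bx n (f j)) : ℕ) : ℤ) ≤ 4 * L - 1 := hb j hj hj'
    rw [Wsh_iff hL, ← gN_lt (by omega), ← gN_lt (by omega)]
    constructor <;> omega
  obtain ⟨Z, hZ, hZ'⟩ := hier_P hd hC hℓ (F := F) k (fun j => bx n (f j)) s1 t1 hstt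
    (fun j hj hj' => hst j (hf j (by omega))) (fun j hj hj' => hgood _ (hW j hj hj')) (by
      have hD := Dk_le hℓ k
      rw [← hLdef] at hD
      have e1' : gN (bx n (f s1)) < 2 * L + 1 := by
        have : ((gN (bx n (f s1)) : ℕ) : ℤ) = 2 * L := e1
        omega
      have e2' : ¬ gN (bx n (f t1)) < 4 * L - 1 := by
        have : ((gN (bx n (f t1)) : ℕ) : ℤ) = 4 * L - 1 := e2
        omega
      rw [gN_lt (by omega)] at e1' e2'
      unfold inA at e2'
      push Not at e2'
      obtain ⟨i, hi⟩ := e2'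
      refine ⟨i, ?_⟩
      have h3 := e1' i
      have h5 : ((4 * L - 1 : ℕ) : ℤ) = 4 * L - 1 := by
        have : 1 ≤ 4 * L := by omega
        push_cast [this]; rfl
      rw [h5] at hi
      push_cast at h3
      by_cases hx : -(4 * (L:ℤ) - 1) ≤ bx n (f t1) i
      · have := hi hx
        refine le_trans ?_ (le_abs_self _)
        show _ ≤ bx n (f t1) i - bx n (f s1) i
        omega
      · refine le_trans ?_ (neg_le_abs _)
        show _ ≤ -(bx n (f t1) i - bx n (f s1) i)
        omega)
  refine ⟨Z, hZ, fun z hz => ?_⟩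
  obtain ⟨hzG, j, hj, hj', rfl⟩ := hZ' z hz
  exact ⟨hzG, hW j hj hj', f j, mem_box_sc_bx hn _, h1.trans (hc j (by omega))⟩
end Mod19

section Mod20
variable {d : ℕ}

/-! ### M20: local uniqueness in a shell, given a start seed -/

def Cr (a : ℕ) (ω : Config d) (v : V d) : Prop :=
  (∃ y ∈ box a (0 : V d), Conn ω (Shl a) v y) ∧ ∃ y, y ∉ box (5 * a - 1) (0 : V d) ∧ Conn ω (Shl a) v y

def LU (a : ℕ) (ω : Config d) : Prop :=
  ∀ v ∈ (Shl a : Set (V d)), ∀ v' ∈ (Shl a : Set (V d)), Cr a ω v → Cr a ω v' → Conn ω (Shl a) v v'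

open Classical in
noncomputable def Wf (L : ℕ) : Finset (V d) := (box (4 * L) (0 : V d)).filter (· ∈ (Wsh L : Set (V d)))

theorem inA_mem_box {N : ℕ} {z : V d} (h : inA N z) : z ∈ box N (0 : V d) := by
  rw [mem_box]; intro i
  have := h i
  simp only [Pi.zero_apply, sub_zero]
  rw [abs_le]; constructor <;> omega

open Classical in
theorem mem_Wf {L : ℕ} (hL : 1 ≤ L) {z : V d} : z ∈ (Wf L : Finset (V d)) ↔ z ∈ (Wsh L : Set (V d)) := by
  unfold Wf
  rw [Finset.mem_filter]
  exact ⟨fun h => h.2, fun h => ⟨inA_mem_box ((Wsh_iff hL z).1 h).1, h⟩⟩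

theorem coe_Wf {L : ℕ} (hL : 1 ≤ L) : ((Wf L : Finset (V d)) : Set (V d)) = Wsh L := by
  ext z; rw [Finset.mem_coe, mem_Wf hL]

noncomputable def st0 (m n : ℕ) (z : V d) : St d := (box m (sc n z), {(z, sc n z)}, ∅)

theorem GI_st0 (m n : ℕ) (z : V d) (W : Set (V d)) (ω : LC d) :
    GI m n W (box m (sc n z) : Finset (V d)) ω (st0 m n z) where
  inv := by
    intro w hw
    have : w = (z, sc n z) := by simpa [st0] using hw
    subst this; exact subset_rfl
  disj := by simp [st0]
  ctr := by
    intro w hw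
    have : w = (z, sc n z) := by simpa [st0] using hw
    subst this; exact self_mem_box _ _
  fW := by intro z hz; simp [st0] at hz
  conn := fun v hv => ⟨v, hv, Conn.refl _ _ _⟩

theorem seed_final {m n : ℕ} {y : V d} (k : Fin 4) {ω : LC d} (h : Seed m y (layer (Sum.inl k) ω)) {S : Set (V d)}
    (hS : ∀ v ∈ box m y, v ∈ S) {a b : V d} (ha : a ∈ box m y) (hb : b ∈ box m y) : Conn (Fin' n ω) S a b := by
  have h1 := seed_conn h ha hb
  clear hb
  induction h1 with
  | refl => exact Conn.refl _ _ _
  | tail _ h2 ih => exact Relation.ReflTransGen.tail ih ⟨final_inl k h2.1, hS _ h2.2.1, hS _ h2.2.2⟩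

theorem LU_det (hd : 2 ≤ d) {C ℓ : ℕ} (hC : C = 2 * 3 ^ d + 4) (hℓ : C + 1 ≤ ℓ) {k : ℕ} (hk : 3 ≤ ℓ ^ k)
    {m n : ℕ} (hm : m ≤ n) (hn : 1 ≤ n) {z0 : V d} (hz0 : z0 ∈ (Wsh (ℓ ^ k) : Set (V d))) {ω : LC d} {s : St d}
    (hs : s = run m n (Wsh (ℓ ^ k)) (Wf (ℓ ^ k) : Finset (V d)).card (st0 m n z0) ω)
    (hseed : Seed m (sc n z0) (layer Lab.start ω))
    (hgood : ∀ b : V d, Ish b → ¬ Bad ℓ (s.2.2 : Set (V d)) k b)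
    (hG : inG ℓ (s.2.2 : Set (V d)) k z0)
    (hcon : ∀ v ∈ (Shl (n * ℓ ^ k) : Set (V d)), Cr (n * ℓ ^ k) (Fin' n ω) v →
      ∃ u ∈ (Wsh (ℓ ^ k) : Set (V d)), inG ℓ (s.2.2 : Set (V d)) k u ∧
        (∃ y ∈ box n (sc n u), Conn (Fin' n ω) (Shl (n * ℓ ^ k)) v y) ∧ Seed n (sc n u) (layer Lab.extra ω)) :
    LU (n * ℓ ^ k) (Fin' n ω) := by
  have hℓ5 : 5 ≤ ℓ := by omega
  have hgi : GI m n (Wsh (ℓ ^ k)) (box m (sc n z0) : Finset (V d)) ω s := by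
    rw [hs]; exact (GI_st0 m n z0 _ ω).run hn hm _
  have hcomp : ¬ ∃ w, Fr (Wsh (ℓ ^ k)) s w := by
    have := run_complete m n (Wf (ℓ ^ k)) _ (st0 m n z0) ω le_rfl
    rw [coe_Wf (by omega)] at this
    rw [hs]; exact this
  have hz0d : z0 ∈ dom s := by
    have h1 : (z0, sc n z0) ∈ s.2.1 := by
      rw [hs]; apply run_mono; simp [st0]
    exact Finset.mem_image_of_mem Prod.fst h1
  have hQ : ∀ z ∈ (dom s : Set (V d)), ∀ z' ∈ (Wsh (ℓ ^ k) : Set (V d)), dist1 z z' = 1 →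
      z' ∉ (s.2.2 : Set (V d)) → z' ∈ (dom s : Set (V d)) := by
    intro z hz z' hz' hzz hF
    by_contra hc
    obtain ⟨w, hw, rfl⟩ := Finset.mem_image.1 hz
    exact hcomp ⟨(z', w.1, w.2), hz', hc, hF, hw, hzz⟩
  have hall : ∀ u ∈ (Wsh (ℓ ^ k) : Set (V d)), inG ℓ (s.2.2 : Set (V d)) k u → u ∈ dom s := by
    have hsub : ∀ w : V d, Ish w → ∀ z, bx (ℓ ^ k) z = w → z ∈ (Wsh (ℓ ^ k) : Set (V d)) := by
      intro w hw z hz; show Ish _; rw [hz]; exact hw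
    let P : V d → Prop := fun w => ∀ z, inG ℓ (s.2.2 : Set (V d)) k z → bx (ℓ ^ k) z = w → z ∈ (dom s : Set (V d))
    have hP : ∀ w w', Ish w → Ish w' → dist1 w w' = 1 → P w → P w' := by
      intro w w' hw hw' hww hPw
      obtain ⟨z, hz, hzw⟩ := good_nonempty hd hℓ5 k w (hgood w hw)
      exact hier_C hd hℓ5 hQ k w w' (Or.inr hww) (hgood _ hw) (hgood _ hw') (hsub _ hw) (hsub _ hw')
        ⟨z, hPw z hz hzw, hz, hzw⟩
    have hP0 : P (bx (ℓ ^ k) z0) :=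
      hier_C hd hℓ5 hQ k _ _ (Or.inl rfl) (hgood _ hz0) (hgood _ hz0) (hsub _ hz0) (hsub _ hz0)
        ⟨z0, hz0d, hG, rfl⟩
    intro u hu hug
    exact shell_closed hd hP hz0 hu hP0 u hug rfl
  have hbn : ∀ u ∈ (Wsh (ℓ ^ k) : Set (V d)), ∀ v ∈ box n (sc n u), v ∈ (Shl (n * ℓ ^ k) : Set (V d)) :=
    fun u hu v hv => box_sub_Shl hn hk hu v (box_mono (by omega) _ hv)
  have hbm : ∀ v ∈ box m (sc n z0), v ∈ (Shl (n * ℓ ^ k) : Set (V d)) :=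
    fun v hv => hbn z0 hz0 v (box_mono hm _ hv)
  have hreg : Reg n (box m (sc n z0) : Finset (V d)) (Wsh (ℓ ^ k)) ⊆ (Shl (n * ℓ ^ k) : Set (V d)) := by
    rintro v (hv | ⟨z, hz, hv⟩)
    · exact hbm v hv
    · exact box_sub_Shl hn hk hz v hv
  have key : ∀ v ∈ (Shl (n * ℓ ^ k) : Set (V d)), Cr (n * ℓ ^ k) (Fin' n ω) v →
      Conn (Fin' n ω) (Shl (n * ℓ ^ k)) (sc n z0) v := by
    intro v hv hcr
    obtain ⟨u, hu, hug, ⟨y, hy, hvy⟩, hus⟩ := hcon v hv hcr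
    obtain ⟨w, hw, hwu⟩ := Finset.mem_image.1 (hall u hu hug)
    have hc1 := hgi.ctr w hw
    rw [hwu] at hc1
    have hc2 : w.2 ∈ s.1 := hgi.inv w hw (self_mem_box _ _)
    obtain ⟨a, ha, hac⟩ := hgi.conn _ hc2
    have h1 : Conn (Fin' n ω) (Shl (n * ℓ ^ k)) (sc n z0) a :=
      seed_final (m := m) (y := sc n z0) 2 hseed hbm (self_mem_box _ _) ha
    have h2 : Conn (Fin' n ω) (Shl (n * ℓ ^ k)) a w.2 := hac.monoS hreg
    have h3 : Conn (Fin' n ω) (Shl (n * ℓ ^ k)) w.2 y :=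
      seed_final (m := n) (y := sc n u) 3 hus (hbn u hu) hc1 hy
    exact h1.trans (h2.trans (h3.trans hvy.symm))
  intro v hv v' hv' hc hc'
  exact (key v hv hc).symm.trans (key v' hv' hc')

theorem LU_start (hd : 2 ≤ d) {C ℓ : ℕ} (hC : C = 2 * 3 ^ d + 4) (hℓ : C + 1 ≤ ℓ) {k : ℕ} (hk : 3 ≤ ℓ ^ k)
    {m n : ℕ} (hm : m ≤ n) (hn : 1 ≤ n) {qq : Lab d → unitInterval} (hq1 : (qq Lab.extra : ℝ) < 1)
    {η : ℝ} (hη : 0 < η) (hη1 : η ≤ 1) (hs : StepProb qq m n η) (hx : (ℓ : ℝ) ^ (2 * d) * η ≤ 1 / 2)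
    {z0 : V d} (hz0 : z0 ∈ (Wsh (ℓ ^ k) : Set (V d))) {H : Set (LC d)} (mH : MeasurableSet H)
    (dH : DetBy {i | i.2 = Lab.start} H) (hH : ∀ ω ∈ H, Seed m (sc n z0) (layer Lab.start ω)) :
    (PL qq).real (H ∩ {ω | ¬ LU (n * ℓ ^ k) (Fin' n ω)}) ≤
      ((9 ^ d : ℕ) * ((ℓ : ℝ) ^ (2 * d) * η) ^ 2 ^ k + 2 * 3 ^ d * ((ℓ : ℝ) ^ (2 * d) * η) +
        (((2 * (5 * (n * ℓ ^ k)) + 1) ^ d * 3 ^ d : ℕ) : ℝ) *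
          (1 - (qq Lab.extra : ℝ) ^ sExp d n) ^ (2 ^ k / 3 ^ d)) * (PL qq).real H := by
  classical
  set W : Set (V d) := Wsh (ℓ ^ k) with hW
  set T := (Wf (ℓ ^ k) : Finset (V d)).card with hT
  set s0 := st0 m n z0 with hs0
  have dH1 : DetBy (stI s0) H := dH.mono fun i hi => Or.inr (Or.inr ⟨2, by decide, hi⟩)
  have dH2 : DetBy {i | i.2 ≠ Lab.extra} H := dH.mono fun i hi => by
    show i.2 ≠ _
    rw [show i.2 = Lab.start from hi]; intro h; cases h
  have hgi : ∀ ω, GI m n W (box m (sc n z0) : Finset (V d)) ω (run m n W T s0 ω) :=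
    fun ω => (GI_st0 m n z0 _ ω).run hn hm _
  have hI : Perco.Inv m s0 := (GI_st0 m n z0 W (fun _ => true)).inv
  have hF : s0.2.2 = ∅ := rfl
  let B : Finset (V d) := box 4 (0 : V d)
  have b1 := bad_prob_all hη hη1 hs (ℓ := ℓ) (by omega) W T s0 hI hF mH dH1 (fun ω _ => (hgi ω).disj) k B
  have b2 := start_prob (by omega) hη hη1 hs (ℓ := ℓ) (by omega) W T s0 hI hF mH dH1 (fun ω _ => (hgi ω).disj) hx k z0
  have hB : B.card = 9 ^ d := by rw [card_box]
  rw [hB] at b1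
  let g : (Fin d → ZMod 3) → St d → Finset (V d) := fun ρ s' =>
    (Wf (ℓ ^ k)).filter fun u => inG ℓ (s'.2.2 : Set (V d)) k u ∧ res 3 u = ρ
  let E : V d × (Fin d → ZMod 3) → Set (LC d) := fun vr => H ∩ {ω |
    2 ^ k / 3 ^ d ≤ (visd n (Shl (n * ℓ ^ k)) vr.1 (g vr.2 (run m n W T s0 ω)) ω).card ∧
      ∀ u ∈ visd n (Shl (n * ℓ ^ k)) vr.1 (g vr.2 (run m n W T s0 ω)) ω, ¬ Seed n (sc n u) (layer Lab.extra ω)}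
  have b3 : ∀ vr, (PL qq).real (E vr) ≤
      (1 - (qq Lab.extra : ℝ) ^ sExp d n) ^ (2 ^ k / 3 ^ d) * (PL qq).real H := by
    intro vr
    refine contact_prob (by omega) hq1 hn W T s0 mH dH2 (Shl (n * ℓ ^ k)) vr.1 (g vr.2) ?_ _
    intro s' u hu u' hu'
    rw [(Finset.mem_filter.1 hu).2.2, (Finset.mem_filter.1 hu').2.2]
  let Vf : Finset (V d × (Fin d → ZMod 3)) := (box (5 * (n * ℓ ^ k)) (0 : V d)) ×ˢ Finset.univ
  have hVf : Vf.card = (2 * (5 * (n * ℓ ^ k)) + 1) ^ d * 3 ^ d := by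
    show (Finset.card (_ ×ˢ _)) = _
    rw [Finset.card_product, card_box, Finset.card_univ, Fintype.card_fun, ZMod.card, Fintype.card_fin]
  have b4 : (PL qq).real (⋃ vr ∈ Vf, E vr) ≤
      (((2 * (5 * (n * ℓ ^ k)) + 1) ^ d * 3 ^ d : ℕ) : ℝ) *
          (1 - (qq Lab.extra : ℝ) ^ sExp d n) ^ (2 ^ k / 3 ^ d) * (PL qq).real H := by
    refine (real_le_sum_of_subset Vf E subset_rfl).trans ?_
    refine (Finset.sum_le_sum fun vr _ => b3 vr).trans ?_
    rw [Finset.sum_const, hVf, nsmul_eq_mul, mul_assoc]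
  have cover : H ∩ {ω | ¬ LU (n * ℓ ^ k) (Fin' n ω)} ⊆
      ((H ∩ {ω | ∃ b ∈ B, Bad ℓ ((run m n W T s0 ω).2.2 : Set (V d)) k b}) ∪
        (H ∩ {ω | ¬ inG ℓ ((run m n W T s0 ω).2.2 : Set (V d)) k z0})) ∪ ⋃ vr ∈ Vf, E vr := by
    rintro ω ⟨hω, hL⟩
    by_contra hc
    rw [Set.mem_union, Set.mem_union, not_or, not_or] at hc
    obtain ⟨⟨c1, c2⟩, c3⟩ := hc
    apply hL
    have hgood : ∀ b : V d, Ish b → ¬ Bad ℓ ((run m n W T s0 ω).2.2 : Set (V d)) k b :=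
      fun b hb hbad => c1 ⟨hω, b, inA_mem_box hb.1, hbad⟩
    refine LU_det hd hC hℓ hk hm hn hz0 rfl (hH ω hω) hgood ?_ ?_
    · by_contra h; exact c2 ⟨hω, h⟩
    · intro v hv hcr
      by_contra hno
      push Not at hno
      obtain ⟨⟨y, hy, hvy⟩, y', hy', hvy'⟩ := hcr
      obtain ⟨Z, hZ, hZ'⟩ := shell_cross (by omega) hC hℓ k hn hgood hy hy' hvy hvy'
      obtain ⟨r, hrZ, hr, hres⟩ := exists_class 1 (2 ^ k / 3 ^ d) Z ((Nat.div_mul_le_self _ _).trans hZ)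
      have hin : ∃ ρ : Fin d → ZMod 3, ∀ u ∈ r, res 3 u = ρ := by
        rcases r.eq_empty_or_nonempty with h | ⟨u0, hu0⟩
        · exact ⟨0, by simp [h]⟩
        · exact ⟨res 3 u0, fun u hu => hres u hu u0 hu0⟩
      obtain ⟨ρ, hρ⟩ := hin
      apply c3
      rw [Set.mem_iUnion₂]
      refine ⟨(v, ρ), Finset.mem_product.2 ⟨hv.1, Finset.mem_univ _⟩, hω, ?_, ?_⟩
      · refine hr.trans (Finset.card_le_card fun u hu => ?_)
        obtain ⟨hu1, hu2, hu3⟩ := hZ' u (hrZ hu)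
        exact mem_visd.2 ⟨Finset.mem_filter.2 ⟨(mem_Wf (by omega)).2 hu2, hu1, hρ u hu⟩, hu3⟩
      · intro u hu
        obtain ⟨hu1, hu2⟩ := mem_visd.1 hu
        obtain ⟨hu3, hu4, hu5⟩ := Finset.mem_filter.1 hu1
        exact hno u ((mem_Wf (by omega)).1 hu3) hu4 hu2
  have h1 := real_union_le (P := PL qq) cover
  have h2 := real_union_le (P := PL qq) (subset_rfl : (H ∩ {ω | ∃ b ∈ B, Bad ℓ ((run m n W T s0 ω).2.2 : Set (V d)) k b}) ∪
        (H ∩ {ω | ¬ inG ℓ ((run m n W T s0 ω).2.2 : Set (V d)) k z0}) ⊆ _)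
  rw [add_mul, add_mul]
  linarith
end Mod20

section Mod21
variable {d : ℕ}

/-! ### M21: local uniqueness with high probability -/

theorem pcU_nonneg (U : UniformCoupling d) : 0 ≤ pcU U := Real.sInf_nonneg fun x hx => hx.1

theorem setup (hd : 2 ≤ d) (U : UniformCoupling d) {q : unitInterval} (hq : pcU U < q) {η : ℝ} (hη : 0 < η) :
    ∃ (m n : ℕ) (qq : Lab d → unitInterval), 1 ≤ m ∧ m ≤ n ∧ 0 < (qq Lab.start : ℝ) ∧ 0 < (qq Lab.extra : ℝ) ∧
      (qq Lab.extra : ℝ) < 1 ∧ StepProb qq m n η ∧ (PL qq).map (Fin' n) = Pc d q := by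
  have h0 := pcU_nonneg U
  have hq1 := q.2.2
  let p' : unitInterval := ⟨(pcU U + q) / 2, by constructor <;> linarith⟩
  have hp' : pcU U < p' := by show _ < (pcU U + q) / 2; linarith
  have hp'q : p' < q := by
    show (pcU U + q) / 2 < (q : ℝ); linarith
  obtain ⟨δ, hδ, hδ1, qq, h1, h2, h3, h4, h5⟩ := exists_params d p' q hp'q
  obtain ⟨m, n, hm, hmn, hst⟩ := step_lemma hd U hp' (lt_of_lt_of_le hp'q hq1) hδ hδ1.le hη
  refine ⟨m, n, qq, hm, hmn, by rw [h2]; exact hδ, by rw [h3]; exact hδ, by rw [h3]; exact hδ1, ?_, h5 n⟩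
  intro z' x i s R hR
  exact hst qq h1 (l1 := lab1 z') (l2 := lab2 z') (by intro h; cases h) (by intro h; cases h)
    (by intro h; injection h with h; injection h with _ h; cases h) (h4 _ _).ge (h4 _ _).ge x i s R hR

theorem meas_Cr (a : ℕ) (v : V d) : MeasurableSet {ω : Config d | Cr a ω v} :=
  meas_and (meas_ex fun y => meas_and (meas_const _) (meas_conn _ _ _))
    (meas_ex fun y => meas_and (meas_const _) (meas_conn _ _ _))

theorem meas_LU (a : ℕ) : MeasurableSet {ω : Config d | LU a ω} :=
  meas_all fun v => meas_imp (meas_const _) (meas_all fun v' => meas_imp (meas_const _)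
    (meas_imp (meas_Cr a v) (meas_imp (meas_Cr a v') (meas_conn _ _ _))))

theorem detBy_LU (a : ℕ) : DetBy (Inside (Shl a)) {ω : Config d | LU a ω} := by
  intro ω ω' h h' v hv v' hv' hc hc'
  have e : ∀ x y, Conn ω (Shl a) x y ↔ Conn ω' (Shl a) x y := fun x y => Conn.congr h
  have e2 : ∀ x, Cr a ω x ↔ Cr a ω' x := fun x => by unfold Cr; simp only [e]
  exact (e _ _).1 (h' v hv v' hv' ((e2 v).2 hc) ((e2 v').2 hc'))

theorem map_final {qq : Lab d → unitInterval} {n : ℕ} {q : unitInterval} (h : (PL qq).map (Fin' n) = Pc d q)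
    {A : Set (Config d)} (hA : MeasurableSet A) : (Pc d q).real A = (PL qq).real {ω | Fin' n ω ∈ A} := by
  rw [← h, Measure.real, Measure.real, Measure.map_apply (meas_Fin' n) hA]; rfl

theorem LU_total (hd : 2 ≤ d) {C ℓ : ℕ} (hC : C = 2 * 3 ^ d + 4) (hℓ : C + 1 ≤ ℓ) {k : ℕ} (hk : 3 ≤ ℓ ^ k)
    {m n : ℕ} (hm : m ≤ n) (hn : 1 ≤ n) {qq : Lab d → unitInterval} (hq1 : (qq Lab.extra : ℝ) < 1)
    {η : ℝ} (hη : 0 < η) (hη1 : η ≤ 1) (hs : StepProb qq m n η) (hx : (ℓ : ℝ) ^ (2 * d) * η ≤ 1 / 2)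
    (K : ℕ) (hK : 3 * K ≤ ℓ ^ k) :
    (PL qq).real {ω | ¬ LU (n * ℓ ^ k) (Fin' n ω)} ≤ (1 - (qq Lab.start : ℝ) ^ sExp d m) ^ K +
      ((9 ^ d : ℕ) * ((ℓ : ℝ) ^ (2 * d) * η) ^ 2 ^ k + 2 * 3 ^ d * ((ℓ : ℝ) ^ (2 * d) * η) +
        (((2 * (5 * (n * ℓ ^ k)) + 1) ^ d * 3 ^ d : ℕ) : ℝ) *
          (1 - (qq Lab.extra : ℝ) ^ sExp d n) ^ (2 ^ k / 3 ^ d)) := by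
  classical
  set L := ℓ ^ k with hL
  set c := ((9 ^ d : ℕ) * ((ℓ : ℝ) ^ (2 * d) * η) ^ 2 ^ k + 2 * 3 ^ d * ((ℓ : ℝ) ^ (2 * d) * η) +
        (((2 * (5 * (n * L)) + 1) ^ d * 3 ^ d : ℕ) : ℝ) *
          (1 - (qq Lab.extra : ℝ) ^ sExp d n) ^ (2 ^ k / 3 ^ d)) with hc
  have hc0 : 0 ≤ c := by
    have : 0 ≤ 1 - (qq Lab.extra : ℝ) ^ sExp d n := by
      have := pow_le_one₀ (n := sExp d n) (qq Lab.extra).2.1 hq1.le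
      linarith
    positivity
  let z : ℕ → V d := fun t => Function.update 0 ⟨0, by omega⟩ (2 * L + 3 * t : ℤ)
  have z0 : ∀ t, z t ⟨0, by omega⟩ = 2 * L + 3 * t := fun t => Function.update_self _ _ _
  have z1 : ∀ t i, i ≠ ⟨0, by omega⟩ → z t i = 0 := fun t i hi => Function.update_of_ne hi _ _
  have hzW : ∀ t < K, z t ∈ (Wsh L : Set (V d)) := by
    intro t ht
    rw [Wsh_iff (by omega)]
    constructor
    · intro i
      by_cases hi : i = ⟨0, by omega⟩
      · subst hi; rw [z0]; push_cast; constructor <;> omega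
      · rw [z1 t i hi]; push_cast; constructor <;> omega
    · intro h
      have := h ⟨0, by omega⟩
      rw [z0] at this; push_cast at this; omega
  have hdisj : ∀ t t', t ≠ t' → Disjoint (box m (sc n (z t))) (box m (sc n (z t'))) := by
    intro t t' htt
    have h1 : res 3 (z t) = res 3 (z t') := by
      funext i
      show ((z t i : ℤ) : ZMod 3) = ((z t' i : ℤ) : ZMod 3)
      by_cases hi : i = ⟨0, by omega⟩
      · subst hi; rw [z0, z0, ZMod.intCast_eq_intCast_iff_dvd_sub]
        exact ⟨(t' - t : ℤ), by push_cast; ring⟩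
      · rw [z1 t i hi, z1 t' i hi]
    have h2 : z t ≠ z t' := fun h => by
      have := congrFun h ⟨0, by omega⟩
      rw [z0, z0] at this; omega
    exact (sc_disj hn h1 h2).mono (box_mono hm _) (box_mono hm _)
  let S : ℕ → Set (LC d) := fun t => {ω | Seed m (sc n (z t)) (layer Lab.start ω)}
  have mS : ∀ t, MeasurableSet (S t) := fun t => meas_layer _ (meas_seed m _)
  have dS : ∀ t, DetBy {i | i.2 = Lab.start} (S t) := fun t => (detBy_seed m Lab.start _).mono fun i hi => hi.2
  let H : ℕ → Set (LC d) := fun t => S t ∩ ⋂ t' ∈ Finset.range t, (S t')ᶜ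
  have mH : ∀ t, MeasurableSet (H t) := fun t => (mS t).inter (Finset.measurableSet_biInter _ fun t' _ => (mS t').compl)
  have dH : ∀ t, DetBy {i | i.2 = Lab.start} (H t) := fun t => (dS t).inter (DetBy.biInter fun t' _ => (dS t').compl)
  have b1 : (PL qq).real (⋂ t ∈ Finset.range K, (S t)ᶜ) ≤ (1 - (qq Lab.start : ℝ) ^ sExp d m) ^ K := by
    have := indep_blocks' (fun i : LI d => qq i.2) (fun t => (S t)ᶜ) (fun t => seedJ m Lab.start (sc n (z t)))
      (Finset.range K) (fun t _ => (mS t).compl) (fun t _ => (detBy_seed m _ _).compl)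
      (fun t _ t' _ h => seedJ_disj (hdisj t t' h) _ _)
    change (PL qq).real _ = _ at this
    rw [this]
    refine (Finset.prod_le_prod (fun t _ => measureReal_nonneg)
      (g := fun _ => (1 - (qq Lab.start : ℝ) ^ sExp d m)) fun t _ => ?_).trans
      (by rw [Finset.prod_const, Finset.card_range])
    show (PL qq).real (S t)ᶜ ≤ _
    rw [probReal_compl_eq_one_sub (mS t)]
    linarith [seed_prob qq Lab.start m (sc n (z t))]
  have b2 : ∀ t ∈ Finset.range K, (PL qq).real (H t ∩ {ω | ¬ LU (n * L) (Fin' n ω)}) ≤ c * (PL qq).real (H t) := by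
    intro t ht
    exact LU_start hd hC hℓ hk hm hn hq1 hη hη1 hs hx (hzW t (Finset.mem_range.1 ht)) (mH t) (dH t) fun ω hω => hω.1
  have b3 : ∑ t ∈ Finset.range K, (PL qq).real (H t) ≤ 1 := by
    rw [← measureReal_biUnion_finset]
    · exact measureReal_le_one
    · intro t _ t' _ htt
      show Disjoint (H t) (H t')
      rw [Set.disjoint_left]
      intro ω h1 h2
      rcases lt_or_gt_of_ne htt with h | h
      · exact (Set.mem_iInter₂.1 h2.2 t (Finset.mem_range.2 h)) h1.1
      · exact (Set.mem_iInter₂.1 h1.2 t' (Finset.mem_range.2 h)) h2.1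
    · exact fun t _ => mH t
  have cover : {ω : LC d | ¬ LU (n * L) (Fin' n ω)} ⊆ (⋂ t ∈ Finset.range K, (S t)ᶜ) ∪
      ⋃ t ∈ Finset.range K, (H t ∩ {ω | ¬ LU (n * L) (Fin' n ω)}) := by
    intro ω hω
    by_cases h : ∃ t, t < K ∧ ω ∈ S t
    · right
      have hf := Nat.find_spec h
      rw [Set.mem_iUnion₂]
      refine ⟨Nat.find h, Finset.mem_range.2 hf.1, ⟨hf.2, ?_⟩, hω⟩
      rw [Set.mem_iInter₂]
      intro t' ht' hS
      have ht'' := Finset.mem_range.1 ht'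
      exact Nat.find_min h ht'' ⟨ht''.trans hf.1, hS⟩
    · left
      rw [Set.mem_iInter₂]
      intro t ht hS
      exact h ⟨t, Finset.mem_range.1 ht, hS⟩
  have h1 := real_union_le (P := PL qq) cover
  have h2 := real_le_sum_of_subset (P := PL qq) (Finset.range K) (fun t => H t ∩ {ω | ¬ LU (n * L) (Fin' n ω)}) subset_rfl
  have h3 := Finset.sum_le_sum b2
  rw [← Finset.mul_sum] at h3
  have h4 := mul_le_mul_of_nonneg_left b3 hc0
  linarith

theorem superexp (A B ρ : ℝ) (hA : 0 ≤ A) (hB : 0 ≤ B) (hρ : 0 ≤ ρ) (hρ1 : ρ < 1) (D : ℕ) (hD : 1 ≤ D) :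
    Tendsto (fun k : ℕ => B * A ^ k * ρ ^ (2 ^ k / D)) atTop (𝓝 0) := by
  obtain ⟨M, hM⟩ : ∃ M : ℕ, A * ρ ^ M ≤ 1 / 2 := by
    have : Tendsto (fun M : ℕ => A * ρ ^ M) atTop (𝓝 (A * 0)) :=
      (tendsto_pow_atTop_nhds_zero_of_lt_one hρ hρ1).const_mul A
    rw [mul_zero] at this
    exact (this.eventually (ge_mem_nhds (by norm_num : (0:ℝ) < 1 / 2))).exists
  have h1 : Tendsto (fun k : ℕ => (k : ℝ) ^ 1 / 2 ^ k) atTop (𝓝 0) :=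
    tendsto_pow_const_div_const_pow_of_one_lt 1 (by norm_num)
  have h2 : ∀ᶠ k : ℕ in atTop, M * k ≤ 2 ^ k / D := by
    have hp : (0 : ℝ) < 1 / (M * D + 1) := by positivity
    filter_upwards [h1.eventually (ge_mem_nhds hp)] with k hk
    rw [Nat.le_div_iff_mul_le (by omega)]
    rw [pow_one, div_le_div_iff₀ (by positivity) (by positivity)] at hk
    have : (M * k * D : ℝ) ≤ 2 ^ k := by
      have : (0 : ℝ) ≤ k := by positivity
      nlinarith
    exact_mod_cast this
  have h3 : Tendsto (fun k : ℕ => B * (1 / 2 : ℝ) ^ k) atTop (𝓝 0) := by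
    have := (tendsto_pow_atTop_nhds_zero_of_lt_one (r := (1 / 2 : ℝ)) (by norm_num) (by norm_num)).const_mul B
    rwa [mul_zero] at this
  refine squeeze_zero' (Eventually.of_forall fun k => by positivity) ?_ h3
  filter_upwards [h2] with k hk
  rw [mul_assoc]
  refine mul_le_mul_of_nonneg_left ?_ hB
  calc A ^ k * ρ ^ (2 ^ k / D) ≤ A ^ k * ρ ^ (M * k) :=
        mul_le_mul_of_nonneg_left (pow_le_pow_of_le_one hρ hρ1.le hk) (by positivity)
    _ = (A * ρ ^ M) ^ k := by rw [mul_pow, pow_mul]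
    _ ≤ _ := pow_le_pow_left₀ (by positivity) hM k

theorem LU_prob (hd : 2 ≤ d) {C ℓ : ℕ} (hC : C = 2 * 3 ^ d + 4) (hℓ : C + 1 ≤ ℓ)
    {m n : ℕ} (hm : m ≤ n) (hn : 1 ≤ n) {qq : Lab d → unitInterval} (hq0 : 0 < (qq Lab.extra : ℝ))
    (hq1 : (qq Lab.extra : ℝ) < 1) (hqs : 0 < (qq Lab.start : ℝ))
    {η ε : ℝ} (hε : 0 < ε) (hη : 0 < η) (hη1 : η ≤ 1) (hs : StepProb qq m n η) (hx : (ℓ : ℝ) ^ (2 * d) * η ≤ 1 / 2)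
    (hxε : 2 * 3 ^ d * ((ℓ : ℝ) ^ (2 * d) * η) ≤ ε / 4) {q : unitInterval} (hqq : (PL qq).map (Fin' n) = Pc d q) :
    ∃ k0, ∀ k ≥ k0, (Pc d q).real {ω | ¬ LU (n * ℓ ^ k) ω} ≤ ε := by
  set x := (ℓ : ℝ) ^ (2 * d) * η with hxdef
  have hℓ0 : 0 < (ℓ : ℝ) := by exact_mod_cast (by omega : 0 < ℓ)
  have hx0 : 0 < x := by positivity
  have hs1 : (qq Lab.start : ℝ) ≤ 1 := (qq Lab.start).2.2
  obtain ⟨K, hK⟩ : ∃ K : ℕ, (1 - (qq Lab.start : ℝ) ^ sExp d m) ^ K ≤ ε / 4 := by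
    have h1 : (qq Lab.start : ℝ) ^ sExp d m ≤ 1 := pow_le_one₀ hqs.le hs1
    have h2 : 0 < (qq Lab.start : ℝ) ^ sExp d m := by positivity
    have := tendsto_pow_atTop_nhds_zero_of_lt_one (r := 1 - (qq Lab.start : ℝ) ^ sExp d m) (by linarith) (by linarith)
    exact (this.eventually (ge_mem_nhds (by linarith : (0:ℝ) < ε / 4))).exists
  have t1 := superexp 1 ((9 ^ d : ℕ) : ℝ) x zero_le_one (by positivity) hx0.le (by linarith) 1 le_rfl
  have g1 : (qq Lab.extra : ℝ) ^ sExp d n ≤ 1 := pow_le_one₀ hq0.le hq1.le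
  have g2 : 0 < (qq Lab.extra : ℝ) ^ sExp d n := by positivity
  have t2 := superexp ((ℓ : ℝ) ^ d) ((11 * n : ℝ) ^ d * 3 ^ d) (1 - (qq Lab.extra : ℝ) ^ sExp d n)
    (by positivity) (by positivity) (by linarith) (by linarith) (3 ^ d) (Nat.one_le_pow _ _ (by norm_num))
  have hε4 : (0 : ℝ) < ε / 4 := by linarith
  obtain ⟨k0, hk0⟩ := eventually_atTop.1 ((t1.eventually (ge_mem_nhds hε4)).and (t2.eventually (ge_mem_nhds hε4)))
  refine ⟨max k0 (max 3 (3 * K)), fun k hk => ?_⟩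
  have hk1 : k0 ≤ k := le_trans (le_max_left _ _) hk
  have hk2 : 3 ≤ k := le_trans ((le_max_left _ _).trans (le_max_right _ _)) hk
  have hk3 : 3 * K ≤ k := le_trans ((le_max_right _ _).trans (le_max_right _ _)) hk
  have hkL : k < ℓ ^ k := Nat.lt_pow_self (by omega)
  obtain ⟨e1, e2⟩ := hk0 k hk1
  have hmf := map_final hqq (meas_LU (d := d) (n * ℓ ^ k)).compl
  change (Pc d q).real {ω | ¬ LU (n * ℓ ^ k) ω} = _ at hmf
  rw [hmf]
  refine (LU_total hd hC hℓ (by omega) hm hn hq1 hη hη1 hs hx K (by omega)).trans ?_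
  rw [← hxdef]
  rw [one_pow, mul_one, Nat.div_one] at e1
  have e3 : (((2 * (5 * (n * ℓ ^ k)) + 1) ^ d * 3 ^ d : ℕ) : ℝ) ≤ (11 * n : ℝ) ^ d * 3 ^ d * ((ℓ : ℝ) ^ d) ^ k := by
    have : (2 * (5 * (n * ℓ ^ k)) + 1) ^ d * 3 ^ d ≤ (11 * (n * ℓ ^ k)) ^ d * 3 ^ d := by
      have h : 1 ≤ n * ℓ ^ k := Nat.mul_pos hn (by omega)
      gcongr
      omega
    calc (((2 * (5 * (n * ℓ ^ k)) + 1) ^ d * 3 ^ d : ℕ) : ℝ) ≤ (((11 * (n * ℓ ^ k)) ^ d * 3 ^ d : ℕ) : ℝ) := by exact_mod_cast this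
      _ = _ := by push_cast; rw [← pow_mul, mul_comm d k, pow_mul]; rw [← mul_assoc, mul_pow]; ring
  have e4 := mul_le_mul_of_nonneg_right e3 (pow_nonneg (by linarith : 0 ≤ 1 - (qq Lab.extra : ℝ) ^ sExp d n) (2 ^ k / 3 ^ d))
  linarith
end Mod21

section Mod22
variable {d : ℕ}

/-! ### M22: tail estimates -/

theorem cross_shell {s : ℕ} (hs : 1 ≤ s) {ω : Config d} {S : Set (V d)} {a y : V d} (ha : a ∈ box (s - 1) (0 : V d))
    (hy : y ∉ box (5 * s - 1) (0 : V d)) (h : Conn ω S a y) :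
    ∃ v ∈ (Shl s : Set (V d)), Cr s ω v ∧ Conn ω (S ∩ (box (5 * s) (0 : V d) : Finset (V d))) a v := by
  have ha' : a ∈ box (5 * s - 1) (0 : V d) := box_mono (by omega) _ ha
  obtain ⟨x, b, hx, hb, hxb, hxS, hbS, hax, -⟩ := h.exit (T := (box (5 * s - 1) (0 : V d) : Finset (V d))) ha' hy
  have hb5 : b ∈ box (5 * s) (0 : V d) := by
    have h1 := mem_box.1 hx
    rw [mem_box]; intro i
    have h2 := abs_le.1 (coord_of_dist1 hxb.adj.le i)
    have h3 := abs_le.1 (h1 i)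
    have h4 : ((5 * s - 1 : ℕ) : ℤ) = 5 * s - 1 := by
      have : 1 ≤ 5 * s := by omega
      push_cast [this]; rfl
    rw [h4] at h3
    simp only [Pi.zero_apply, sub_zero] at *
    push_cast
    rw [abs_le]; constructor <;> omega
  have hsub : S ∩ (box (5 * s - 1) (0 : V d) : Finset (V d)) ⊆ S ∩ (box (5 * s) (0 : V d) : Finset (V d)) :=
    fun z hz => ⟨hz.1, box_mono (by omega) _ hz.2⟩
  have hx5 : x ∈ box (5 * s) (0 : V d) := box_mono (by omega) _ hx
  have hab : Conn ω (S ∩ (box (5 * s) (0 : V d) : Finset (V d))) a b :=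
    Relation.ReflTransGen.tail (hax.monoS hsub) ⟨hxb, ⟨hxS, hx5⟩, ⟨hbS, hb5⟩⟩
  have hbn : b ∉ box (s - 1) (0 : V d) := fun h => hb (box_mono (by omega) _ h)
  obtain ⟨a', b', ha'', hb', hab', -, hb'S, hb'b, haa⟩ := hab.last_exit (T := (box (s - 1) (0 : V d) : Finset (V d))) ha hbn
  have hsub2 : (S ∩ (box (5 * s) (0 : V d) : Finset (V d))) \ (box (s - 1) (0 : V d) : Finset (V d)) ⊆ (Shl s : Set (V d)) :=
    fun z hz => ⟨hz.1.2, hz.2⟩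
  have hbb := hb'b.monoS hsub2
  have hb's : b' ∈ box s (0 : V d) := by
    have h1 := mem_box.1 ha''
    rw [mem_box]; intro i
    have h2 := abs_le.1 (coord_of_dist1 hab'.adj.le i)
    have h3 := abs_le.1 (h1 i)
    have h4 : ((s - 1 : ℕ) : ℤ) = s - 1 := by push_cast [hs]; rfl
    rw [h4] at h3
    simp only [Pi.zero_apply, sub_zero] at *
    rw [abs_le]; constructor <;> omega
  have haa' : Conn ω (S ∩ (box (5 * s) (0 : V d) : Finset (V d))) a b' := by
    have := hab.trans (hb'b.monoS (Set.diff_subset)).symm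
    exact this
  exact ⟨b', ⟨hb'S.2, hb'⟩, ⟨⟨b', hb's, Conn.refl _ _ _⟩, b, hb, hbb⟩, haa'⟩

theorem Inside_disj {S S' : Set (V d)} (h : Disjoint S S') : Disjoint (Inside S) (Inside S') := by
  rw [Set.disjoint_left]
  intro e h1 h2
  obtain ⟨x, y, hxy, rfl⟩ := Edge.exists_mk e
  exact Set.disjoint_left.1 h (mkE_inside.1 h1).1 (mkE_inside.1 h2).1

theorem Shl_disj {s t : ℕ} (h : 5 * s ≤ t - 1) : Disjoint (Shl s : Set (V d)) (Shl t) := by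
  rw [Set.disjoint_left]
  intro y h1 h2
  exact h2.2 (box_mono h _ h1.1)

/-- reaching far away from a point of the box `n ℓ^k` -/
def Far (R : ℕ) (ω : Config d) (a : V d) : Prop := ∃ y, y ∉ box R (0 : V d) ∧ Conn ω Set.univ a y

def NU (n ℓ k : ℕ) (ω : Config d) : Prop :=
  ∃ a ∈ box (n * ℓ ^ k) (0 : V d), ∃ b ∈ box (n * ℓ ^ k) (0 : V d),
    Far (5 * (n * ℓ ^ (2 * k))) ω a ∧ Far (5 * (n * ℓ ^ (2 * k))) ω b ∧
      ¬ Conn ω (box (5 * (n * ℓ ^ (2 * k))) (0 : V d) : Finset (V d)) a b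

theorem meas_Far (R : ℕ) (a : V d) : MeasurableSet {ω : Config d | Far R ω a} :=
  meas_ex fun y => meas_and (meas_const _) (meas_conn _ _ _)

theorem meas_NU (n ℓ k : ℕ) : MeasurableSet {ω : Config d | NU n ℓ k ω} :=
  meas_ex fun a => meas_and (meas_const _) (meas_ex fun b => meas_and (meas_const _)
    (meas_and (meas_Far _ a) (meas_and (meas_Far _ b) (meas_not (meas_conn _ _ _)))))

theorem NU_sub {n ℓ k : ℕ} (hn : 1 ≤ n) (hℓ : 2 ≤ ℓ) {ω : Config d} (h : NU n ℓ k ω) {j : ℕ} (hj : k < j) (hj' : j ≤ 2 * k) :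
    ¬ LU (n * ℓ ^ j) ω := by
  intro hL
  obtain ⟨a, ha, b, hb, ⟨y, hy, hay⟩, ⟨y', hy', hby⟩, hab⟩ := h
  have h1 : n * ℓ ^ k ≤ n * ℓ ^ j - 1 := by
    have : ℓ ^ k < ℓ ^ j := Nat.pow_lt_pow_right (by omega) hj
    have : n * ℓ ^ k < n * ℓ ^ j := Nat.mul_lt_mul_of_pos_left this (by omega)
    omega
  have h2 : 5 * (n * ℓ ^ j) ≤ 5 * (n * ℓ ^ (2 * k)) := by
    have : ℓ ^ j ≤ ℓ ^ (2 * k) := Nat.pow_le_pow_right (by omega) hj'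
    have := Nat.mul_le_mul_left n this
    omega
  have hs : 1 ≤ n * ℓ ^ j := Nat.mul_pos (by omega) (Nat.pow_pos (by omega))
  obtain ⟨v, hv, hvc, hav⟩ := cross_shell hs (box_mono h1 _ ha) (fun hc => hy (box_mono (by omega) _ hc)) hay
  obtain ⟨v', hv', hvc', hbv⟩ := cross_shell hs (box_mono h1 _ hb) (fun hc => hy' (box_mono (by omega) _ hc)) hby
  have h3 := hL v hv v' hv' hvc hvc'
  have e1 : Set.univ ∩ ((box (5 * (n * ℓ ^ j)) (0 : V d) : Finset (V d)) : Set (V d)) ⊆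
      (box (5 * (n * ℓ ^ (2 * k))) (0 : V d) : Finset (V d)) := fun z hz => box_mono h2 _ hz.2
  have e2 : (Shl (n * ℓ ^ j) : Set (V d)) ⊆ (box (5 * (n * ℓ ^ (2 * k))) (0 : V d) : Finset (V d)) :=
    fun z hz => box_mono h2 _ hz.1
  exact hab ((hav.monoS e1).trans ((h3.monoS e2).trans (hbv.monoS e1).symm))

theorem NU_prob {n ℓ k0 : ℕ} (hn : 1 ≤ n) (hℓ : 6 ≤ ℓ) {ε : ℝ} {q : unitInterval}
    (h : ∀ k ≥ k0, (Pc d q).real {ω : Config d | ¬ LU (n * ℓ ^ k) ω} ≤ ε) {k : ℕ} (hk : k0 ≤ k) :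
    (Pc d q).real {ω : Config d | NU n ℓ k ω} ≤ ε ^ k := by
  have hsub : {ω : Config d | NU n ℓ k ω} ⊆ ⋂ j ∈ Finset.Ioc k (2 * k), {ω | LU (n * ℓ ^ j) ω}ᶜ := by
    intro ω hω
    rw [Set.mem_iInter₂]
    intro j hj
    rw [Finset.mem_Ioc] at hj
    exact NU_sub hn (by omega) hω hj.1 hj.2
  refine (measureReal_mono hsub).trans ?_
  have key : ∀ j j', j < j' → Disjoint (Inside (Shl (n * ℓ ^ j) : Set (V d))) (Inside (Shl (n * ℓ ^ j') : Set (V d))) := by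
    intro j j' hjj
    apply Inside_disj
    apply Shl_disj
    have h1 : ℓ ^ (j + 1) ≤ ℓ ^ j' := Nat.pow_le_pow_right (by omega) hjj
    have h2 : n * ℓ ^ (j + 1) ≤ n * ℓ ^ j' := Nat.mul_le_mul_left n h1
    have h3 : n * ℓ ^ (j + 1) = ℓ * (n * ℓ ^ j) := by rw [pow_succ]; ring
    have h4 : 1 ≤ n * ℓ ^ j := Nat.mul_pos (by omega) (Nat.pow_pos (by omega))
    have h5 : 6 * (n * ℓ ^ j) ≤ ℓ * (n * ℓ ^ j) := Nat.mul_le_mul_right _ hℓ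
    omega
  have := indep_blocks' (fun _ : Edge d => q) (fun j => {ω : Config d | LU (n * ℓ ^ j) ω}ᶜ)
    (fun j => Inside (Shl (n * ℓ ^ j))) (Finset.Ioc k (2 * k)) (fun j _ => (meas_LU _).compl)
    (fun j _ => (detBy_LU _).compl) (fun j _ j' _ hjj => by
      rcases lt_or_gt_of_ne hjj with h | h
      · exact key _ _ h
      · exact (key _ _ h).symm)
  change (Pc d q).real _ = _ at this
  rw [this]
  refine (Finset.prod_le_prod (fun t _ => measureReal_nonneg) (g := fun _ => ε) fun j hj => ?_).trans
      (by rw [Finset.prod_const, Nat.card_Ioc]; rw [show 2 * k - k = k by omega])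
  rw [Finset.mem_Ioc] at hj
  exact h j (by omega)
end Mod22

section Mod23
variable {d : ℕ}

/-! ### M23: the box `n ℓ^k` meets the infinite cluster with high probability -/

theorem far_exists_L (hd : 2 ≤ d) {ℓ : ℕ} (hℓ : 5 ≤ ℓ) {k : ℕ} (hk : 1 ≤ k)
    {m n : ℕ} (hm : m ≤ n) (hn : 1 ≤ n) {qq : Lab d → unitInterval}
    {η : ℝ} (hη : 0 < η) (hη1 : η ≤ 1) (hs : StepProb qq m n η) :
    (PL qq).real {ω | ¬ ∃ a ∈ box (n * ℓ ^ k) (0 : V d), Far (5 * (n * ℓ ^ (4 * k))) (Fin' n ω) a} ≤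
      (((2 * (6 * ℓ ^ (3 * k)) + 1) ^ d : ℕ) : ℝ) * ((ℓ : ℝ) ^ (2 * d) * η) ^ 2 ^ k := by
  classical
  set L := ℓ ^ k with hL
  set M := 6 * ℓ ^ (3 * k) with hM
  have hL1 : 1 ≤ L := Nat.one_le_pow _ _ (by omega)
  let B : Finset (V d) := box M (0 : V d)
  let Wb : Finset (V d) := B.biUnion (subb L)
  have hWb : ∀ z, z ∈ (Wb : Set (V d)) ↔ bx L z ∈ B := by
    intro z
    rw [Finset.mem_coe, Finset.mem_biUnion]
    constructor
    · rintro ⟨b, hb, hz⟩; rw [(mem_subb hL1).1 hz]; exact hb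
    · intro h; exact ⟨_, h, (mem_subb hL1).2 rfl⟩
  let s0 : St d := (box (n * L) (0 : V d), (subb L (0 : V d)).image (fun z => (z, sc n z)), ∅)
  have hsub0 : ∀ z ∈ subb L (0 : V d), ∀ i, 0 ≤ z i ∧ z i < L := by
    intro z hz i
    have h1 := congrFun ((mem_subb hL1).1 hz) i
    have h2 : z i / (L : ℤ) = 0 := h1
    have hL0 : (0 : ℤ) < L := by exact_mod_cast hL1
    constructor
    · have := (Int.le_ediv_iff_mul_le hL0 (a := 0) (b := z i)).1 h2.ge
      simpa using this
    · have := (Int.ediv_lt_iff_lt_mul hL0 (a := z i) (b := 1)).1 (by omega)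
      simpa using this
  have hg0 : ∀ ω, GI m n (Wb : Set (V d)) (box (n * L) (0 : V d) : Finset (V d)) ω s0 := by
    intro ω
    refine ⟨?_, ?_, ?_, ?_, fun v hv => ⟨v, hv, Conn.refl _ _ _⟩⟩
    · intro w hw
      obtain ⟨z, hz, rfl⟩ := Finset.mem_image.1 hw
      intro v hv
      show v ∈ box (n * L) (0 : V d)
      rw [mem_box] at hv ⊢
      intro i
      have h1 := hv i
      have h2 := hsub0 z hz i
      have h3 : sc n z i = n * z i := rfl
      rw [abs_le] at h1 ⊢
      simp only [Pi.zero_apply, sub_zero]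
      change _ ≤ v i - sc n z i ∧ v i - sc n z i ≤ _ at h1
      rw [h3] at h1
      push_cast
      have h4 : (m : ℤ) ≤ n := by exact_mod_cast hm
      have h5 : (0 : ℤ) ≤ n * z i := by have := h2.1; positivity
      have h6 : (n : ℤ) * z i ≤ n * (L - 1) := by
        apply mul_le_mul_of_nonneg_left _ (by positivity); omega
      have h7 : (n : ℤ) ≤ n * L := by
        have : (1 : ℤ) ≤ L := by exact_mod_cast hL1
        nlinarith
      constructor <;> linarith
    · show Disjoint _ (∅ : Finset (V d)); simp
    · intro w hw
      obtain ⟨z, hz, rfl⟩ := Finset.mem_image.1 hw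
      exact self_mem_box _ _
    · intro z hz; exact absurd hz (Finset.notMem_empty z)
  have hI : Perco.Inv m s0 := (hg0 (fun _ => true)).inv
  set T := Wb.card with hT
  have hgi := fun ω => (hg0 ω).run hn hm T
  have b1 := bad_prob_all hη hη1 hs (ℓ := ℓ) (by omega) (Wb : Set (V d)) T s0 hI rfl MeasurableSet.univ
    (H := Set.univ) (fun _ _ _ _ => trivial) (fun ω _ => (hgi ω).disj) k B
  rw [probReal_univ, mul_one, show B.card = (2 * M + 1) ^ d from card_box _ _] at b1
  refine le_trans (measureReal_mono ?_) b1
  intro ω hω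
  refine ⟨trivial, ?_⟩
  by_contra hno
  apply hω
  set s := run m n (Wb : Set (V d)) T s0 ω with hsdef
  have hgood : ∀ b ∈ B, ¬ Bad ℓ (s.2.2 : Set (V d)) k b := fun b hb hbad => hno ⟨b, hb, hbad⟩
  have hcomp : ¬ ∃ w, Fr (Wb : Set (V d)) s w := run_complete m n Wb _ s0 ω le_rfl
  have hQ : ∀ z ∈ (dom s : Set (V d)), ∀ z' ∈ (Wb : Set (V d)), dist1 z z' = 1 →
      z' ∉ (s.2.2 : Set (V d)) → z' ∈ (dom s : Set (V d)) := by
    intro z hz z' hz' hzz hF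
    by_contra hc
    obtain ⟨w, hw, rfl⟩ := Finset.mem_image.1 hz
    exact hcomp ⟨(z', w.1, w.2), hz', hc, hF, hw, hzz⟩
  let i0 : Fin d := ⟨0, by omega⟩
  let g : ℕ → V d := fun t => Function.update 0 i0 (t : ℤ)
  have g0 : ∀ t, g t i0 = t := fun t => Function.update_self _ _ _
  have g1 : ∀ t i, i ≠ i0 → g t i = 0 := fun t i hi => Function.update_of_ne hi _ _
  have hgB : ∀ t ≤ M, g t ∈ B := by
    intro t ht
    show g t ∈ box M (0 : V d)
    rw [mem_box]; intro i
    by_cases hi : i = i0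
    · subst hi; rw [g0]; simp only [Pi.zero_apply, sub_zero]; rw [abs_le]; constructor <;> omega
    · rw [g1 t i hi]; simp
  have hgW : ∀ t ≤ M, ∀ z, bx L z = g t → z ∈ (Wb : Set (V d)) := by
    intro t ht z hz; rw [hWb, hz]; exact hgB t ht
  have hga : ∀ t, dist1 (g t) (g (t + 1)) = 1 := by
    intro t
    unfold dist1
    rw [Finset.sum_eq_single i0]
    · rw [g0, g0]; push_cast; rw [show (t : ℤ) - (t + 1) = -1 by ring]; rfl
    · intro i _ hi; rw [g1 _ _ hi, g1 _ _ hi]; simp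
    · intro h; exact absurd (Finset.mem_univ _) h
  have hall : ∀ t ≤ M, ∀ z, inG ℓ (s.2.2 : Set (V d)) k z → bx L z = g t → z ∈ (dom s : Set (V d)) := by
    intro t
    induction t with
    | zero =>
      intro _ z _ hz
      have hz0 : bx L z = 0 := by
        rw [hz]; funext i
        by_cases hi : i = i0
        · subst hi; rw [g0]; simp
        · rw [g1 _ _ hi]; simp
      have h1 : (z, sc n z) ∈ s.2.1 := by
        apply run_mono
        exact Finset.mem_image.2 ⟨z, (mem_subb hL1).2 hz0, rfl⟩
      exact Finset.mem_image_of_mem Prod.fst h1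
    | succ t ih =>
      intro ht
      obtain ⟨z, hz, hzw⟩ := good_nonempty hd hℓ k (g t) (hgood _ (hgB t (by omega)))
      exact hier_C hd hℓ hQ k (g t) (g (t + 1)) (Or.inr (hga t)) (hgood _ (hgB t (by omega))) (hgood _ (hgB _ ht))
        (hgW t (by omega)) (hgW _ ht) ⟨z, ih (by omega) z hz hzw, hz, hzw⟩
  obtain ⟨z, hz, hzw⟩ := good_nonempty hd hℓ k (g M) (hgood _ (hgB M le_rfl))
  obtain ⟨w, hw, hwz⟩ := Finset.mem_image.1 (hall M le_rfl z hz hzw)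
  have hc := (hgi ω).ctr w hw
  rw [hwz] at hc
  have hc2 : w.2 ∈ s.1 := (hgi ω).inv w hw (self_mem_box _ _)
  obtain ⟨a, ha, hac⟩ := (hgi ω).conn _ hc2
  refine ⟨a, ha, w.2, ?_, hac.monoS (Set.subset_univ _)⟩
  intro hbox
  have h1 := mem_box.1 hc i0
  have h2 := mem_box.1 hbox i0
  simp only [Pi.zero_apply, sub_zero] at h2
  have h3 : sc n z i0 = n * z i0 := rfl
  rw [h3, abs_le] at h1
  have h4 : (M : ℤ) * L ≤ z i0 := by
    have h5 : z i0 / (L : ℤ) = M := (congrFun hzw i0).trans (g0 M)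
    exact (Int.le_ediv_iff_mul_le (by exact_mod_cast hL1)).1 h5.ge
  have h6 : (M : ℤ) * L = 6 * ((ℓ ^ (4 * k) : ℕ) : ℤ) := by
    rw [hM, hL]; push_cast; rw [mul_assoc, ← pow_add]; congr 2; ring
  have h7 : 5 ≤ ℓ ^ (4 * k) := by
    calc 5 ≤ ℓ := hℓ
      _ = ℓ ^ 1 := (pow_one _).symm
      _ ≤ _ := Nat.pow_le_pow_right (by omega) (by omega)
  have h7' : (5 : ℤ) ≤ ((ℓ ^ (4 * k) : ℕ) : ℤ) := by exact_mod_cast h7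
  set X : ℤ := ((ℓ ^ (4 * k) : ℕ) : ℤ) with hX
  have h8 : ((5 * (n * ℓ ^ (4 * k)) : ℕ) : ℤ) = 5 * (n * X) := by rw [hX]; push_cast; rfl
  rw [h8, abs_le] at h2
  rw [h6] at h4
  have hn' : (1 : ℤ) ≤ n := by exact_mod_cast hn
  nlinarith [mul_le_mul_of_nonneg_left h4 (by omega : (0:ℤ) ≤ n), mul_le_mul_of_nonneg_left h7' (by omega : (0:ℤ) ≤ n)]
end Mod23

section Mod24
variable {d : ℕ}

/-! ### M24: the two tail estimates -/

def Hit (r : ℕ) (ω : Config d) : Prop := ∃ x ∈ box r (0 : V d), InInfiniteCluster ω x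

theorem meas_Hit (r : ℕ) : MeasurableSet {ω : Config d | Hit r ω} :=
  meas_ex fun x => meas_and (meas_const _) (meas_inf x)

theorem Hit.mono {r r' : ℕ} (h : r ≤ r') {ω : Config d} (hh : Hit r ω) : Hit r' ω := by
  obtain ⟨x, hx, hi⟩ := hh
  exact ⟨x, box_mono h _ hx, hi⟩

theorem far_of_inf {ω : Config d} {x : V d} (h : InInfiniteCluster ω x) (R : ℕ) : Far R ω x := (inf_iff.1 h) R

theorem hit_step {n ℓ k : ℕ} (hℓ : 1 ≤ ℓ) {ω : Config d}
    (h1 : ∃ a ∈ box (n * ℓ ^ k) (0 : V d), Far (5 * (n * ℓ ^ (4 * k))) ω a) (h2 : ¬ NU n ℓ (2 * k) ω)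
    (h3 : Hit (n * ℓ ^ (2 * k)) ω) : Hit (n * ℓ ^ k) ω := by
  obtain ⟨a, ha, hfa⟩ := h1
  obtain ⟨x, hx, hxi⟩ := h3
  refine ⟨a, ha, ?_⟩
  by_contra hai
  apply h2
  rw [show 4 * k = 2 * (2 * k) by ring] at hfa
  refine ⟨a, box_mono (Nat.mul_le_mul_left n (Nat.pow_le_pow_right hℓ (by omega))) _ ha, x, hx, hfa, far_of_inf hxi _, ?_⟩
  intro hc
  exact hai (inf_of_conn hxi (hc.monoS (Set.subset_univ _)).symm)

theorem tail (hd : 2 ≤ d) (U : UniformCoupling d) {q : unitInterval} (hq : pcU U < q) {ε : ℝ} (hε : 0 < ε) (hε2 : ε ≤ 1 / 2) :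
    ∃ n k0 : ℕ, 1 ≤ n ∧ ∀ k ≥ k0, (Pc d q).real {ω | ¬ Hit (n * (2 * 3 ^ d + 5) ^ k) ω} ≤ 4 * ε ^ k ∧
      (Pc d q).real {ω | NU n (2 * 3 ^ d + 5) k ω} ≤ ε ^ k := by
  set ℓ := 2 * 3 ^ d + 5 with hℓ
  have h3 : 1 ≤ 3 ^ d := Nat.one_le_pow _ _ (by norm_num)
  have hℓ0 : 0 < (ℓ : ℝ) := by exact_mod_cast (by omega : 0 < ℓ)
  have h3r : (1 : ℝ) ≤ 3 ^ d := by exact_mod_cast h3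
  let η : ℝ := ε / (8 * 3 ^ d * (ℓ : ℝ) ^ (2 * d))
  have hη : 0 < η := by positivity
  have hpow : (1 : ℝ) ≤ (ℓ : ℝ) ^ (2 * d) := one_le_pow₀ (by exact_mod_cast (by omega : 1 ≤ ℓ))
  have hxe : (ℓ : ℝ) ^ (2 * d) * η = ε / (8 * 3 ^ d) := by
    show (ℓ : ℝ) ^ (2 * d) * (ε / (8 * 3 ^ d * (ℓ : ℝ) ^ (2 * d))) = _
    field_simp
  have hx : (ℓ : ℝ) ^ (2 * d) * η ≤ 1 / 2 := by
    rw [hxe, div_le_iff₀ (by positivity)]; linarith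
  have hη1 : η ≤ 1 := by
    have : η ≤ (ℓ : ℝ) ^ (2 * d) * η := le_mul_of_one_le_left hη.le hpow
    linarith
  have hxε : 2 * 3 ^ d * ((ℓ : ℝ) ^ (2 * d) * η) ≤ ε / 4 := by
    rw [hxe]; apply le_of_eq; field_simp; ring
  obtain ⟨m, n, qq, hm1, hmn, hqs, hq0, hq1, hst, hmap⟩ := setup hd U hq hη
  have hn : 1 ≤ n := hm1.trans hmn
  obtain ⟨k1, hk1⟩ := LU_prob hd rfl (le_refl (2 * 3 ^ d + 4 + 1)) hmn hn hq0 hq1 hqs hε hη hη1 hst hx hxε hmap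
  have hx0 : 0 < (ℓ : ℝ) ^ (2 * d) * η := by positivity
  have t1 := superexp ((ℓ : ℝ) ^ (3 * d) / ε) ((13 : ℝ) ^ d) ((ℓ : ℝ) ^ (2 * d) * η) (by positivity) (by positivity)
    hx0.le (by linarith) 1 le_rfl
  obtain ⟨k2, hk2⟩ := eventually_atTop.1 (t1.eventually (ge_mem_nhds (zero_lt_one)))
  have hT2 : ∀ k ≥ k1, (Pc d q).real {ω | NU n ℓ k ω} ≤ ε ^ k := fun k hk => NU_prob hn (by omega) hk1 hk
  have hfar : ∀ k ≥ max k2 1, (Pc d q).real {ω | ¬ ∃ a ∈ box (n * ℓ ^ k) (0 : V d), Far (5 * (n * ℓ ^ (4 * k))) ω a} ≤ ε ^ k := by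
    intro k hk
    have hmf := map_final hmap (meas_ex fun a => meas_and (meas_const (a ∈ box (n * ℓ ^ k) (0 : V d)))
      (meas_Far (d := d) (5 * (n * ℓ ^ (4 * k))) a)).compl
    change (Pc d q).real {ω | ¬ ∃ a, a ∈ box (n * ℓ ^ k) (0 : V d) ∧ Far (5 * (n * ℓ ^ (4 * k))) ω a} = _ at hmf
    rw [hmf]
    refine (far_exists_L hd (ℓ := ℓ) (by omega) (le_trans (le_max_right _ _) hk) hmn hn hη hη1 hst).trans ?_
    have h := hk2 k (le_trans (le_max_left _ _) hk)
    rw [Nat.div_one, div_pow] at h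
    have e1 : (((2 * (6 * ℓ ^ (3 * k)) + 1) ^ d : ℕ) : ℝ) ≤ 13 ^ d * ((ℓ : ℝ) ^ (3 * d)) ^ k := by
      have h1 : 1 ≤ ℓ ^ (3 * k) := Nat.one_le_pow _ _ (by omega)
      have : (2 * (6 * ℓ ^ (3 * k)) + 1) ^ d ≤ (13 * ℓ ^ (3 * k)) ^ d := Nat.pow_le_pow_left (by omega) d
      calc (((2 * (6 * ℓ ^ (3 * k)) + 1) ^ d : ℕ) : ℝ) ≤ (((13 * ℓ ^ (3 * k)) ^ d : ℕ) : ℝ) := by exact_mod_cast this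
        _ = _ := by push_cast; rw [mul_pow, ← pow_mul, ← pow_mul]; congr 2; ring
    have e2 := mul_le_mul_of_nonneg_right e1 (pow_nonneg hx0.le (2 ^ k))
    refine e2.trans ?_
    have hεk : 0 < ε ^ k := by positivity
    rw [mul_div_assoc', div_mul_eq_mul_div, div_le_iff₀ hεk, one_mul] at h
    exact h
  have hstep : ∀ k ≥ max (max k1 k2) 1, (Pc d q).real {ω | ¬ Hit (n * ℓ ^ k) ω} ≤
      2 * ε ^ k + (Pc d q).real {ω | ¬ Hit (n * ℓ ^ (2 * k)) ω} := by
    intro k hk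
    have hka : k1 ≤ k := le_trans ((le_max_left _ _).trans (le_max_left _ _)) hk
    have hkb : k2 ≤ k := le_trans ((le_max_right _ _).trans (le_max_left _ _)) hk
    have hkc : 1 ≤ k := le_trans (le_max_right _ _) hk
    have hcov : {ω : Config d | ¬ Hit (n * ℓ ^ k) ω} ⊆
        ({ω | ¬ ∃ a ∈ box (n * ℓ ^ k) (0 : V d), Far (5 * (n * ℓ ^ (4 * k))) ω a} ∪ {ω | NU n ℓ (2 * k) ω}) ∪
          {ω | ¬ Hit (n * ℓ ^ (2 * k)) ω} := by
      intro ω hω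
      by_contra hc
      rw [Set.mem_union, Set.mem_union, not_or, not_or] at hc
      exact hω (hit_step (by omega) (not_not.1 hc.1.1) hc.1.2 (not_not.1 hc.2))
    have r1 := real_union_le (P := Pc d q) hcov
    have r2 := real_union_le (P := Pc d q) (subset_rfl : ({ω | ¬ ∃ a ∈ box (n * ℓ ^ k) (0 : V d), Far (5 * (n * ℓ ^ (4 * k))) ω a} ∪ {ω | NU n ℓ (2 * k) ω}) ⊆ _)
    have r3 := hfar k (max_le hkb hkc)
    have r4 := hT2 (2 * k) (by omega)
    have r5 : ε ^ (2 * k) ≤ ε ^ k := pow_le_pow_of_le_one hε.le (by linarith) (by omega)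
    linarith
  have hiter : ∀ I : ℕ, ∀ k ≥ max (max k1 k2) 1, (Pc d q).real {ω | ¬ Hit (n * ℓ ^ k) ω} ≤
      4 * ε ^ k + (Pc d q).real {ω | ¬ Hit (n * ℓ ^ (2 ^ I * k)) ω} := by
    intro I
    induction I with
    | zero => intro k hk; rw [pow_zero, one_mul]; have : 0 ≤ ε ^ k := by positivity
              linarith
    | succ I ih =>
      intro k hk
      have hkc : 1 ≤ k := le_trans (le_max_right _ _) hk
      have r1 := hstep k hk
      have r2 := ih (2 * k) (by omega)
      have r3 : ε ^ (2 * k) ≤ ε ^ k * (1 / 2) := by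
        rw [two_mul, pow_add]
        apply mul_le_mul_of_nonneg_left _ (by positivity)
        calc ε ^ k ≤ ε ^ 1 := pow_le_pow_of_le_one hε.le (by linarith) hkc
          _ ≤ 1 / 2 := by rw [pow_one]; exact hε2
      rw [show 2 ^ I * (2 * k) = 2 ^ (I + 1) * k by ring] at r2
      linarith
  refine ⟨n, max (max k1 k2) 1, hn, fun k hk => ⟨?_, hT2 k (le_trans ((le_max_left _ _).trans (le_max_left _ _)) hk)⟩⟩
  have hkc : 1 ≤ k := le_trans (le_max_right _ _) hk
  refine le_of_forall_pos_le_add fun δ hδ => ?_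
  obtain ⟨M, hM1, hM⟩ := exists_box_inf hd U hq hδ
  refine (hiter M k hk).trans ?_
  have hle : M ≤ n * ℓ ^ (2 ^ M * k) := by
    have a1 : M < 2 ^ M := Nat.lt_two_pow_self
    have a2 : 2 ^ M * k < ℓ ^ (2 ^ M * k) := Nat.lt_pow_self (by omega)
    have a3 : 2 ^ M * 1 ≤ 2 ^ M * k := Nat.mul_le_mul_left _ hkc
    have a4 : 1 * ℓ ^ (2 ^ M * k) ≤ n * ℓ ^ (2 ^ M * k) := Nat.mul_le_mul_right _ hn
    omega
  have hP : (Pc d q).real {ω | ¬ Hit (n * ℓ ^ (2 ^ M * k)) ω} ≤ (Pc d q).real {ω : Config d | Hit M ω}ᶜ :=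
    measureReal_mono fun ω hω hh => hω (Hit.mono hle hh)
  rw [probReal_compl_eq_one_sub (meas_Hit M)] at hP
  change _ ≤ (Pc d q).real {ω : Config d | Hit M ω} at hM
  linarith
end Mod24

section Mod25
variable {d : ℕ}

/-! ### M25: the regularised chemical distances -/

/-- `a` is a nearest point of the infinite cluster to `y` -/
def Am (ω : Config d) (y a : V d) : Prop := InInfiniteCluster ω a ∧ ∀ z, InInfiniteCluster ω z → dist1 y a ≤ dist1 y z

noncomputable def FX (w w1 w2 : Config d) (y y' : V d) : ℝ≥0∞ :=
  ⨆ ab : V d × V d, ⨆ (_ : Am w1 y ab.1 ∧ Am w2 y' ab.2), chemDist w ab.1 ab.2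

theorem le_FX {w w1 w2 : Config d} {y y' a b : V d} (ha : Am w1 y a) (hb : Am w2 y' b) :
    chemDist w a b ≤ FX w w1 w2 y y' :=
  le_iSup₂ (f := fun (ab : V d × V d) (_ : Am w1 y ab.1 ∧ Am w2 y' ab.2) => chemDist w ab.1 ab.2) (a, b) ⟨ha, hb⟩

theorem FX_le {w w1 w2 : Config d} {y y' : V d} {c : ℝ≥0∞}
    (h : ∀ a b, Am w1 y a → Am w2 y' b → chemDist w a b ≤ c) : FX w w1 w2 y y' ≤ c :=
  iSup₂_le fun ab hab => h _ _ hab.1 hab.2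

theorem Am_exists {ω : Config d} (h : ∃ x, InInfiniteCluster ω x) (y : V d) : ∃ a, Am ω y a := by
  obtain ⟨a, ha, hm⟩ := WellFounded.has_min (measure (fun x : V d => dist1 y x)).wf {x | InInfiniteCluster ω x} h
  exact ⟨a, ha, fun z hz => not_lt.1 (hm z hz)⟩

theorem regPoint_Am {ω : Config d} (h : ∃ x, InInfiniteCluster ω x) (y : V d) : Am ω y (regPoint ω y) := by
  have h' : ∃ a : V d, InInfiniteCluster ω a ∧ ∀ z : V d, InInfiniteCluster ω z → dist1 y a ≤ dist1 y z := Am_exists h y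
  unfold regPoint
  rw [dif_pos h']
  exact h'.choose_spec

theorem FX_tri {w w1 w2 w3 : Config d} (h : ∃ x, InInfiniteCluster w2 x) (y y' y'' : V d) :
    FX w w1 w3 y y'' ≤ FX w w1 w2 y y' + FX w w2 w3 y' y'' := by
  obtain ⟨c, hc⟩ := Am_exists h y'
  exact FX_le fun a b ha hb => (chemDist_triangle w a c b).trans (add_le_add (le_FX ha hc) (le_FX hc hb))

theorem FX_symm (w w1 w2 : Config d) (y y' : V d) : FX w w1 w2 y y' = FX w w2 w1 y' y := by
  apply le_antisymm
  · exact FX_le fun a b ha hb => by rw [chemDist_comm]; exact le_FX hb ha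
  · exact FX_le fun a b ha hb => by rw [chemDist_comm]; exact le_FX hb ha

theorem Am_tr (v : V d) (ω : Config d) (y a : V d) :
    Am (fun e => ω ((Iso.tr v).e e)) y a ↔ Am ω (y + v) (a + v) := by
  unfold Am
  rw [inf_iso]
  have hiso : ∀ x y : V d, dist1 (x + v) (y + v) = dist1 x y := fun x y => (Iso.tr v).iso x y
  constructor
  · rintro ⟨h1, h2⟩
    refine ⟨h1, fun z hz => ?_⟩
    have h3 := h2 (z - v) (by rw [inf_iso]; simpa using hz)
    rw [hiso]
    rw [← hiso y (z - v)] at h3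
    simpa using h3
  · rintro ⟨h1, h2⟩
    refine ⟨h1, fun z hz => ?_⟩
    rw [inf_iso] at hz
    have := h2 _ hz
    rw [hiso, Iso.tr_apply, hiso] at this
    exact this

theorem FX_tr (v : V d) (w w1 w2 : Config d) (y y' : V d) :
    FX (fun e => w ((Iso.tr v).e e)) (fun e => w1 ((Iso.tr v).e e)) (fun e => w2 ((Iso.tr v).e e)) y y' =
      FX w w1 w2 (y + v) (y' + v) := by
  apply le_antisymm
  · refine FX_le fun a b ha hb => ?_
    rw [chemDist_iso]
    exact le_FX ((Am_tr _ _ _ _).1 ha) ((Am_tr _ _ _ _).1 hb)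
  · refine FX_le fun a b ha hb => ?_
    have h1 : chemDist (fun e => w ((Iso.tr v).e e)) (a - v) (b - v) = chemDist w a b := by
      rw [chemDist_iso]; simp
    rw [← h1]
    exact le_FX ((Am_tr _ _ _ _).2 (by simpa using ha)) ((Am_tr _ _ _ _).2 (by simpa using hb))

theorem meas_steps (n : ℕ) (x y : V d) : MeasurableSet {ω : Config d | Steps ω n x y} := by
  induction n generalizing y with
  | zero => exact meas_const _
  | succ n ih => exact meas_ex fun z => meas_and (ih z) (meas_edgeOpen z y)

theorem meas_iSupP {Ω : Type*} [MeasurableSpace Ω] {P : Ω → Prop} (hP : MeasurableSet {ω | P ω}) {g : Ω → ℝ≥0∞} (hg : Measurable g) :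
    Measurable fun ω => ⨆ (_ : P ω), g ω := by
  classical
  have : (fun ω => ⨆ (_ : P ω), g ω) = fun ω => if P ω then g ω else 0 := by
    funext ω
    by_cases h : P ω <;> simp [h]
  rw [this]
  exact Measurable.ite hP hg measurable_const

theorem meas_chemDist (x y : V d) : Measurable fun ω : Config d => chemDist ω x y := by
  classical
  have : (fun ω : Config d => chemDist ω x y) = fun ω => ⨅ n : ℕ, if Steps ω n x y then (n : ℝ≥0∞) else ⊤ := by
    funext ω
    apply le_antisymm
    · refine le_iInf fun n => ?_
      split_ifs with h
      · exact chemDist_le_of_steps h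
      · exact le_top
    · by_cases hc : Connected ω x y
      · obtain ⟨n, hn, he⟩ := exists_steps_chemDist hc
        refine (iInf_le _ n).trans ?_
        simp [hn, he]
      · have : chemDist ω x y = ⊤ := not_not.1 hc
        rw [this]; exact le_top
  rw [this]
  exact Measurable.iInf fun n => Measurable.ite (meas_steps n x y) measurable_const measurable_const

theorem meas_Am (y a : V d) : MeasurableSet {ω : Config d | Am ω y a} :=
  meas_and (meas_inf a) (meas_all fun z => meas_imp (meas_inf z) (meas_const _))

theorem meas_FX (p p1 p2 : ℝ) (y y' : V d) :
    Measurable fun u : Edge d → ℝ => FX (cfgAt u p) (cfgAt u p1) (cfgAt u p2) y y' := by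
  refine Measurable.iSup fun ab => meas_iSupP (meas_and ?_ ?_) ((meas_chemDist _ _).comp (meas_cfgAt p))
  · exact meas_cfgAt p1 (meas_Am y ab.1)
  · exact meas_cfgAt p2 (meas_Am y' ab.2)
end Mod25

section Mod26
variable {d : ℕ}

/-! ### M26: integrability -/

theorem FX_det {w w1 w2 : Config d} (h1 : w1 ≤ w) (h2 : w2 ≤ w) {n ℓ j r1 r2 : ℕ} {y : V d}
    (hr1 : d * r1 ≤ n * ℓ ^ j) (hr2 : dist1 0 y + d * r2 ≤ n * ℓ ^ j)
    (hh1 : Hit r1 w1) (hh2 : Hit r2 (fun e => w2 ((Iso.tr y).e e))) (hN : ¬ NU n ℓ j w) :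
    FX w w1 w2 0 y ≤ ((2 * (5 * (n * ℓ ^ (2 * j))) + 1) ^ d : ℕ) := by
  refine FX_le fun a b ha hb => ?_
  obtain ⟨x, hx, hxi⟩ := hh1
  obtain ⟨x', hx', hxi'⟩ := hh2
  rw [inf_iso, Iso.tr_apply] at hxi'
  have ha1 : dist1 0 a ≤ n * ℓ ^ j := ((ha.2 x hxi).trans (dist1_le_of_box hx)).trans hr1
  have hb0 : dist1 y b ≤ d * r2 := by
    refine (hb.2 _ hxi').trans ?_
    have : dist1 (0 + y) (x' + y) = dist1 0 x' := (Iso.tr y).iso 0 x'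
    rw [zero_add] at this
    rw [this]; exact dist1_le_of_box hx'
  have hb1 : dist1 0 b ≤ n * ℓ ^ j := by
    have := dist1_triangle (0 : V d) y b
    omega
  have ha2 := box_mono ha1 _ (mem_box_dist1 0 a)
  have hb2 := box_mono hb1 _ (mem_box_dist1 0 b)
  have hc : Conn w (box (5 * (n * ℓ ^ (2 * j))) (0 : V d) : Finset (V d)) a b := by
    by_contra hc
    exact hN ⟨a, ha2, b, hb2, far_of_inf (inf_mono_cfg h1 ha.1) _, far_of_inf (inf_mono_cfg h2 hb.1) _, hc⟩
  have ha3 : a ∈ box (5 * (n * ℓ ^ (2 * j))) (0 : V d) := by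
    refine box_mono ?_ _ ha2
    rcases Nat.eq_zero_or_pos ℓ with h | h
    · subst h
      rcases Nat.eq_zero_or_pos j with h | h
      · subst h; simp; omega
      · rw [zero_pow h.ne']; simp
    · have : n * ℓ ^ j ≤ n * ℓ ^ (2 * j) := Nat.mul_le_mul_left n (Nat.pow_le_pow_right h (by omega))
      omega
  have := hc.chemDist_le ha3
  rwa [card_box] at this

theorem lint_tail {Ω : Type*} [MeasurableSpace Ω] {P : Measure Ω} [IsProbabilityMeasure P] {f : Ω → ℝ≥0∞} {B : ℕ → Set Ω}
    (mB : ∀ k, MeasurableSet (B k)) {c a m r : ℝ≥0∞} (hc0 : c ≠ 0) (hc : c ≠ ⊤) (ha1 : 1 ≤ a) (ha : a ≠ ⊤) (hm : m ≠ ⊤)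
    (har : a * r < 1) (hf : ∀ k, ∀ ω ∉ B k, f ω ≤ c * a ^ k) (hB : ∀ k, P (B k) ≤ m * r ^ k) : ∫⁻ ω, f ω ∂P < ⊤ := by
  have hp : ∀ ω, f ω ≤ c + ∑' k, (B k).indicator (fun _ => c * a ^ (k + 1)) ω := by
    intro ω
    by_cases h : ∃ k, ω ∉ B k
    · classical
      have h1 := Nat.find_spec h
      have h2 := hf _ ω h1
      rcases hk : Nat.find h with _ | j
      · rw [hk, pow_zero, mul_one] at h2
        exact h2.trans le_self_add
      · rw [hk] at h2
        have h3 : ω ∈ B j := by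
          by_contra h3
          have := Nat.find_min' h h3
          omega
        calc f ω ≤ c * a ^ (j + 1) := h2
          _ = (B j).indicator (fun _ => c * a ^ (j + 1)) ω := by rw [Set.indicator_of_mem h3]
          _ ≤ ∑' k, (B k).indicator (fun _ => c * a ^ (k + 1)) ω := ENNReal.le_tsum (f := fun k => (B k).indicator (fun _ => c * a ^ (k + 1)) ω) j
          _ ≤ _ := le_add_self
    · push Not at h
      have : ∑' k, (B k).indicator (fun _ => c * a ^ (k + 1)) ω = ⊤ := by
        rw [eq_top_iff, ← ENNReal.tsum_const_eq_top_of_ne_zero (α := ℕ) hc0]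
        refine ENNReal.tsum_le_tsum fun k => ?_
        rw [Set.indicator_of_mem (h k)]
        exact le_mul_of_one_le_right' (one_le_pow₀ ha1)
      rw [this]; simp
  refine (lintegral_mono hp).trans_lt ?_
  rw [lintegral_add_left measurable_const, lintegral_const, measure_univ, mul_one,
    lintegral_tsum fun k => (measurable_const.indicator (mB k)).aemeasurable]
  refine ENNReal.add_lt_top.2 ⟨hc.lt_top, ?_⟩
  have : ∀ k, ∫⁻ ω, (B k).indicator (fun _ => c * a ^ (k + 1)) ω ∂P ≤ (c * a * m) * (a * r) ^ k := by
    intro k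
    rw [lintegral_indicator_const (mB k)]
    calc c * a ^ (k + 1) * P (B k) ≤ c * a ^ (k + 1) * (m * r ^ k) := by gcongr; exact hB k
      _ = _ := by rw [mul_pow, pow_succ]; ring
  refine (ENNReal.tsum_le_tsum this).trans_lt ?_
  rw [ENNReal.tsum_mul_left, ENNReal.tsum_geometric]
  refine ENNReal.mul_lt_top (ENNReal.mul_lt_top (ENNReal.mul_lt_top hc.lt_top ha.lt_top) hm.lt_top) ?_
  rw [ENNReal.inv_lt_top]
  exact tsub_pos_of_lt har

theorem cfgAt_le (u : Edge d → ℝ) {p q : ℝ} (h : p ≤ q) : cfgAt u p ≤ cfgAt u q := by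
  intro e
  cases h1 : cfgAt u p e
  · exact Bool.false_le _
  · rw [cfgAt_mono h h1]

theorem FX_int (hd : 2 ≤ d) (U : UniformCoupling d) {p p1 p2 : ℝ} (hp : p ≤ 1) (hp1 : pcU U < p1) (hp2 : pcU U < p2)
    (h1 : p1 ≤ p) (h2 : p2 ≤ p) (y : V d) : ∫⁻ u, FX (cfgAt u p) (cfgAt u p1) (cfgAt u p2) 0 y ∂U.Q < ⊤ := by
  have := U.prob
  have hpc := pcU_nonneg U
  let P : unitInterval := ⟨p, by linarith, hp⟩
  let P1 : unitInterval := ⟨p1, by linarith, by linarith⟩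
  let P2 : unitInterval := ⟨p2, by linarith, by linarith⟩
  set ℓ := 2 * 3 ^ d + 5 with hℓ
  have hℓ1 : 1 ≤ ℓ := by omega
  have hℓ2 : 2 ≤ ℓ := by omega
  set A : ℕ := ℓ ^ (2 * d) with hA
  have hA1 : 1 ≤ A := Nat.one_le_pow _ _ hℓ1
  have hA1r : (1 : ℝ) ≤ A := by exact_mod_cast hA1
  set ε : ℝ := 1 / (2 * A) with hε
  have hε0 : 0 < ε := by positivity
  have hε2 : ε ≤ 1 / 2 := by rw [hε]; apply one_div_le_one_div_of_le (by norm_num); linarith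
  obtain ⟨n, k0, hn, ht⟩ := tail hd U (q := P) (lt_of_lt_of_le hp1 h1) hε0 hε2
  obtain ⟨n1, k1, hn1, ht1⟩ := tail hd U (q := P1) hp1 hε0 hε2
  obtain ⟨n2, k2, hn2, ht2⟩ := tail hd U (q := P2) hp2 hε0 hε2
  rw [← hℓ] at ht ht1 ht2
  set s := d * n1 + d * n2 + dist1 0 y with hs
  set K := k0 + k1 + k2 with hK
  have hsl : s ≤ ℓ ^ s := (Nat.lt_pow_self (by omega)).le
  let B : ℕ → Set (Edge d → ℝ) := fun k =>
    ({u | cfgAt u p1 ∈ {ω | ¬ Hit (n1 * ℓ ^ (K + k)) ω}} ∪ {u | cfgAt u p2 ∈ {ω | (fun e => ω ((Iso.tr y).e e)) ∈ {ω | ¬ Hit (n2 * ℓ ^ (K + k)) ω}}}) ∪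
      {u | cfgAt u p ∈ {ω | NU n ℓ (K + k + s) ω}}
  have mT : Measurable (fun (ω : Config d) e => ω ((Iso.tr y).e e)) := measurable_pi_lambda _ fun e => measurable_pi_apply _
  have m1 : ∀ r, MeasurableSet {ω : Config d | ¬ Hit r ω} := fun r => meas_not (meas_Hit r)
  have m2 : ∀ r, MeasurableSet {ω : Config d | (fun e => ω ((Iso.tr y).e e)) ∈ {ω | ¬ Hit r ω}} := fun r => mT (m1 r)
  have m3 : ∀ k, MeasurableSet {ω : Config d | NU n ℓ k ω} := fun k => meas_NU n ℓ k
  have mB : ∀ k, MeasurableSet (B k) := fun k =>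
    ((meas_cfgAt p1 (m1 _)).union (meas_cfgAt p2 (m2 _))).union (meas_cfgAt p (m3 _))
  have hB : ∀ k, U.Q.real (B k) ≤ 9 * ε ^ k := by
    intro k
    have e1 : U.Q.real {u | cfgAt u p1 ∈ {ω | ¬ Hit (n1 * ℓ ^ (K + k)) ω}} ≤ 4 * ε ^ (K + k) := by
      rw [UQ_real_cfgAt U P1 (m1 _)]; exact (ht1 (K + k) (by omega)).1
    have e2 : U.Q.real {u | cfgAt u p2 ∈ {ω | (fun e => ω ((Iso.tr y).e e)) ∈ {ω | ¬ Hit (n2 * ℓ ^ (K + k)) ω}}} ≤ 4 * ε ^ (K + k) := by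
      rw [UQ_real_cfgAt U P2 (m2 _), Pc_iso _ _ (m1 _)]; exact (ht2 (K + k) (by omega)).1
    have e3 : U.Q.real {u | cfgAt u p ∈ {ω | NU n ℓ (K + k + s) ω}} ≤ ε ^ (K + k + s) := by
      rw [UQ_real_cfgAt U P (m3 _)]; exact (ht (K + k + s) (by omega)).2
    have e4 := measureReal_union_le (μ := U.Q) ({u | cfgAt u p1 ∈ {ω | ¬ Hit (n1 * ℓ ^ (K + k)) ω}} ∪ {u | cfgAt u p2 ∈ {ω | (fun e => ω ((Iso.tr y).e e)) ∈ {ω | ¬ Hit (n2 * ℓ ^ (K + k)) ω}}}) {u | cfgAt u p ∈ {ω | NU n ℓ (K + k + s) ω}}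
    have e5 := measureReal_union_le (μ := U.Q) {u | cfgAt u p1 ∈ {ω | ¬ Hit (n1 * ℓ ^ (K + k)) ω}} {u | cfgAt u p2 ∈ {ω | (fun e => ω ((Iso.tr y).e e)) ∈ {ω | ¬ Hit (n2 * ℓ ^ (K + k)) ω}}}
    have e6 : ε ^ (K + k) ≤ ε ^ k := pow_le_pow_of_le_one hε0.le (by linarith) (by omega)
    have e7 : ε ^ (K + k + s) ≤ ε ^ k := pow_le_pow_of_le_one hε0.le (by linarith) (by omega)
    show U.Q.real (_ ∪ _) ≤ _
    linarith
  refine lint_tail (B := B) mB (c := (((11 * n * ℓ ^ (2 * (K + s))) ^ d : ℕ) : ℝ≥0∞)) (a := (A : ℝ≥0∞)) (m := ENNReal.ofReal 9) (r := ENNReal.ofReal ε) ?_ (ENNReal.natCast_ne_top _) (by exact_mod_cast hA1) (ENNReal.natCast_ne_top _) ENNReal.ofReal_ne_top ?_ ?_ ?_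
  · have : 0 < (11 * n * ℓ ^ (2 * (K + s))) ^ d := by positivity
    exact_mod_cast this.ne'
  · rw [← ENNReal.ofReal_natCast, ← ENNReal.ofReal_mul (by positivity), ENNReal.ofReal_lt_one, hε]
    rw [mul_one_div, div_lt_one (by positivity)]; linarith
  · intro k u hu
    have hu' : Hit (n1 * ℓ ^ (K + k)) (cfgAt u p1) ∧ Hit (n2 * ℓ ^ (K + k)) (fun e => cfgAt u p2 ((Iso.tr y).e e)) ∧ ¬ NU n ℓ (K + k + s) (cfgAt u p) := by
      refine ⟨?_, ?_, ?_⟩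
      · by_contra h; exact hu (Or.inl (Or.inl h))
      · by_contra h; exact hu (Or.inl (Or.inr h))
      · intro h; exact hu (Or.inr h)
    have hpos : 1 ≤ ℓ ^ (K + k) := Nat.one_le_pow _ _ hℓ1
    have hbig : s * ℓ ^ (K + k) ≤ n * ℓ ^ (K + k + s) := by
      rw [pow_add ℓ (K + k) s]
      calc s * ℓ ^ (K + k) ≤ ℓ ^ s * ℓ ^ (K + k) := Nat.mul_le_mul_right _ hsl
        _ = 1 * (ℓ ^ (K + k) * ℓ ^ s) := by ring
        _ ≤ _ := Nat.mul_le_mul_right _ hn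
    have hsx : s * ℓ ^ (K + k) = d * (n1 * ℓ ^ (K + k)) + d * (n2 * ℓ ^ (K + k)) + dist1 0 y * ℓ ^ (K + k) := by rw [hs]; ring
    have hy : dist1 0 y ≤ dist1 0 y * ℓ ^ (K + k) := Nat.le_mul_of_pos_right _ hpos
    refine (FX_det (cfgAt_le u h1) (cfgAt_le u h2) (n := n) (ℓ := ℓ) (j := K + k + s) (by omega) (by omega) hu'.1 hu'.2.1 hu'.2.2).trans ?_
    have : (2 * (5 * (n * ℓ ^ (2 * (K + k + s)))) + 1) ^ d ≤ (11 * n * ℓ ^ (2 * (K + s))) ^ d * A ^ k := by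
      have e : (11 * n * ℓ ^ (2 * (K + s))) ^ d * A ^ k = (11 * (n * ℓ ^ (2 * (K + k + s)))) ^ d := by
        rw [hA, ← pow_mul, show 2 * d * k = (2 * k) * d by ring, pow_mul ℓ (2 * k) d, ← mul_pow]
        congr 1
        rw [show 2 * (K + k + s) = 2 * (K + s) + 2 * k by ring, pow_add]; ring
      rw [e]
      apply Nat.pow_le_pow_left
      have : 1 ≤ n * ℓ ^ (2 * (K + k + s)) := Nat.one_le_iff_ne_zero.2 (by positivity)
      omega
    exact_mod_cast this
  · intro k
    rw [← ENNReal.ofReal_pow hε0.le, ← ENNReal.ofReal_mul (by norm_num), ← ofReal_measureReal]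
    exact ENNReal.ofReal_le_ofReal (hB k)

theorem ae_inf (hd : 2 ≤ d) (U : UniformCoupling d) {p : ℝ} (hp : pcU U < p) (hp1 : p ≤ 1) :
    ∀ᵐ u ∂U.Q, ∃ x, InInfiniteCluster (cfgAt u p) x := by
  have := U.prob
  have hpc := pcU_nonneg U
  let P : unitInterval := ⟨p, by linarith, hp1⟩
  have h := exists_inf_ae hd U (q := P) hp
  have mE : MeasurableSet {ω : Config d | ∃ x, InInfiniteCluster ω x} := meas_ex meas_inf
  rw [← UQ_real_cfgAt U P mE, measureReal_def] at h
  have h2 : U.Q {u | cfgAt u p ∈ {ω | ∃ x, InInfiniteCluster ω x}} = 1 := by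
    rw [← ENNReal.toReal_eq_one_iff]; exact h
  exact (mem_ae_iff_prob_eq_one (meas_cfgAt p mE)).2 h2
end Mod26

section Mod27
/-! ### M27: the subadditive ergodic theorem -/

theorem greedy {ψ : ℕ → ℕ → ℝ} {w : ℕ → ℝ} {A : Set ℕ} [DecidablePred (· ∈ A)] {N : ℕ} (hs : ∀ k l l', ψ k (l + l') ≤ ψ k l + ψ (k + l) l')
    (h0 : ∀ k, ψ k 0 ≤ 0) (hw : ∀ k, 0 ≤ w k) (h1 : ∀ k, ψ k 1 ≤ w k) (hA : ∀ k ∈ A, ∃ l, 1 ≤ l ∧ l ≤ N ∧ ψ k l ≤ 0) (n k : ℕ) :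
    ψ k n ≤ ∑ i ∈ Finset.range n, ((if k + i ∈ A then 0 else w (k + i)) + (if n ≤ i + N then w (k + i) else 0)) := by
  have hnn : ∀ n k i, 0 ≤ ((if k + i ∈ A then 0 else w (k + i)) + (if n ≤ i + N then w (k + i) else 0)) := by
    intro n k i
    have := hw (k + i)
    split_ifs <;> simp [this]
  induction n using Nat.strong_induction_on generalizing k with
  | _ n ih =>
    have key : ∀ l m, 1 ≤ l → n = l + m → ψ k l ≤ ∑ i ∈ Finset.range l, ((if k + i ∈ A then 0 else w (k + i)) + (if n ≤ i + N then w (k + i) else 0)) →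
        ψ k n ≤ ∑ i ∈ Finset.range n, ((if k + i ∈ A then 0 else w (k + i)) + (if n ≤ i + N then w (k + i) else 0)) := by
      intro l m hl hn hb
      have h2 := ih m (by omega) (k + l)
      have h3 := hs k l m
      rw [← hn] at h3
      conv_rhs => rw [hn]
      rw [Finset.sum_range_add, ← hn]
      have h4 : ∑ i ∈ Finset.range m, ((if k + l + i ∈ A then 0 else w (k + l + i)) + (if m ≤ i + N then w (k + l + i) else 0)) =
          ∑ i ∈ Finset.range m, ((if k + (l + i) ∈ A then 0 else w (k + (l + i))) + (if n ≤ l + i + N then w (k + (l + i)) else 0)) := by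
        refine Finset.sum_congr rfl fun i _ => ?_
        rw [add_assoc k l i]
        congr 1
        have : (m ≤ i + N) ↔ (n ≤ l + i + N) := by omega
        simp only [this]
      linarith
    rcases Nat.eq_zero_or_pos n with hn | hn
    · subst hn; simpa using h0 k
    by_cases hk : k ∈ A
    · obtain ⟨l, hl1, hlN, hl⟩ := hA k hk
      by_cases hln : l ≤ n
      · exact key l (n - l) hl1 (by omega) (hl.trans (Finset.sum_nonneg fun i _ => hnn n k i))
      · refine key 1 (n - 1) le_rfl (by omega) ?_
        have : n ≤ N := by omega
        simpa [hk, this] using h1 k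
    · refine key 1 (n - 1) le_rfl (by omega) ?_
      have := h1 k
      have := hw k
      simp only [Finset.range_one, Finset.sum_singleton, add_zero, hk, if_false]
      split_ifs <;> linarith

section king
variable {Ω : Type*} [MeasurableSpace Ω] {P : Measure Ω} [IsProbabilityMeasure P] {T : Ω → Ω}

theorem ae_orbit (hT : MeasurePreserving T P P) {p : Ω → Prop} (h : ∀ᵐ ω ∂P, p ω) : ∀ᵐ ω ∂P, ∀ k, p (T^[k] ω) :=
  ae_all_iff.2 fun k => (hT.iterate k).quasiMeasurePreserving.ae h

theorem king_low (hT : Ergodic T P) {f : ℕ → Ω → ℝ} (mf : ∀ n, Measurable (f n)) (hintg : ∀ n, Integrable (f n) P)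
    (hsub : ∀ᵐ ω ∂P, ∀ m n, f (m + n) ω ≤ f m ω + f n (T^[m] ω)) (h0 : ∀ᵐ ω ∂P, f 0 ω ≤ 0) {γ α : ℝ}
    (hγ : ∀ n : ℕ, γ * n ≤ ∫ ω, f n ω ∂P) (hα : α < γ) : ∀ᵐ ω ∂P, ∀ᶠ n : ℕ in atTop, α * n ≤ f n ω := by
  classical
  have hmp := hT.toMeasurePreserving
  have hso := ae_orbit hmp hsub
  have h0o := ae_orbit hmp h0
  let E : Set Ω := {ω | ∀ j : ℕ, ∃ᶠ n : ℕ in atTop, f n ω < (α + 1 / ((j : ℝ) + 1)) * n}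
  have mE : MeasurableSet E := by
    have : E = ⋂ j : ℕ, ⋂ a : ℕ, ⋃ b : ℕ, {ω | a ≤ b ∧ f b ω < (α + 1 / ((j : ℝ) + 1)) * b} := by
      ext ω; simp [E, frequently_atTop]
    rw [this]
    refine MeasurableSet.iInter fun j => MeasurableSet.iInter fun a => MeasurableSet.iUnion fun b => ?_
    exact (MeasurableSet.const _).inter (measurableSet_lt (mf b) measurable_const)
  have hE : T ⁻¹' E ≤ᵐ[P] E := by
    filter_upwards [hsub] with ω hω hTω
    intro j
    have h1 : ∃ᶠ n : ℕ in atTop, f n (T ω) < (α + 1 / (((j + 1 : ℕ) : ℝ) + 1)) * n := hTω (j + 1)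
    set δ : ℝ := 1 / ((j : ℝ) + 1) with hδ
    set δ' : ℝ := 1 / (((j + 1 : ℕ) : ℝ) + 1) with hδ'
    have hlt : δ' < δ := by
      rw [hδ, hδ']; push_cast
      exact one_div_lt_one_div_of_lt (by positivity) (by linarith)
    obtain ⟨M, hM⟩ := exists_nat_ge ((f 1 ω - (α + δ)) / (δ - δ'))
    have h2 := h1.and_eventually (eventually_ge_atTop M)
    rw [frequently_atTop] at h2 ⊢
    intro a
    obtain ⟨b, hab, hb, hMb⟩ := h2 a
    refine ⟨1 + b, by omega, ?_⟩
    have h3 := hω 1 b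
    rw [div_le_iff₀ (by linarith)] at hM
    have h4 : (M : ℝ) ≤ b := by exact_mod_cast hMb
    have h5 : (M : ℝ) * (δ - δ') ≤ b * (δ - δ') := mul_le_mul_of_nonneg_right h4 (by linarith)
    simp only [Function.iterate_one] at h3
    push_cast
    nlinarith
  rcases hT.ae_empty_or_univ_of_preimage_ae_le mE.nullMeasurableSet hE with h | h
  · have h' : ∀ᵐ ω ∂P, ω ∉ E := by
      filter_upwards [h] with ω hω hω2
      have : (E : Set Ω) ω = (∅ : Set Ω) ω := hω
      exact (this ▸ hω2 : (∅ : Set Ω) ω)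
    filter_upwards [h'] with ω hω
    by_contra hc
    apply hω
    intro j
    rw [not_eventually] at hc
    refine hc.mono fun n hn => ?_
    push Not at hn
    have : (0 : ℝ) ≤ 1 / ((j : ℝ) + 1) * n := by positivity
    linarith
  · exfalso
    have hE1 : ∀ᵐ ω ∂P, ω ∈ E := by
      filter_upwards [h] with ω hω
      have : (E : Set Ω) ω = (Set.univ : Set Ω) ω := hω
      exact (this.symm ▸ trivial : (E : Set Ω) ω)
    obtain ⟨j, hj⟩ := exists_nat_one_div_lt (sub_pos.2 hα)
    set β : ℝ := α + 1 / ((j : ℝ) + 1) with hβ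
    have hβγ : β < γ := by linarith
    let A : ℕ → Set Ω := fun N => {ω | ∃ l : ℕ, 1 ≤ l ∧ l ≤ N ∧ f l ω - β * l ≤ 0}
    have mA : ∀ N, MeasurableSet (A N) := by
      intro N
      have : A N = ⋃ l : ℕ, {ω | (1 ≤ l ∧ l ≤ N) ∧ f l ω - β * l ≤ 0} := by ext ω; simp [A, and_assoc]
      rw [this]
      exact MeasurableSet.iUnion fun l => (MeasurableSet.const _).inter (measurableSet_le ((mf l).sub measurable_const) measurable_const)
    let w : Ω → ℝ := fun ω => |f 1 ω - β|
    have mw : Measurable w := ((mf 1).sub measurable_const).norm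
    have iw : Integrable w P := ((hintg 1).sub (integrable_const _)).norm
    have hw0 : ∀ ω, 0 ≤ w ω := fun ω => abs_nonneg _
    let g : ℕ → Ω → ℝ := fun N ω => if ω ∈ A N then 0 else w ω
    have mg : ∀ N, Measurable (g N) := fun N => Measurable.ite (mA N) measurable_const mw
    have hgw : ∀ N ω, ‖g N ω‖ ≤ w ω := by
      intro N ω
      show ‖if ω ∈ A N then 0 else w ω‖ ≤ w ω
      split_ifs
      · simpa using hw0 ω
      · rw [Real.norm_of_nonneg (hw0 ω)]
    have ig : ∀ N, Integrable (g N) P := fun N => iw.mono' (mg N).aestronglyMeasurable (ae_of_all _ (hgw N))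
    have hcomp : ∀ {h : Ω → ℝ} (_ : Integrable h P) (i : ℕ), Integrable (fun ω => h (T^[i] ω)) P := fun hi i =>
      (hmp.iterate i).integrable_comp_of_integrable hi
    have hcompI : ∀ {h : Ω → ℝ} (_ : Measurable h) (i : ℕ), ∫ ω, h (T^[i] ω) ∂P = ∫ ω, h ω ∂P := fun {h} mh i => by
      have := integral_map (μ := P) (φ := T^[i]) (hmp.iterate i).measurable.aemeasurable (f := h) mh.aestronglyMeasurable
      rw [(hmp.iterate i).map_eq] at this
      exact this.symm
    have main : ∀ N, γ - β ≤ ∫ ω, g N ω ∂P := by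
      intro N
      by_contra hc
      push Not at hc
      have hn : ∀ n : ℕ, γ * n - β * n ≤ n * (∫ ω, g N ω ∂P) + N * ∫ ω, w ω ∂P := by
        intro n
        have hpt : ∀ᵐ ω ∂P, f n ω - β * n ≤ ∑ i ∈ Finset.range n, (g N (T^[i] ω) + if n ≤ i + N then w (T^[i] ω) else 0) := by
          filter_upwards [hso, h0o] with ω h1 h2
          have := greedy (ψ := fun k l => f l (T^[k] ω) - β * l) (w := fun k => w (T^[k] ω)) (A := {k | T^[k] ω ∈ A N}) (N := N) ?_ ?_ ?_ ?_ ?_ n 0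
          · simpa [g] using this
          · intro k l l'
            have := h1 k l l'
            rw [← Function.iterate_add_apply, add_comm l k] at this
            push_cast; linarith
          · intro k; simpa using h2 k
          · intro k; exact hw0 _
          · intro k; simpa using le_abs_self (f 1 (T^[k] ω) - β)
          · intro k hk; exact hk
        have hi2 : ∀ i, Integrable (fun ω => if n ≤ i + N then w (T^[i] ω) else 0) P := by
          intro i
          split_ifs
          · exact hcomp iw i
          · exact integrable_const _
        have h3 := integral_mono_ae ((hintg n).sub (integrable_const (β * n))) (integrable_finsetSum (Finset.range n) fun i _ => (hcomp (ig N) i).add (hi2 i)) hpt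
        have h4 : ∫ ω, (f n - (fun _ : Ω => β * (n : ℝ))) ω ∂P = (∫ ω, f n ω ∂P) - β * n := by
          simp only [Pi.sub_apply]
          rw [integral_sub (hintg n) (integrable_const _)]; simp
        have h5 : ∫ ω, ∑ i ∈ Finset.range n, ((fun ω : Ω => g N (T^[i] ω)) + (fun ω : Ω => if n ≤ i + N then w (T^[i] ω) else 0)) ω ∂P ≤
            n * (∫ ω, g N ω ∂P) + N * ∫ ω, w ω ∂P := by
          rw [integral_finsetSum _ fun i _ => (hcomp (ig N) i).add (hi2 i)]
          have e : ∀ i ∈ Finset.range n, ∫ ω, ((fun ω : Ω => g N (T^[i] ω)) + (fun ω : Ω => if n ≤ i + N then w (T^[i] ω) else 0)) ω ∂P =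
              (∫ ω, g N ω ∂P) + if n ≤ i + N then ∫ ω, w ω ∂P else 0 := by
            intro i _
            simp only [Pi.add_apply]
            rw [integral_add (hcomp (ig N) i) (hi2 i), hcompI (mg N)]
            split_ifs
            · rw [hcompI mw]
            · simp
          rw [Finset.sum_congr rfl e, Finset.sum_add_distrib, Finset.sum_const, Finset.card_range, nsmul_eq_mul,
            ← Finset.sum_filter, Finset.sum_const, nsmul_eq_mul]
          have hcard : ((Finset.range n).filter fun i => n ≤ i + N).card ≤ N := by
            have : (Finset.range n).filter (fun i => n ≤ i + N) ⊆ Finset.Ico (n - N) n := by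
              intro i hi
              simp only [Finset.mem_filter, Finset.mem_range] at hi
              simp only [Finset.mem_Ico]; omega
            have := Finset.card_le_card this
            rw [Nat.card_Ico] at this; omega
          have : (((Finset.range n).filter fun i => n ≤ i + N).card : ℝ) * ∫ ω, w ω ∂P ≤ N * ∫ ω, w ω ∂P :=
            mul_le_mul_of_nonneg_right (by exact_mod_cast hcard) (integral_nonneg hw0)
          linarith
        have h6 := hγ n
        rw [h4] at h3
        have h7 := h3.trans h5
        linarith
      obtain ⟨n, hn'⟩ := exists_nat_gt ((N * ∫ ω, w ω ∂P) / (γ - β - ∫ ω, g N ω ∂P))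
      rw [div_lt_iff₀ (by linarith)] at hn'
      have := hn n
      nlinarith
    have lim : Tendsto (fun N => ∫ ω, g N ω ∂P) atTop (𝓝 (∫ _, (0 : ℝ) ∂P)) := by
      refine tendsto_integral_of_dominated_convergence w (fun N => (mg N).aestronglyMeasurable) iw (fun N => ae_of_all _ (hgw N)) ?_
      filter_upwards [hE1] with ω hω
      have h1 := ((hω j).and_eventually (eventually_ge_atTop 1)).exists
      obtain ⟨l, hl, hl1⟩ := h1
      refine tendsto_const_nhds.congr' ?_
      filter_upwards [eventually_ge_atTop l] with N hN
      have : ω ∈ A N := ⟨l, hl1, hN, by linarith⟩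
      simp [g, this]
    have := ge_of_tendsto' lim main
    simp at this
    linarith

theorem king_low_all (hT : Ergodic T P) {f : ℕ → Ω → ℝ} (mf : ∀ n, Measurable (f n)) (hintg : ∀ n, Integrable (f n) P)
    (hsub : ∀ᵐ ω ∂P, ∀ m n, f (m + n) ω ≤ f m ω + f n (T^[m] ω)) (h0 : ∀ᵐ ω ∂P, f 0 ω ≤ 0) {γ : ℝ}
    (hγ : ∀ n : ℕ, γ * n ≤ ∫ ω, f n ω ∂P) : ∀ᵐ ω ∂P, ∀ α < γ, ∀ᶠ n : ℕ in atTop, α < f n ω / n := by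
  have h : ∀ᵐ ω ∂P, ∀ j : ℕ, ∀ᶠ n : ℕ in atTop, (γ - 1 / ((j : ℝ) + 1)) * n ≤ f n ω :=
    ae_all_iff.2 fun j => king_low hT mf hintg hsub h0 hγ (sub_lt_self γ (by positivity))
  filter_upwards [h] with ω hω α hα
  obtain ⟨j, hj⟩ := exists_nat_one_div_lt (sub_pos.2 hα)
  filter_upwards [hω j, eventually_ge_atTop 1] with n hn hn1
  have : (0 : ℝ) < n := by exact_mod_cast hn1
  rw [lt_div_iff₀ this]
  refine lt_of_lt_of_le ?_ hn
  exact mul_lt_mul_of_pos_right (by linarith) this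

theorem birkhoff_ae (hT : Ergodic T P) {h : Ω → ℝ} (mh : Measurable h) (ih : Integrable h P) :
    ∀ᵐ ω ∂P, Tendsto (fun n : ℕ => birkhoffSum T h n ω / n) atTop (𝓝 (∫ ω, h ω ∂P)) := by
  have hmp := hT.toMeasurePreserving
  have key : ∀ {h : Ω → ℝ} (_ : Measurable h) (_ : Integrable h P), ∀ᵐ ω ∂P, ∀ α < ∫ ω, h ω ∂P, ∀ᶠ n : ℕ in atTop, α < birkhoffSum T h n ω / n := by
    intro h mh ih
    have hcomp : ∀ (i : ℕ), Integrable (fun ω => h (T^[i] ω)) P := fun i => (hmp.iterate i).integrable_comp_of_integrable ih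
    refine king_low_all hT (f := fun n ω => birkhoffSum T h n ω) ?_ ?_ ?_ ?_ ?_
    · intro n
      exact Finset.measurable_fun_sum _ fun i _ => mh.comp (hmp.iterate i).measurable
    · intro n
      exact integrable_finsetSum _ fun i _ => hcomp i
    · exact ae_of_all _ fun ω m n => (birkhoffSum_add T h m n ω).le
    · exact ae_of_all _ fun ω => by simp
    · intro n
      simp only [birkhoffSum]
      rw [integral_finsetSum _ fun i _ => hcomp i]
      have e : ∀ i ∈ Finset.range n, ∫ ω, h (T^[i] ω) ∂P = ∫ ω, h ω ∂P := fun i _ => by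
        have := integral_map (μ := P) (φ := T^[i]) (hmp.iterate i).measurable.aemeasurable (f := h) mh.aestronglyMeasurable
        rw [(hmp.iterate i).map_eq] at this
        exact this.symm
      rw [Finset.sum_congr rfl e]
      simp [mul_comm]
  filter_upwards [key mh ih, key mh.neg ih.neg] with ω h1 h2
  rw [tendsto_order]
  refine ⟨h1, fun a ha => ?_⟩
  have : -a < ∫ ω, (-h) ω ∂P := by simp only [Pi.neg_apply]; rw [integral_neg]; linarith
  filter_upwards [h2 (-a) this] with n hn
  have e : birkhoffSum T (-h) n ω = - birkhoffSum T h n ω := by simp [birkhoffSum]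
  rw [e, neg_div] at hn
  linarith

theorem orbit_small (hT : Ergodic T P) {h : Ω → ℝ} (mh : Measurable h) (ih : Integrable h P) :
    ∀ᵐ ω ∂P, Tendsto (fun n : ℕ => h (T^[n] ω) / n) atTop (𝓝 0) := by
  filter_upwards [birkhoff_ae hT mh ih] with ω hω
  set I := ∫ ω, h ω ∂P
  have h1 := (tendsto_add_atTop_iff_nat 1).2 hω
  have h2 : Tendsto (fun n : ℕ => ((n + 1 : ℕ) : ℝ) / n) atTop (𝓝 1) := by
    have h3 : Tendsto (fun n : ℕ => 1 + (1 : ℝ) / n) atTop (𝓝 (1 + 0)) :=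
      tendsto_const_nhds.add tendsto_one_div_atTop_nhds_zero_nat
    rw [add_zero] at h3
    refine h3.congr' ?_
    filter_upwards [eventually_ge_atTop 1] with n hn
    have : (n : ℝ) ≠ 0 := by positivity
    push_cast; field_simp
  have h4 := (h1.mul h2).sub hω
  rw [mul_one, sub_self] at h4
  refine h4.congr' ?_
  filter_upwards [eventually_ge_atTop 1] with n hn
  have : (n : ℝ) ≠ 0 := by positivity
  have e : birkhoffSum T h (n + 1) ω = birkhoffSum T h n ω + h (T^[n] ω) := birkhoffSum_succ T h n ω
  have h5 : (((n + 1 : ℕ) : ℝ)) ≠ 0 := by positivity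
  rw [e]; field_simp; ring

theorem king_up (hT : MeasurePreserving T P P) {f : ℕ → Ω → ℝ} (mf : ∀ n, Measurable (f n)) (hintg : ∀ n, Integrable (f n) P) (hf0 : ∀ n ω, 0 ≤ f n ω)
    (hsub : ∀ᵐ ω ∂P, ∀ m n, f (m + n) ω ≤ f m ω + f n (T^[m] ω)) {m : ℕ} (hm : 1 ≤ m) (hTm : Ergodic (T^[m]) P) :
    ∀ᵐ ω ∂P, ∀ β, (∫ ω, f m ω ∂P) / m < β → ∀ᶠ n : ℕ in atTop, f n ω / n < β := by
  have hm0 : (0 : ℝ) < m := by exact_mod_cast hm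
  let R : Ω → ℝ := fun ω => ∑ r ∈ Finset.range m, f r ω
  have mR : Measurable R := Finset.measurable_fun_sum _ fun i _ => mf i
  have iR : Integrable R P := integrable_finsetSum _ fun i _ => hintg i
  filter_upwards [birkhoff_ae hTm (mf m) (hintg m), orbit_small hTm mR iR, ae_orbit hT hsub] with ω h1 h2 h3 β hβ
  set I := ∫ ω, f m ω ∂P
  have hIpos : 0 ≤ I := integral_nonneg (hf0 m)
  have hβ0 : 0 ≤ β := le_of_lt (lt_of_le_of_lt (by positivity) hβ)
  rw [div_lt_iff₀ hm0] at hβ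
  have h4 := (h1.add h2)
  rw [add_zero] at h4
  have h5 := (h4.comp (Nat.tendsto_div_const_atTop (by omega : m ≠ 0))).eventually (gt_mem_nhds hβ)
  filter_upwards [h5, eventually_ge_atTop m] with n hn hnm
  set q := n / m with hq
  have hq1 : 1 ≤ q := (Nat.one_le_div_iff (by omega)).2 hnm
  have hq0 : (0 : ℝ) < q := by exact_mod_cast hq1
  have hn0 : (0 : ℝ) < n := by exact_mod_cast (by omega : 0 < n)
  simp only [Function.comp] at hn
  rw [← hq, ← add_div, div_lt_iff₀ hq0] at hn
  have hmain : ∀ q r, f (m * q + r) ω ≤ birkhoffSum T^[m] (f m) q ω + f r ((T^[m])^[q] ω) := by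
    intro q
    induction q with
    | zero => intro r; simp
    | succ q ihq =>
      intro r
      have e1 := ihq (m + r)
      have e2 := h3 (m * q) m r
      rw [birkhoffSum_succ]
      rw [← Function.iterate_mul] at e1 ⊢
      rw [← Function.iterate_add_apply, ← Function.iterate_mul] at *
      rw [show m * (q + 1) + r = m * q + (m + r) by ring, show m * (q + 1) = m + m * q by ring]
      linarith
  have e := hmain q (n % m)
  rw [Nat.div_add_mod] at e
  have eR : f (n % m) ((T^[m])^[q] ω) ≤ R ((T^[m])^[q] ω) :=
    Finset.single_le_sum (f := fun r => f r ((T^[m])^[q] ω)) (fun r _ => hf0 r _) (Finset.mem_range.2 (Nat.mod_lt _ (by omega)))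
  have hqn : (m : ℝ) * q ≤ n := by exact_mod_cast Nat.mul_div_le n m
  rw [div_lt_iff₀ hn0]
  have : β * (m * q) ≤ β * n := mul_le_mul_of_nonneg_left hqn hβ0
  linarith

theorem kingman (hT : MeasurePreserving T P P) (hTm : ∀ m, 1 ≤ m → Ergodic (T^[m]) P) {f : ℕ → Ω → ℝ} (mf : ∀ n, Measurable (f n))
    (hintg : ∀ n, Integrable (f n) P) (hf0 : ∀ n ω, 0 ≤ f n ω) (h0 : ∀ᵐ ω ∂P, f 0 ω ≤ 0)
    (hsub : ∀ᵐ ω ∂P, ∀ m n, f (m + n) ω ≤ f m ω + f n (T^[m] ω)) :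
    ∃ γ : ℝ, 0 ≤ γ ∧ (∀ᵐ ω ∂P, Tendsto (fun n : ℕ => f n ω / n) atTop (𝓝 γ)) ∧
      Tendsto (fun n : ℕ => ∫ ω, |f n ω / n - γ| ∂P) atTop (𝓝 0) := by
  have hcompI : ∀ {h : Ω → ℝ} (_ : Measurable h) (i : ℕ), ∫ ω, h (T^[i] ω) ∂P = ∫ ω, h ω ∂P := fun {h} mh i => by
    have := integral_map (μ := P) (φ := T^[i]) (hT.iterate i).measurable.aemeasurable (f := h) mh.aestronglyMeasurable
    rw [(hT.iterate i).map_eq] at this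
    exact this.symm
  have hu : Subadditive fun n => ∫ ω, f n ω ∂P := by
    intro m n
    have ic := (hT.iterate m).integrable_comp_of_integrable (hintg n)
    have h1 := integral_mono_ae (hintg (m + n)) ((hintg m).add ic) (hsub.mono fun ω h => h m n)
    have h2 : ∫ ω, (f m + (f n ∘ T^[m])) ω ∂P = (∫ ω, f m ω ∂P) + ∫ ω, f n ω ∂P := by
      simp only [Pi.add_apply]
      rw [integral_add (hintg m) ic, ← hcompI (mf n) m]; rfl
    exact h1.trans h2.le
  have hbdd : BddBelow (Set.range fun n : ℕ => (∫ ω, f n ω ∂P) / n) := by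
    refine ⟨0, ?_⟩
    rintro _ ⟨n, rfl⟩
    exact div_nonneg (integral_nonneg (hf0 n)) (Nat.cast_nonneg n)
  have hlim := hu.tendsto_lim hbdd
  set γ := hu.lim with hγ
  have hγ0 : 0 ≤ γ := ge_of_tendsto' hlim fun n => div_nonneg (integral_nonneg (hf0 n)) (Nat.cast_nonneg n)
  have hge : ∀ n : ℕ, γ * n ≤ ∫ ω, f n ω ∂P := by
    intro n
    rcases Nat.eq_zero_or_pos n with h | h
    · subst h; simp; exact integral_nonneg (hf0 0)
    · have := hu.lim_le_div hbdd h.ne'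
      rwa [le_div_iff₀ (by exact_mod_cast h)] at this
  have hT1 : Ergodic T P := by simpa using hTm 1 le_rfl
  have hup : ∀ᵐ ω ∂P, ∀ m : ℕ, 1 ≤ m → ∀ β, (∫ ω, f m ω ∂P) / m < β → ∀ᶠ n : ℕ in atTop, f n ω / n < β := by
    rw [ae_all_iff]
    intro m
    by_cases hm : 1 ≤ m
    · filter_upwards [king_up hT mf hintg hf0 hsub hm (hTm m hm)] with ω hω _
      exact hω
    · exact ae_of_all _ fun ω h => absurd h hm
  have has : ∀ᵐ ω ∂P, Tendsto (fun n : ℕ => f n ω / n) atTop (𝓝 γ) := by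
    filter_upwards [hup, king_low_all hT1 mf hintg hsub h0 hge] with ω h1 h2
    rw [tendsto_order]
    refine ⟨h2, fun β hβ => ?_⟩
    obtain ⟨m, hm, hm1⟩ := ((hlim.eventually (gt_mem_nhds hβ)).and (eventually_ge_atTop 1)).exists
    exact h1 m hm1 β hm
  refine ⟨γ, hγ0, has, ?_⟩
  have id : ∀ n : ℕ, Integrable (fun ω => f n ω / n - γ) P := fun n => ((hintg n).div_const _).sub (integrable_const _)
  have mmax : ∀ n : ℕ, Measurable fun ω => max (γ - f n ω / n) 0 := fun n => (measurable_const.sub ((mf n).div_const _)).max measurable_const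
  have hmb : ∀ (n : ℕ) ω, ‖max (γ - f n ω / n) 0‖ ≤ γ := by
    intro n ω
    rw [Real.norm_of_nonneg (le_max_right _ _)]
    refine max_le ?_ hγ0
    have : 0 ≤ f n ω / n := div_nonneg (hf0 n ω) (Nat.cast_nonneg n)
    linarith
  have imax : ∀ n : ℕ, Integrable (fun ω => max (γ - f n ω / n) 0) P := fun n =>
    (integrable_const γ).mono' (mmax n).aestronglyMeasurable (ae_of_all _ (hmb n))
  have l2 : Tendsto (fun n : ℕ => ∫ ω, max (γ - f n ω / n) 0 ∂P) atTop (𝓝 (∫ _, (0 : ℝ) ∂P)) := by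
    refine tendsto_integral_of_dominated_convergence (fun _ => γ) (fun n => (mmax n).aestronglyMeasurable) (integrable_const _) (fun n => ae_of_all _ (hmb n)) ?_
    filter_upwards [has] with ω hω
    have := (((tendsto_const_nhds (x := γ)).sub hω).max (tendsto_const_nhds (x := (0 : ℝ))))
    simpa using this
  have l3 := (hlim.sub (tendsto_const_nhds (x := γ))).add (l2.const_mul 2)
  simp only [integral_zero, sub_self, mul_zero, add_zero] at l3
  refine l3.congr fun n => ?_
  have e : ∀ ω, |f n ω / n - γ| = (f n ω / n - γ) + 2 * max (γ - f n ω / n) 0 := by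
    intro ω
    rcases le_total γ (f n ω / n) with h | h
    · rw [abs_of_nonneg (by linarith), max_eq_right (by linarith)]; ring
    · rw [abs_of_nonpos (by linarith), max_eq_left (by linarith)]; ring
  simp only [e]
  rw [integral_add (id n) ((imax n).const_mul 2), integral_sub ((hintg n).div_const _) (integrable_const _), integral_div, integral_const_mul]
  simp

end king
end Mod27

section Mod28
variable {d : ℕ}

/-! ### M28: assembly -/

/-- the spatial shift -/
def shft (x : V d) (u : Edge d → ℝ) : Edge d → ℝ := fun e => u ((Iso.tr x).e e)

theorem tr_e_add (x y : V d) (e : Edge d) : (Iso.tr x).e ((Iso.tr y).e e) = (Iso.tr (y + x)).e e := by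
  apply Subtype.ext
  show (e.1.map (Iso.tr y).φ).map (Iso.tr x).φ = e.1.map (Iso.tr (y + x)).φ
  rw [Sym2.map_map]
  congr 1
  funext z
  simp [add_assoc]

theorem tr_e_zero (e : Edge d) : (Iso.tr (0 : V d)).e e = e := by
  apply Subtype.ext
  show e.1.map (Iso.tr (0 : V d)).φ = e.1
  have : ((Iso.tr (0 : V d)).φ : V d → V d) = id := by funext z; simp
  rw [this, Sym2.map_id]; rfl

theorem shft_iter (x : V d) (m : ℕ) : (shft x)^[m] = shft (m • x) := by
  induction m with
  | zero =>
    funext u e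
    simp only [Function.iterate_zero, id, zero_smul, shft]
    rw [tr_e_zero]
  | succ m ih =>
    rw [Function.iterate_succ', ih]
    funext u e
    simp only [Function.comp, shft]
    rw [tr_e_add, add_comm, succ_nsmul]

theorem cfgAt_shft (v : V d) (u : Edge d → ℝ) (p : ℝ) : cfgAt (shft v u) p = fun e => cfgAt u p ((Iso.tr v).e e) := rfl

theorem FX_shft (v : V d) (u : Edge d → ℝ) (p p1 p2 : ℝ) (y y' : V d) :
    FX (cfgAt (shft v u) p) (cfgAt (shft v u) p1) (cfgAt (shft v u) p2) y y' =
      FX (cfgAt u p) (cfgAt u p1) (cfgAt u p2) (y + v) (y' + v) := by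
  rw [← FX_tr v (cfgAt u p) (cfgAt u p1) (cfgAt u p2) y y', cfgAt_shft, cfgAt_shft, cfgAt_shft]

theorem one_dir (hd : 2 ≤ d) (U : UniformCoupling d) (p : ℝ) (hp : pcU U < p) (hp1 : p ≤ 1) {x : V d} (hx : x ≠ 0) :
    ∃ γ : ℝ, 0 ≤ γ ∧ ∀ p₀, pcU U < p₀ → p₀ ≤ p →
      (∀ᵐ u ∂U.Q, Tendsto (fun n : ℕ => DReg (cfgAt u p) (cfgAt u p₀) 0 (n • x) / n) atTop (𝓝 γ)) ∧
      Tendsto (fun n : ℕ => ∫ u, |DReg (cfgAt u p) (cfgAt u p₀) 0 (n • x) / n - γ| ∂U.Q) atTop (𝓝 0) := by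
  have := U.prob
  have hE : ∀ v : V d, v ≠ 0 → Ergodic (shft v) U.Q := fun v hv => ergodic_tr U hv
  have hT := (hE x hx).toMeasurePreserving
  have hTm : ∀ m, 1 ≤ m → Ergodic ((shft x)^[m]) U.Q := by
    intro m hm
    rw [shft_iter]
    exact hE _ (smul_ne_zero (by omega) hx)
  let F : ℕ → (Edge d → ℝ) → ℝ≥0∞ := fun n u => FX (cfgAt u p) (cfgAt u p) (cfgAt u p) 0 (n • x)
  have mF : ∀ n, Measurable (F n) := fun n => meas_FX p p p 0 (n • x)
  have iF : ∀ n, ∫⁻ u, F n u ∂U.Q < ⊤ := fun n => FX_int hd U hp1 hp hp le_rfl le_rfl _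
  have hFfin : ∀ᵐ u ∂U.Q, ∀ n, F n u < ⊤ := ae_all_iff.2 fun n => ae_lt_top (mF n) (iF n).ne
  let f : ℕ → (Edge d → ℝ) → ℝ := fun n u => if n = 0 then 0 else (F n u).toReal
  have mf : ∀ n, Measurable (f n) := by
    intro n
    show Measurable fun u => if n = 0 then 0 else (F n u).toReal
    split_ifs
    · exact measurable_const
    · exact (mF n).ennreal_toReal
  have hintg : ∀ n, Integrable (f n) U.Q := by
    intro n
    show Integrable (fun u => if n = 0 then 0 else (F n u).toReal) U.Q
    split_ifs
    · exact integrable_const _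
    · exact integrable_toReal_of_lintegral_ne_top (mF n).aemeasurable (iF n).ne
  have hf0 : ∀ n u, 0 ≤ f n u := by
    intro n u
    show 0 ≤ if n = 0 then 0 else (F n u).toReal
    split_ifs
    · exact le_rfl
    · exact ENNReal.toReal_nonneg
  have hsub : ∀ᵐ u ∂U.Q, ∀ m n, f (m + n) u ≤ f m u + f n ((shft x)^[m] u) := by
    filter_upwards [ae_orbit hT hFfin, ae_inf hd U hp hp1] with u h1 h2 m n
    rcases Nat.eq_zero_or_pos m with hm | hm
    · subst hm; simp [f]
    rcases Nat.eq_zero_or_pos n with hn | hn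
    · subst hn; simp [f]
    have hFs : F (m + n) u ≤ F m u + F n ((shft x)^[m] u) := by
      have e : F n ((shft x)^[m] u) = FX (cfgAt u p) (cfgAt u p) (cfgAt u p) (m • x) ((m + n) • x) := by
        rw [shft_iter]
        show FX (cfgAt (shft (m • x) u) p) _ _ 0 (n • x) = _
        rw [FX_shft, zero_add, add_comm m n, add_smul]
      rw [e]
      exact FX_tri h2 _ _ _
    have e1 : f (m + n) u = (F (m + n) u).toReal := if_neg (by omega)
    have e2 : f m u = (F m u).toReal := if_neg (by omega)
    have e3 : f n ((shft x)^[m] u) = (F n ((shft x)^[m] u)).toReal := if_neg (by omega)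
    have f1 : F m u < ⊤ := h1 0 m
    rw [e1, e2, e3, ← ENNReal.toReal_add f1.ne (h1 m n).ne]
    exact ENNReal.toReal_mono (ENNReal.add_lt_top.2 ⟨f1, h1 m n⟩).ne hFs
  obtain ⟨γ, hγ0, has, hL1⟩ := kingman hT hTm mf hintg hf0 (ae_of_all _ fun u => by simp [f]) hsub
  refine ⟨γ, hγ0, fun p₀ hp0 hp0p => ?_⟩
  let H : (Edge d → ℝ) → ℝ≥0∞ := fun u => FX (cfgAt u p) (cfgAt u p₀) (cfgAt u p) 0 0
  have mH : Measurable H := meas_FX p p₀ p 0 0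
  have iH : ∫⁻ u, H u ∂U.Q < ⊤ := FX_int hd U hp1 hp0 hp hp0p le_rfl _
  have hHfin : ∀ᵐ u ∂U.Q, H u < ⊤ := ae_lt_top mH iH.ne
  let h : (Edge d → ℝ) → ℝ := fun u => (H u).toReal
  have mh : Measurable h := mH.ennreal_toReal
  have ih : Integrable h U.Q := integrable_toReal_of_lintegral_ne_top mH.aemeasurable iH.ne
  have hh0 : ∀ u, 0 ≤ h u := fun u => ENNReal.toReal_nonneg
  have hcmp : ∀ᵐ u ∂U.Q, ∀ n : ℕ, 1 ≤ n → |DReg (cfgAt u p) (cfgAt u p₀) 0 (n • x) / n - f n u / n| ≤ h u / n + h ((shft x)^[n] u) / n := by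
    filter_upwards [hFfin, ae_orbit hT hHfin, ae_inf hd U hp hp1, ae_inf hd U hp0 (hp0p.trans hp1)] with u h1 h2 h3 h4 n hn
    have hn0 : (0 : ℝ) < n := by exact_mod_cast hn
    have e : H ((shft x)^[n] u) = FX (cfgAt u p) (cfgAt u p₀) (cfgAt u p) (n • x) (n • x) := by
      rw [shft_iter]
      show FX (cfgAt (shft (n • x) u) p) _ _ 0 0 = _
      rw [FX_shft, zero_add]
    have ha := regPoint_Am h4 0
    have hb := regPoint_Am h4 (n • x)
    set a := regPoint (cfgAt u p₀) 0
    set b := regPoint (cfgAt u p₀) (n • x)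
    set D := chemDist (cfgAt u p) a b with hD
    have b1 : D ≤ H u + F n u + H ((shft x)^[n] u) := by
      refine (le_FX ha hb).trans ((FX_tri h3 0 (n • x) (n • x)).trans ?_)
      rw [e, FX_symm _ _ (cfgAt u p₀) (n • x) (n • x)]
      gcongr
      exact FX_tri h3 0 0 (n • x)
    have b2 : F n u ≤ H u + D + H ((shft x)^[n] u) := by
      refine FX_le fun a' b' ha' hb' => ?_
      refine (chemDist_triangle _ a' b b').trans ?_
      rw [e]
      gcongr
      · refine (chemDist_triangle _ a' a b).trans ?_
        gcongr
        rw [chemDist_comm]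
        exact le_FX ha ha'
      · exact le_FX hb hb'
    have f1 := (h1 n).ne
    have f2 : H u ≠ ⊤ := (h2 0).ne
    have f3 := (h2 n).ne
    have f4 : D ≠ ⊤ := (b1.trans_lt (ENNReal.add_lt_top.2 ⟨ENNReal.add_lt_top.2 ⟨h2 0, h1 n⟩, h2 n⟩)).ne
    have c1 : D.toReal ≤ h u + (F n u).toReal + h ((shft x)^[n] u) := by
      have := ENNReal.toReal_mono (ENNReal.add_ne_top.2 ⟨ENNReal.add_ne_top.2 ⟨f2, f1⟩, f3⟩) b1
      rwa [ENNReal.toReal_add (ENNReal.add_ne_top.2 ⟨f2, f1⟩) f3, ENNReal.toReal_add f2 f1] at this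
    have c2 : (F n u).toReal ≤ h u + D.toReal + h ((shft x)^[n] u) := by
      have := ENNReal.toReal_mono (ENNReal.add_ne_top.2 ⟨ENNReal.add_ne_top.2 ⟨f2, f4⟩, f3⟩) b2
      rwa [ENNReal.toReal_add (ENNReal.add_ne_top.2 ⟨f2, f4⟩) f3, ENNReal.toReal_add f2 f4] at this
    have e2 : f n u = (F n u).toReal := if_neg (by omega)
    rw [← sub_div, ← add_div, abs_div, abs_of_pos hn0]
    apply div_le_div_of_nonneg_right _ hn0.le
    rw [e2]
    show |D.toReal - _| ≤ _
    rw [abs_le]; constructor <;> linarith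
  have hinv : Tendsto (fun n : ℕ => (n : ℝ)⁻¹) atTop (𝓝 0) := tendsto_inv_atTop_nhds_zero_nat
  constructor
  · filter_upwards [has, hcmp, orbit_small (hE x hx) mh ih] with u h1 h2 h3
    have h4 : Tendsto (fun n : ℕ => h u / n + h ((shft x)^[n] u) / n) atTop (𝓝 0) := by
      have := (hinv.const_mul (h u)).add h3
      simpa [div_eq_mul_inv] using this
    have h5 : Tendsto (fun n : ℕ => DReg (cfgAt u p) (cfgAt u p₀) 0 (n • x) / n - f n u / n) atTop (𝓝 0) := by
      refine squeeze_zero_norm' ?_ h4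
      filter_upwards [eventually_ge_atTop 1] with n hn
      exact h2 n hn
    have := h5.add h1
    simpa using this
  · have hcI : ∀ n : ℕ, ∫ u, h ((shft x)^[n] u) ∂U.Q = ∫ u, h u ∂U.Q := by
      intro n
      have := integral_map (μ := U.Q) (φ := (shft x)^[n]) (hT.iterate n).measurable.aemeasurable (f := h) mh.aestronglyMeasurable
      rw [(hT.iterate n).map_eq] at this
      exact this.symm
    have ic : ∀ n : ℕ, Integrable (fun u => h ((shft x)^[n] u)) U.Q := fun n => (hT.iterate n).integrable_comp_of_integrable ih
    have lim : Tendsto (fun n : ℕ => (∫ u, |f n u / n - γ| ∂U.Q) + 2 * (∫ u, h u ∂U.Q) * (n : ℝ)⁻¹) atTop (𝓝 0) := by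
      have := hL1.add (hinv.const_mul (2 * (∫ u, h u ∂U.Q)))
      simpa using this
    refine squeeze_zero' (Eventually.of_forall fun n => integral_nonneg fun u => abs_nonneg _) ?_ lim
    filter_upwards [eventually_ge_atTop 1] with n hn
    have i1 : Integrable (fun u => |f n u / n - γ|) U.Q := (((hintg n).div_const _).sub (integrable_const _)).norm
    have i2 : Integrable (fun u => h u / n + h ((shft x)^[n] u) / n) U.Q := (ih.div_const _).add ((ic n).div_const _)
    have e : (∫ u, |f n u / n - γ| ∂U.Q) + 2 * (∫ u, h u ∂U.Q) * (n : ℝ)⁻¹ =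
        ∫ u, (|f n u / n - γ| + (h u / n + h ((shft x)^[n] u) / n)) ∂U.Q := by
      rw [integral_add i1 i2, integral_add (ih.div_const _) ((ic n).div_const _), integral_div, integral_div, hcI]
      ring
    rw [e]
    refine integral_mono_of_nonneg (ae_of_all _ fun u => abs_nonneg _) (i1.add i2) ?_
    filter_upwards [hcmp] with u hu
    have h1 := hu n hn
    have h2 := abs_sub_le (DReg (cfgAt u p) (cfgAt u p₀) 0 (n • x) / n) (f n u / n) γ
    show _ ≤ |f n u / n - γ| + (h u / n + h ((shft x)^[n] u) / n)
    linarith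

theorem all_dir (hd : 2 ≤ d) (U : UniformCoupling d) (p : ℝ) (hp : pcU U < p) (hp1 : p ≤ 1) (x : V d) :
    ∃ γ : ℝ, 0 ≤ γ ∧ ∀ p₀, pcU U < p₀ → p₀ ≤ p →
      (∀ᵐ u ∂U.Q, Tendsto (fun n : ℕ => DReg (cfgAt u p) (cfgAt u p₀) 0 (n • x) / n) atTop (𝓝 γ)) ∧
      Tendsto (fun n : ℕ => ∫ u, |DReg (cfgAt u p) (cfgAt u p₀) 0 (n • x) / n - γ| ∂U.Q) atTop (𝓝 0) := by
  by_cases hx : x = 0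
  · subst hx
    have e : ∀ (w w' : Config d) (n : ℕ), DReg w w' 0 (n • (0 : V d)) = 0 := by
      intro w w' n
      unfold DReg
      rw [smul_zero, chemDist_self]; rfl
    refine ⟨0, le_rfl, fun p₀ _ _ => ⟨ae_of_all _ fun u => ?_, ?_⟩⟩
    · simp only [e, zero_div]; exact tendsto_const_nhds
    · simp only [e, zero_div, sub_zero, abs_zero, integral_zero]; exact tendsto_const_nhds
  · exact one_dir hd U p hp hp1 hx

end Mod28

/-- **Existence of the regularized time constant.**
Let `d ≥ 2` and `p > p_c(d)`. There is a deterministic `μ_p : ℤ^d → [0, ∞)` such that for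
every `p₀ ∈ (p_c(d), p]` and every `x ∈ ℤ^d`, under the standard coupling,
`D^{𝒞_p}(0̃^{𝒞_{p₀}}, ñx^{𝒞_{p₀}})/n → μ_p(x)` almost surely and in `L¹`. -/
theorem statement_2 (d : ℕ) (hd : 2 ≤ d) (U : UniformCoupling d)
    (p : ℝ) (hp : pcU U < p) (hp1 : p ≤ 1) :
    ∃ μ : V d → ℝ, (∀ x, 0 ≤ μ x) ∧
      ∀ p₀ : ℝ, pcU U < p₀ → p₀ ≤ p → ∀ x : V d,
        (∀ᵐ u ∂U.Q, Tendsto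
          (fun n : ℕ => DReg (cfgAt u p) (cfgAt u p₀) 0 (n • x) / n) atTop (𝓝 (μ x))) ∧
        Tendsto (fun n : ℕ =>
            ∫ u, |DReg (cfgAt u p) (cfgAt u p₀) 0 (n • x) / n - μ x| ∂U.Q)
          atTop (𝓝 0) := by
  choose μ h0 h1 using all_dir hd U p hp hp1
  exact ⟨μ, h0, fun p₀ h2 h3 x => h1 x p₀ h2 h3⟩

end Perco
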